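/- Suppose Assumption (H) holds. Then for every R > 0, r > 0 and S ≥ 0 there exist constants M > 0 and σ > 0 (depending only on ρ*, R, r and S) such that: for every classical solution of the two-piston system with the normalization ∫_{a(t)}^{b(t)} ρ(t,x)dx = 1 for all t ≥ 0, with input given by the boundary feedback law u(t) = −R((r+1)v(t,a(t)) + k(ρ(t,a(t)))) for t > 0, and with initial Lyapunov value V(a(0), b(0), ρ[0], v[0]) ≤ S, the estimate N(t) ≤ M exp(−σ t) N(0) holds for all t ≥ 0. -/

import Mathlib

open MeasureTheory Set Filter

/-- `Q(ρ) = ρ ∫_{ρ*}^{ρ} P(τ)/τ² dτ − (P(ρ*)/ρ*)ρ + P(ρ*)`. -/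
noncomputable def Qf (P : ℝ → ℝ) (ρs x : ℝ) : ℝ :=
  x * (∫ τ in ρs..x, P τ / τ ^ 2) - (P ρs / ρs) * x + P ρs

/-- `k(ρ) = ∫_{ρ*}^{ρ} μ(τ)/τ dτ`. -/
noncomputable def kf (μ : ℝ → ℝ) (ρs x : ℝ) : ℝ :=
  ∫ τ in ρs..x, μ τ / τ

/-- `G(ρ) = ∫_{ρ*}^{ρ} μ(l) l^{-3/2} √(Q(l)) dl`. -/
noncomputable def Gf (P μ : ℝ → ℝ) (ρs x : ℝ) : ℝ :=
  ∫ l in ρs..x, μ l / l ^ ((3 : ℝ) / 2) * Real.sqrt (Qf P ρs l)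

/-- Assumption (H): `G(ρ) → +∞` as `ρ → +∞`, `G(ρ) → −∞` as `ρ → 0⁺`,
and `k(ρ) → +∞` as `ρ → +∞`. -/
def AssumpH (P μ : ℝ → ℝ) (ρs : ℝ) : Prop :=
  Tendsto (Gf P μ ρs) atTop atTop ∧
  Tendsto (Gf P μ ρs) (nhdsWithin 0 (Ioi 0)) atBot ∧
  Tendsto (kf μ ρs) atTop atTop

/-- Potential energy `U(a,b,ρ) = ∫_a^b Q(ρ(x)) dx`. -/
noncomputable def Uf (P : ℝ → ℝ) (ρs a b : ℝ) (ρ : ℝ → ℝ) : ℝ :=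
  ∫ x in a..b, Qf P ρs (ρ x)

/-- Total mechanical energy `E`. -/
noncomputable def Ef (P : ℝ → ℝ) (ρs a b : ℝ) (ρ v : ℝ → ℝ) : ℝ :=
  (v a) ^ 2 / 2 + (v b) ^ 2 / 2 + (1 / 2) * (∫ x in a..b, ρ x * (v x) ^ 2)
    + Uf P ρs a b ρ

/-- Transformed energy `W`. -/
noncomputable def Wf (P μ : ℝ → ℝ) (ρs a b : ℝ) (ρ ρx v : ℝ → ℝ) : ℝ :=
  (1 / 2) * (∫ x in a..b, (ρ x)⁻¹ * (ρ x * v x + μ (ρ x) * (ρ x)⁻¹ * ρx x) ^ 2)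
    + (1 / 2) * (v b - kf μ ρs (ρ b)) ^ 2
    + (1 / 2) * (v a + kf μ ρs (ρ a)) ^ 2
    + Uf P ρs a b ρ

/-- Control Lyapunov functional `V = W + r E`. -/
noncomputable def Vf (P μ : ℝ → ℝ) (ρs r a b : ℝ) (ρ ρx v : ℝ → ℝ) : ℝ :=
  Wf P μ ρs a b ρ ρx v + r * Ef P ρs a b ρ v

/-- `f ∈ H¹(a,b)` with weak derivative `f'`:  `f' ∈ L¹ ∩ L²(a,b)` and
`f(x) = f(a) + ∫_a^x f'(s) ds` on `[a,b]`. -/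
def H1On (a b : ℝ) (f f' : ℝ → ℝ) : Prop :=
  IntervalIntegrable f' volume a b ∧
  IntervalIntegrable (fun s => (f' s) ^ 2) volume a b ∧
  ∀ x ∈ Icc a b, f x = f a + ∫ s in a..x, f' s

/-- A classical solution of the two-piston system (2.1)-(2.5) with boundary input `u`:
piston positions `a < b` (with velocities `a'`, `b'` and accelerations `a''`, `b''`),
gas density `ρ > 0` and velocity `v` on the moving domain `{(t,x) : a(t) ≤ x ≤ b(t)}`,
with the indicated partial derivatives, satisfying mass conservation, the momentum
(Navier–Stokes) equation, the kinematic boundary conditions, and Newton's law for the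
two pistons. -/
structure PistonSol (P μ : ℝ → ℝ) (Pext : ℝ) where
  /-- position of the left piston -/
  a : ℝ → ℝ
  /-- position of the right piston -/
  b : ℝ → ℝ
  a' : ℝ → ℝ
  b' : ℝ → ℝ
  a'' : ℝ → ℝ
  b'' : ℝ → ℝ
  /-- boundary control input -/
  u : ℝ → ℝ
  /-- gas density -/
  ρ : ℝ → ℝ → ℝ
  /-- gas velocity -/
  v : ℝ → ℝ → ℝ
  ρt : ℝ → ℝ → ℝ
  ρx : ℝ → ℝ → ℝ
  vt : ℝ → ℝ → ℝ
  vx : ℝ → ℝ → ℝ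
  u_cont : ContinuousOn u (Ici 0)
  hab : ∀ t, 0 ≤ t → a t < b t
  ha' : ∀ t, 0 ≤ t → HasDerivWithinAt a (a' t) (Ici 0) t
  hb' : ∀ t, 0 ≤ t → HasDerivWithinAt b (b' t) (Ici 0) t
  ha'_cont : ContinuousOn a' (Ici 0)
  hb'_cont : ContinuousOn b' (Ici 0)
  ha'' : ∀ t, 0 < t → HasDerivAt a' (a'' t) t
  hb'' : ∀ t, 0 < t → HasDerivAt b' (b'' t) t
  ρ_pos : ∀ t, 0 ≤ t → ∀ x ∈ Icc (a t) (b t), 0 < ρ t x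
  ρ_cont : ContinuousOn (fun p : ℝ × ℝ => ρ p.1 p.2)
    {p : ℝ × ℝ | 0 ≤ p.1 ∧ p.2 ∈ Icc (a p.1) (b p.1)}
  v_cont : ContinuousOn (fun p : ℝ × ℝ => v p.1 p.2)
    {p : ℝ × ℝ | 0 ≤ p.1 ∧ p.2 ∈ Icc (a p.1) (b p.1)}
  hρt : ∀ t, 0 < t → ∀ x ∈ Icc (a t) (b t), HasDerivAt (fun s => ρ s x) (ρt t x) t
  hρx : ∀ t, 0 ≤ t → ∀ x ∈ Icc (a t) (b t), HasDerivAt (fun y => ρ t y) (ρx t x) x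
  hvt : ∀ t, 0 < t → ∀ x ∈ Icc (a t) (b t), HasDerivAt (fun s => v s x) (vt t x) t
  hvx : ∀ t, 0 < t → ∀ x ∈ Icc (a t) (b t), HasDerivAt (fun y => v t y) (vx t x) x
  ρx_cont : ∀ t, 0 ≤ t → ContinuousOn (ρx t) (Icc (a t) (b t))
  vx_cont : ∀ t, 0 < t → ContinuousOn (vx t) (Icc (a t) (b t))
  /-- mass conservation `ρ_t + (ρ v)_x = 0` on `[a(t), b(t)]` -/
  mass_eq : ∀ t, 0 < t → ∀ x ∈ Icc (a t) (b t),
    ρt t x + (ρx t x * v t x + ρ t x * vx t x) = 0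
  /-- momentum equation `ρ(v_t + v v_x) = (μ(ρ) v_x − P(ρ))_x` on `(a(t), b(t))` -/
  momentum_eq : ∀ t, 0 < t → ∀ x ∈ Ioo (a t) (b t),
    HasDerivAt (fun y => μ (ρ t y) * vx t y - P (ρ t y))
      (ρ t x * (vt t x + v t x * vx t x)) x
  /-- `v(t, a(t)) = a'(t)` -/
  bc_a : ∀ t, 0 ≤ t → v t (a t) = a' t
  /-- `v(t, b(t)) = b'(t)` -/
  bc_b : ∀ t, 0 ≤ t → v t (b t) = b' t
  /-- Newton's law for the right piston -/
  newton_b : ∀ t, 0 < t →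
    b'' t = P (ρ t (b t)) - μ (ρ t (b t)) * vx t (b t) - Pext
  /-- Newton's law for the left (actuated) piston -/
  newton_a : ∀ t, 0 < t →
    a'' t = u t + Pext - P (ρ t (a t)) + μ (ρ t (a t)) * vx t (a t)

/-- The quantity `N(t)` measuring the deviation of the solution from the set of
equilibria: `N(t) = √(v²(t,a(t)) + v²(t,b(t))) + max_{[a(t),b(t)]} |ρ(t,·) − ρ*|
+ ((b−a)⁻¹ ∫ v²)^{1/2} + ((b−a) ∫ ρ_x²)^{1/2}`. -/
noncomputable def Npiston {P μ : ℝ → ℝ} {Pext : ℝ} (ρs : ℝ)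
    (sol : PistonSol P μ Pext) (t : ℝ) : ℝ :=
  Real.sqrt ((sol.v t (sol.a t)) ^ 2 + (sol.v t (sol.b t)) ^ 2)
  + sSup ((fun x => |sol.ρ t x - ρs|) '' Icc (sol.a t) (sol.b t))
  + Real.sqrt ((sol.b t - sol.a t)⁻¹ * ∫ x in sol.a t..sol.b t, (sol.v t x) ^ 2)
  + Real.sqrt ((sol.b t - sol.a t) * ∫ x in sol.a t..sol.b t, (sol.ρx t x) ^ 2)

open Topology
open intervalIntegral renaming integral_sub → iSub, integral_const_mul → iCM, integral_interval_sub_left → iISL, integral_congr → iCong, integral_add → iAdd, norm_integral_le_of_norm_le_const → iNorm, integral_const → iConst, integral_add_adjacent_intervals → iAdj, integral_same → iSame, integral_mul_const → iMC, integral_hasDerivAt_right → iHD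
local notation "𝕀" => Icc (0:ℝ) 1
local notation "𝕁" => Ioo (0:ℝ) 1

theorem mll {a b c : ℝ} (h : b ≤ c) (ha : 0 ≤ a) : a * b ≤ a * c := mul_le_mul_of_nonneg_left h ha
theorem mlr {a b c : ℝ} (h : b ≤ c) (ha : 0 ≤ a) : b * a ≤ c * a := mul_le_mul_of_nonneg_right h ha

theorem absInt {a b C : ℝ} {f : ℝ → ℝ} (h : ∀ x ∈ uIoc a b, |f x| ≤ C) :
    |∫ x in a..b, f x| ≤ C * |b - a| := by
  rw [← Real.norm_eq_abs]
  exact iNorm h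

theorem tend0 {f : ℝ → ℝ} {c : ℝ} (h : Continuous f) (h0 : f 0 = c) :
    Tendsto f (𝓝[>] 0) (𝓝 c) := by
  have := h.tendsto 0
  rw [h0] at this; exact this.mono_left nhdsWithin_le_nhds

theorem weakConv {ι : Type*} {l : Filter ι} [l.IsCountablyGenerated] [NeBot l]
    {c d L : ℝ} (hcd : c ≤ d) {F : ι → ℝ → ℝ} {F0 g : ℝ → ℝ}
    (hF : ∀ᶠ i in l, ContinuousOn (F i) (Icc c d)) (hF0 : ContinuousOn F0 (Icc c d))
    (hL : ∀ᶠ i in l, ∀ x ∈ Icc c d, |F i x| ≤ L) (hL0 : ∀ x ∈ Icc c d, |F0 x| ≤ L)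
    (hc : ∀ x ∈ Icc c d, Tendsto (fun i => ∫ y in c..x, F i y) l (𝓝 (∫ y in c..x, F0 y)))
    (hg : ContinuousOn g (Icc c d)) :
    Tendsto (fun i => ∫ x in c..d, F i x * g x) l (𝓝 (∫ x in c..d, F0 x * g x)) := by
  have hLn : 0 ≤ L := (abs_nonneg _).trans (hL0 c (left_mem_Icc.2 hcd))
  have hint : ∀ f : ℝ → ℝ, ContinuousOn f (Icc c d) → IntervalIntegrable f volume c d :=
    fun f hf => ContinuousOn.intervalIntegrable (by rwa [uIcc_of_le hcd])
  have key : ∀ (p : Polynomial ℝ) (f : ℝ → ℝ), ContinuousOn f (Icc c d) →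
      ∫ x in c..d, f x * p.eval x = (∫ y in c..d, f y) * p.eval d
        - ∫ x in c..d, (∫ y in c..x, f y) * p.derivative.eval x := by
    intro p f hf
    have h1 := intervalIntegral.integral_mul_deriv_eq_deriv_mul_of_hasDerivAt (a := c) (b := d)
      (u := fun x => ∫ y in c..x, f y) (v := fun x => p.eval x) (u' := f)
      (v' := fun x => p.derivative.eval x) ?_ ?_ ?_ ?_ ?_
      ((Polynomial.continuous _).intervalIntegrable _ _)
    · simp only [iSame, zero_mul, sub_zero] at h1
      linarith
    · have := intervalIntegral.continuousOn_primitive_interval (μ := volume) (f := f)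
        (a := c) (b := d) ((hint f hf).1.congr_set_ae ?_)
      · exact this
      · rw [uIcc_of_le hcd]; exact Ioc_ae_eq_Icc.symm
    · exact (Polynomial.continuous p).continuousOn
    · intro x hx
      rw [min_eq_left hcd, max_eq_right hcd] at hx
      refine iHD ?_ ?_ ?_
      · exact ContinuousOn.intervalIntegrable (by
          rw [uIcc_of_le hx.1.le]; exact hf.mono (Icc_subset_Icc le_rfl hx.2.le))
      · exact ContinuousOn.stronglyMeasurableAtFilter isOpen_Ioo (hf.mono Ioo_subset_Icc_self) x hx
      · exact hf.continuousAt (Icc_mem_nhds hx.1 hx.2)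
    · intro x hx; exact p.hasDerivAt x
    · exact hint f hf
  have keylim : ∀ p : Polynomial ℝ, Tendsto (fun i => ∫ x in c..d, F i x * p.eval x) l
      (𝓝 (∫ x in c..d, F0 x * p.eval x)) := by
    intro p
    rw [key p F0 hF0]
    have : Tendsto (fun i => (∫ y in c..d, F i y) * p.eval d
        - ∫ x in c..d, (∫ y in c..x, F i y) * p.derivative.eval x) l
        (𝓝 ((∫ y in c..d, F0 y) * p.eval d
        - ∫ x in c..d, (∫ y in c..x, F0 y) * p.derivative.eval x)) := by
      refine ((hc d (right_mem_Icc.2 hcd)).mul_const _).sub ?_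
      refine intervalIntegral.tendsto_integral_filter_of_dominated_convergence
        (fun x => L * (d - c) * |p.derivative.eval x|) ?_ ?_ ?_ ?_
      · filter_upwards [hF] with i hi
        refine ContinuousOn.aestronglyMeasurable (ContinuousOn.mul ?_
          (Polynomial.continuous _).continuousOn) measurableSet_uIoc
        have := intervalIntegral.continuousOn_primitive_interval (μ := volume) (f := F i)
          (a := c) (b := d) ((hint _ hi).1.congr_set_ae (by
            rw [uIcc_of_le hcd]; exact Ioc_ae_eq_Icc.symm))
        exact this.mono uIoc_subset_uIcc
      · filter_upwards [hL] with i hi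
        refine ae_of_all _ fun x hx => ?_
        rw [uIoc_of_le hcd] at hx
        rw [norm_mul]
        refine mlr ?_ (abs_nonneg _)
        refine (iNorm (C := L) ?_).trans ?_
        · intro y hy
          rw [uIoc_of_le hx.1.le] at hy
          exact hi y ⟨hy.1.le, hy.2.trans hx.2⟩
        · rw [abs_of_nonneg (by linarith [hx.1])]
          exact mll (by linarith [hx.2]) hLn
      · exact ((Polynomial.continuous p.derivative).abs.const_mul _).intervalIntegrable _ _
      · refine ae_of_all _ fun x hx => ?_
        rw [uIoc_of_le hcd] at hx
        exact (hc x ⟨hx.1.le, hx.2⟩).mul_const _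
    refine this.congr' ?_
    filter_upwards [hF] with i hi using (key p _ hi).symm
  rw [Metric.tendsto_nhds]
  intro ε hε
  obtain ⟨p, hp⟩ := exists_polynomial_near_of_continuousOn c d g hg (ε / (4 * (L * (d - c) + 1)))
    (by have : 0 ≤ L * (d - c) := mul_nonneg hLn (by linarith)
        positivity)
  have hbd : ∀ f : ℝ → ℝ, ContinuousOn f (Icc c d) → (∀ x ∈ Icc c d, |f x| ≤ L) →
      |(∫ x in c..d, f x * p.eval x) - ∫ x in c..d, f x * g x| ≤ ε / 4 := by
    intro f hf hfL
    rw [← iSub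
      (hint _ (hf.fun_mul (Polynomial.continuous _).continuousOn)) (hint _ (hf.fun_mul hg))]
    have h0 : 0 ≤ L * (d - c) := mul_nonneg hLn (by linarith)
    refine (absInt
      (C := L * (ε / (4 * (L * (d - c) + 1)))) ?_).trans ?_
    · intro y hy
      rw [uIoc_of_le hcd] at hy
      have hy' : y ∈ Icc c d := ⟨hy.1.le, hy.2⟩
      rw [← mul_sub, abs_mul]
      exact mul_le_mul (hfL y hy') (hp y hy').le (abs_nonneg _) hLn
    · rw [abs_of_nonneg (by linarith)]
      have : L * (ε / (4 * (L * (d - c) + 1))) * (d - c)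
        = ε / 4 * ((L * (d - c)) / (L * (d - c) + 1)) := by field_simp
      rw [this]
      have h2 : (L * (d - c)) / (L * (d - c) + 1) ≤ 1 := by
        rw [div_le_one (by linarith)]; linarith
      nlinarith
  filter_upwards [Metric.tendsto_nhds.1 (keylim p) (ε / 4) (by linarith), hF, hL] with i h1 h2 h3
  have h4 := hbd _ h2 h3
  have h5 := hbd _ hF0 hL0
  rw [Real.dist_eq] at h1 ⊢
  rw [abs_le] at h4 h5
  rw [abs_lt] at h1 ⊢
  constructor <;> linarith

theorem secondDiff {f f' : ℝ → ℝ} {x f'' : ℝ} (h1 : ∀ᶠ y in 𝓝 x, HasDerivAt f (f' y) y)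
    (h2 : HasDerivAt f' f'' x) :
    Tendsto (fun h => (f (x + h) + f (x - h) - 2 * f x) / h ^ 2) (𝓝[>] 0) (𝓝 f'') := by
  have hp : Tendsto (fun h : ℝ => x + h) (𝓝[>] 0) (𝓝 x) := tend0 (by fun_prop) (by simp)
  have hm : Tendsto (fun h : ℝ => x - h) (𝓝[>] 0) (𝓝 x) := tend0 (by fun_prop) (by simp)
  refine HasDerivAt.lhopital_zero_nhdsGT (f' := fun h => f' (x + h) + -f' (x - h))
    (g' := fun h => 2 * h) ?_ ?_ ?_ ?_ ?_ ?_
  · filter_upwards [hp.eventually h1, hm.eventually h1] with h ha hb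
    have e1 := ha.comp_const_add x h
    have e2 := hb.comp_const_sub x h
    exact (e1.fun_add e2).sub_const (2 * f x)
  · filter_upwards with h
    simpa using hasDerivAt_pow 2 h
  · filter_upwards [self_mem_nhdsWithin] with h hh
    have : (0:ℝ) < h := hh
    positivity
  · have hc := (h1.self_of_nhds).continuousAt
    have := ((hc.tendsto.comp hp).add (hc.tendsto.comp hm)).sub_const (2 * f x)
    rwa [show f x + f x - 2 * f x = 0 by ring] at this
  · exact tend0 (by fun_prop) (by simp)
  · have s1 := h2.tendsto_slope_zero_right
    have s2 := h2.tendsto_slope_zero_left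
    have hneg : Tendsto (fun h : ℝ => -h) (𝓝[>] 0) (𝓝[<] 0) := by
      refine tendsto_nhdsWithin_iff.2 ⟨?_, ?_⟩
      · exact tend0 (by fun_prop) (by simp)
      · filter_upwards [self_mem_nhdsWithin] with h hh
        exact neg_lt_zero.2 (mem_Ioi.1 hh)
    have := (s1.add (s2.comp hneg)).div_const 2
    rw [add_self_div_two] at this
    refine this.congr' ?_
    filter_upwards [self_mem_nhdsWithin] with h hh
    have : (0:ℝ) < h := hh
    simp only [Function.comp, smul_eq_mul]
    field_simp
    ring_nf

theorem midConvex {g : ℝ → ℝ} {x h : ℝ} (hh : 0 < h) (hg : Continuous g)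
    (H : ∀ y ∈ Ioo (x - h) (x + h), ∀ᶠ e in 𝓝[>] (0:ℝ), 0 < g (y + e) + g (y - e) - 2 * g y) :
    0 ≤ g (x + h) + g (x - h) - 2 * g x := by
  by_contra hcon
  push Not at hcon
  set G : ℝ → ℝ := fun y => g y - (g (x - h) + (g (x + h) - g (x - h)) / (2 * h) * (y - (x - h)))
    with hG
  have hGc : Continuous G := by fun_prop
  obtain ⟨y, hy, hmax⟩ := isCompact_Icc.exists_isMaxOn (s := Icc (x - h) (x + h))
    ⟨x, by constructor <;> linarith⟩ hGc.continuousOn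
  have hx0 : 0 < G x := by
    simp only [hG]
    have : (g (x + h) - g (x - h)) / (2 * h) * (x - (x - h)) = (g (x + h) - g (x - h)) / 2 := by
      field_simp; ring
    rw [this]; linarith
  have hGy : 0 < G y := hx0.trans_le (hmax (by constructor <;> linarith))
  have hl : G (x - h) = 0 := by simp [hG]
  have hr : G (x + h) = 0 := by simp only [hG]; field_simp; ring
  have hy' : y ∈ Ioo (x - h) (x + h) := by
    refine ⟨lt_of_le_of_ne hy.1 ?_, lt_of_le_of_ne hy.2 ?_⟩
    · rintro rfl; linarith
    · rintro rfl; linarith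
  have h3 : ∀ᶠ e in 𝓝[>] (0:ℝ), e < min (y - (x - h)) (x + h - y) := by
    refine nhdsWithin_le_nhds (eventually_lt_nhds ?_)
    exact lt_min (by linarith [hy'.1]) (by linarith [hy'.2])
  obtain ⟨e, he1, he2, he3⟩ := ((H y hy').and (h3.and self_mem_nhdsWithin)).exists
  have he : 0 < e := he3
  have ha := hmax (show y + e ∈ Icc (x - h) (x + h) by
    constructor <;> linarith [lt_min_iff.1 he2, hy.1, (lt_min_iff.1 he2).2])
  have hb := hmax (show y - e ∈ Icc (x - h) (x + h) by
    constructor <;> linarith [lt_min_iff.1 he2, hy.2, (lt_min_iff.1 he2).1])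
  simp only [mem_ofPred_eq, hG] at ha hb
  nlinarith

theorem chainInt {θ c K K' : ℝ → ℝ} {α β C : ℝ} (hθ : ContinuousOn θ (Icc α β))
    (hc : IntervalIntegrable c volume α β) (hαβ : α ≤ β) (hC : ∀ t ∈ Icc α β, |c t| ≤ C)
    (hint : ∀ t ∈ Icc α β, θ t - θ α = ∫ s in α..t, c s)
    (hK : ∀ t ∈ Icc α β, HasDerivAt K (K' (θ t)) (θ t))
    (hK' : ContinuousOn (fun t => K' (θ t)) (Icc α β)) :
    K (θ β) - K (θ α) = ∫ s in α..β, K' (θ s) * c s := by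
  have hC0 : 0 ≤ C := (abs_nonneg _).trans (hC α (left_mem_Icc.2 hαβ))
  have hi2 : IntervalIntegrable (fun s => K' (θ s) * c s) volume α β :=
    hc.continuousOn_mul (by rwa [uIcc_of_le hαβ])
  have hsub : ∀ s ∈ Icc α β, ∀ t ∈ Icc α β, uIcc s t ⊆ uIcc α β := by
    intro s hs t ht
    rw [uIcc_of_le hαβ]; exact ordConnected_Icc.uIcc_subset hs ht
  have hdiff : ∀ s ∈ Icc α β, ∀ t ∈ Icc α β, θ t - θ s = ∫ y in s..t, c y := by
    intro s hs t ht
    have hα := left_mem_Icc.2 hαβ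
    have := iISL (μ := volume) (f := c)
      (hc.mono_set (hsub α hα t ht)) (hc.mono_set (hsub α hα s hs))
    rw [← this, ← hint t ht, ← hint s hs]; ring
  set Λ : ℝ → ℝ := fun t => K (θ t) - ∫ s in α..t, K' (θ s) * c s with hΛ
  have hder : ∀ t ∈ Icc α β, HasDerivWithinAt Λ 0 (Icc α β) t := by
    intro t ht
    rw [hasDerivWithinAt_iff_isLittleO, Asymptotics.isLittleO_iff]
    intro e he
    have h1 := ((hasDerivAt_iff_isLittleO.1 (hK t ht)).def
      (c := e / (2 * (C + 1))) (by positivity))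
    have h1' := (hθ t ht).tendsto.eventually h1
    have h2 : ∀ᶠ s in 𝓝[Icc α β] t, |K' (θ s) - K' (θ t)| < e / (2 * (C + 1)) := by
      have := Metric.tendsto_nhds.1 (hK' t ht) (e / (2 * (C + 1))) (by positivity)
      exact this
    have h3 : ∀ᶠ s in 𝓝[Icc α β] t, ∀ y ∈ uIcc t s, |K' (θ y) - K' (θ t)| < e / (2 * (C + 1)) := by
      rw [eventually_nhdsWithin_iff, Metric.eventually_nhds_iff] at h2
      obtain ⟨d, hd, h2⟩ := h2
      rw [eventually_nhdsWithin_iff, Metric.eventually_nhds_iff]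
      refine ⟨d, hd, fun s hs hsI y hy => h2 ?_ (ordConnected_Icc.uIcc_subset ht hsI hy)⟩
      rw [Real.dist_eq] at hs ⊢
      exact (abs_sub_left_of_mem_uIcc hy).trans_lt hs
    filter_upwards [h1', h3, self_mem_nhdsWithin] with s hs1 hs2 hsI
    have hd := hdiff t ht s hsI
    have hθb : |θ s - θ t| ≤ C * |s - t| := by
      rw [hd]
      exact absInt fun y hy =>
        hC y (ordConnected_Icc.uIcc_subset ht hsI (uIoc_subset_uIcc hy))
    have hci := hc.mono_set (hsub t ht s hsI)
    have hci2 := hi2.mono_set (hsub t ht s hsI)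
    have e2 : |∫ y in t..s, (K' (θ y) * c y - K' (θ t) * c y)| ≤ e / (2 * (C + 1)) * C * |s - t| := by
      refine absInt fun y hy => ?_
      have hy' := uIoc_subset_uIcc hy
      rw [← sub_mul, abs_mul]
      exact mul_le_mul (hs2 y hy').le (hC y (ordConnected_Icc.uIcc_subset ht hsI hy'))
        (abs_nonneg _) (by positivity)
    rw [iSub hci2 (hci.const_mul _),
      iCM, ← hd] at e2
    have e3 : Λ s - Λ t = (K (θ s) - K (θ t)) - ∫ y in t..s, K' (θ y) * c y := by
      have hα := left_mem_Icc.2 hαβ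
      rw [← iISL (μ := volume)
        (hi2.mono_set (hsub α hα s hsI)) (hi2.mono_set (hsub α hα t ht))]
      simp only [hΛ]; ring
    simp only [smul_eq_mul, mul_zero, sub_zero, Real.norm_eq_abs] at hs1 ⊢
    rw [e3]
    have : (K (θ s) - K (θ t)) - ∫ y in t..s, K' (θ y) * c y =
      (K (θ s) - K (θ t) - (θ s - θ t) * K' (θ t)) -
        ((∫ y in t..s, K' (θ y) * c y) - K' (θ t) * (θ s - θ t)) := by ring
    rw [this]
    refine (abs_sub _ _).trans ?_
    have e4 : e / (2 * (C + 1)) * |θ s - θ t| ≤ e / (2 * (C + 1)) * (C * |s - t|) :=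
      mll hθb (by positivity)
    have e5 : e / (2 * (C + 1)) * (C * |s - t|) ≤ e / 2 * |s - t| := by
      have : e / (2 * (C + 1)) * (C * |s - t|) = e / 2 * |s - t| * (C / (C + 1)) := by
        field_simp
      rw [this]
      exact mul_le_of_le_one_right (by positivity) (by rw [div_le_one (by linarith)]; linarith)
    have e6 : e / (2 * (C + 1)) * C * |s - t| = e / (2 * (C + 1)) * (C * |s - t|) := by ring
    linarith
  have hconst := constant_of_derivWithin_zero (f := Λ) (a := α) (b := β)
    (fun t ht => (hder t ht).differentiableWithinAt)
    (fun t ht => (hder t ⟨ht.1, ht.2.le⟩).derivWithin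
      (uniqueDiffOn_Icc (ht.1.trans_lt ht.2) t ⟨ht.1, ht.2.le⟩)) β (right_mem_Icc.2 hαβ)
  simp only [hΛ, iSame, sub_zero] at hconst
  linarith

noncomputable def supc (w : ℝ × ℝ → ℝ) (ε : ℝ) (p : ℝ × ℝ) : ℝ :=
  sSup ((fun τ => w (p.1 + τ, p.2) - τ ^ 2 / (2 * ε)) '' Icc (-1) 1)

theorem supc_cont {w : ℝ × ℝ → ℝ} (hw : Continuous w) (ε : ℝ) : Continuous (supc w ε) := by
  unfold supc
  refine IsCompact.continuous_sSup (f := fun (p : ℝ × ℝ) τ => w (p.1 + τ, p.2) - τ ^ 2 / (2 * ε))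
    isCompact_Icc ?_
  fun_prop

theorem supc_max {w : ℝ × ℝ → ℝ} (hw : Continuous w) (ε : ℝ) (p : ℝ × ℝ) :
    ∃ τ ∈ Icc (-1:ℝ) 1, supc w ε p = w (p.1 + τ, p.2) - τ ^ 2 / (2 * ε) :=
  isCompact_Icc.exists_sSup_image_eq ⟨0, by simp⟩ (by fun_prop)

theorem le_supc {w : ℝ × ℝ → ℝ} (hw : Continuous w) (ε : ℝ) (p : ℝ × ℝ) {τ : ℝ}
    (hτ : τ ∈ Icc (-1:ℝ) 1) : w (p.1 + τ, p.2) - τ ^ 2 / (2 * ε) ≤ supc w ε p := by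
  refine le_csSup ?_ ⟨τ, hτ, rfl⟩
  exact (isCompact_Icc.image (by fun_prop)).bddAbove

theorem supc_lip {w : ℝ × ℝ → ℝ} (hw : Continuous w) {ε L : ℝ}
    (hL : ∀ t x y, |w (t, x) - w (t, y)| ≤ L * |x - y|) (t x y : ℝ) :
    |supc w ε (t, x) - supc w ε (t, y)| ≤ L * |x - y| := by
  have key : ∀ x y, supc w ε (t, x) - supc w ε (t, y) ≤ L * |x - y| := by
    intro x y
    obtain ⟨τ, hτ, h⟩ := supc_max hw ε (t, x)
    have h2 := le_supc hw ε (t, y) hτ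
    have h3 := (abs_le.1 (hL (t + τ) x y)).2
    simp only at h h2
    linarith
  rw [abs_le]
  have h1 := key x y
  have h2 := key y x
  rw [abs_sub_comm y x] at h2
  constructor <;> linarith

theorem supc_le {w : ℝ × ℝ → ℝ} (hw : Continuous w) {ε M : ℝ} (hε : 0 < ε)
    (hM : ∀ p, |w p| ≤ M) (p : ℝ × ℝ) : |supc w ε p| ≤ M := by
  obtain ⟨τ, hτ, h⟩ := supc_max hw ε p
  have h2 := le_supc hw ε p (τ := 0) (by simp)
  have h3 := abs_le.1 (hM p)
  have h4 := abs_le.1 (hM (p.1 + τ, p.2))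
  have : 0 ≤ τ ^ 2 / (2 * ε) := by positivity
  simp at h2
  rw [abs_le]; constructor <;> linarith

theorem supc_opt {w : ℝ × ℝ → ℝ} (hw : Continuous w) {ε M : ℝ} (hε : 0 < ε)
    (hM : ∀ p, |w p| ≤ M) (p : ℝ × ℝ) :
    ∃ τ ∈ Icc (-1:ℝ) 1, supc w ε p = w (p.1 + τ, p.2) - τ ^ 2 / (2 * ε) ∧
      τ ^ 2 / (2 * ε) ≤ w (p.1 + τ, p.2) - w p ∧ τ ^ 2 ≤ 4 * M * ε := by
  obtain ⟨τ, hτ, h⟩ := supc_max hw ε p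
  have h2 := le_supc hw ε p (τ := 0) (by simp)
  have h3 := abs_le.1 (hM p)
  have h4 := abs_le.1 (hM (p.1 + τ, p.2))
  simp at h2
  refine ⟨τ, hτ, h, by linarith, ?_⟩
  have h5 : τ ^ 2 / (2 * ε) ≤ 2 * M := by linarith
  rw [div_le_iff₀ (by linarith)] at h5
  linarith

theorem supc_tendsto {w : ℝ × ℝ → ℝ} (hw : Continuous w) {M : ℝ}
    (hM : ∀ p, |w p| ≤ M) (p : ℝ × ℝ) {ι : Type*} {l : Filter ι} {ε : ι → ℝ}
    (h0 : ∀ i, 0 < ε i) (hε : Tendsto ε l (𝓝 0)) :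
    Tendsto (fun i => supc w (ε i) p) l (𝓝 (w p)) := by
  choose τ hτ h1 h2 h3 using fun i => supc_opt hw (h0 i) hM p
  have hτ0 : Tendsto τ l (𝓝 0) := by
    have : Tendsto (fun i => (τ i) ^ 2) l (𝓝 0) := by
      refine squeeze_zero (fun i => sq_nonneg _) h3 ?_
      simpa using hε.const_mul (4 * M)
    have h := (Real.continuous_sqrt.tendsto 0).comp this
    simp only [Real.sqrt_zero, Function.comp_def, Real.sqrt_sq_eq_abs] at h
    exact (tendsto_zero_iff_abs_tendsto_zero _).2 h
  have hup : Tendsto (fun i => w (p.1 + τ i, p.2)) l (𝓝 (w p)) := by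
    have : Continuous fun s => w (p.1 + s, p.2) := by fun_prop
    have := (this.tendsto 0).comp hτ0
    simpa [Function.comp_def] using this
  refine tendsto_of_tendsto_of_tendsto_of_le_of_le tendsto_const_nhds hup ?_ ?_
  · intro i
    have := le_supc hw (ε i) p (τ := 0) (by simp)
    simpa using this
  · intro i
    have : 0 ≤ (τ i) ^ 2 / (2 * ε i) := by have := h0 i; positivity
    simp only [h1 i]; linarith

theorem supc_step {w wx wxx B Bt φ : ℝ × ℝ → ℝ} {D : Set (ℝ × ℝ)} {M LB r ε e1 : ℝ}
    (hD : IsOpen D) (hw : Continuous w) (hM : ∀ p, |w p| ≤ M)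
    (hwx : ∀ p ∈ D, HasDerivAt (fun y => w (p.1, y)) (wx p) p.2)
    (hwxx : ∀ p ∈ D, HasDerivAt (fun y => wx (p.1, y)) (wxx p) p.2)
    (hT : ∀ p ∈ D, ∀ q C : ℝ, (∀ᶠ s in 𝓝[<] p.1, q * (p.1 - s) - C * (p.1 - s) ^ 2 ≤
      w p - w (s, p.2)) → B p * q ≤ wxx p)
    (hB : Continuous B) (hB0 : ∀ p ∈ D, 0 ≤ B p)
    (hBt : ∀ p ∈ D, HasDerivAt (fun s => B (s, p.2)) (Bt p) p.1) (hBL : ∀ p ∈ D, |Bt p| ≤ LB)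
    (hφ : Continuous φ) (hφ0 : ∀ p, 0 ≤ φ p) (hφc : HasCompactSupport φ)
    (hr : 0 < r) (hr1 : r ≤ 1) (hK : Metric.cthickening r (tsupport φ) ⊆ D)
    (hε : 0 < ε) (hεr : 4 * M * ε < (r / 2) ^ 2)
    (he1 : ∀ p ∈ tsupport φ, ∀ τ : ℝ, τ ^ 2 ≤ 4 * M * ε → 2 * LB * (w (p.1 + τ, p.2) - w p) ≤ e1)
    (he : 0 ≤ e1) :
    ∀ᶠ h in 𝓝[>] (0:ℝ), -e1 * (∫ p, φ p) - ε ≤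
      ∫ p, φ p * ((supc w ε (p.1, p.2 + h) + supc w ε (p.1, p.2 - h) - 2 * supc w ε p) / h ^ 2
        - B p * ((supc w ε p - supc w ε (p.1 - h, p.2)) / h)) := by
  set W := supc w ε with hW
  have hWc : Continuous W := supc_cont hw ε
  set K := tsupport φ with hKd
  set K' := Metric.cthickening r K with hK'd
  have hKc : IsCompact K := hφc
  have hK'c : IsCompact K' := hKc.cthickening
  have hKK' : ∀ p ∈ K, ∀ q : ℝ × ℝ, |q.1 - p.1| ≤ r → |q.2 - p.2| ≤ r → q ∈ K' := by
    intro p hp q h1 h2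
    refine Metric.mem_cthickening_of_dist_le q p r K hp ?_
    rw [Prod.dist_eq, Real.dist_eq, Real.dist_eq]
    exact max_le h1 h2
  obtain ⟨B1, hB1⟩ := hK'c.exists_bound_of_continuousOn hB.continuousOn
  choose τ hτI hτ1 hτ2 hτ3 using fun p => supc_opt hw hε hM p
  have hτr : ∀ p, |τ p| < r / 2 := fun p =>
    abs_lt_of_sq_lt_sq ((hτ3 p).trans_lt hεr) (by linarith)
  have hτD : ∀ t x, (∃ y, |x - y| ≤ r ∧ (t, y) ∈ K) → (t + τ (t, x), x) ∈ K' := by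
    rintro t x ⟨y, hy, hyK⟩
    refine hKK' _ hyK _ ?_ hy
    have := hτr (t, x)
    simp only [add_sub_cancel_left]; linarith
  have touchx : ∀ p : ℝ × ℝ, ∀ e : ℝ,
      w (p.1 + τ p, p.2 + e) + w (p.1 + τ p, p.2 - e) - 2 * w (p.1 + τ p, p.2) ≤
      W (p.1, p.2 + e) + W (p.1, p.2 - e) - 2 * W p := by
    intro p e
    have h1 := le_supc hw ε (p.1, p.2 + e) (hτI p)
    have h2 := le_supc hw ε (p.1, p.2 - e) (hτI p)
    have h3 := hτ1 p
    simp only [hW] at h1 h2 h3 ⊢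
    linarith
  have toucht : ∀ p : ℝ × ℝ, ∀ h : ℝ, |h| ≤ r / 2 →
      W p - W (p.1 - h, p.2) ≤ h * (τ p / ε) + h ^ 2 / (2 * ε) := by
    intro p h hh
    have hm : τ p + h ∈ Icc (-1:ℝ) 1 := by
      have h1 := abs_le.1 (hτr p).le
      have h2 := abs_le.1 hh
      constructor <;> linarith
    have h1 := le_supc hw ε (p.1 - h, p.2) hm
    have h3 := hτ1 p
    simp only [hW] at h1 h3 ⊢
    rw [show p.1 - h + (τ p + h) = p.1 + τ p by ring] at h1
    have : (τ p + h) ^ 2 / (2 * ε) = τ p ^ 2 / (2 * ε) + h * (τ p / ε) + h ^ 2 / (2 * ε) := by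
      field_simp; ring
    linarith
  have hTopt : ∀ p : ℝ × ℝ, (p.1 + τ p, p.2) ∈ D →
      B (p.1 + τ p, p.2) * (τ p / ε) ≤ wxx (p.1 + τ p, p.2) := by
    intro p hp
    refine hT _ hp _ (1 / (2 * ε)) ?_
    have hlt : ∀ᶠ s in 𝓝[<] (p.1 + τ p), p.1 + τ p - r / 2 < s :=
      nhdsWithin_le_nhds (eventually_gt_nhds (by linarith))
    filter_upwards [hlt, self_mem_nhdsWithin] with s hs hs2
    have hs2' : s < p.1 + τ p := hs2
    have hm : s - p.1 ∈ Icc (-1:ℝ) 1 := by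
      have h1 := abs_le.1 (hτr p).le
      constructor <;> linarith
    have h1 := le_supc hw ε p hm
    have h3 := hτ1 p
    rw [show p.1 + (s - p.1) = s by ring] at h1
    have e4 : τ p / ε * (p.1 + τ p - s) - 1 / (2 * ε) * (p.1 + τ p - s) ^ 2
      = τ p ^ 2 / (2 * ε) - (s - p.1) ^ 2 / (2 * ε) := by field_simp; ring
    linarith
  have hsd : ∀ q ∈ D, Tendsto (fun h => (w (q.1, q.2 + h) + w (q.1, q.2 - h)
      - 2 * w (q.1, q.2)) / h ^ 2) (𝓝[>] 0) (𝓝 (wxx q)) := by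
    intro q hq
    have hcu : Continuous fun y : ℝ => (q.1, y) := by fun_prop
    have hev : ∀ᶠ y in 𝓝 q.2, (q.1, y) ∈ D := hcu.continuousAt.eventually (hD.mem_nhds hq)
    exact secondDiff (f := fun y => w (q.1, y)) (f' := fun y => wx (q.1, y))
      (hev.mono fun y hy => hwx (q.1, y) hy) (hwxx q hq)
  set Cε : ℝ := |B1| * (r / ε) + 1 with hCε
  have hlow : ∀ p ∈ K, ∀ h : ℝ, 0 < h → h < r →
      -Cε * h ^ 2 ≤ W (p.1, p.2 + h) + W (p.1, p.2 - h) - 2 * W p := by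
    intro p hp h hh hhr
    have := midConvex (g := fun y => W (p.1, y) + Cε / 2 * y ^ 2) (x := p.2) hh
      (by fun_prop) ?_
    · have e5 : (p.1, p.2) = p := rfl
      rw [e5] at this
      nlinarith
    · intro y hy
      have hyr : |y - p.2| ≤ r := by rw [abs_le]; constructor <;> linarith [hy.1, hy.2]
      have hq := hτD p.1 y ⟨p.2, hyr, hp⟩
      have hlim := hsd _ (hK hq)
      have hTo := hTopt (p.1, y) (hK hq)
      have hBb := hB1 _ hq
      have hτb := hτr (p.1, y)
      have hwl : -Cε < wxx (p.1 + τ (p.1, y), y) := by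
        simp only at hTo
        refine lt_of_lt_of_le ?_ hTo
        have h7 : |B (p.1 + τ (p.1, y), y) * (τ (p.1, y) / ε)| ≤ |B1| * (r / ε) := by
          rw [abs_mul, abs_div, abs_of_pos hε]
          refine mul_le_mul (hBb.trans (le_abs_self _)) ?_ (by positivity) (abs_nonneg _)
          exact div_le_div_of_nonneg_right (by linarith) hε.le
        have := (abs_le.1 h7).1
        linarith
      filter_upwards [hlim.eventually (lt_mem_nhds hwl), self_mem_nhdsWithin] with e he1 he2
      have he0 : 0 < e := he2
      rw [lt_div_iff₀ (by positivity)] at he1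
      have := touchx (p.1, y) e
      simp only at this he1 ⊢
      nlinarith
  set Θ : ℝ → ℝ × ℝ → ℝ := fun h p => (W (p.1, p.2 + h) + W (p.1, p.2 - h) - 2 * W p) / h ^ 2
        - B p * ((W p - W (p.1 - h, p.2)) / h) with hΘ
  have hΘc : ∀ h, Continuous (Θ h) := fun h => by simp only [hΘ]; fun_prop
  have hΘlow : ∀ p ∈ K, ∀ h : ℝ, 0 < h → h < r / 2 →
      -Cε - |B1| * (r / ε + 1 / ε) ≤ Θ h p := by
    intro p hp h hh hhr
    have h1 := hlow p hp h hh (by linarith)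
    have h2 := toucht p h (by rw [abs_of_pos hh]; exact hhr.le)
    have hpK : p ∈ K' := hKK' p hp p (by simp [hr.le]) (by simp [hr.le])
    have hBp := hB1 p hpK
    have hB0p := hB0 p (hK hpK)
    rw [Real.norm_eq_abs, abs_of_nonneg hB0p] at hBp
    have h3 : -Cε ≤ (W (p.1, p.2 + h) + W (p.1, p.2 - h) - 2 * W p) / h ^ 2 := by
      rw [le_div_iff₀ (by positivity)]; exact h1
    have h4 : (W p - W (p.1 - h, p.2)) / h ≤ r / ε + 1 / ε := by
      rw [div_le_iff₀ hh]
      refine h2.trans ?_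
      have h5 : τ p / ε ≤ r / ε := div_le_div_of_nonneg_right
        (by linarith [(abs_le.1 (hτr p).le).2]) hε.le
      have h6 : h / (2 * ε) ≤ 1 / ε := by
        rw [div_le_div_iff₀ (by linarith) hε]; nlinarith
      have : h ^ 2 / (2 * ε) = h / (2 * ε) * h := by ring
      rw [this]; nlinarith
    have h5 : B p * ((W p - W (p.1 - h, p.2)) / h) ≤ |B1| * (r / ε + 1 / ε) :=
      (mll h4 hB0p).trans
        (mlr (hBp.trans (le_abs_self _)) (by positivity))
    simp only [hΘ]
    linarith
  have hneg : ∀ p ∈ K, Tendsto (fun h => min (Θ h p + e1) 0) (𝓝[>] 0) (𝓝 0) := by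
    intro p hp
    have hpK : p ∈ K' := hKK' p hp p (by simp [hr.le]) (by simp [hr.le])
    have hq := hτD p.1 p.2 ⟨p.2, by simp [hr.le], hp⟩
    have hq : (p.1 + τ p, p.2) ∈ K' := hq
    have hTo := hTopt p (hK hq)
    have hBlip : |B (p.1 + τ p, p.2) - B p| ≤ LB * |τ p| := by
      have := Convex.norm_image_sub_le_of_norm_hasDerivWithin_le (𝕜 := ℝ)
        (f := fun s => B (s, p.2)) (f' := fun s => Bt (s, p.2)) (s := uIcc p.1 (p.1 + τ p))
        (x := p.1) (y := p.1 + τ p) (C := LB) ?_ ?_ (convex_uIcc _ _) left_mem_uIcc right_mem_uIcc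
      · simpa using this
      · intro s hs
        have hsD : (s, p.2) ∈ D := hK (hKK' p hp _ (by
          have := abs_sub_left_of_mem_uIcc hs
          have h2 := hτr p
          simp only [add_sub_cancel_left] at this ⊢; linarith) (by simp [hr.le]))
        exact (hBt _ hsD).hasDerivWithinAt
      · intro s hs
        have hsD : (s, p.2) ∈ D := hK (hKK' p hp _ (by
          have := abs_sub_left_of_mem_uIcc hs
          have h2 := hτr p
          simp only [add_sub_cancel_left] at this ⊢; linarith) (by simp [hr.le]))
        exact hBL _ hsD
    have hmain : -e1 ≤ wxx (p.1 + τ p, p.2) - B p * (τ p / ε) := by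
      have h1 : |(B (p.1 + τ p, p.2) - B p) * (τ p / ε)| ≤ e1 := by
        rw [abs_mul, abs_div, abs_of_pos hε]
        have h2 : |B (p.1 + τ p, p.2) - B p| * (|τ p| / ε) ≤ LB * |τ p| * (|τ p| / ε) :=
          mlr hBlip (by positivity)
        have h3 : LB * |τ p| * (|τ p| / ε) = 2 * LB * (τ p ^ 2 / (2 * ε)) := by
          rw [← sq_abs (τ p)]; field_simp
        have hLB : 0 ≤ LB := (abs_nonneg _).trans (hBL p (hK hpK))
        have h4 : 2 * LB * (τ p ^ 2 / (2 * ε)) ≤ 2 * LB * (w (p.1 + τ p, p.2) - w p) :=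
          mll (hτ2 p) (by linarith)
        linarith [he1 p hp _ (hτ3 p)]
      have := (abs_le.1 h1).1
      linarith [sub_mul (B (p.1 + τ p, p.2)) (B p) (τ p / ε)]
    have hlow2 : Tendsto (fun h => (w (p.1 + τ p, p.2 + h) + w (p.1 + τ p, p.2 - h)
      - 2 * w (p.1 + τ p, p.2)) / h ^ 2 - B p * (τ p / ε + h / (2 * ε)) + e1) (𝓝[>] 0)
      (𝓝 (wxx (p.1 + τ p, p.2) - B p * (τ p / ε + 0) + e1)) :=
      ((hsd _ (hK hq)).sub ((tendsto_const_nhds.add (tend0 (by fun_prop) (by simp))).const_mul _)).add_const _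
    have hlow3 := hlow2.min (tendsto_const_nhds (x := (0:ℝ)))
    rw [min_eq_right (by rw [add_zero]; linarith)] at hlow3
    refine tendsto_of_tendsto_of_tendsto_of_le_of_le' hlow3 tendsto_const_nhds ?_
      (Eventually.of_forall fun h => min_le_right _ _)
    have hlt : ∀ᶠ h in 𝓝[>] (0:ℝ), h < r / 2 :=
      nhdsWithin_le_nhds (eventually_lt_nhds (by linarith))
    filter_upwards [hlt, self_mem_nhdsWithin] with h hhr hh0
    have hh : 0 < h := hh0
    refine min_le_min_right _ ?_
    have h1 := touchx p h
    have h2 := toucht p h (by rw [abs_of_pos hh]; exact hhr.le)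
    have h3 : (W p - W (p.1 - h, p.2)) / h ≤ τ p / ε + h / (2 * ε) := by
      rw [div_le_iff₀ hh]; exact h2.trans_eq (by ring)
    have h4 := mll h3 (hB0 p (hK hpK))
    have h5 := div_le_div_of_nonneg_right h1 (sq_nonneg h)
    simp only [hΘ]
    linarith
  have hlim : Tendsto (fun h => ∫ p, φ p * min (Θ h p + e1) 0) (𝓝[>] 0) (𝓝 (∫ p : ℝ × ℝ, (0:ℝ))) := by
    refine tendsto_integral_filter_of_dominated_convergence
      (fun p => φ p * (Cε + |B1| * (r / ε + 1 / ε))) ?_ ?_ ?_ ?_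
    · exact Eventually.of_forall fun h =>
        (hφ.mul (((hΘc h).add continuous_const).min continuous_const)).aestronglyMeasurable
    · have hlt : ∀ᶠ h in 𝓝[>] (0:ℝ), h < r / 2 :=
        nhdsWithin_le_nhds (eventually_lt_nhds (by linarith))
      filter_upwards [hlt, self_mem_nhdsWithin] with h hhr hh0
      refine ae_of_all _ fun p => ?_
      rw [Real.norm_eq_abs, abs_mul, abs_of_nonneg (hφ0 p)]
      by_cases hp : p ∈ K
      · refine mll ?_ (hφ0 p)
        have h1 := hΘlow p hp h hh0 hhr
        have hpos : 0 ≤ Cε + |B1| * (r / ε + 1 / ε) := by positivity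
        rw [abs_le]
        refine ⟨le_min (by linarith) (by linarith), (min_le_right _ _).trans hpos⟩
      · rw [image_eq_zero_of_notMem_tsupport hp]; simp
    · exact (hφ.mul continuous_const).integrable_of_hasCompactSupport hφc.mul_right
    · refine ae_of_all _ fun p => ?_
      by_cases hp : p ∈ K
      · simpa using (hneg p hp).const_mul (φ p)
      · rw [image_eq_zero_of_notMem_tsupport hp]; simp
  simp only [integral_zero] at hlim
  filter_upwards [hlim.eventually (lt_mem_nhds (show -ε < 0 by linarith))] with h hh
  have hi1 : Integrable (fun p => φ p * min (Θ h p + e1) 0) :=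
    (hφ.mul (((hΘc h).add continuous_const).min continuous_const)).integrable_of_hasCompactSupport
      hφc.mul_right
  have hi2 : Integrable (fun p => φ p * Θ h p) :=
    (hφ.mul (hΘc h)).integrable_of_hasCompactSupport hφc.mul_right
  have hi3 : Integrable φ := hφ.integrable_of_hasCompactSupport hφc
  have hmono : ∫ p, (φ p * min (Θ h p + e1) 0 - e1 * φ p) ≤ ∫ p, φ p * Θ h p := by
    refine integral_mono (hi1.sub (hi3.const_mul _)) hi2 fun p => ?_
    have h1 := mll (min_le_left (Θ h p + e1) 0) (hφ0 p)
    simp only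
    linarith
  rw [integral_sub hi1 (hi3.const_mul _), integral_const_mul] at hmono
  linarith

theorem shiftInt {W : ℝ → ℝ} (hW : Continuous W) {L h c x : ℝ} (hh : 0 < h)
    (hL : ∀ x y, |W x - W y| ≤ L * |x - y|) :
    |(∫ y in c..x, (W (y + h) - W y) / h) - (W x - W c)| ≤ 2 * (L * h) := by
  have hi : ∀ a b, IntervalIntegrable W volume a b := fun a b => hW.intervalIntegrable _ _
  have h1 : (∫ y in c..x, (W (y + h) - W y) / h)
      = ((∫ y in x..x + h, W y) - ∫ y in c..c + h, W y) / h := by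
    rw [intervalIntegral.integral_div, iSub
      ((show Continuous fun y => W (y + h) by fun_prop).intervalIntegrable _ _) (hi _ _),
      intervalIntegral.integral_comp_add_right,
      intervalIntegral.integral_interval_sub_interval_comm (hi _ _) (hi _ _) (hi _ _)]
    rw [intervalIntegral.integral_symm c (c+h),
      intervalIntegral.integral_symm x (x+h)]
    ring
  have h2 : ∀ z, |(∫ y in z..z + h, W y) / h - W z| ≤ L * h := by
    intro z
    have e1 : (∫ y in z..z + h, W y) / h - W z = (∫ y in z..z + h, (W y - W z)) / h := by
      rw [iSub (hi _ _) (by simp)]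
      simp
      field_simp
    rw [e1, abs_div, abs_of_pos hh, div_le_iff₀ hh]
    have := absInt (a := z) (b := z + h) (C := L * h) (f := fun y => W y - W z) ?_
    · simpa [abs_of_pos hh] using this
    · intro y hy
      rw [uIoc_of_le (by linarith)] at hy
      refine (hL y z).trans ?_
      have hLn : 0 ≤ L := by
        have := (abs_nonneg _).trans (hL 1 0)
        simpa using this
      refine mll ?_ hLn
      rw [abs_of_nonneg (by linarith [hy.1])]; linarith [hy.2]
  rw [h1, sub_div]
  have a1 := abs_le.1 (h2 x)
  have a2 := abs_le.1 (h2 c)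
  rw [abs_le]; constructor <;> linarith

theorem lipOf {f f' : ℝ → ℝ} {C : ℝ} (h : ∀ x, HasDerivAt f (f' x) x) (hC : ∀ x, |f' x| ≤ C)
    (x y : ℝ) : |f x - f y| ≤ C * |x - y| := by
  have := Convex.norm_image_sub_le_of_norm_hasDerivWithin_le (𝕜 := ℝ) (f := f) (f' := f')
    (s := univ) (x := y) (y := x) (C := C) (fun x _ => (h x).hasDerivWithinAt)
    (fun x _ => hC x) convex_univ trivial trivial
  simpa using this

theorem SC0 {w wx wxx B Bt φ φx gt : ℝ × ℝ → ℝ} {D : Set (ℝ × ℝ)} {M L LB C : ℝ}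
    (hD : IsOpen D) (hDs : ∀ t, OrdConnected {x | (t, x) ∈ D})
    (hw : Continuous w) (hM : ∀ p, |w p| ≤ M)
    (hL : ∀ t x y, |w (t, x) - w (t, y)| ≤ L * |x - y|)
    (hwx : ∀ p ∈ D, HasDerivAt (fun y => w (p.1, y)) (wx p) p.2)
    (hwxx : ∀ p ∈ D, HasDerivAt (fun y => wx (p.1, y)) (wxx p) p.2)
    (hT : ∀ p ∈ D, ∀ q C : ℝ, (∀ᶠ s in 𝓝[<] p.1, q * (p.1 - s) - C * (p.1 - s) ^ 2 ≤
      w p - w (s, p.2)) → B p * q ≤ wxx p)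
    (hB : Continuous B) (hB0 : ∀ p ∈ D, 0 ≤ B p)
    (hBt : ∀ p ∈ D, HasDerivAt (fun s => B (s, p.2)) (Bt p) p.1) (hBL : ∀ p ∈ D, |Bt p| ≤ LB)
    (hφ : Continuous φ) (hφ0 : ∀ p, 0 ≤ φ p) (hφc : HasCompactSupport φ)
    (hφD : tsupport φ ⊆ D)
    (hφx : ∀ p : ℝ × ℝ, HasDerivAt (fun y => φ (p.1, y)) (φx p) p.2)
    (hφxc : ∀ t, Continuous fun y => φx (t, y)) (hφxb : ∀ p, |φx p| ≤ C)
    (hgt : ∀ p : ℝ × ℝ, HasDerivAt (fun s => B (s, p.2) * φ (s, p.2)) (gt p) p.1)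
    (hgb : ∀ p, |gt p| ≤ C) :
    0 ≤ -(∫ t, ∫ x, wx (t, x) * φx (t, x)) + ∫ p, w p * gt p := by
  have hLn : 0 ≤ L := by
    have := (abs_nonneg _).trans (hL 0 1 0)
    simpa using this
  have hCn : 0 ≤ C := (abs_nonneg _).trans (hgb 0)
  have hMn : 0 ≤ M := (abs_nonneg _).trans (hM 0)
  have hKc : IsCompact (tsupport φ) := hφc
  obtain ⟨r0, hr0, hr0D⟩ := hKc.exists_cthickening_subset_open hD hφD
  set r := min r0 1 with hrd
  have hr : 0 < r := lt_min hr0 one_pos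
  have hrD : Metric.cthickening r (tsupport φ) ⊆ D :=
    (Metric.cthickening_mono (min_le_left _ _) _).trans hr0D
  have hseq : ∀ n : ℕ, ∃ ε h : ℝ, 0 < ε ∧ ε ≤ 1 / ((n:ℝ) + 1) ∧ 0 < h ∧ h ≤ 1 / ((n:ℝ) + 1) ∧
      -(1 / ((n:ℝ) + 1)) * (∫ p, φ p) - 1 / ((n:ℝ) + 1) ≤
      ∫ p, φ p * ((supc w ε (p.1, p.2 + h) + supc w ε (p.1, p.2 - h) - 2 * supc w ε p) / h ^ 2
        - B p * ((supc w ε p - supc w ε (p.1 - h, p.2)) / h)) := by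
    intro n
    set e : ℝ := 1 / ((n:ℝ) + 1) with he
    have hepos : 0 < e := by positivity
    have huc := (hKc.cthickening (r := 1)).uniformContinuousOn_of_continuous hw.continuousOn
    rw [Metric.uniformContinuousOn_iff] at huc
    obtain ⟨d, hd, hud⟩ := huc (e / (2 * |LB| + 1)) (by positivity)
    set d' := min d (min 1 (r / 2)) with hd'
    have hd'0 : 0 < d' := by positivity
    obtain ⟨ε, hε0, hε1, hε2⟩ : ∃ ε : ℝ, 0 < ε ∧ ε ≤ e ∧ 4 * M * ε < d' ^ 2 := by
      refine ⟨min e (d' ^ 2 / (4 * M + 1) / 2), by positivity, min_le_left _ _, ?_⟩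
      have h1 : 4 * M * min e (d' ^ 2 / (4 * M + 1) / 2) ≤ 4 * M * (d' ^ 2 / (4 * M + 1) / 2) :=
        mll (min_le_right _ _) (by positivity)
      have h2 : 4 * M * (d' ^ 2 / (4 * M + 1) / 2) = d' ^ 2 * (4 * M / (4 * M + 1)) / 2 := by
        field_simp
      have h3 : 4 * M / (4 * M + 1) ≤ 1 := by rw [div_le_one (by positivity)]; linarith
      have h4 : 0 < d' ^ 2 := by positivity
      nlinarith
    have hstep := supc_step (ε := ε) (e1 := e) hD hw hM hwx hwxx hT hB hB0 hBt hBL hφ hφ0 hφc hr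
      (min_le_right _ _) hrD hε0 (hε2.trans_le ?_) ?_ hepos.le
    · have hlt : ∀ᶠ h in 𝓝[>] (0:ℝ), h < e := nhdsWithin_le_nhds (eventually_lt_nhds hepos)
      obtain ⟨h, h1, h2, h3⟩ := (hstep.and (hlt.and self_mem_nhdsWithin)).exists
      exact ⟨ε, h, hε0, hε1, h3, h2.le, by linarith⟩
    · have : d' ≤ r / 2 := (min_le_right _ _).trans (min_le_right _ _)
      nlinarith
    · intro p hp τ hτ
      have hτd : |τ| < d' := abs_lt_of_sq_lt_sq (hτ.trans_lt hε2) hd'0.le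
      have hd1 : dist (p.1 + τ, p.2) p ≤ |τ| := by
        rw [Prod.dist_eq]; simp
      have hτ1 : |τ| ≤ 1 := hτd.le.trans ((min_le_right _ _).trans (min_le_left _ _))
      have h1 := hud (p.1 + τ, p.2)
        (Metric.mem_cthickening_of_dist_le _ p 1 _ hp (hd1.trans hτ1)) p
        (Metric.mem_cthickening_of_dist_le _ p 1 _ hp (by simp))
        (hd1.trans_lt (hτd.trans_le (min_le_left _ _)))
      rw [Real.dist_eq] at h1
      have h2 : 2 * LB * (w (p.1 + τ, p.2) - w p) ≤ 2 * |LB| * |w (p.1 + τ, p.2) - w p| := by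
        rw [show 2 * |LB| * |w (p.1 + τ, p.2) - w p| = |2 * LB * (w (p.1 + τ, p.2) - w p)| by
          rw [abs_mul, abs_mul]; simp]
        exact le_abs_self _
      have h3 : 2 * |LB| * |w (p.1 + τ, p.2) - w p| ≤ 2 * |LB| * (e / (2 * |LB| + 1)) :=
        mll h1.le (by positivity)
      have h4 : 2 * |LB| * (e / (2 * |LB| + 1)) ≤ e := by
        rw [mul_div_assoc', div_le_iff₀ (by positivity)]
        nlinarith [abs_nonneg LB]
      linarith
  choose ε h hε0 hε1 hh0 hh1 hineq using hseq
  have hinv : Tendsto (fun n : ℕ => 1 / ((n:ℝ) + 1)) atTop (𝓝 0) := tendsto_one_div_add_atTop_nhds_zero_nat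
  have hεt : Tendsto ε atTop (𝓝 0) :=
    squeeze_zero (fun n => (hε0 n).le) hε1 hinv
  have hht : Tendsto h atTop (𝓝 0) :=
    squeeze_zero (fun n => (hh0 n).le) hh1 hinv
  have hht' : Tendsto h atTop (𝓝[>] 0) :=
    tendsto_nhdsWithin_iff.2 ⟨hht, Eventually.of_forall fun n => hh0 n⟩
  have hhle : ∀ n, h n ≤ 1 := fun n => (hh1 n).trans (by
    rw [div_le_one (by positivity)]; linarith [Nat.cast_nonneg (α := ℝ) n])
  set W : ℕ → ℝ × ℝ → ℝ := fun n => supc w (ε n) with hWd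
  have hWc : ∀ n, Continuous (W n) := fun n => supc_cont hw _
  have hWL : ∀ n t x y, |W n (t, x) - W n (t, y)| ≤ L * |x - y| := fun n => supc_lip hw hL
  have hWM : ∀ n p, |W n p| ≤ M := fun n => supc_le hw (hε0 n) hM
  have hWt : ∀ p, Tendsto (fun n => W n p) atTop (𝓝 (w p)) := fun p =>
    supc_tendsto hw hM p hε0 hεt
  obtain ⟨T0, hT0⟩ := hKc.isBounded.subset_closedBall 0
  set T := |T0| + 2 with hTd
  have hTpos : 0 < T := by positivity
  have hbox : ∀ p : ℝ × ℝ, φ p ≠ 0 → |p.1| ≤ T - 2 ∧ |p.2| ≤ T - 2 := by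
    intro p hp
    have := hT0 (subset_tsupport φ hp)
    rw [mem_closedBall_zero_iff, Prod.norm_def] at this
    have h2 := max_le_iff.1 (this.trans (le_abs_self T0))
    simp only [Real.norm_eq_abs] at h2
    exact ⟨by rw [hTd]; linarith [h2.1], by rw [hTd]; linarith [h2.2]⟩
  have hφz : ∀ p : ℝ × ℝ, (T - 2 < |p.1| ∨ T - 2 < |p.2|) → φ p = 0 := by
    intro p hp
    by_contra hne
    have := hbox p hne
    rcases hp with hp | hp <;> linarith [this.1, this.2]
  set g : ℝ × ℝ → ℝ := fun p => B p * φ p with hg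
  have hgc : Continuous g := hB.mul hφ
  have hgcs : HasCompactSupport g := hφc.mul_left
  set DW : ℕ → ℝ × ℝ → ℝ := fun n p => (W n (p.1, p.2 + h n) - W n p) / h n with hDW
  set Dφ : ℕ → ℝ × ℝ → ℝ := fun n p => (φ (p.1, p.2 + h n) - φ p) / h n with hDφ
  set Dg : ℕ → ℝ × ℝ → ℝ := fun n p => (g (p.1 + h n, p.2) - g p) / h n with hDg
  have hDWc : ∀ n, Continuous (DW n) := fun n => by
    have := hWc n
    simp only [hDW]; fun_prop
  have hDφc : ∀ n, Continuous (Dφ n) := fun n => by simp only [hDφ]; fun_prop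
  have hDgc : ∀ n, Continuous (Dg n) := fun n => by simp only [hDg]; fun_prop
  have hDWb : ∀ n p, |DW n p| ≤ L := by
    intro n p
    simp only [hDW]
    rw [abs_div, abs_of_pos (hh0 n), div_le_iff₀ (hh0 n)]
    have := hWL n p.1 (p.2 + h n) p.2
    simpa [abs_of_pos (hh0 n)] using this
  have hDφb : ∀ n p, |Dφ n p| ≤ C := by
    intro n p
    simp only [hDφ]
    rw [abs_div, abs_of_pos (hh0 n), div_le_iff₀ (hh0 n)]
    have := lipOf (f := fun y => φ (p.1, y)) (f' := fun y => φx (p.1, y))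
      (fun y => hφx (p.1, y)) (fun y => hφxb _) (p.2 + h n) p.2
    simpa [abs_of_pos (hh0 n)] using this
  have hDgb : ∀ n p, |Dg n p| ≤ C := by
    intro n p
    simp only [hDg]
    rw [abs_div, abs_of_pos (hh0 n), div_le_iff₀ (hh0 n)]
    have := lipOf (f := fun y => g (y, p.2)) (f' := fun y => gt (y, p.2))
      (fun y => hgt (y, p.2)) (fun y => hgb _) (p.1 + h n) p.1
    simpa [abs_of_pos (hh0 n)] using this
  have hcs : ∀ u : ℝ × ℝ → ℝ, (∀ p : ℝ × ℝ, (T < |p.1| ∨ T < |p.2|) → u p = 0) →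
      HasCompactSupport u := by
    intro u hu
    refine HasCompactSupport.intro ((isCompact_Icc (a := -T) (b := T)).prod
      (isCompact_Icc (a := -T) (b := T))) fun p hp => hu p ?_
    by_contra hcon
    push Not at hcon
    exact hp ⟨abs_le.1 hcon.1, abs_le.1 hcon.2⟩
  have hbig : ∀ (n : ℕ) (z : ℝ), T < |z| → T - 2 < |z + h n| := by
    intro n z hz
    have h1 := abs_sub_abs_le_abs_sub z (z + h n)
    have h2 : |z - (z + h n)| = h n := by
      rw [show z - (z + h n) = -h n by ring, abs_neg, abs_of_pos (hh0 n)]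
    linarith [hhle n]
  have hDφz : ∀ n, ∀ p : ℝ × ℝ, (T < |p.1| ∨ T < |p.2|) → Dφ n p = 0 := by
    intro n p hp
    simp only [hDφ]
    rw [hφz p (hp.imp (fun h => by linarith) fun h => by linarith),
      hφz (p.1, p.2 + h n) (hp.imp (fun h => by simp only; linarith) fun hp => hbig n _ hp)]
    simp
  have hDgz : ∀ n, ∀ p : ℝ × ℝ, (T < |p.1| ∨ T < |p.2|) → Dg n p = 0 := by
    intro n p hp
    simp only [hDg, hg]
    rw [hφz p (hp.imp (fun h => by linarith) fun h => by linarith),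
      hφz (p.1 + h n, p.2) (hp.imp (fun hp => hbig n _ hp) fun h => by simp only; linarith)]
    simp
  have hint2 : ∀ n, Integrable (fun p => DW n p * Dφ n p) := fun n =>
    ((hDWc n).mul (hDφc n)).integrable_of_hasCompactSupport
      (hcs _ fun p hp => by simp [hDφz n p hp])
  have hparts : ∀ n, ∫ p, φ p * ((W n (p.1, p.2 + h n) + W n (p.1, p.2 - h n) - 2 * W n p) / h n ^ 2
        - B p * ((W n p - W n (p.1 - h n, p.2)) / h n))
      = -(∫ p, DW n p * Dφ n p) + ∫ p, W n p * Dg n p := by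
    intro n
    have hWn := hWc n
    have hne : h n ≠ 0 := (hh0 n).ne'
    have hI : ∀ u v : ℝ × ℝ → ℝ, Continuous u → Continuous v → HasCompactSupport u →
        Integrable (fun p => u p * v p) := fun u v hu hv hc =>
      (hu.mul hv).integrable_of_hasCompactSupport hc.mul_right
    have i1 : Integrable (fun p => φ p * (DW n p / h n)) :=
      hI _ _ hφ (by have := hDWc n; fun_prop) hφc
    have c2 : Continuous fun p : ℝ × ℝ => DW n (p.1, p.2 - h n) / h n := by
      have := hDWc n; fun_prop
    have i2 : Integrable (fun p => φ p * (DW n (p.1, p.2 - h n) / h n)) := hI _ _ hφ c2 hφc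
    have i3 : Integrable (fun p => g p * (W n p / h n)) := hI _ _ hgc (by fun_prop) hgcs
    have i4 : Integrable (fun p => g p * (W n (p.1 - h n, p.2) / h n)) :=
      hI _ _ hgc (by fun_prop) hgcs
    have e1 : ∀ p : ℝ × ℝ, φ p * ((W n (p.1, p.2 + h n) + W n (p.1, p.2 - h n) - 2 * W n p) / h n ^ 2
        - B p * ((W n p - W n (p.1 - h n, p.2)) / h n)) =
        (φ p * (DW n p / h n) - φ p * (DW n (p.1, p.2 - h n) / h n)) -
        (g p * (W n p / h n) - g p * (W n (p.1 - h n, p.2) / h n)) := by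
      intro p
      simp only [hDW, hg, sub_add_cancel]
      field_simp
      ring
    simp_rw [e1]
    rw [integral_sub (by exact i1.sub i2) (by exact i3.sub i4), integral_sub i1 i2, integral_sub i3 i4]
    have q1 : ∀ p : ℝ × ℝ, p + (0, h n) = (p.1, p.2 + h n) := fun p => by ext <;> simp
    have q2 : ∀ p : ℝ × ℝ, p + (h n, 0) = (p.1 + h n, p.2) := fun p => by ext <;> simp
    have s1 : ∫ p : ℝ × ℝ, φ p * (DW n (p.1, p.2 - h n) / h n)
        = ∫ p : ℝ × ℝ, φ (p.1, p.2 + h n) * (DW n p / h n) := by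
      rw [← integral_add_right_eq_self (μ := volume) _ ((0, h n) : ℝ × ℝ)]
      simp [q1]
    have s2 : ∫ p : ℝ × ℝ, g p * (W n (p.1 - h n, p.2) / h n)
        = ∫ p : ℝ × ℝ, g (p.1 + h n, p.2) * (W n p / h n) := by
      rw [← integral_add_right_eq_self (μ := volume) _ ((h n, 0) : ℝ × ℝ)]
      simp [q2]
    have i2' : Integrable (fun p : ℝ × ℝ => φ (p.1, p.2 + h n) * (DW n p / h n)) := by
      have := i2.comp_add_right ((0, h n) : ℝ × ℝ)
      simpa [q1] using this
    have i4' : Integrable (fun p : ℝ × ℝ => g (p.1 + h n, p.2) * (W n p / h n)) := by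
      have := i4.comp_add_right ((h n, 0) : ℝ × ℝ)
      simpa [q2] using this
    rw [s1, s2, ← integral_sub i1 i2', ← integral_sub i3 i4', ← integral_neg, sub_eq_add_neg,
      ← integral_neg]
    congr 1
    · congr 1; ext p; simp only [hDφ]; field_simp; ring
    · congr 1; ext p; simp only [hDg]; field_simp; ring
  have hlimT : Tendsto (fun n => ∫ p, W n p * Dg n p) atTop (𝓝 (∫ p, w p * gt p)) := by
    refine tendsto_integral_of_dominated_convergence
      ((Icc (-T) T ×ˢ Icc (-T) T).indicator fun _ => M * C) ?_ ?_ ?_ ?_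
    · exact fun n => ((hWc n).mul (hDgc n)).aestronglyMeasurable
    · rw [integrable_indicator_iff (measurableSet_Icc.prod measurableSet_Icc)]
      exact integrableOn_const (by
        exact (isCompact_Icc.prod isCompact_Icc).measure_ne_top)
    · intro n
      refine ae_of_all _ fun p => ?_
      by_cases hp : p ∈ Icc (-T) T ×ˢ Icc (-T) T
      · rw [indicator_of_mem hp, norm_mul]
        exact mul_le_mul (hWM n p) (hDgb n p) (norm_nonneg _) hMn
      · rw [indicator_of_notMem hp, hDgz n p ?_]
        · simp
        · by_contra hcon
          push Not at hcon
          exact hp ⟨abs_le.1 hcon.1, abs_le.1 hcon.2⟩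
    · refine ae_of_all _ fun p => (hWt p).mul ?_
      have := (hgt p).tendsto_slope_zero_right.comp hht'
      refine this.congr fun n => ?_
      simp only [Function.comp, smul_eq_mul, hDg, hg]
      rw [inv_mul_eq_div]
  have hinner : ∀ t, Tendsto (fun n => ∫ x, DW n (t, x) * Dφ n (t, x)) atTop
      (𝓝 (∫ x, wx (t, x) * φx (t, x))) := by
    intro t
    have hφxz : ∀ x, (t, x) ∉ tsupport φ → φx (t, x) = 0 := by
      intro x hx
      have hcu : Continuous fun y : ℝ => (t, y) := by fun_prop
      have hev : ∀ᶠ y in 𝓝 x, (t, y) ∉ tsupport φ :=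
        hcu.continuousAt.eventually ((isClosed_tsupport φ).isOpen_compl.mem_nhds hx)
      have h0 : HasDerivAt (fun y => φ (t, y)) 0 x :=
        (hasDerivAt_const x (0:ℝ)).congr_of_eventuallyEq
          (hev.mono fun y hy => image_eq_zero_of_notMem_tsupport hy)
      exact (hφx (t, x)).unique h0
    have hKT : ∀ x, (t, x) ∈ tsupport φ → |x| ≤ T := by
      intro x hx
      have := hT0 hx
      rw [mem_closedBall_zero_iff, Prod.norm_def] at this
      have h2 := (max_le_iff.1 (this.trans (le_abs_self T0))).2
      simp only [Real.norm_eq_abs] at h2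
      rw [hTd]; linarith
    have hA : Tendsto (fun n => ∫ x, DW n (t, x) * (Dφ n (t, x) - φx (t, x))) atTop (𝓝 0) := by
      have : Tendsto (fun n => ∫ x, DW n (t, x) * (Dφ n (t, x) - φx (t, x))) atTop
          (𝓝 (∫ x : ℝ, (0:ℝ))) := by
        refine tendsto_integral_of_dominated_convergence
          ((Icc (-T) T).indicator fun _ => L * (2 * C)) ?_ ?_ ?_ ?_
        · intro n
          have c1 := hDWc n
          have c2 := hDφc n
          have c3 := hφxc t
          have c1' : Continuous fun x => DW n (t, x) := c1.comp (Continuous.prodMk_right t)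
          have c2' : Continuous fun x => Dφ n (t, x) := c2.comp (Continuous.prodMk_right t)
          exact (c1'.mul (c2'.sub c3)).aestronglyMeasurable
        · rw [integrable_indicator_iff measurableSet_Icc]
          exact integrableOn_const (by simp)
        · intro n
          refine ae_of_all _ fun x => ?_
          by_cases hp : x ∈ Icc (-T) T
          · rw [indicator_of_mem hp, norm_mul]
            refine mul_le_mul (hDWb n _) ?_ (norm_nonneg _) hLn
            refine (norm_sub_le _ _).trans ?_
            have h1 := hDφb n (t, x)
            have h2 := hφxb (t, x)
            simp only [Real.norm_eq_abs]; linarith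
          · have hx : T < |x| := by
              by_contra hcon
              exact hp (abs_le.1 (not_lt.1 hcon))
            rw [indicator_of_notMem hp, hDφz n _ (Or.inr hx), hφxz x fun hh => by
              linarith [hKT x hh]]
            simp
        · refine ae_of_all _ fun x => ?_
          have h1 : Tendsto (fun n => Dφ n (t, x) - φx (t, x)) atTop (𝓝 0) := by
            have := (hφx (t, x)).tendsto_slope_zero_right.comp hht'
            have h2 := (this.sub_const (φx (t, x)))
            rw [sub_self] at h2
            refine h2.congr fun n => ?_
            simp only [Function.comp, smul_eq_mul, hDφ]
            rw [inv_mul_eq_div]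
          refine squeeze_zero_norm (a := fun n => L * |Dφ n (t, x) - φx (t, x)|) (fun n => ?_) ?_
          · rw [norm_mul]
            exact mlr (hDWb n _) (norm_nonneg _)
          · simpa using (h1.abs).const_mul L
      simpa using this
    have hBlim : Tendsto (fun n => ∫ x, DW n (t, x) * φx (t, x)) atTop
        (𝓝 (∫ x, wx (t, x) * φx (t, x))) := by
      by_cases hS : ∃ x, (t, x) ∈ tsupport φ
      swap
      · push Not at hS
        have : ∀ x, φx (t, x) = 0 := fun x => hφxz x (hS x)
        simp [this]
      have hSc : IsCompact {x | (t, x) ∈ tsupport φ} := by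
        refine Metric.isCompact_of_isClosed_isBounded ?_ ?_
        · exact (isClosed_tsupport φ).preimage (by fun_prop : Continuous fun x : ℝ => (t, x))
        · exact (Metric.isBounded_Icc (-T) T).subset fun x hx => abs_le.1 (hKT x hx)
      have hc := hSc.sInf_mem hS
      have hd := hSc.sSup_mem hS
      set c := sInf {x | (t, x) ∈ tsupport φ}
      set d := sSup {x | (t, x) ∈ tsupport φ}
      have hsub : ∀ x, (t, x) ∈ tsupport φ → x ∈ Icc c d := fun x hx =>
        ⟨csInf_le hSc.bddBelow hx, le_csSup hSc.bddAbove hx⟩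
      have hcd : c ≤ d := (hsub d hd).1
      have hDcd : ∀ x ∈ Icc c d, (t, x) ∈ D := fun x hx =>
        (hDs t).out (show (t, c) ∈ D from hφD hc) (show (t, d) ∈ D from hφD hd) hx
      have hconv : ∀ u : ℝ → ℝ, ∫ x, u x * φx (t, x) = ∫ x in c..d, u x * φx (t, x) := by
        intro u
        rw [intervalIntegral.integral_of_le hcd, ← integral_Icc_eq_integral_Ioc,
          setIntegral_eq_integral_of_forall_compl_eq_zero]
        intro x hx
        rw [hφxz x fun hh => hx (hsub x hh), mul_zero]
      simp_rw [hconv]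
      have hwxc : ContinuousOn (fun x => wx (t, x)) (Icc c d) := fun x hx =>
        (hwxx (t, x) (hDcd x hx)).continuousAt.continuousWithinAt
      refine weakConv (L := L) hcd (Eventually.of_forall fun n => ?_) hwxc
        (Eventually.of_forall fun n x _ => hDWb n _) ?_ ?_ (hφxc t).continuousOn
      · have := hDWc n
        exact Continuous.continuousOn (by fun_prop)
      · intro x hx
        refine (hwx (t, x) (hDcd x hx)).le_of_lip' hLn (Eventually.of_forall fun y => ?_)
        exact hL t y x
      · intro x hx
        have hFTC : ∫ y in c..x, wx (t, y) = w (t, x) - w (t, c) := by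
          refine intervalIntegral.integral_eq_sub_of_hasDerivAt (f := fun y => w (t, y)) ?_ ?_
          · intro y hy
            rw [uIcc_of_le hx.1] at hy
            exact hwx (t, y) (hDcd y ⟨hy.1, hy.2.trans hx.2⟩)
          · refine ContinuousOn.intervalIntegrable ?_
            rw [uIcc_of_le hx.1]
            exact hwxc.mono (Icc_subset_Icc le_rfl hx.2)
        rw [hFTC]
        have hmid : Tendsto (fun n => W n (t, x) - W n (t, c)) atTop (𝓝 (w (t, x) - w (t, c))) :=
          (hWt _).sub (hWt _)
        refine tendsto_of_tendsto_of_dist hmid ?_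
        have : Tendsto (fun n => 2 * (L * h n)) atTop (𝓝 0) := by
          simpa using (hht.const_mul L).const_mul 2
        refine squeeze_zero (fun _ => dist_nonneg) (fun n => ?_) this
        rw [dist_comm, Real.dist_eq]
        have c1 := hWc n
        exact shiftInt (W := fun y => W n (t, y)) (by fun_prop) (hh0 n) (hWL n t)
    have hsum := hA.add hBlim
    rw [zero_add] at hsum
    refine hsum.congr fun n => ?_
    have c1 := hDWc n
    have c2 := hDφc n
    have c3 := hφxc t
    have hz1 : HasCompactSupport fun x => φx (t, x) :=
      HasCompactSupport.intro (isCompact_Icc (a := -T) (b := T)) fun x hx =>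
        hφxz x fun hh => hx (abs_le.1 (hKT x hh))
    have hz2 : HasCompactSupport fun x => Dφ n (t, x) :=
      HasCompactSupport.intro (isCompact_Icc (a := -T) (b := T)) fun x hx =>
        hDφz n _ (Or.inr (by by_contra hcon; exact hx (abs_le.1 (not_lt.1 hcon))))
    have c1' : Continuous fun x => DW n (t, x) := c1.comp (Continuous.prodMk_right t)
    have c2' : Continuous fun x => Dφ n (t, x) := c2.comp (Continuous.prodMk_right t)
    rw [← integral_add]
    · congr 1; ext x; ring
    · exact Continuous.integrable_of_hasCompactSupport (c1'.mul (c2'.sub c3)) (hz2.sub hz1).mul_left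
    · exact Continuous.integrable_of_hasCompactSupport (c1'.mul c3) hz1.mul_left
  have hlimX : Tendsto (fun n => ∫ p, DW n p * Dφ n p) atTop
      (𝓝 (∫ t, ∫ x, wx (t, x) * φx (t, x))) := by
    have hF : ∀ n, ∫ p, DW n p * Dφ n p = ∫ t, ∫ x, DW n (t, x) * Dφ n (t, x) := by
      intro n
      rw [Measure.volume_eq_prod] 
      exact integral_prod _ (hint2 n)
    simp_rw [hF]
    refine tendsto_integral_of_dominated_convergence
      ((Icc (-T) T).indicator fun _ => L * C * (2 * T)) ?_ ?_ ?_ (ae_of_all _ hinner)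
    · exact fun n => (Integrable.integral_prod_left (hint2 n)).aestronglyMeasurable
    · rw [integrable_indicator_iff measurableSet_Icc]
      exact integrableOn_const (by simp)
    · intro n
      refine ae_of_all _ fun t => ?_
      by_cases ht : t ∈ Icc (-T) T
      · rw [indicator_of_mem ht]
        have h1 : ∫ x, DW n (t, x) * Dφ n (t, x) = ∫ x in Icc (-T) T, DW n (t, x) * Dφ n (t, x) := by
          rw [setIntegral_eq_integral_of_forall_compl_eq_zero]
          intro x hx
          rw [hDφz n _ (Or.inr (by by_contra hcon; exact hx (abs_le.1 (not_lt.1 hcon)))), mul_zero]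
        rw [h1]
        refine (norm_setIntegral_le_of_norm_le_const (C := L * C) (by simp) fun x hx => ?_).trans ?_
        · rw [norm_mul]
          exact mul_le_mul (hDWb n _) (hDφb n _) (norm_nonneg _) hLn
        · simp only [measureReal_def, Real.volume_Icc]
          rw [ENNReal.toReal_ofReal (by linarith)]
          exact le_of_eq (by ring)
      · rw [indicator_of_notMem ht]
        have h1 : ∀ x, Dφ n (t, x) = 0 := fun x => hDφz n _ (Or.inl (by
          by_contra hcon; exact ht (abs_le.1 (not_lt.1 hcon))))
        simp [h1]
  have hfin := (hlimX.neg).add hlimT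
  have hlow : Tendsto (fun n : ℕ => -(1 / ((n:ℝ) + 1)) * (∫ p, φ p) - 1 / ((n:ℝ) + 1)) atTop
      (𝓝 (-0 * (∫ p, φ p) - 0)) := (hinv.neg.mul_const _).sub hinv
  simp only [neg_zero, zero_mul, sub_zero] at hlow
  refine le_of_tendsto_of_tendsto' hlow hfin fun n => ?_
  rw [← hparts n]
  exact hineq n

theorem SC1 {w wx wxx wt B Bt φ φx gt : ℝ × ℝ → ℝ} {F : ℝ → ℝ} {D : Set (ℝ × ℝ)} {M L LB C : ℝ}
    (hD : IsOpen D) (hDs : ∀ t, OrdConnected {x | (t, x) ∈ D})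
    (hw : Continuous w) (hM : ∀ p, |w p| ≤ M)
    (hL : ∀ t x y, |w (t, x) - w (t, y)| ≤ L * |x - y|)
    (hwx : ∀ p ∈ D, HasDerivAt (fun y => w (p.1, y)) (wx p) p.2)
    (hwxx : ∀ p ∈ D, HasDerivAt (fun y => wx (p.1, y)) (wxx p) p.2)
    (hwt : ∀ p ∈ D, HasDerivAt (fun s => w (s, p.2)) (wt p) p.1)
    (hF : Integrable F)
    (hT : ∀ p ∈ D, B p * (wt p - F p.1) ≤ wxx p)
    (hB : Continuous B) (hB0 : ∀ p ∈ D, 0 ≤ B p)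
    (hBt : ∀ p ∈ D, HasDerivAt (fun s => B (s, p.2)) (Bt p) p.1) (hBL : ∀ p ∈ D, |Bt p| ≤ LB)
    (hφ : Continuous φ) (hφ0 : ∀ p, 0 ≤ φ p) (hφc : HasCompactSupport φ)
    (hφD : tsupport φ ⊆ D)
    (hφx : ∀ p : ℝ × ℝ, HasDerivAt (fun y => φ (p.1, y)) (φx p) p.2)
    (hφxc : ∀ t, Continuous fun y => φx (t, y)) (hφxb : ∀ p, |φx p| ≤ C)
    (hgt : ∀ p : ℝ × ℝ, HasDerivAt (fun s => B (s, p.2) * φ (s, p.2)) (gt p) p.1)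
    (hgb : ∀ p, |gt p| ≤ C) (c : ℝ) :
    0 ≤ -(∫ t, ∫ x, wx (t, x) * φx (t, x)) + ∫ p, (w p - ∫ s in c..p.1, F s) * gt p := by
  have hgm : Measurable gt := by
    have h1 := measurable_deriv_with_param (𝕜 := ℝ) (α := ℝ)
      (f := fun x s => B (s, x) * φ (s, x)) (by fun_prop)
    have h2 : gt = fun p : ℝ × ℝ => (fun p : ℝ × ℝ => deriv
      ((fun x s => B (s, x) * φ (s, x)) p.1) p.2) (p.2, p.1) := by
      funext p; exact (hgt p).deriv.symm
    rw [h2]; exact h1.comp measurable_swap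
  have hgz : ∀ p, p ∉ tsupport φ → gt p = 0 := by
    intro p hp
    have h1 : ∀ᶠ s in 𝓝 p.1, (s, p.2) ∉ tsupport φ := by
      have hc : Tendsto (fun s : ℝ => (s, p.2)) (𝓝 p.1) (𝓝 p) :=
        (Continuous.prodMk_left p.2).tendsto p.1
      exact hc.eventually ((isClosed_tsupport φ).isOpen_compl.mem_nhds hp)
    have h2 : (fun s => B (s, p.2) * φ (s, p.2)) =ᶠ[𝓝 p.1] fun _ => 0 := by
      filter_upwards [h1] with s hs
      rw [image_eq_zero_of_notMem_tsupport hs, mul_zero]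
    exact ((hgt p).congr_of_eventuallyEq h2.symm).unique (hasDerivAt_const _ _)
  have hgi : Integrable gt := by
    have : IntegrableOn gt (tsupport φ) :=
      IntegrableOn.of_bound (IsCompact.measure_lt_top hφc)
        hgm.aestronglyMeasurable C (ae_of_all _ fun p => hgb p)
    exact (integrableOn_iff_integrable_of_support_subset fun p hp => by
      by_contra h; exact hp (hgz p h)).1 this
  have key : ∀ δ : ℝ, 0 < δ → -(δ * ∫ p, |gt p|) ≤
      -(∫ t, ∫ x, wx (t, x) * φx (t, x)) + ∫ p, (w p - ∫ s in c..p.1, F s) * gt p := by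
    intro δ hδ
    obtain ⟨g, hg1, hg2, hg3, hg4, hg5⟩ := exists_lt_lowerSemicontinuous_integral_lt F hF hδ
    set G : ℝ → ℝ := fun x => (g x).toReal with hG
    have hER : ∀ (c : ℝ) (e : EReal), (c : EReal) < e → e < ⊤ → c ≤ e.toReal := fun c e h1 h2 =>
      EReal.coe_le_coe_iff.1 (by
        rw [EReal.coe_toReal h2.ne (ne_bot_of_gt h1)]; exact h1.le)
    have hFG : ∀ᵐ x, F x ≤ G x := by
      filter_upwards [hg4] with x hx
      exact hER _ _ (hg1 x) hx
    have hηc : Continuous fun t => ∫ s in c..t, G s :=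
      intervalIntegral.continuous_primitive (fun a b => hg3.intervalIntegrable) c
    have hη : ∀ s, ∀ᶠ s' in 𝓝[<] s, F s * (s - s') ≤ (∫ τ in c..s, G τ) - ∫ τ in c..s', G τ := by
      intro s
      have h1 := hg2 s (F s) (hg1 s)
      obtain ⟨l, hl, hls⟩ := exists_Ioc_subset_of_mem_nhds h1 ⟨s - 1, by linarith⟩
      filter_upwards [Ioo_mem_nhdsLT hl] with s' hs'
      rw [iISL hg3.intervalIntegrable hg3.intervalIntegrable]
      have h2 : ∫ τ in s'..s, F s ≤ ∫ τ in s'..s, G τ := by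
        refine intervalIntegral.integral_mono_ae_restrict hs'.2.le (by simp)
          hg3.intervalIntegrable ?_
        rw [EventuallyLE, ae_restrict_iff' measurableSet_Icc]
        filter_upwards [hg4] with x hx hxs
        have h3 : (F s : EReal) < g x := hls ⟨hs'.1.trans_le hxs.1, hxs.2⟩
        exact hER _ _ h3 hx
      simp only [iConst, smul_eq_mul] at h2
      linarith
    have hcl : ∀ t, |(∫ s in c..t, G s) - ∫ s in c..t, F s| ≤ δ := by
      intro t
      rw [← iSub hg3.intervalIntegrable hF.intervalIntegrable]
      rw [← Real.norm_eq_abs]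
      refine (intervalIntegral.norm_integral_le_integral_norm_uIoc).trans ?_
      have h1 : ∫ x in uIoc c t, ‖G x - F x‖ ≤ ∫ x, ‖G x - F x‖ :=
        setIntegral_le_integral (hg3.sub hF).norm (ae_of_all _ fun x => norm_nonneg _)
      have h2 : ∫ x, ‖G x - F x‖ = ∫ x, (G x - F x) := by
        refine integral_congr_ae ?_
        filter_upwards [hFG] with x hx
        rw [Real.norm_of_nonneg (sub_nonneg.2 hx)]
      rw [integral_sub hg3 hF] at h2
      linarith
    have hηb : ∀ t, |∫ s in c..t, G s| ≤ ∫ x, ‖G x‖ := fun t =>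
      (intervalIntegral.norm_integral_le_integral_norm_uIoc).trans
        (setIntegral_le_integral hg3.norm (ae_of_all _ fun x => norm_nonneg _))
    have h0 := SC0 (w := fun p => w p - ∫ s in c..p.1, G s) (wx := wx) (wxx := wxx)
      (M := M + ∫ x, ‖G x‖) (L := L) hD hDs (hw.sub (hηc.comp continuous_fst))
      (fun p => (abs_sub _ _).trans (add_le_add (hM p) (hηb _)))
      (fun t x y => by simpa using hL t x y) (fun p hp => by simpa using (hwx p hp).sub_const (∫ s in c..p.1, G s)) hwxx
      (fun p hp q C' hq => by
        refine le_trans (mll ?_ (hB0 p hp)) (hT p hp)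
        have h1 := (hwt p hp).tendsto_slope
        have h2 : Tendsto (slope (fun s => w (s, p.2)) p.1) (𝓝[<] p.1) (𝓝 (wt p)) :=
          h1.mono_left (nhdsWithin_mono _ fun x hx => ne_of_lt hx)
        have h3 : Tendsto (fun s => q - C' * (p.1 - s)) (𝓝[<] p.1) (𝓝 q) := by
          have : Tendsto (fun s => q - C' * (p.1 - s)) (𝓝 p.1) (𝓝 (q - C' * (p.1 - p.1))) :=
            Continuous.tendsto (by fun_prop) _
          simp only [sub_self, mul_zero, sub_zero] at this
          exact this.mono_left nhdsWithin_le_nhds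
        refine le_of_tendsto_of_tendsto h3 (h2.sub_const _) ?_
        filter_upwards [hq, hη p.1, self_mem_nhdsWithin] with s hs1 hs2 hs3
        have hs3 : s < p.1 := hs3
        have : slope (fun s => w (s, p.2)) p.1 s = (w p - w (s, p.2)) / (p.1 - s) := by
          rw [slope_comm, slope_def_field]
        rw [this, le_sub_iff_add_le, le_div_iff₀ (by linarith)]
        nlinarith) hB hB0 hBt hBL hφ hφ0 hφc hφD hφx hφxc hφxb hgt hgb
    have i1 : ∀ H : ℝ → ℝ, (Continuous H) → (∃ K, ∀ t, |H t| ≤ K) →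
        Integrable fun p : ℝ × ℝ => (w p - H p.1) * gt p := by
      rintro H hH ⟨K, hK⟩
      refine hgi.bdd_mul (c := M + K) (by fun_prop) (ae_of_all _ fun p => ?_)
      exact (abs_sub _ _).trans (add_le_add (hM p) (hK _))
    have i2 := i1 _ hηc ⟨_, hηb⟩
    have i3 := i1 (fun t => ∫ s in c..t, F s)
      (intervalIntegral.continuous_primitive (fun a b => hF.intervalIntegrable) c)
      ⟨∫ x, ‖F x‖, fun t => (intervalIntegral.norm_integral_le_integral_norm_uIoc).trans
        (setIntegral_le_integral hF.norm (ae_of_all _ fun x => norm_nonneg _))⟩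
    have h5 : (∫ p, (w p - ∫ s in c..p.1, G s) * gt p) -
        ∫ p, (w p - ∫ s in c..p.1, F s) * gt p ≤ ∫ p, δ * |gt p| := by
      rw [← integral_sub i2 i3]
      refine integral_mono (i2.sub i3) (hgi.abs.const_mul δ) fun p => ?_
      have : (w p - ∫ s in c..p.1, G s) * gt p - (w p - ∫ s in c..p.1, F s) * gt p =
        -((∫ s in c..p.1, G s) - ∫ s in c..p.1, F s) * gt p := by ring
      simp only [this]
      refine (le_abs_self _).trans ?_
      rw [abs_mul, abs_neg]
      exact mlr (hcl _) (abs_nonneg _)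
    rw [integral_const_mul] at h5
    linarith
  by_contra hcon
  push Not at hcon
  set Z := -(∫ t, ∫ x, wx (t, x) * φx (t, x)) + ∫ p, (w p - ∫ s in c..p.1, F s) * gt p
  set I := ∫ p, |gt p| with hI
  have hIn : 0 ≤ I := integral_nonneg fun p => abs_nonneg _
  have := key (-Z / (2 * (I + 1))) (by apply div_pos <;> linarith)
  have h2 : -Z / (2 * (I + 1)) * I ≤ -Z / 2 := by
    rw [div_mul_eq_mul_div, div_le_div_iff₀ (by linarith) (by norm_num)]
    nlinarith
  linarith

theorem leftD {f : ℝ → ℝ} {d t : ℝ} (h : HasDerivWithinAt f d (Iio t) t)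
    (hf : ∀ᶠ s in 𝓝[<] t, f s ≤ f t) : 0 ≤ d := by
  rw [hasDerivWithinAt_iff_tendsto_slope' (by simp)] at h
  refine ge_of_tendsto h ?_
  filter_upwards [hf, self_mem_nhdsWithin] with s h1 h2
  have h2 : s < t := h2
  rw [slope_def_field]
  exact div_nonneg_of_nonpos (by linarith) (by linarith)

theorem rightD {f : ℝ → ℝ} {d t : ℝ} (h : HasDerivWithinAt f d (Ioi t) t)
    (hf : ∀ᶠ s in 𝓝[>] t, f s ≤ f t) : d ≤ 0 := by
  rw [hasDerivWithinAt_iff_tendsto_slope' (by simp)] at h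
  refine le_of_tendsto h ?_
  filter_upwards [hf, self_mem_nhdsWithin] with s h1 h2
  have h2 : t < s := h2
  rw [slope_def_field]
  exact div_nonpos_of_nonpos_of_nonneg (by linarith) (by linarith)

theorem max2 {f f' : ℝ → ℝ} {f'' x : ℝ} (h : IsLocalMax f x)
    (hf : ∀ᶠ y in 𝓝 x, HasDerivAt f (f' y) y) (h2 : HasDerivAt f' f'' x) :
    f' x = 0 ∧ f'' ≤ 0 := by
  have h0 := h.hasDerivAt_eq_zero hf.self_of_nhds
  refine ⟨h0, ?_⟩
  by_contra hc
  push Not at hc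
  have e1 : deriv f =ᶠ[𝓝 x] f' := hf.mono fun y hy => hy.deriv
  have e2 : deriv (deriv f) x = f'' := by rw [e1.deriv_eq]; exact h2.deriv
  have h3 := isLocalMin_of_deriv_deriv_pos (by rw [e2]; exact hc)
    (by rw [hf.self_of_nhds.deriv, h0]) hf.self_of_nhds.continuousAt
  have e3 : f =ᶠ[𝓝 x] fun _ => f x := by
    filter_upwards [h, h3] with y a b using le_antisymm a b
  have e4 : deriv f =ᶠ[𝓝 x] fun _ => 0 := by
    have := e3.deriv
    simpa using this
  have e5 : deriv (deriv f) x = 0 := by rw [e4.deriv_eq]; simp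
  linarith

set_option maxHeartbeats 1000000 in
theorem GB {a b : ℝ → ℝ} {w : ℝ × ℝ → ℝ} {wt wx wxx A : ℝ → ℝ → ℝ}
    {a' b' wa wb ca cb : ℝ → ℝ} {α β M C c n ℓ K L : ℝ}
    (ha : Continuous a) (hb : Continuous b) (hw : Continuous w)
    (hℓ0 : 0 < ℓ) (hℓ : ∀ t ∈ Icc α β, ℓ ≤ b t - a t)
    (hwM : ∀ t ∈ Icc α β, ∀ x, |w (t, x)| ≤ M)
    (haM : ∀ t ∈ Ioc α β, |a' t| ≤ M) (hbM : ∀ t ∈ Ioc α β, |b' t| ≤ M)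
    (ha' : ∀ t ∈ Ioc α β, HasDerivAt a (a' t) t) (hb' : ∀ t ∈ Ioc α β, HasDerivAt b (b' t) t)
    (hwt : ∀ t ∈ Ioc α β, ∀ x ∈ Ioo (a t) (b t), HasDerivAt (fun s => w (s, x)) (wt t x) t)
    (hwx : ∀ t ∈ Ioc α β, ∀ x ∈ Ioo (a t) (b t), HasDerivAt (fun y => w (t, y)) (wx t x) x)
    (hwxx : ∀ t ∈ Ioc α β, ∀ x ∈ Ioo (a t) (b t), HasDerivAt (wx t) (wxx t x) x)
    (hwxa : ∀ t ∈ Ioc α β, HasDerivWithinAt (fun y => w (t, y)) (wx t (a t)) (Ioi (a t)) (a t))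
    (hwxb : ∀ t ∈ Ioc α β, HasDerivWithinAt (fun y => w (t, y)) (wx t (b t)) (Iio (b t)) (b t))
    (hwa : ∀ t ∈ Ioc α β, HasDerivAt (fun s => w (s, a s)) (wa t) t)
    (hwb : ∀ t ∈ Ioc α β, HasDerivAt (fun s => w (s, b s)) (wb t) t)
    (hc : 0 < c) (hC : 0 ≤ C) (hA : ∀ t ∈ Ioc α β, ∀ x ∈ Ioo (a t) (b t), c ≤ A t x)
    (hpde : ∀ t ∈ Ioc α β, ∀ x ∈ Ioo (a t) (b t),
      |wt t x - A t x * wxx t x| ≤ C * (1 + |wx t x|))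
    (hca : ∀ t ∈ Ioc α β, 0 ≤ ca t) (hcb : ∀ t ∈ Ioc α β, 0 ≤ cb t)
    (hbb : ∀ t ∈ Ioc α β, |wb t + cb t * wx t (b t)| ≤ C)
    (hba : ∀ t ∈ Ioc α β, |wa t - ca t * wx t (a t)| ≤ C)
    (hn : ∀ x ∈ Icc (a α) (b α), ∀ y ∈ Icc (a α) (b α), |w (α, x) - w (α, y)| ≤ n * |x - y|)
    (hK : 4 * C + 2 * M < c * K) (hKℓ : 1 < K * ℓ) (hL1 : 1 ≤ L) (hLn : n ≤ L)
    (hLM : 2 * M * K ≤ L) :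
    ∀ t ∈ Icc α β, ∀ y x, a t ≤ y → y ≤ x → x ≤ b t → w (t, x) - w (t, y) ≤ 2 * L * (x - y) := by
  intro t0 ht0
  have hM0 : 0 ≤ M := (abs_nonneg _).trans (hwM t0 ht0 0)
  have hK0 : 0 < K := by
    by_contra h; push Not at h; nlinarith
  set δ := 1 / K with hδ
  have hδ0 : 0 < δ := by positivity
  have hKδ : K * δ = 1 := by rw [hδ]; field_simp
  have hδℓ : δ < ℓ := by rw [hδ, div_lt_iff₀ hK0]; linarith
  set Φ : ℝ × ℝ × ℝ → ℝ := fun p => w (p.1, p.2.1) - w (p.1, p.2.2)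
    - L * (2 * (p.2.1 - p.2.2) - K * (p.2.1 - p.2.2) ^ 2 / 2) with hΦ
  set S : Set (ℝ × ℝ × ℝ) := {p | (α ≤ p.1 ∧ p.1 ≤ β) ∧ a p.1 ≤ p.2.2 ∧ p.2.2 ≤ p.2.1 ∧
    p.2.1 ≤ b p.1 ∧ p.2.1 ≤ p.2.2 + δ} with hS
  have hSc : IsCompact S := by
    obtain ⟨lo, hlo⟩ := (isCompact_Icc (a := α) (b := β)).bddBelow_image ha.continuousOn
    obtain ⟨hi, hhi⟩ := (isCompact_Icc (a := α) (b := β)).bddAbove_image hb.continuousOn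
    refine IsCompact.of_isClosed_subset (isCompact_Icc.prod (isCompact_Icc.prod isCompact_Icc))
      (s := Icc α β ×ˢ Icc lo hi ×ˢ Icc lo hi) ?_ ?_
    · refine IsClosed.and (IsClosed.and ?_ ?_) (IsClosed.and ?_
        (IsClosed.and ?_ (IsClosed.and ?_ ?_))) <;>
        exact isClosed_le (by fun_prop) (by fun_prop)
    · rintro ⟨t, x, y⟩ ⟨h1, h2, h3, h4, h5⟩
      simp only at h1 h2 h3 h4 h5
      have e1 : lo ≤ a t := hlo (mem_image_of_mem _ h1)
      have e2 : b t ≤ hi := hhi (mem_image_of_mem _ h1)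
      exact ⟨h1, ⟨by linarith, by linarith⟩, ⟨by linarith, by linarith⟩⟩
  have hmain : ∀ p ∈ S, Φ p ≤ 0 := by
    by_contra hcon
    push Not at hcon
    obtain ⟨p0, hp0, hp0'⟩ := hcon
    obtain ⟨⟨t, x, y⟩, hpS, hmax⟩ := hSc.exists_isMaxOn ⟨p0, hp0⟩
      (f := Φ) (Continuous.continuousOn (by fun_prop))
    have hpos : 0 < Φ (t, x, y) := hp0'.trans_le (hmax hp0)
    obtain ⟨htI, hay, hyx, hxb, hxδ⟩ := hpS
    simp only at htI hay hyx hxb hxδ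
    set d := x - y with hd
    have hΦv : ∀ t' x' y', Φ (t', x', y') = w (t', x') - w (t', y')
      - L * (2 * (x' - y') - K * (x' - y') ^ 2 / 2) := fun _ _ _ => rfl
    rw [hΦv] at hpos
    have hd0 : 0 < d := by
      rcases hyx.lt_or_eq with h | h
      · linarith
      · exfalso; rw [h] at hpos; simp at hpos
    have hdδ' : d ≤ δ := by linarith
    have hKd : K * d ≤ 1 := by rw [← hKδ]; exact mll hdδ' hK0.le
    have hφd : d ≤ 2 * d - K * d ^ 2 / 2 := by
      have := mlr hKd hd0.le
      linarith
    have hdδ : d < δ := by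
      rcases hdδ'.lt_or_eq with h | h
      · exact h
      · exfalso
        have h1 := abs_le.1 (hwM t htI x)
        have h2 := abs_le.1 (hwM t htI y)
        have h3 : 2 * M ≤ L * δ := by
          have := mlr hLM hδ0.le
          rwa [mul_assoc, hKδ, mul_one] at this
        rw [h] at hφd
        rw [← hd, h] at hpos
        have h4 := mll hφd (by linarith : (0:ℝ) ≤ L)
        linarith
    have htα : α < t := by
      rcases htI.1.lt_or_eq with h | h
      · exact h
      · exfalso
        subst h
        have h1 := (le_abs_self _).trans (hn x ⟨by linarith, hxb⟩ y ⟨hay, by linarith⟩)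
        rw [← hd, abs_of_pos hd0] at h1
        rw [← hd] at hpos
        have h4 := mll hφd (by linarith : (0:ℝ) ≤ L)
        have h5 := mlr hLn hd0.le
        linarith
    have htO : t ∈ Ioc α β := ⟨htα, htI.2⟩
    have hev : ∀ {f g : ℝ → ℝ}, ContinuousAt f t → ContinuousAt g t → f t < g t →
        ∀ᶠ s in 𝓝[<] t, f s < g s := fun hf hg h =>
      nhdsWithin_le_nhds (hf.eventually_lt hg h)
    have hsα : ∀ᶠ s in 𝓝[<] t, α < s ∧ s < t := Ioo_mem_nhdsLT htα
    have hxδ2 : x < y + δ := by linarith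
    have hnotboth : ¬ (x = b t ∧ y = a t) := by
      rintro ⟨h1, h2⟩
      have := hℓ t htI
      rw [h1, h2] at hd; linarith
    have hφ' : ∀ x' : ℝ, HasDerivAt (fun x' => L * (2 * (x' - y) - K * (x' - y) ^ 2 / 2))
        (L * (2 - K * (x' - y))) x' := by
      intro x'
      have h1 : HasDerivAt (fun x' : ℝ => x' - y) 1 x' := (hasDerivAt_id x').sub_const y
      have := ((h1.const_mul 2).sub (((h1.fun_pow 2).const_mul K).div_const 2)).const_mul L
      exact this.congr_deriv (by push_cast; ring)
    have hφ2 : ∀ y' : ℝ, HasDerivAt (fun y' => L * (2 * (x - y') - K * (x - y') ^ 2 / 2))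
        (-(L * (2 - K * (x - y')))) y' := by
      intro y'
      have h1 : HasDerivAt (fun y' : ℝ => x - y') (-1) y' := (hasDerivAt_id y').const_sub x
      have := ((h1.const_mul 2).sub (((h1.fun_pow 2).const_mul K).div_const 2)).const_mul L
      exact this.congr_deriv (by push_cast; ring)
    have hX : x < b t → wx t x = L * (2 - K * d) ∧ wxx t x ≤ -(L * K) := by
      intro hxb'
      have hxI : x ∈ Ioo (a t) (b t) := ⟨by linarith, hxb'⟩
      have h1 := max2 (f := fun x' => w (t, x') - L * (2 * (x' - y) - K * (x' - y) ^ 2 / 2))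
        (f' := fun x' => wx t x' - L * (2 - K * (x' - y))) (f'' := wxx t x + L * K) (x := x) ?_ ?_ ?_
      · simp only [← hd] at h1
        exact ⟨by linarith [h1.1], by linarith [h1.2]⟩
      · filter_upwards [Ioo_mem_nhds (show y < x by linarith) hxb', Iio_mem_nhds hxδ2] with x' h1 h2
        have h2 : x' < y + δ := h2
        have := hmax (show (t, x', y) ∈ S from ⟨htI, hay, h1.1.le, h1.2.le, h2.le⟩)
        simp only [mem_ofPred_eq, hΦv] at this
        linarith
      · filter_upwards [Ioo_mem_nhds hxI.1 hxI.2] with x' h1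
        exact (hwx t htO x' h1).sub (hφ' x')
      · have := ((((hasDerivAt_id x).sub_const y).const_mul K).const_sub 2).const_mul L
        exact ((hwxx t htO x hxI).fun_sub this).congr_deriv (by ring)
    have hY : a t < y → wx t y = L * (2 - K * d) ∧ L * K ≤ wxx t y := by
      intro hay'
      have hyI : y ∈ Ioo (a t) (b t) := ⟨hay', by linarith⟩
      have h1 := max2 (f := fun y' => -w (t, y') - L * (2 * (x - y') - K * (x - y') ^ 2 / 2))
        (f' := fun y' => -wx t y' - -(L * (2 - K * (x - y')))) (f'' := -wxx t y + L * K)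
        (x := y) ?_ ?_ ?_
      · simp only [← hd] at h1
        exact ⟨by linarith [h1.1], by linarith [h1.2]⟩
      · filter_upwards [Ioo_mem_nhds hay' (show y < x by linarith),
          Ioi_mem_nhds (show x - δ < y by linarith)] with y' h1 h2
        have h2 : x - δ < y' := h2
        have := hmax (show (t, x, y') ∈ S from ⟨htI, h1.1.le, h1.2.le, hxb, by simp only; linarith⟩)
        simp only [mem_ofPred_eq, hΦv] at this
        linarith
      · filter_upwards [Ioo_mem_nhds hyI.1 hyI.2] with y' h1
        exact (hwx t htO y' h1).fun_neg.sub (hφ2 y')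
      · have := (((((hasDerivAt_id y).const_sub x).const_mul K).const_sub 2).const_mul L).fun_neg
        exact ((hwxx t htO y hyI).fun_neg.fun_sub this).congr_deriv (by ring)
    have hKd0 : 0 ≤ K * d := by positivity
    have hLφ1 : 0 ≤ L * (2 - K * d) := mul_nonneg (by linarith) (by linarith)
    have hLφ2 : L * (2 - K * d) ≤ 2 * L := by
      have := mul_nonneg (by linarith : (0:ℝ) ≤ L) hKd0
      linarith
    have hCL : C * (1 + L * (2 - K * d)) ≤ 3 * C * L := by
      have := mll (show 1 + L * (2 - K * d) ≤ 3 * L by linarith) hC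
      linarith
    have hcK : 0 < L * (c * K - 4 * C - 2 * M) := mul_pos (by linarith) (by linarith)
    have hLC : C ≤ C * L := le_mul_of_one_le_right hC hL1
    have hML : M ≤ M * L := le_mul_of_one_le_right hM0 hL1
    have pX : x < b t → wt t x ≤ -(c * (L * K)) + 3 * C * L := by
      intro h
      obtain ⟨h1, h2⟩ := hX h
      have h3 := (abs_le.1 (hpde t htO x ⟨by linarith, h⟩)).2
      rw [h1, abs_of_nonneg hLφ1] at h3
      have h4 := hA t htO x ⟨by linarith, h⟩
      have h5 : 0 ≤ L * K := by positivity
      have h6 := mll h2 (hc.le.trans h4)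
      have h7 := mlr h4 h5
      linarith
    have pY : a t < y → c * (L * K) - 3 * C * L ≤ wt t y := by
      intro h
      obtain ⟨h1, h2⟩ := hY h
      have h3 := (abs_le.1 (hpde t htO y ⟨h, by linarith⟩)).1
      rw [h1, abs_of_nonneg hLφ1] at h3
      have h4 := hA t htO y ⟨h, by linarith⟩
      have h5 : 0 ≤ L * K := by positivity
      have h6 := mll h2 (hc.le.trans h4)
      have h7 := mlr h4 h5
      linarith
    have hMb : |b' t * (L * (2 - K * d))| ≤ 2 * M * L := by
      rw [abs_mul, abs_of_nonneg hLφ1]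
      have := mul_le_mul (hbM t htO) hLφ2 hLφ1 hM0
      linarith
    have hMa : |a' t * (L * (2 - K * d))| ≤ 2 * M * L := by
      rw [abs_mul, abs_of_nonneg hLφ1]
      have := mul_le_mul (haM t htO) hLφ2 hLφ1 hM0
      linarith
    rcases hxb.lt_or_eq with hxb1 | hxb1
    · rcases hay.lt_or_eq with hay1 | hay1
      ·
        have h1 := leftD (((hwt t htO x ⟨by linarith, hxb1⟩).fun_sub
          (hwt t htO y ⟨hay1, by linarith⟩)).hasDerivWithinAt) (by
          filter_upwards [hsα, hev continuousAt_const hb.continuousAt hxb1,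
            hev ha.continuousAt continuousAt_const hay1] with s h1 h2 h3
          have := hmax (show (s, x, y) ∈ S from
            ⟨⟨h1.1.le, by simp only; linarith [htI.2]⟩, h3.le, hyx, h2.le, hxδ⟩)
          simp only [mem_ofPred_eq, hΦv] at this
          linarith)
        have := pX hxb1
        have := pY hay1
        have := mul_nonneg hM0 (by linarith : (0:ℝ) ≤ L)
        have := mul_nonneg hC (by linarith : (0:ℝ) ≤ L)
        linarith
      ·
        have hd1 : HasDerivAt (fun s => L * (2 * (x - a s) - K * (x - a s) ^ 2 / 2))
            (-(L * (2 - K * (x - a t))) * a' t) t := by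
          have := hφ2 y
          rw [← hay1] at this
          exact this.comp t (ha' t htO)
        have h1 := leftD (((hwt t htO x ⟨by linarith, hxb1⟩).fun_sub (hwa t htO)).fun_sub
          hd1).hasDerivWithinAt (by
          filter_upwards [hsα, hev continuousAt_const hb.continuousAt hxb1,
            hev ha.continuousAt continuousAt_const (show a t < x by linarith),
            hev continuousAt_const (ha.continuousAt.add continuousAt_const)
              (show x < a t + δ by linarith)] with s h1 h2 h3 h4
          have := hmax (show (s, x, a s) ∈ S from
            ⟨⟨h1.1.le, by simp only; linarith [htI.2]⟩, le_rfl, h3.le, h2.le, h4.le⟩)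
          simp only [mem_ofPred_eq, hΦv] at this
          rw [← hay1] at this
          linarith)
        have h2 := rightD (((hwxa t htO).fun_neg).fun_sub (by
            have := (hφ2 y).hasDerivWithinAt (s := Ioi (a t))
            rw [← hay1] at this; exact this)) (by
          filter_upwards [Ioo_mem_nhdsGT (show a t < x by linarith)] with y' h1
          have := hmax (show (t, x, y') ∈ S from
            ⟨htI, h1.1.le, h1.2.le, hxb, by simp only; linarith [h1.1]⟩)
          simp only [mem_ofPred_eq, hΦv] at this
          rw [← hay1] at this
          linarith)
        have e : x - a t = d := by rw [hd, hay1]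
        rw [e] at h1 h2
        have h3 := pX hxb1
        have h4 := (abs_le.1 (hba t htO)).1
        have h5 : 0 ≤ ca t * wx t (a t) := mul_nonneg (hca t htO) (by linarith)
        have h6 := (abs_le.1 hMa).2
        linarith
    · have hay1 : a t < y := hay.lt_of_ne fun h => hnotboth ⟨hxb1, h.symm⟩
      have hd1 : HasDerivAt (fun s => L * (2 * (b s - y) - K * (b s - y) ^ 2 / 2))
            ((L * (2 - K * (b t - y))) * b' t) t := by
        exact (hφ' (b t)).comp t (hb' t htO)
      have h1 := leftD (((hwb t htO).fun_sub (hwt t htO y ⟨hay1, by linarith⟩)).fun_sub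
          hd1).hasDerivWithinAt (by
          filter_upwards [hsα, hev continuousAt_const hb.continuousAt (show y < b t by linarith),
            hev ha.continuousAt continuousAt_const hay1,
            hev hb.continuousAt continuousAt_const
              (show b t < y + δ by linarith)] with s h1 h2 h3 h4
          have := hmax (show (s, b s, y) ∈ S from
            ⟨⟨h1.1.le, by simp only; linarith [htI.2]⟩, h3.le, h2.le, le_rfl, h4.le⟩)
          simp only [mem_ofPred_eq, hΦv] at this
          rw [hxb1] at this
          linarith)
      have h2 := leftD ((hwxb t htO).fun_sub (hφ' (b t)).hasDerivWithinAt) (by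
          filter_upwards [Ioo_mem_nhdsLT (show y < b t by linarith)] with x' h1
          have := hmax (show (t, x', y) ∈ S from
            ⟨htI, hay, h1.1.le, h1.2.le, by simp only; linarith [h1.2]⟩)
          simp only [mem_ofPred_eq, hΦv] at this
          rw [hxb1] at this
          linarith)
      have e : b t - y = d := by rw [hd, hxb1]
      rw [e] at h1 h2
      have h3 := pY hay1
      have h4 := (abs_le.1 (hbb t htO)).2
      have h5 : 0 ≤ cb t * wx t (b t) := mul_nonneg (hcb t htO) (by linarith)
      have h6 := (abs_le.1 hMb).1
      linarith
  intro y x hay hyx hxb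
  by_cases hx : x ≤ y + δ
  · have h1 := hmain (t0, x, y) ⟨ht0, hay, hyx, hxb, hx⟩
    simp only [hΦ] at h1
    have := mul_nonneg (mul_nonneg (by linarith : (0:ℝ) ≤ L) hK0.le) (sq_nonneg (x - y))
    linarith
  · push Not at hx
    have h1 := abs_le.1 (hwM t0 ht0 x)
    have h2 := abs_le.1 (hwM t0 ht0 y)
    have h3 : 2 * M ≤ L * δ := by
      have := mlr hLM hδ0.le
      rwa [mul_assoc, hKδ, mul_one] at this
    have h4 := mll (show δ ≤ x - y by linarith) (by linarith : (0:ℝ) ≤ L)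
    have h5 := mul_nonneg (by linarith : (0:ℝ) ≤ L) (by linarith : 0 ≤ x - y)
    linarith

theorem leftDesc {f : ℝ → ℝ} {T : ℝ} (hT : 0 ≤ T) (hf : ContinuousOn f (Icc 0 T))
    (h : ∀ t ∈ Ioc 0 T, ∃ s, 0 ≤ s ∧ s < t ∧ f t ≤ f s) : f T ≤ f 0 := by
  set S := {t | t ∈ Icc 0 T ∧ f t ∈ Ici (f T)} with hS
  have hSc : IsClosed S := hf.preimage_isClosed_of_isClosed isClosed_Icc isClosed_Ici
  have hSb : BddBelow S := ⟨0, fun t ht => ht.1.1⟩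
  have hm := hSc.csInf_mem ⟨T, ⟨hT, le_rfl⟩, (le_rfl : f T ≤ f T)⟩ hSb
  set t0 := sInf S
  have h3 : f T ≤ f t0 := hm.2
  rcases hm.1.1.lt_or_eq with h0 | h0
  · obtain ⟨s, h1, h2, h4⟩ := h t0 ⟨h0, hm.1.2⟩
    have : t0 ≤ s := csInf_le hSb ⟨⟨h1, h2.le.trans hm.1.2⟩, (h3.trans h4 : f T ≤ f s)⟩
    linarith
  · rw [← h0] at h3; exact h3

theorem decay {V : ℝ → ℝ} {c T : ℝ} (hT : 0 ≤ T) (hV : ContinuousOn V (Icc 0 T))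
    (h : ∀ t ∈ Ioc 0 T, ∀ ε > 0, ∀ᶠ s in 𝓝[<] t, V t - V s ≤ (-c * V t + ε) * (t - s)) :
    V T ≤ V 0 * Real.exp (-c * T) := by
  have key : ∀ ε > 0, Real.exp (c * T) * V T - ε * T ≤ V 0 := by
    intro ε hε
    have := leftDesc (f := fun t => Real.exp (c * t) * V t - ε * t) hT
      (ContinuousOn.sub (ContinuousOn.mul (by fun_prop) hV) (by fun_prop)) ?_
    · simpa using this
    intro t ht
    set e := Real.exp (c * t) with he
    have he0 : 0 < e := Real.exp_pos _
    have h1 := h t ht (ε / (4 * e)) (by positivity)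
    have hVs : Tendsto V (𝓝[<] t) (𝓝 (V t)) := by
      have h1 : Tendsto V (𝓝[Ioo 0 t] t) (𝓝 (V t)) :=
        (hV t ⟨ht.1.le, ht.2⟩).tendsto.mono_left (nhdsWithin_mono _ fun s hs =>
        ⟨hs.1.le, hs.2.le.trans ht.2⟩)
      rwa [nhdsWithin_Ioo_eq_nhdsLT ht.1] at h1
    have h2 : Tendsto (fun s => slope (fun s => Real.exp (c * s)) t s * V s) (𝓝[<] t)
        (𝓝 (c * e * V t)) := by
      refine Tendsto.mul ?_ hVs
      have : HasDerivAt (fun s => Real.exp (c * s)) (c * e) t := by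
        have := ((hasDerivAt_id t).const_mul c).exp
        simp only [id, mul_one] at this
        rw [mul_comm]; exact this
      exact this.tendsto_slope.mono_left (nhdsWithin_mono _ fun x hx => ne_of_lt hx)
    have h3 := h2.eventually (gt_mem_nhds (show c * e * V t < c * e * V t + ε / 4 by linarith))
    obtain ⟨s, hs1, hs2, hs3⟩ := (h1.and (h3.and (Ioo_mem_nhdsLT ht.1))).exists
    refine ⟨s, hs3.1.le, hs3.2, ?_⟩
    have hts : 0 < t - s := by linarith [hs3.2]
    rw [slope_comm, slope_def_field] at hs2
    have hs2' : (e - Real.exp (c * s)) * V s < (c * e * V t + ε / 4) * (t - s) := by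
      rw [← div_lt_iff₀ hts]
      calc _ = (e - Real.exp (c * s)) / (t - s) * V s := by ring
        _ < _ := hs2
    have hs1' := mll hs1 he0.le
    have : e * ((-c * V t + ε / (4 * e)) * (t - s)) = (-(c * e * V t) + ε / 4) * (t - s) := by
      field_simp
    rw [this] at hs1'
    have := mul_pos hε hts
    show e * V t - ε * t ≤ Real.exp (c * s) * V s - ε * s
    linarith
  have h1 : Real.exp (c * T) * V T ≤ V 0 := by
    refine le_of_forall_pos_le_add fun ε hε => ?_
    have := key (ε / (T + 1)) (by positivity)
    have h2 : ε / (T + 1) * T ≤ ε := by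
      rw [div_mul_eq_mul_div, div_le_iff₀ (by linarith)]; nlinarith
    linarith
  have h2 : Real.exp (c * T) * Real.exp (-c * T) = 1 := by
    rw [← Real.exp_add]; simp
  calc V T = Real.exp (c * T) * V T * Real.exp (-c * T) := by
        rw [mul_right_comm, h2, one_mul]
    _ ≤ _ := mlr h1 (Real.exp_pos _).le

structure Law (P μ P' μ' : ℝ → ℝ) : Prop where
  dP : ∀ x, 0 < x → HasDerivAt P (P' x) x
  dμ : ∀ x, 0 < x → HasDerivAt μ (μ' x) x
  cP' : ContinuousOn P' (Ioi 0)
  cμ' : ContinuousOn μ' (Ioi 0)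
  Ppos : ∀ x, 0 < x → 0 < P x
  μpos : ∀ x, 0 < x → 0 < μ x
  P'pos : ∀ x, 0 < x → 0 < P' x

structure Fl (P μ : ℝ → ℝ) (Pe : ℝ) where
  a : ℝ → ℝ
  b : ℝ → ℝ
  u : ℝ → ℝ
  ρ : ℝ × ℝ → ℝ
  v : ℝ × ℝ → ℝ
  ρx : ℝ × ℝ → ℝ
  vx : ℝ × ℝ → ℝ
  vt : ℝ × ℝ → ℝ
  ha : Continuous a
  hb : Continuous b
  hu : Continuous u
  hab : ∀ t, a t < b t
  hρ : Continuous ρ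
  hv : Continuous v
  ρpos : ∀ p, 0 < ρ p
  hρl : ∀ t x, x ≤ a t → ρ (t, x) = ρ (t, a t)
  hρr : ∀ t x, b t ≤ x → ρ (t, x) = ρ (t, b t)
  hvl : ∀ t x, x ≤ a t → v (t, x) = v (t, a t)
  hvr : ∀ t x, b t ≤ x → v (t, x) = v (t, b t)
  mass : ∀ t, ∫ x in a t..b t, ρ (t, x) = 1
  ha' : ∀ t, 0 < t → HasDerivAt a (v (t, a t)) t
  hb' : ∀ t, 0 < t → HasDerivAt b (v (t, b t)) t
  hρt : ∀ t, 0 < t → ∀ x ∈ Icc (a t) (b t), HasDerivWithinAt (fun s => ρ (s, x))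
    (-(ρx (t, x) * v (t, x) + ρ (t, x) * vx (t, x))) {s | x ∈ Icc (a s) (b s)} t
  hvt : ∀ t, 0 < t → ∀ x ∈ Ioo (a t) (b t), HasDerivAt (fun s => v (s, x)) (vt (t, x)) t
  hρx : ∀ t, ∀ x ∈ Icc (a t) (b t),
    HasDerivWithinAt (fun y => ρ (t, y)) (ρx (t, x)) (Icc (a t) (b t)) x
  hvx : ∀ t, 0 < t → ∀ x ∈ Icc (a t) (b t),
    HasDerivWithinAt (fun y => v (t, y)) (vx (t, x)) (Icc (a t) (b t)) x
  cρx : ∀ t, ContinuousOn (fun x => ρx (t, x)) (Icc (a t) (b t))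
  cvx : ∀ t, 0 < t → ContinuousOn (fun x => vx (t, x)) (Icc (a t) (b t))
  mom : ∀ t, 0 < t → ∀ x ∈ Ioo (a t) (b t),
    HasDerivAt (fun y => μ (ρ (t, y)) * vx (t, y) - P (ρ (t, y)))
      (ρ (t, x) * (vt (t, x) + v (t, x) * vx (t, x))) x
  na : ∀ t, 0 < t → HasDerivAt (fun s => v (s, a s))
    (u t + Pe - P (ρ (t, a t)) + μ (ρ (t, a t)) * vx (t, a t)) t
  nb : ∀ t, 0 < t → HasDerivAt (fun s => v (s, b s))
    (P (ρ (t, b t)) - μ (ρ (t, b t)) * vx (t, b t) - Pe) t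

namespace Fl
variable {P μ : ℝ → ℝ} {Pe : ℝ} (F : Fl P μ Pe)

noncomputable def mm (t x : ℝ) : ℝ := ∫ y in F.a t..x, F.ρ (t, y)

theorem cρ (t : ℝ) : Continuous fun y => F.ρ (t, y) := F.hρ.comp (Continuous.prodMk_right t)
theorem cv (t : ℝ) : Continuous fun y => F.v (t, y) := F.hv.comp (Continuous.prodMk_right t)

theorem mm_sub (t x y : ℝ) : F.mm t y - F.mm t x = ∫ z in x..y, F.ρ (t, z) :=
  iISL ((F.cρ t).intervalIntegrable _ _)
    ((F.cρ t).intervalIntegrable _ _)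

theorem mm_cont : Continuous fun p : ℝ × ℝ => F.mm p.1 p.2 := by
  have h1 : Continuous fun p : ℝ × ℝ => ∫ y in 0..p.2, F.ρ (p.1, y) := by
    have := F.hρ
    exact intervalIntegral.continuous_parametric_intervalIntegral_of_continuous
      (f := fun (p : ℝ × ℝ) y => F.ρ (p.1, y)) (by fun_prop) continuous_snd
  have h2 : ∀ p : ℝ × ℝ, F.mm p.1 p.2 = (∫ y in 0..p.2, F.ρ (p.1, y)) -
      ∫ y in 0..F.a p.1, F.ρ (p.1, y) := fun p =>
    (iISL ((F.cρ _).intervalIntegrable _ _)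
      ((F.cρ _).intervalIntegrable _ _)).symm
  simp_rw [h2]
  have := F.ha
  exact h1.sub (h1.comp (g := fun p : ℝ × ℝ => ∫ y in 0..p.2, F.ρ (p.1, y))
    (f := fun p : ℝ × ℝ => (p.1, F.a p.1)) (by fun_prop))

theorem mm_der (t x : ℝ) : HasDerivAt (F.mm t) (F.ρ (t, x)) x :=
  iHD ((F.cρ t).intervalIntegrable _ _)
    ((F.cρ t).stronglyMeasurableAtFilter _ _) (F.cρ t).continuousAt

theorem mm_mono (t : ℝ) : StrictMono (F.mm t) :=
  strictMono_of_hasDerivAt_pos (F.mm_der t) fun x => F.ρpos _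

theorem mm_a (t : ℝ) : F.mm t (F.a t) = 0 := iSame
theorem mm_b (t : ℝ) : F.mm t (F.b t) = 1 := F.mass t

theorem mm_surj (t m : ℝ) : ∃ x, F.mm t x = m := by
  have hc : Continuous (F.mm t) := F.mm_cont.comp (Continuous.prodMk_right t)
  refine mem_range_of_exists_le_of_exists_ge hc ?_ ?_
  · set c := F.ρ (t, F.a t)
    have hc : 0 < c := F.ρpos _
    refine ⟨F.a t - |m| / c, ?_⟩
    have h1 := F.mm_sub t (F.a t - |m| / c) (F.a t)
    have h2 : ∫ z in (F.a t - |m| / c)..F.a t, F.ρ (t, z) = ∫ z in (F.a t - |m| / c)..F.a t, c := by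
      refine iCong fun z hz => ?_
      rw [uIcc_of_le (by have : 0 ≤ |m| / c := by positivity
                         linarith)] at hz
      exact F.hρl t z hz.2
    rw [h2, F.mm_a, iConst, smul_eq_mul] at h1
    have h3 : (F.a t - (F.a t - |m| / c)) * c = |m| := by field_simp; ring
    linarith [neg_abs_le m]
  · set c := F.ρ (t, F.b t)
    have hc : 0 < c := F.ρpos _
    refine ⟨F.b t + |m| / c, ?_⟩
    have h1 := F.mm_sub t (F.b t) (F.b t + |m| / c)
    have h2 : ∫ z in F.b t..(F.b t + |m| / c), F.ρ (t, z) = ∫ z in F.b t..(F.b t + |m| / c), c := by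
      refine iCong fun z hz => ?_
      rw [uIcc_of_le (by have : 0 ≤ |m| / c := by positivity
                         linarith)] at hz
      exact F.hρr t z hz.1
    rw [h2, F.mm_b, iConst, smul_eq_mul] at h1
    have h3 : (F.b t + |m| / c - F.b t) * c = |m| := by field_simp; ring
    linarith [le_abs_self m]

noncomputable def X (t m : ℝ) : ℝ := (F.mm_surj t m).choose

theorem mm_X (t m : ℝ) : F.mm t (F.X t m) = m := (F.mm_surj t m).choose_spec
theorem X_mm (t x : ℝ) : F.X t (F.mm t x) = x := (F.mm_mono t).injective (F.mm_X t _)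
theorem X_0 (t : ℝ) : F.X t 0 = F.a t := by rw [← F.mm_a t, X_mm]
theorem X_1 (t : ℝ) : F.X t 1 = F.b t := by rw [← F.mm_b t, X_mm]
theorem X_mono (t : ℝ) : StrictMono (F.X t) := fun m m' h => by
  rw [← (F.mm_mono t).lt_iff_lt, mm_X, mm_X]; exact h

theorem X_cont : Continuous fun p : ℝ × ℝ => F.X p.1 p.2 := by
  rw [OrderTopology.continuous_iff]
  intro c
  have hc : Continuous fun p : ℝ × ℝ => F.mm p.1 c :=
    F.mm_cont.comp (f := fun p : ℝ × ℝ => (p.1, c)) (by fun_prop)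
  constructor
  · have : (fun p : ℝ × ℝ => F.X p.1 p.2) ⁻¹' Ioi c = {p | F.mm p.1 c < p.2} := by
      ext p
      simp only [mem_preimage, mem_Ioi, mem_ofPred_eq]
      rw [← (F.mm_mono p.1).lt_iff_lt, mm_X]
    rw [this]; exact isOpen_lt hc continuous_snd
  · have : (fun p : ℝ × ℝ => F.X p.1 p.2) ⁻¹' Iio c = {p | p.2 < F.mm p.1 c} := by
      ext p
      simp only [mem_preimage, mem_Iio, mem_ofPred_eq]
      rw [← (F.mm_mono p.1).lt_iff_lt, mm_X]
    rw [this]; exact isOpen_lt continuous_snd hc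

theorem X_mem {t m : ℝ} (hm : m ∈ 𝕀) : F.X t m ∈ Icc (F.a t) (F.b t) := by
  rw [← F.X_0, ← F.X_1]
  exact ⟨(F.X_mono t).monotone hm.1, (F.X_mono t).monotone hm.2⟩

theorem X_memo {t m : ℝ} (hm : m ∈ 𝕁) : F.X t m ∈ Ioo (F.a t) (F.b t) := by
  rw [← F.X_0, ← F.X_1]
  exact ⟨F.X_mono t hm.1, F.X_mono t hm.2⟩

noncomputable def rh (t m : ℝ) : ℝ := F.ρ (t, F.X t m)
noncomputable def vh (t m : ℝ) : ℝ := F.v (t, F.X t m)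

theorem rh_cont : Continuous fun p : ℝ × ℝ => F.rh p.1 p.2 := by
  have h1 := F.X_cont
  have h2 := F.hρ
  exact h2.comp (f := fun p : ℝ × ℝ => (p.1, F.X p.1 p.2)) (by fun_prop)
theorem vh_cont : Continuous fun p : ℝ × ℝ => F.vh p.1 p.2 := by
  have h1 := F.X_cont
  have h2 := F.hv
  exact h2.comp (f := fun p : ℝ × ℝ => (p.1, F.X p.1 p.2)) (by fun_prop)
theorem rh_pos (t m : ℝ) : 0 < F.rh t m := F.ρpos _

theorem X_der (t m : ℝ) : HasDerivAt (F.X t) (F.rh t m)⁻¹ m := by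
  have hc : Continuous (F.X t) := F.X_cont.comp (Continuous.prodMk_right t)
  exact HasDerivAt.of_local_left_inverse (f := F.mm t) hc.continuousAt (F.mm_der t _)
    (F.ρpos _).ne' (Eventually.of_forall fun y => F.mm_X t y)

def E (n : ℝ) : Set ℝ := {t | ∀ x y, |F.v (t, x) - F.v (t, y)| ≤ n * |x - y| ∧
  |F.ρ (t, x) - F.ρ (t, y)| ≤ n * |x - y|}

theorem E_closed (n : ℝ) : IsClosed (F.E n) := by
  have h1 := F.hρ
  have h2 := F.hv
  simp only [E, Set.setOf_forall]
  refine isClosed_iInter fun x => isClosed_iInter fun y => IsClosed.and ?_ ?_ <;>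
    exact isClosed_le (by fun_prop) (by fun_prop)

theorem E_mono {n n' : ℝ} (h : n ≤ n') : F.E n ⊆ F.E n' := fun t ht x y =>
  ⟨(ht x y).1.trans (mlr h (abs_nonneg _)),
    (ht x y).2.trans (mlr h (abs_nonneg _))⟩

theorem hρx' {t x : ℝ} (hx : x ∈ Ioo (F.a t) (F.b t)) :
    HasDerivAt (fun y => F.ρ (t, y)) (F.ρx (t, x)) x :=
  (F.hρx t x ⟨hx.1.le, hx.2.le⟩).hasDerivAt (Icc_mem_nhds hx.1 hx.2)

theorem hvx' {t x : ℝ} (ht : 0 < t) (hx : x ∈ Ioo (F.a t) (F.b t)) :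
    HasDerivAt (fun y => F.v (t, y)) (F.vx (t, x)) x :=
  (F.hvx t ht x ⟨hx.1.le, hx.2.le⟩).hasDerivAt (Icc_mem_nhds hx.1 hx.2)

theorem nhds_Icc {t x : ℝ} (hx : x ∈ Ioo (F.a t) (F.b t)) :
    ∀ᶠ s in 𝓝 t, x ∈ Ioo (F.a s) (F.b s) :=
  (F.ha.continuousAt.eventually_lt continuousAt_const hx.1).and
    (continuousAt_const.eventually_lt F.hb.continuousAt hx.2)

theorem hρt' {t x : ℝ} (ht : 0 < t) (hx : x ∈ Ioo (F.a t) (F.b t)) :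
    HasDerivAt (fun s => F.ρ (s, x)) (-(F.ρx (t, x) * F.v (t, x) + F.ρ (t, x) * F.vx (t, x))) t :=
  (F.hρt t ht x ⟨hx.1.le, hx.2.le⟩).hasDerivAt
    ((F.nhds_Icc hx).mono fun _ h => ⟨h.1.le, h.2.le⟩)

end Fl
theorem derBd {f : ℝ → ℝ} {f' a b x n : ℝ} (hab : a < b) (hx : x ∈ Icc a b)
    (hf : HasDerivWithinAt f f' (Icc a b) x) (hL : ∀ y ∈ Icc a b, |f y - f x| ≤ n * |y - x|) :
    |f'| ≤ n := by
  have h1 := hasDerivWithinAt_iff_tendsto_slope.1 hf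
  have : (𝓝[Icc a b \ {x}] x).NeBot := by
    have h2 := (uniqueDiffOn_Icc hab) x hx
    rw [uniqueDiffWithinAt_iff_accPt, accPt_principal_iff_nhdsWithin] at h2
    exact h2
  refine le_of_tendsto h1.abs ?_
  filter_upwards [self_mem_nhdsWithin] with y hy
  rw [slope_def_field, abs_div, div_le_iff₀ (abs_pos.2 (sub_ne_zero.2 hy.2))]
  exact hL _ hy.1
namespace Fl
variable {P μ : ℝ → ℝ} {Pe : ℝ} (F : Fl P μ Pe)

theorem ρx_le {n t x : ℝ} (h : t ∈ F.E n) (hx : x ∈ Icc (F.a t) (F.b t)) : |F.ρx (t, x)| ≤ n :=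
  derBd (F.hab t) hx (F.hρx t x hx) fun y _ => (h y x).2

theorem vx_le {n t x : ℝ} (ht : 0 < t) (h : t ∈ F.E n) (hx : x ∈ Icc (F.a t) (F.b t)) :
    |F.vx (t, x)| ≤ n :=
  derBd (F.hab t) hx (F.hvx t ht x hx) fun y _ => (h y x).1

end Fl

theorem litInt {g : ℝ × ℝ → ℝ} (hg : Continuous g) {f : ℝ → ℝ} {t0 : ℝ} (hf : ContinuousAt f t0) :
    (fun t => (∫ y in f t0..f t, g (t, y)) - g (t0, f t0) * (f t - f t0)) =o[𝓝 t0]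
      fun t => f t - f t0 := by
  rw [Asymptotics.isLittleO_iff]
  intro c hc
  obtain ⟨δ, hδ, h1⟩ := Metric.continuousAt_iff.1 (hg.continuousAt (x := (t0, f t0))) c hc
  obtain ⟨δ', hδ', h2⟩ := Metric.continuousAt_iff.1 hf δ hδ
  filter_upwards [Metric.ball_mem_nhds t0 (lt_min hδ hδ')] with t ht
  rw [Metric.mem_ball, lt_min_iff] at ht
  have h3 : (∫ y in f t0..f t, g (t, y)) - g (t0, f t0) * (f t - f t0) =
      ∫ y in f t0..f t, (g (t, y) - g (t0, f t0)) := by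
    rw [iSub
      ((by fun_prop : Continuous fun y => g (t, y)).intervalIntegrable _ _) (by simp),
      iConst, smul_eq_mul]
    ring
  rw [h3, Real.norm_eq_abs (f t - f t0)]
  refine iNorm fun y hy => ?_
  have h4 := h2 ht.2
  rw [Real.dist_eq] at h4
  have h5 : |y - f t0| ≤ |f t - f t0| := abs_sub_left_of_mem_uIcc (uIoc_subset_uIcc hy)
  have := @h1 (t, y) (by
    rw [Prod.dist_eq]
    exact max_lt ht.1 (by rw [Real.dist_eq]; linarith))
  rw [Real.dist_eq] at this
  exact this.le

theorem derInt {g : ℝ × ℝ → ℝ} (hg : Continuous g) {f : ℝ → ℝ} {t0 f' : ℝ}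
    (hf : HasDerivAt f f' t0) :
    HasDerivAt (fun t => ∫ y in f t0..f t, g (t, y)) (g (t0, f t0) * f') t0 := by
  have h1 := litInt hg hf.continuousAt
  have h2 := h1.trans_isBigO hf.isBigO_sub
  have h3 := (hf.const_mul (g (t0, f t0)))
  rw [hasDerivAt_iff_isLittleO] at h3 ⊢
  refine (h3.add h2).congr_left fun t => ?_
  simp; ring

namespace Fl
variable {P μ : ℝ → ℝ} {Pe : ℝ} (F : Fl P μ Pe)

theorem bdd {g : ℝ × ℝ → ℝ} (hg : Continuous g) (hl : ∀ t x, x ≤ F.a t → g (t, x) = g (t, F.a t))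
    (hr : ∀ t x, F.b t ≤ x → g (t, x) = g (t, F.b t)) (α β : ℝ) :
    ∃ M, 0 < M ∧ ∀ t ∈ Icc α β, ∀ x, |g (t, x)| ≤ M := by
  have h1 := F.ha
  have h2 := F.hb
  have hK : IsCompact ((fun p : ℝ × ℝ => (p.1, F.a p.1 + p.2 * (F.b p.1 - F.a p.1))) ''
    (Icc α β ×ˢ Icc 0 1)) := (isCompact_Icc.prod isCompact_Icc).image (by fun_prop)
  obtain ⟨M, hM⟩ := hK.exists_bound_of_continuousOn hg.continuousOn
  have h0 : ∀ t ∈ Icc α β, ∀ x ∈ Icc (F.a t) (F.b t), |g (t, x)| ≤ M := by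
    intro t ht x hx
    refine hM _ ⟨(t, (x - F.a t) / (F.b t - F.a t)), ⟨ht, ?_⟩, ?_⟩
    · have := sub_pos.2 (F.hab t)
      exact ⟨div_nonneg (by linarith [hx.1]) this.le, (div_le_one this).2 (by linarith [hx.2])⟩
    · have := (sub_pos.2 (F.hab t)).ne'
      simp only [Prod.mk.injEq, true_and]
      field_simp
      ring
  refine ⟨|M| + 1, by positivity, fun t ht x => ?_⟩
  have hM' : M ≤ |M| + 1 := by linarith [le_abs_self M]
  refine le_trans ?_ hM'
  rcases le_total x (F.a t) with hx | hx
  · rw [hl t x hx]; exact h0 t ht _ ⟨le_rfl, (F.hab t).le⟩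
  rcases le_total (F.b t) x with hx' | hx'
  · rw [hr t x hx']; exact h0 t ht _ ⟨(F.hab t).le, le_rfl⟩
  exact h0 t ht x ⟨hx, hx'⟩

theorem bddv (α β : ℝ) : ∃ M, 0 < M ∧ ∀ t ∈ Icc α β, ∀ x, |F.v (t, x)| ≤ M :=
  F.bdd F.hv F.hvl F.hvr α β
theorem bddρ (α β : ℝ) : ∃ M, 0 < M ∧ ∀ t ∈ Icc α β, ∀ x, F.ρ (t, x) ≤ M := by
  obtain ⟨M, h1, h2⟩ := F.bdd F.hρ F.hρl F.hρr α β
  exact ⟨M, h1, fun t ht x => (le_abs_self _).trans (h2 t ht x)⟩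
theorem bddi (α β : ℝ) : ∃ M, 0 < M ∧ ∀ t ∈ Icc α β, ∀ x, (F.ρ (t, x))⁻¹ ≤ M := by
  obtain ⟨M, h1, h2⟩ := F.bdd (g := fun p => (F.ρ p)⁻¹) (F.hρ.inv₀ fun p => (F.ρpos p).ne')
    (fun t x h => by rw [F.hρl t x h]) (fun t x h => by rw [F.hρr t x h]) α β
  exact ⟨M, h1, fun t ht x => (le_abs_self _).trans (h2 t ht x)⟩

theorem X_lip {α β C : ℝ} (hC : ∀ t ∈ Icc α β, ∀ x, (F.ρ (t, x))⁻¹ ≤ C) {t : ℝ} (ht : t ∈ Icc α β)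
    (m m' : ℝ) : |F.X t m - F.X t m'| ≤ C * |m - m'| := by
  have := Convex.norm_image_sub_le_of_norm_hasDerivWithin_le (f := F.X t) (C := C)
    (fun x _ => (F.X_der t x).hasDerivWithinAt) (s := univ) (fun x _ => by
      rw [Real.norm_eq_abs, abs_of_pos (inv_pos.2 (F.rh_pos _ _))]; exact hC t ht _) convex_univ
      (mem_univ m') (mem_univ m)
  simpa using this

theorem ρLip {α β n t0 x0 : ℝ} (hα : 0 < α) (hE : ∀ t ∈ Icc α β, t ∈ F.E n)
    (ht0 : t0 ∈ Ioo α β) (hx0 : x0 ∈ Ioo (F.a t0) (F.b t0)) :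
    ∃ ε > 0, ∃ L, ∀ s ∈ Metric.ball t0 ε, ∀ s' ∈ Metric.ball t0 ε, ∀ y ≤ x0,
      |F.ρ (s, y) - F.ρ (s', y)| ≤ L * |s - s'| := by
  obtain ⟨M, hM0, hM⟩ := F.bddv α β
  obtain ⟨N, hN0, hN⟩ := F.bddρ α β
  obtain ⟨ε, hε, h1⟩ := Metric.eventually_nhds_iff_ball.1
    ((F.nhds_Icc hx0).and (Ioo_mem_nhds ht0.1 ht0.2))
  have hn : 0 ≤ n := by
    have := (hE t0 ⟨ht0.1.le, ht0.2.le⟩ 0 1).1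
    norm_num at this
    exact (abs_nonneg _).trans this
  have haL : ∀ s ∈ Icc α β, ∀ s' ∈ Icc α β, |F.a s - F.a s'| ≤ M * |s - s'| := by
    intro s hs s' hs'
    have := Convex.norm_image_sub_le_of_norm_hasDerivWithin_le (f := F.a) (C := M) (s := Icc α β)
      (fun x hx => (F.ha' x (hα.trans_le hx.1)).hasDerivWithinAt) (fun x hx => hM x hx _)
      (convex_Icc α β) hs' hs
    simpa using this
  refine ⟨ε, hε, 2 * n * M + (n * M + N * n), ?_⟩
  intro s hs s' hs' y hy
  wlog hss : s ≤ s' generalizing s s'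
  · rw [abs_sub_comm, abs_sub_comm s]; exact this s' hs' s hs (le_of_not_ge hss)
  have hsub : Icc s s' ⊆ Metric.ball t0 ε := by
    rw [Real.ball_eq_Ioo] at hs hs' ⊢
    exact Icc_subset_Ioo hs.1 hs'.2
  have hsub' : ∀ τ ∈ Icc s s', τ ∈ Icc α β := fun τ hτ => Ioo_subset_Icc_self (h1 τ (hsub hτ)).2
  obtain ⟨τm, hτm, hmax⟩ := isCompact_Icc.exists_isMaxOn (nonempty_Icc.2 hss) F.ha.continuousOn
  set z := max y (F.a τm) with hz
  have hzx : z ≤ x0 := max_le hy (h1 _ (hsub hτm)).1.1.le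
  have hzs : ∀ τ ∈ Icc s s', z ∈ Icc (F.a τ) (F.b τ) := fun τ hτ =>
    ⟨(hmax hτ).trans (le_max_right _ _), hzx.trans (h1 _ (hsub hτ)).1.2.le⟩
  have key : |F.ρ (s', z) - F.ρ (s, z)| ≤ (n * M + N * n) * |s' - s| := by
    refine Convex.norm_image_sub_le_of_norm_hasDerivWithin_le (f := fun τ => F.ρ (τ, z))
      (s := Icc s s')
      (fun τ hτ => (F.hρt τ (hα.trans_le (hsub' τ hτ).1) z (hzs τ hτ)).mono fun τ' hτ' => hzs τ' hτ')
      (fun τ hτ => ?_) (convex_Icc s s') ⟨le_rfl, hss⟩ ⟨hss, le_rfl⟩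
    have hτ' := hsub' τ hτ
    have e1 := F.ρx_le (hE τ hτ') (hzs τ hτ)
    have e2 := F.vx_le (hα.trans_le hτ'.1) (hE τ hτ') (hzs τ hτ)
    have e3 := hM τ hτ' z
    have e4 := hN τ hτ' z
    rw [norm_neg, Real.norm_eq_abs]
    refine (abs_add_le _ _).trans ?_
    rw [abs_mul, abs_mul, abs_of_pos (F.ρpos _)]
    gcongr
  have side : ∀ τ ∈ Icc s s', |F.ρ (τ, y) - F.ρ (τ, z)| ≤ n * M * |s - s'| := by
    intro τ hτ
    have hLip := hE τ (hsub' τ hτ)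
    have h2 : F.a τm - F.a τ ≤ M * |s - s'| := by
      have h3 := (le_abs_self _).trans (haL τm (hsub' _ hτm) τ (hsub' _ hτ))
      refine h3.trans (mll ?_ hM0.le)
      rw [abs_sub_comm s, abs_of_nonneg (sub_nonneg.2 hss), abs_le]
      constructor <;> linarith [hτ.1, hτ.2, hτm.1, hτm.2]
    have h0 : 0 ≤ M * |s - s'| := by positivity
    have h4 : F.a τ ≤ F.a τm := hmax hτ
    rw [mul_assoc]
    rcases le_total (F.a τm) y with hc | hc
    · rw [hz, max_eq_left hc, sub_self, abs_zero]; positivity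
    · rw [hz, max_eq_right hc]
      rcases le_total (F.a τ) y with hd | hd
      · refine (hLip y (F.a τm)).2.trans (mll ?_ hn)
        rw [abs_le]; constructor <;> linarith
      · rw [F.hρl τ y hd]
        refine (hLip _ (F.a τm)).2.trans (mll ?_ hn)
        rw [abs_le]; constructor <;> linarith
  have s1 := side s ⟨le_rfl, hss⟩
  have s2 := side s' ⟨hss, le_rfl⟩
  rw [abs_sub_comm s' s] at key
  have : F.ρ (s, y) - F.ρ (s', y) = (F.ρ (s, y) - F.ρ (s, z)) - (F.ρ (s', z) - F.ρ (s, z)) -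
    (F.ρ (s', y) - F.ρ (s', z)) := by ring
  rw [this]
  refine (abs_sub _ _).trans ((add_le_add_left (abs_sub _ _) _).trans ?_)
  linarith

theorem mm_t {α β n t0 x0 : ℝ} (hα : 0 < α) (hE : ∀ t ∈ Icc α β, t ∈ F.E n)
    (ht0 : t0 ∈ Ioo α β) (hx0 : x0 ∈ Ioo (F.a t0) (F.b t0)) :
    HasDerivAt (fun t => F.mm t x0) (-(F.ρ (t0, x0) * F.v (t0, x0))) t0 := by
  have ht0' : 0 < t0 := hα.trans ht0.1
  obtain ⟨ε, hε, L, hL⟩ := F.ρLip hα hE ht0 hx0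
  set f' : ℝ → ℝ := fun x => F.ρx (t0, x) * F.v (t0, x) + F.ρ (t0, x) * F.vx (t0, x) with hf'
  have hcf : ContinuousOn f' (uIcc (F.a t0) x0) := by
    rw [uIcc_of_le hx0.1.le]
    have hs : Icc (F.a t0) x0 ⊆ Icc (F.a t0) (F.b t0) := Icc_subset_Icc_right hx0.2.le
    exact (((F.cρx t0).mono hs).mul (F.cv t0).continuousOn).add
      ((F.cρ t0).continuousOn.mul ((F.cvx t0 ht0').mono hs))
  have h1 : HasDerivAt (fun t => ∫ y in F.a t0..x0, F.ρ (t, y)) (∫ y in F.a t0..x0, -f' y) t0 := by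
    refine (intervalIntegral.hasDerivAt_integral_of_dominated_loc_of_lip
      (bound := fun _ => L) (F := fun t y => F.ρ (t, y)) (Metric.ball_mem_nhds t0 hε) ?_ ?_ ?_ ?_ ?_ ?_).2
    · exact Eventually.of_forall fun t => (F.cρ t).aestronglyMeasurable
    · exact (F.cρ t0).intervalIntegrable _ _
    · exact (hcf.neg.mono uIoc_subset_uIcc).aestronglyMeasurable measurableSet_uIoc
    · refine Eventually.of_forall fun y hy => ?_
      rw [uIoc_of_le hx0.1.le] at hy
      refine LipschitzOnWith.of_dist_le_mul fun s hs s' hs' => ?_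
      rw [Real.dist_eq, Real.dist_eq]
      refine (hL s hs s' hs' y hy.2).trans (mlr (by simpa using le_abs_self L) (abs_nonneg _))
    · simp
    · refine Eventually.of_forall fun y hy => ?_
      rw [uIoc_of_le hx0.1.le] at hy
      exact F.hρt' ht0' ⟨hy.1, hy.2.trans_lt hx0.2⟩
  have h2 : ∫ y in F.a t0..x0, f' y = F.ρ (t0, x0) * F.v (t0, x0) -
      F.ρ (t0, F.a t0) * F.v (t0, F.a t0) := by
    refine intervalIntegral.integral_eq_sub_of_hasDerivAt_of_le (f := fun y => F.ρ (t0, y) * F.v (t0, y))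
      hx0.1.le ((F.cρ t0).mul (F.cv t0)).continuousOn (fun y hy => ?_) hcf.intervalIntegrable
    have hy' : y ∈ Ioo (F.a t0) (F.b t0) := ⟨hy.1, hy.2.trans hx0.2⟩
    exact (F.hρx' hy').fun_mul (F.hvx' ht0' hy')
  have h3 := h1.fun_sub (derInt F.hρ (F.ha' t0 ht0'))
  refine (h3.congr_deriv ?_).congr_of_eventuallyEq (Eventually.of_forall fun t => ?_)
  · rw [intervalIntegral.integral_neg, h2]; ring
  · show F.mm t x0 = _
    exact (iISL ((F.cρ t).intervalIntegrable _ _)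
      ((F.cρ t).intervalIntegrable _ _)).symm

theorem X_t {α β n t0 m : ℝ} (hα : 0 < α) (hE : ∀ t ∈ Icc α β, t ∈ F.E n)
    (ht0 : t0 ∈ Ioo α β) (hm : m ∈ 𝕀) :
    HasDerivAt (fun t => F.X t m) (F.vh t0 m) t0 := by
  have ht0' : 0 < t0 := hα.trans ht0.1
  rcases eq_or_lt_of_le hm.1 with rfl | hm0
  · simp only [vh, X_0]; exact F.ha' t0 ht0'
  rcases eq_or_lt_of_le hm.2 with rfl | hm1
  · simp only [vh, X_1]; exact F.hb' t0 ht0'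
  have hx0 : F.X t0 m ∈ Ioo (F.a t0) (F.b t0) := F.X_memo ⟨hm0, hm1⟩
  have hXc : Continuous fun t => F.X t m := F.X_cont.comp (Continuous.prodMk_left m)
  have h1 := F.mm_t hα hE ht0 hx0
  have h2 := litInt F.hρ (f := fun t => F.X t m) (t0 := t0) hXc.continuousAt
  set ρ0 := F.ρ (t0, F.X t0 m) with hρ0
  have hp : 0 < ρ0 := F.ρpos _
  have e : ∀ t, ∫ y in F.X t0 m..F.X t m, F.ρ (t, y) = m - F.mm t (F.X t0 m) := fun t => by
    rw [← F.mm_sub, mm_X]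
  simp_rw [e] at h2
  have h3 : (fun t => F.X t m - F.X t0 m) =O[𝓝 t0] fun t => t - t0 := by
    have h4 : (fun t => ρ0 * (F.X t m - F.X t0 m)) =O[𝓝 t0]
        fun t => m - F.mm t (F.X t0 m) := by
      have h5 : (fun t => (m - F.mm t (F.X t0 m)) - ρ0 * (F.X t m - F.X t0 m)) =o[𝓝 t0]
        fun t => ρ0 * (F.X t m - F.X t0 m) :=
        h2.trans_isBigO (Asymptotics.isBigO_self_const_mul hp.ne' _ _)
      exact (h5.right_isBigO_add).congr_right fun t => by ring
    have h6 : (fun t => m - F.mm t (F.X t0 m)) =O[𝓝 t0] fun t => t - t0 := by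
      refine (h1.isBigO_sub.neg_left).congr_left fun t => ?_
      rw [mm_X]; ring
    exact (Asymptotics.isBigO_self_const_mul hp.ne' _ _).trans (h4.trans h6)
  have h7 := h2.trans_isBigO h3
  rw [hasDerivAt_iff_isLittleO] at h1 ⊢
  have h8 := (h1.add h7).const_mul_left (-ρ0⁻¹)
  refine h8.congr_left fun t => ?_
  simp only [smul_eq_mul, mm_X, vh, ← hρ0]
  field_simp
  ring

noncomputable def vm (t m : ℝ) : ℝ := F.vx (t, F.X t m) * (F.rh t m)⁻¹

theorem vh_m {t m : ℝ} (ht : 0 < t) (hm : m ∈ 𝕁) : HasDerivAt (F.vh t) (F.vm t m) m :=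
  (F.hvx' ht (F.X_memo hm)).comp m (F.X_der t m)

theorem vh_lip {α β C n t : ℝ} (hC : ∀ t ∈ Icc α β, ∀ x, (F.ρ (t, x))⁻¹ ≤ C) (hC0 : 0 ≤ C)
    (ht : t ∈ Icc α β) (hE : t ∈ F.E n) (m m' : ℝ) : |F.vh t m - F.vh t m'| ≤ n * C * |m - m'| := by
  have hn : 0 ≤ n := by
    have := (hE 0 1).1
    norm_num at this
    exact (abs_nonneg _).trans this
  refine ((hE _ _).1).trans ?_
  rw [mul_assoc]
  exact mll (F.X_lip hC ht m m') hn

theorem rh_lip {α β C n t : ℝ} (hC : ∀ t ∈ Icc α β, ∀ x, (F.ρ (t, x))⁻¹ ≤ C)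
    (ht : t ∈ Icc α β) (hn : 0 ≤ n) (hE : ∀ x y, |F.ρ (t, x) - F.ρ (t, y)| ≤ n * |x - y|) (m m' : ℝ) :
    |F.rh t m - F.rh t m'| ≤ n * C * |m - m'| := by
  refine (hE _ _).trans ?_
  rw [mul_assoc]
  exact mll (F.X_lip hC ht m m') hn

theorem vm_le {α β C n t m : ℝ} (hC : ∀ t ∈ Icc α β, ∀ x, (F.ρ (t, x))⁻¹ ≤ C)
    (hα : 0 < α) (ht : t ∈ Icc α β) (hE : t ∈ F.E n) (hm : m ∈ 𝕀) : |F.vm t m| ≤ n * C := by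
  have h1 := F.vx_le (hα.trans_le ht.1) hE (F.X_mem hm)
  rw [vm, abs_mul, abs_of_pos (inv_pos.2 (F.rh_pos _ _))]
  exact mul_le_mul h1 (hC t ht _) (inv_pos.2 (F.rh_pos _ _)).le ((abs_nonneg _).trans h1)

theorem vm_meas (m : ℝ) (hm : m ∈ 𝕁) {s t : ℝ} (hs : 0 < s) :
    AEStronglyMeasurable (fun τ => F.vm τ m) (volume.restrict (Ioc s t)) := by
  have h1 : Measurable fun p : ℝ × ℝ => deriv (F.vh p.1) p.2 :=
    measurable_deriv_with_param (f := F.vh) F.vh_cont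
  have h2 : Measurable fun τ => deriv (F.vh τ) m := h1.comp (f := fun τ => (τ, m)) (by fun_prop)
  refine (h2.aestronglyMeasurable).congr ?_
  refine (ae_restrict_mem measurableSet_Ioc).mono fun τ hτ => ?_
  exact (F.vh_m (hs.trans hτ.1) hm).deriv

theorem vm_int {α β n : ℝ} (hα : 0 < α) (hαβ : α ≤ β) (hE : ∀ t ∈ Icc α β, t ∈ F.E n)
    {m : ℝ} (hm : m ∈ 𝕁) : IntervalIntegrable (fun τ => F.vm τ m) volume α β := by
  obtain ⟨C, hC0, hC⟩ := F.bddi α β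
  rw [intervalIntegrable_iff_integrableOn_Ioc_of_le hαβ]
  refine Integrable.of_bound (F.vm_meas m hm hα) (n * C) ?_
  refine (ae_restrict_mem measurableSet_Ioc).mono fun τ hτ => ?_
  have hτ' := Ioc_subset_Icc_self hτ
  exact F.vm_le hC hα hτ' (hE τ hτ') ⟨hm.1.le, hm.2.le⟩

theorem X_int {α β n : ℝ} (hα : 0 < α) (hαβ : α ≤ β) (hE : ∀ t ∈ Icc α β, t ∈ F.E n)
    {m : ℝ} (hm : m ∈ 𝕀) : F.X β m - F.X α m = ∫ τ in α..β, F.vh τ m := by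
  have hXc : Continuous fun t => F.X t m := F.X_cont.comp (Continuous.prodMk_left m)
  have hvc : Continuous fun t => F.vh t m := F.vh_cont.comp (Continuous.prodMk_left m)
  exact (intervalIntegral.integral_eq_sub_of_hasDerivAt_of_le hαβ hXc.continuousOn
    (fun τ hτ => F.X_t hα hE hτ hm) (hvc.intervalIntegrable _ _)).symm

theorem θ_int {α β n : ℝ} (hα : 0 < α) (hαβ : α ≤ β) (hE : ∀ t ∈ Icc α β, t ∈ F.E n)
    {m : ℝ} (hm : m ∈ 𝕁) :
    (F.rh β m)⁻¹ - (F.rh α m)⁻¹ = ∫ τ in α..β, F.vm τ m := by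
  obtain ⟨C, hC0, hC⟩ := F.bddi α β
  have h1 : HasDerivAt (fun m => ∫ τ in α..β, F.vh τ m) (∫ τ in α..β, F.vm τ m) m := by
    refine (intervalIntegral.hasDerivAt_integral_of_dominated_loc_of_lip
      (bound := fun _ => n * C) (F := fun m τ => F.vh τ m) (Ioo_mem_nhds hm.1 hm.2) ?_ ?_ ?_ ?_ ?_ ?_).2
    · exact Eventually.of_forall fun m =>
        (F.vh_cont.comp (Continuous.prodMk_left m)).aestronglyMeasurable
    · exact (F.vh_cont.comp (Continuous.prodMk_left m)).intervalIntegrable _ _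
    · rw [uIoc_of_le hαβ]; exact F.vm_meas m hm hα
    · refine Eventually.of_forall fun τ hτ => ?_
      rw [uIoc_of_le hαβ] at hτ
      have hτ' := Ioc_subset_Icc_self hτ
      refine LipschitzOnWith.of_dist_le_mul fun s hs s' hs' => ?_
      rw [Real.dist_eq, Real.dist_eq]
      exact (F.vh_lip hC hC0.le hτ' (hE τ hτ') _ _).trans
        (mlr (by simpa using le_abs_self (n * C)) (abs_nonneg _))
    · simp
    · refine Eventually.of_forall fun τ hτ => ?_
      rw [uIoc_of_le hαβ] at hτ
      exact F.vh_m (hα.trans hτ.1) hm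
  have h2 : HasDerivAt (fun m => F.X β m - F.X α m) ((F.rh β m)⁻¹ - (F.rh α m)⁻¹) m :=
    (F.X_der β m).fun_sub (F.X_der α m)
  refine h2.unique (h1.congr_of_eventuallyEq ?_)
  filter_upwards [Icc_mem_nhds hm.1 hm.2] with m' hm'
  exact F.X_int hα hαβ hE hm'

theorem κ_int {α β n : ℝ} (hα : 0 < α) (hαβ : α ≤ β) (hE : ∀ t ∈ Icc α β, t ∈ F.E n)
    (hμ : ContinuousOn μ (Ioi 0)) {k : ℝ → ℝ} (hk : ∀ x, 0 < x → HasDerivAt k (μ x / x) x)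
    {m : ℝ} (hm : m ∈ 𝕁) :
    k (F.rh β m) - k (F.rh α m) = -∫ τ in α..β, μ (F.rh τ m) * F.vx (τ, F.X τ m) := by
  obtain ⟨C, hC0, hC⟩ := F.bddi α β
  have hrc : Continuous fun t => F.rh t m := F.rh_cont.comp (Continuous.prodMk_left m)
  have hθc : Continuous fun t => (F.rh t m)⁻¹ := hrc.inv₀ fun t => (F.rh_pos t m).ne'
  have := chainInt (θ := fun t => (F.rh t m)⁻¹) (c := fun τ => F.vm τ m) (K := fun y => k y⁻¹)
    (K' := fun y => -(μ y⁻¹ * y⁻¹)) (C := n * C) hθc.continuousOn (F.vm_int hα hαβ hE hm) hαβ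
    (fun t ht => F.vm_le hC hα ht (hE t ht) ⟨hm.1.le, hm.2.le⟩)
    (fun t ht => F.θ_int hα ht.1 (fun s hs => hE s ⟨hs.1, hs.2.trans ht.2⟩) hm) (fun t ht => ?_) ?_
  · simp only [inv_inv] at this
    rw [this, ← intervalIntegral.integral_neg]
    refine iCong fun τ _ => ?_
    have := (F.rh_pos τ m).ne'
    simp only [vm]
    field_simp
  · have h0 := (F.rh_pos t m)
    have h1 := hk _ h0
    have h2 := hasDerivAt_inv (x := (F.rh t m)⁻¹) (inv_pos.2 h0).ne'
    rw [← inv_inv (F.rh t m)] at h1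
    refine (h1.comp _ h2).congr_deriv ?_
    simp only [inv_inv]
    field_simp
  · simp only [inv_inv]
    have : Continuous fun t => μ (F.rh t m) := by
      rw [← continuousOn_univ]
      exact hμ.comp hrc.continuousOn fun t _ => F.rh_pos t m
    exact (this.mul hrc).neg.continuousOn

end Fl

noncomputable def ste (ε p x : ℝ) : ℝ := Real.smoothTransition ((x - p) / ε)
noncomputable def ste' (ε p x : ℝ) : ℝ := deriv Real.smoothTransition ((x - p) / ε) / ε

theorem ste_der {ε : ℝ} (p x : ℝ) : HasDerivAt (ste ε p) (ste' ε p x) x := by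
  have h1 : HasDerivAt Real.smoothTransition (deriv Real.smoothTransition ((x - p) / ε)) ((x - p) / ε) :=
    ((Real.smoothTransition.contDiff (n := 1)).differentiable (by norm_num) _).hasDerivAt
  have h2 : HasDerivAt (fun x : ℝ => (x - p) / ε) (1 / ε) x :=
    ((hasDerivAt_id x).sub_const p).div_const ε
  exact (h1.comp x h2).congr_deriv (by rw [ste']; ring)
theorem ste'_cont (ε p : ℝ) : Continuous (ste' ε p) := by
  have := (Real.smoothTransition.contDiff (n := 1)).continuous_deriv (by norm_num)
  unfold ste'
  fun_prop
theorem ste_cont (ε p : ℝ) : Continuous (ste ε p) :=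
  continuous_iff_continuousAt.2 fun x => (ste_der p x).continuousAt
theorem ste_mono {ε : ℝ} (hε : 0 < ε) (p : ℝ) : Monotone (ste ε p) := fun x y h =>
  Real.smoothTransition.monotone (by gcongr)
theorem ste'_nonneg {ε : ℝ} (hε : 0 < ε) (p x : ℝ) : 0 ≤ ste' ε p x := by
  rw [← (ste_der p x).deriv]; exact (ste_mono hε p).deriv_nonneg
theorem ste_zero {ε p x : ℝ} (hε : 0 < ε) (h : x ≤ p) : ste ε p x = 0 :=
  Real.smoothTransition.zero_of_nonpos (div_nonpos_of_nonpos_of_nonneg (by linarith) hε.le)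
theorem ste_one {ε p x : ℝ} (hε : 0 < ε) (h : p + ε ≤ x) : ste ε p x = 1 :=
  Real.smoothTransition.one_of_one_le ((one_le_div hε).2 (by linarith))
theorem ste'_zero {ε p x : ℝ} (hε : 0 < ε) (h : x < p ∨ p + ε < x) : ste' ε p x = 0 := by
  rcases h with h | h
  · refine (ste_der p x).unique ((hasDerivAt_const x (0:ℝ)).congr_of_eventuallyEq ?_)
    filter_upwards [Iio_mem_nhds h] with y hy using ste_zero hε (le_of_lt hy)
  · refine (ste_der p x).unique ((hasDerivAt_const x (1:ℝ)).congr_of_eventuallyEq ?_)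
    filter_upwards [Ioi_mem_nhds h] with y hy using ste_one hε (le_of_lt hy)
theorem ste_int (ε p A B : ℝ) : ∫ x in A..B, ste' ε p x = ste ε p B - ste ε p A :=
  intervalIntegral.integral_eq_sub_of_hasDerivAt (fun x _ => ste_der p x)
    ((ste'_cont ε p).intervalIntegrable _ _)

theorem steInt_le {g : ℝ → ℝ} {A B p ε C : ℝ} (hε : 0 < ε) (hAB : A ≤ B) (hC : 0 ≤ C)
    (hg : ∀ x ∈ Icc A B, p ≤ x → x ≤ p + ε → |g x| ≤ C) : |∫ x in A..B, g x * ste' ε p x| ≤ C := by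
  have h1 : |∫ x in A..B, g x * ste' ε p x| ≤ ∫ x in A..B, C * ste' ε p x := by
    rw [← Real.norm_eq_abs]
    refine intervalIntegral.norm_integral_le_of_norm_le hAB (Eventually.of_forall fun x hx => ?_)
      (((ste'_cont ε p).const_mul C).intervalIntegrable _ _)
    rw [norm_mul, Real.norm_eq_abs, Real.norm_of_nonneg (ste'_nonneg hε p x)]
    by_cases h : x < p ∨ p + ε < x
    · rw [ste'_zero hε h]; simp
    · push Not at h
      exact mlr (hg x (Ioc_subset_Icc_self hx) h.1 h.2) (ste'_nonneg hε p x)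
  refine h1.trans ?_
  rw [iCM, ste_int]
  have h2 : ste ε p B ≤ 1 := Real.smoothTransition.le_one _
  have h3 : 0 ≤ ste ε p A := Real.smoothTransition.nonneg _
  have := mll (by linarith : ste ε p B - ste ε p A ≤ 1) hC
  linarith

theorem steLim {g : ℝ → ℝ} {A B p : ℝ} (hg : ContinuousOn g (Icc A B)) (hp : p ∈ Ico A B) :
    Tendsto (fun ε => ∫ x in A..B, g x * ste' ε p x) (𝓝[>] 0) (𝓝 (g p)) := by
  have hAB : A ≤ B := hp.1.trans hp.2.le
  rw [Metric.tendsto_nhds]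
  intro η hη
  obtain ⟨δ, hδ, h1⟩ := Metric.continuousWithinAt_iff.1 (hg p ⟨hp.1, hp.2.le⟩) (η / 2) (half_pos hη)
  filter_upwards [self_mem_nhdsWithin, nhdsWithin_le_nhds (Iio_mem_nhds hδ),
    nhdsWithin_le_nhds (Iio_mem_nhds (sub_pos.2 hp.2))] with ε hε hε1 hε2
  have hε : 0 < ε := hε
  simp only [mem_Iio] at hε1 hε2
  have e1 : (∫ x in A..B, g x * ste' ε p x) - g p = ∫ x in A..B, (g x - g p) * ste' ε p x := by
    simp_rw [sub_mul]
    rw [iSub, iCM, ste_int,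
      ste_one hε (by linarith), ste_zero hε hp.1]
    · ring
    · exact ContinuousOn.intervalIntegrable (by
        rw [uIcc_of_le hAB]; exact hg.mul (ste'_cont ε p).continuousOn)
    · exact ((ste'_cont ε p).const_mul _).intervalIntegrable _ _
  rw [Real.dist_eq, e1]
  refine (steInt_le hε hAB (half_pos hη).le fun x hx h2 h3 => ?_).trans_lt (half_lt_self hη)
  have := h1 hx (by rw [Real.dist_eq, abs_of_nonneg (by linarith)]; linarith)
  rw [Real.dist_eq] at this
  exact this.le

noncomputable def bump (ε p q x : ℝ) : ℝ := ste ε p x - ste ε q x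
noncomputable def bump' (ε p q x : ℝ) : ℝ := ste' ε p x - ste' ε q x

theorem bump_der (ε p q x : ℝ) : HasDerivAt (bump ε p q) (bump' ε p q x) x :=
  (ste_der p x).fun_sub (ste_der q x)
theorem bump'_cont (ε p q : ℝ) : Continuous (bump' ε p q) := (ste'_cont ε p).sub (ste'_cont ε q)
theorem bump_cont (ε p q : ℝ) : Continuous (bump ε p q) := (ste_cont ε p).sub (ste_cont ε q)
theorem bump_nonneg {ε p q : ℝ} (hε : 0 < ε) (hpq : p ≤ q) (x : ℝ) : 0 ≤ bump ε p q x := by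
  have : (x - q) / ε ≤ (x - p) / ε := by gcongr
  exact sub_nonneg.2 (Real.smoothTransition.monotone this)
theorem bump_le (ε p q x : ℝ) : bump ε p q x ≤ 1 := by
  have h2 : ste ε p x ≤ 1 := Real.smoothTransition.le_one _
  have h3 : 0 ≤ ste ε q x := Real.smoothTransition.nonneg _
  rw [bump]; linarith
theorem bump_zero {ε p q x : ℝ} (hε : 0 < ε) (hpq : p ≤ q) (h : x ∉ Icc p (q + ε)) : bump ε p q x = 0 := by
  rw [mem_Icc, not_and_or, not_le, not_le] at h
  rcases h with h | h
  · rw [bump, ste_zero hε h.le, ste_zero hε (h.le.trans hpq), sub_zero]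
  · rw [bump, ste_one hε h.le, ste_one hε (by linarith), sub_self]
theorem bumpLim {g : ℝ → ℝ} {A B p q : ℝ} (hg : ContinuousOn g (Icc A B)) (hp : p ∈ Ico A B)
    (hq : q ∈ Ico A B) :
    Tendsto (fun ε => ∫ x in A..B, g x * bump' ε p q x) (𝓝[>] 0) (𝓝 (g p - g q)) := by
  have hAB : A ≤ B := hp.1.trans hp.2.le
  refine ((steLim hg hp).sub (steLim hg hq)).congr fun ε => ?_
  have : ∀ r, IntervalIntegrable (fun x => g x * ste' ε r x) volume A B := fun r =>
    ContinuousOn.intervalIntegrable (by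
      rw [uIcc_of_le hAB]; exact hg.mul (ste'_cont ε r).continuousOn)
  rw [← iSub (this p) (this q)]
  simp_rw [bump', mul_sub]
theorem bumpInt_le {g : ℝ → ℝ} {A B p q ε C : ℝ} (hε : 0 < ε) (hAB : A ≤ B)
    (hg : ContinuousOn g (Icc A B)) (hC : ∀ x ∈ Icc A B, |g x| ≤ C) :
    |∫ x in A..B, g x * bump' ε p q x| ≤ 2 * C := by
  have : ∀ r, IntervalIntegrable (fun x => g x * ste' ε r x) volume A B := fun r =>
    ContinuousOn.intervalIntegrable (by
      rw [uIcc_of_le hAB]; exact hg.mul (ste'_cont ε r).continuousOn)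
  have hC0 : 0 ≤ C := (abs_nonneg _).trans (hC A ⟨le_rfl, hAB⟩)
  simp_rw [bump', mul_sub]
  rw [iSub (this p) (this q)]
  have h1 := steInt_le (p := p) hε hAB hC0 fun x hx _ _ => hC x hx
  have h2 := steInt_le (p := q) hε hAB hC0 fun x hx _ _ => hC x hx
  refine (abs_sub _ _).trans (by linarith)
theorem bump_pt (p q x : ℝ) (hpq : p ≤ q) :
    Tendsto (fun ε => bump ε p q x) (𝓝[>] 0) (𝓝 ((Ioc p q).indicator 1 x)) := by
  refine tendsto_const_nhds.congr' ?_
  have key : ∀ r, r < x → ∀ᶠ ε in 𝓝[>] (0:ℝ), ste ε r x = 1 := fun r hr => by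
    filter_upwards [self_mem_nhdsWithin, nhdsWithin_le_nhds (Iio_mem_nhds (sub_pos.2 hr))] with ε h1 h2
    exact ste_one h1 (by simp only [mem_Iio] at h2; linarith)
  have key2 : ∀ r, x ≤ r → ∀ᶠ ε in 𝓝[>] (0:ℝ), ste ε r x = 0 := fun r hr => by
    filter_upwards [self_mem_nhdsWithin] with ε h1
    exact ste_zero h1 hr
  by_cases hx : x ∈ Ioc p q
  · rw [indicator_of_mem hx]
    filter_upwards [key p hx.1, key2 q hx.2] with ε h1 h2
    simp [bump, h1, h2]
  · rw [indicator_of_notMem hx]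
    rcases le_or_gt x p with h | h
    · filter_upwards [key2 p h, key2 q (h.trans hpq)] with ε h1 h2
      simp [bump, h1, h2]
    · have h' : q < x := by by_contra h2; exact hx ⟨h, not_lt.1 h2⟩
      filter_upwards [key p h, key q h'] with ε h1 h2
      simp [bump, h1, h2]
theorem bumpInt {g : ℝ → ℝ} {A B p q : ℝ} (hAp : A ≤ p) (hpq : p ≤ q) (hqB : q ≤ B)
    (hg : IntervalIntegrable g volume A B) :
    Tendsto (fun ε => ∫ x in A..B, g x * bump ε p q x) (𝓝[>] 0) (𝓝 (∫ x in p..q, g x)) := by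
  have hAB := hAp.trans (hpq.trans hqB)
  have h1 : ∫ x in p..q, g x = ∫ x in A..B, g x * (Ioc p q).indicator 1 x := by
    rw [intervalIntegral.integral_of_le hpq, intervalIntegral.integral_of_le hAB,
      ← integral_indicator measurableSet_Ioc, ← integral_indicator measurableSet_Ioc]
    congr 1; funext x
    by_cases hx : x ∈ Ioc p q
    · rw [indicator_of_mem hx, indicator_of_mem (Ioc_subset_Ioc hAp hqB hx), indicator_of_mem hx]
      simp
    · rw [indicator_of_notMem hx]
      simp [indicator, hx]
  rw [h1]
  refine intervalIntegral.tendsto_integral_filter_of_dominated_convergence (fun x => |g x|) ?_ ?_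
    hg.abs ?_
  · refine Eventually.of_forall fun ε => ?_
    exact (hg.def'.aestronglyMeasurable).mul (bump_cont ε p q).aestronglyMeasurable
  · filter_upwards [self_mem_nhdsWithin] with ε hε
    refine Eventually.of_forall fun x _ => ?_
    rw [norm_mul, Real.norm_eq_abs, Real.norm_of_nonneg (bump_nonneg hε hpq x)]
    exact mul_le_of_le_one_right (abs_nonneg _) (bump_le _ _ _ _)
  · exact Eventually.of_forall fun x _ => (bump_pt p q x hpq).const_mul _

theorem csZero {f f' : ℝ → ℝ} {a b : ℝ} (hf : ∀ t, HasDerivAt f (f' t) t)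
    (hz : ∀ t, t ∉ Icc a b → f t = 0) (t : ℝ) (ht : t ∉ Icc a b) : f' t = 0 := by
  refine (hf t).unique ((hasDerivAt_const t (0:ℝ)).congr_of_eventuallyEq ?_)
  filter_upwards [isClosed_Icc.isOpen_compl.mem_nhds ht] with s hs using hz s hs

theorem csBdd {f : ℝ → ℝ} {a b : ℝ} (hf : Continuous f) (hz : ∀ t, t ∉ Icc a b → f t = 0) :
    ∃ C, 0 ≤ C ∧ ∀ t, |f t| ≤ C := by
  obtain ⟨C, hC⟩ := (isCompact_Icc (a := a) (b := b)).exists_bound_of_continuousOn hf.continuousOn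
  refine ⟨|C|, abs_nonneg _, fun t => ?_⟩
  by_cases ht : t ∈ Icc a b
  · exact (hC t ht).trans (le_abs_self C)
  · rw [hz t ht, abs_zero]; exact abs_nonneg _

namespace Fl
variable {P μ : ℝ → ℝ} {Pe : ℝ} (F : Fl P μ Pe) {P' μ' : ℝ → ℝ}

noncomputable def dv (t m : ℝ) : ℝ := deriv (F.vh t) m * F.rh t m
noncomputable def dr (t m : ℝ) : ℝ := deriv (F.rh t) m * F.rh t m
noncomputable def qh (P' μ' : ℝ → ℝ) (t m : ℝ) : ℝ :=
  -F.vh t m * F.dv t m - P' (F.rh t m) * F.dr t m / F.rh t m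
    + μ' (F.rh t m) * F.dr t m * F.dv t m / F.rh t m
noncomputable def sh (t m : ℝ) : ℝ := μ (F.rh t m) * F.dv t m - P (F.rh t m)

theorem dv_eq {t m : ℝ} (ht : 0 < t) (hm : m ∈ 𝕁) : F.dv t m = F.vx (t, F.X t m) := by
  rw [dv, (F.vh_m ht hm).deriv, vm]; have := (F.rh_pos t m).ne'; field_simp
theorem dr_eq {t m : ℝ} (hm : m ∈ 𝕁) : F.dr t m = F.ρx (t, F.X t m) := by
  have h : HasDerivAt (F.rh t) (F.ρx (t, F.X t m) * (F.rh t m)⁻¹) m :=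
    (F.hρx' (F.X_memo hm)).comp m (F.X_der t m)
  rw [dr, h.deriv]; have := (F.rh_pos t m).ne'; field_simp

theorem comp_cont {h : ℝ → ℝ} (hh : ContinuousOn h (Ioi 0)) : Continuous fun p => h (F.ρ p) := by
  rw [← continuousOn_univ]; exact hh.comp F.hρ.continuousOn fun p _ => F.ρpos p
theorem comp_rh {h : ℝ → ℝ} (hh : ContinuousOn h (Ioi 0)) :
    Continuous fun p : ℝ × ℝ => h (F.rh p.1 p.2) := by
  rw [← continuousOn_univ]; exact hh.comp F.rh_cont.continuousOn fun p _ => F.rh_pos _ _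
theorem bddc {h : ℝ → ℝ} (hh : ContinuousOn h (Ioi 0)) (α β : ℝ) :
    ∃ M, 0 < M ∧ ∀ t ∈ Icc α β, ∀ x, |h (F.ρ (t, x))| ≤ M :=
  F.bdd (g := fun p => h (F.ρ p)) (F.comp_cont hh)
    (fun t x hx => by rw [F.hρl t x hx]) (fun t x hx => by rw [F.hρr t x hx]) α β

theorem dv_meas : Measurable fun p : ℝ × ℝ => F.dv p.1 p.2 :=
  (measurable_deriv_with_param (f := F.vh) F.vh_cont).mul F.rh_cont.measurable
theorem dr_meas : Measurable fun p : ℝ × ℝ => F.dr p.1 p.2 :=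
  (measurable_deriv_with_param (f := F.rh) F.rh_cont).mul F.rh_cont.measurable
theorem qh_meas (hP' : ContinuousOn P' (Ioi 0)) (hμ' : ContinuousOn μ' (Ioi 0)) :
    Measurable fun p : ℝ × ℝ => F.qh P' μ' p.1 p.2 := by
  have h1 := F.dv_meas
  have h2 := F.dr_meas
  have h3 := (F.comp_rh hP').measurable
  have h4 := (F.comp_rh hμ').measurable
  have h5 := F.vh_cont.measurable
  have h6 := F.rh_cont.measurable
  exact ((h5.neg.mul h1).sub ((h3.mul h2).div h6)).add (((h4.mul h2).mul h1).div h6)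
theorem sh_meas (hP : ContinuousOn P (Ioi 0)) (hμ : ContinuousOn μ (Ioi 0)) :
    Measurable fun p : ℝ × ℝ => F.sh p.1 p.2 :=
  ((F.comp_rh hμ).measurable.mul F.dv_meas).sub (F.comp_rh hP).measurable

theorem dv_le {n t m : ℝ} (ht : 0 < t) (hE : t ∈ F.E n) (hm : m ∈ 𝕁) : |F.dv t m| ≤ n := by
  rw [F.dv_eq ht hm]; exact F.vx_le ht hE (F.X_mem ⟨hm.1.le, hm.2.le⟩)
theorem dr_le {n t m : ℝ} (hE : t ∈ F.E n) (hm : m ∈ 𝕁) : |F.dr t m| ≤ n := by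
  rw [F.dr_eq hm]; exact F.ρx_le hE (F.X_mem ⟨hm.1.le, hm.2.le⟩)

theorem dv_cont {t : ℝ} (ht : 0 < t) : ContinuousOn (F.dv t) (Ioo 0 1) := by
  have hX : Continuous (F.X t) := F.X_cont.comp (Continuous.prodMk_right t)
  refine ((F.cvx t ht).comp hX.continuousOn fun m hm => ?_).congr fun m hm => F.dv_eq ht hm
  exact F.X_mem ⟨hm.1.le, hm.2.le⟩
theorem dr_cont (t : ℝ) : ContinuousOn (F.dr t) (Ioo 0 1) := by
  have hX : Continuous (F.X t) := F.X_cont.comp (Continuous.prodMk_right t)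
  refine ((F.cρx t).comp hX.continuousOn fun m hm => ?_).congr fun m hm => F.dr_eq hm
  exact F.X_mem ⟨hm.1.le, hm.2.le⟩
end Fl
theorem Law.cP {P μ P' μ' : ℝ → ℝ} (hL : Law P μ P' μ') : ContinuousOn P (Ioi 0) :=
  fun x hx => (hL.dP x hx).continuousAt.continuousWithinAt
theorem Law.cμ {P μ P' μ' : ℝ → ℝ} (hL : Law P μ P' μ') : ContinuousOn μ (Ioi 0) :=
  fun x hx => (hL.dμ x hx).continuousAt.continuousWithinAt
namespace Fl
variable {P μ : ℝ → ℝ} {Pe : ℝ} (F : Fl P μ Pe) {P' μ' : ℝ → ℝ}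
theorem qh_cont (hL : Law P μ P' μ') {t : ℝ} (ht : 0 < t) :
    ContinuousOn (F.qh P' μ' t) (Ioo 0 1) := by
  have c1 := F.dv_cont ht
  have c2 := F.dr_cont t
  have c3 : Continuous (F.rh t) := F.rh_cont.comp (Continuous.prodMk_right t)
  have c4 : Continuous (F.vh t) := F.vh_cont.comp (Continuous.prodMk_right t)
  have c5 : Continuous fun m => P' (F.rh t m) := (F.comp_rh hL.cP').comp (Continuous.prodMk_right t)
  have c6 : Continuous fun m => μ' (F.rh t m) := (F.comp_rh hL.cμ').comp (Continuous.prodMk_right t)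
  have c7 : ∀ m ∈ 𝕁, F.rh t m ≠ 0 := fun m _ => (F.rh_pos t m).ne'
  exact ((c4.neg.continuousOn.mul c1).sub ((c5.continuousOn.mul c2).div c3.continuousOn c7)).add
    (((c6.continuousOn.mul c2).mul c1).div c3.continuousOn c7)
theorem sh_cont (hL : Law P μ P' μ') {t : ℝ} (ht : 0 < t) :
    ContinuousOn (F.sh t) (Ioo 0 1) := by
  have c5 : Continuous fun m => P (F.rh t m) := (F.comp_rh hL.cP).comp (Continuous.prodMk_right t)
  have c6 : Continuous fun m => μ (F.rh t m) := (F.comp_rh hL.cμ).comp (Continuous.prodMk_right t)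
  exact (c6.continuousOn.mul (F.dv_cont ht)).sub c5.continuousOn
theorem qsBdd (hL : Law P μ P' μ') {α β n : ℝ} (hα : 0 < α) (hαβ : α ≤ β)
    (hE : ∀ t ∈ Icc α β, t ∈ F.E n) :
    ∃ C, 0 < C ∧ ∀ t ∈ Icc α β, ∀ m ∈ 𝕁, |F.qh P' μ' t m| ≤ C ∧ |F.sh t m| ≤ C := by
  obtain ⟨M, hM0, hM⟩ := F.bddv α β
  obtain ⟨k1, h10, h1⟩ := F.bddc hL.cP' α β
  obtain ⟨k2, h20, h2⟩ := F.bddc hL.cμ' α β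
  obtain ⟨k3, h30, h3⟩ := F.bddc hL.cP α β
  obtain ⟨k4, h40, h4⟩ := F.bddc hL.cμ α β
  obtain ⟨k5, h50, h5⟩ := F.bddi α β
  have hn : 0 ≤ n := (abs_nonneg _).trans
    (F.dv_le hα (hE α ⟨le_rfl, hαβ⟩) (m := 1/2) (by norm_num))
  refine ⟨M * n + k1 * n * k5 + k2 * n * n * k5 + k4 * n + k3, by positivity, fun t ht m hm => ?_⟩
  have a1 := F.dv_le (hα.trans_le ht.1) (hE t ht) hm
  have a2 := F.dr_le (hE t ht) hm
  have a3 : |F.vh t m| ≤ M := hM t ht _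
  have a4 : |P' (F.rh t m)| ≤ k1 := h1 t ht _
  have a5 : |μ' (F.rh t m)| ≤ k2 := h2 t ht _
  have a6 : |P (F.rh t m)| ≤ k3 := h3 t ht _
  have a7 : |μ (F.rh t m)| ≤ k4 := h4 t ht _
  have a8 : (F.rh t m)⁻¹ ≤ k5 := h5 t ht _
  have a9 : |(F.rh t m)⁻¹| ≤ k5 := by rwa [abs_of_pos (inv_pos.2 (F.rh_pos _ _))]
  constructor
  · rw [qh, div_eq_mul_inv, div_eq_mul_inv]
    refine (abs_add_le _ _).trans ((add_le_add_left (abs_sub _ _) _).trans ?_)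
    simp only [abs_mul, abs_neg]
    have e1 : |F.vh t m| * |F.dv t m| ≤ M * n := by gcongr
    have e2 : |P' (F.rh t m)| * |F.dr t m| * |(F.rh t m)⁻¹| ≤ k1 * n * k5 := by gcongr
    have e3 : |μ' (F.rh t m)| * |F.dr t m| * |F.dv t m| * |(F.rh t m)⁻¹| ≤ k2 * n * n * k5 := by gcongr
    have e4 : 0 ≤ k4 * n + k3 := by positivity
    linarith
  · rw [sh]
    refine (abs_sub _ _).trans ?_
    rw [abs_mul]
    have e1 : |μ (F.rh t m)| * |F.dv t m| ≤ k4 * n := by gcongr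
    have e2 : 0 ≤ M * n + k1 * n * k5 + k2 * n * n * k5 := by positivity
    linarith
end Fl

structure Cut (f f' : ℝ → ℝ) (a b : ℝ) : Prop where
  der : ∀ t, HasDerivAt f (f' t) t
  cont' : Continuous f'
  nonneg : ∀ t, 0 ≤ f t
  zero : ∀ t, t ∉ Icc a b → f t = 0

theorem Cut.cont {f f' : ℝ → ℝ} {a b : ℝ} (h : Cut f f' a b) : Continuous f :=
  continuous_iff_continuousAt.2 fun x => (h.der x).continuousAt
theorem Cut.zero' {f f' : ℝ → ℝ} {a b : ℝ} (h : Cut f f' a b) : ∀ t, t ∉ Icc a b → f' t = 0 :=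
  csZero h.der h.zero
theorem Cut.bd {f f' : ℝ → ℝ} {a b : ℝ} (h : Cut f f' a b) :
    ∃ C, 0 ≤ C ∧ (∀ t, |f t| ≤ C) ∧ ∀ t, |f' t| ≤ C := by
  obtain ⟨C, h1, h2⟩ := csBdd h.cont h.zero
  obtain ⟨C', h1', h2'⟩ := csBdd h.cont' h.zero'
  exact ⟨max C C', le_max_of_le_left h1, fun t => (h2 t).trans (le_max_left _ _),
    fun t => (h2' t).trans (le_max_right _ _)⟩

namespace Fl
variable {P μ : ℝ → ℝ} {Pe : ℝ} (F : Fl P μ Pe) {P' μ' : ℝ → ℝ}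

noncomputable def tφ (χ ζ : ℝ → ℝ) (p : ℝ × ℝ) : ℝ := μ (F.ρ p) * (χ p.1 * ζ (F.mm p.1 p.2))
noncomputable def tφx (μ' χ ζ ζ' : ℝ → ℝ) (p : ℝ × ℝ) : ℝ := χ p.1 * (μ' (F.ρ p) * F.ρx p *
  ζ (F.mm p.1 p.2) + μ (F.ρ p) * (ζ' (F.mm p.1 p.2) * F.ρ p))
noncomputable def tgt (χ χ' ζ ζ' : ℝ → ℝ) (p : ℝ × ℝ) : ℝ := χ' p.1 * (F.ρ p * ζ (F.mm p.1 p.2)) +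
  χ p.1 * (-(F.ρx p * F.v p + F.ρ p * F.vx p) * ζ (F.mm p.1 p.2) +
    F.ρ p * (ζ' (F.mm p.1 p.2) * -(F.ρ p * F.v p)))

theorem mem_of_mm {t x : ℝ} (h : F.mm t x ∈ 𝕁) : x ∈ Ioo (F.a t) (F.b t) := by
  have := F.X_memo (t := t) h; rwa [X_mm] at this

variable {χ χ' ζ ζ' : ℝ → ℝ} {α β n α' β' p' q' : ℝ}

theorem tφx_der (hL : Law P μ P' μ') (hζ : Cut ζ ζ' p' q') (hp : 0 < p') (hq : q' < 1) (p : ℝ × ℝ) :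
    HasDerivAt (fun y => F.tφ χ ζ (p.1, y)) (F.tφx μ' χ ζ ζ' p) p.2 := by
  have hmc : Continuous (F.mm p.1) := F.mm_cont.comp (Continuous.prodMk_right p.1)
  by_cases h : F.mm p.1 p.2 ∈ Icc p' q'
  · have hx := F.mem_of_mm (t := p.1) (x := p.2) ⟨hp.trans_le h.1, h.2.trans_lt hq⟩
    have h1 := (hL.dμ (F.ρ (p.1, p.2)) (F.ρpos _)).comp p.2 (F.hρx' hx)
    have h2 := ((hζ.der (F.mm p.1 p.2)).comp p.2 (F.mm_der p.1 p.2)).const_mul (χ p.1)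
    refine (h1.fun_mul h2).congr_deriv ?_
    simp only [tφx, Function.comp]; ring
  · have h1 : F.tφx μ' χ ζ ζ' p = 0 := by simp [tφx, hζ.zero _ h, hζ.zero' _ h]
    rw [h1]
    refine (hasDerivAt_const _ (0:ℝ)).congr_of_eventuallyEq ?_
    filter_upwards [hmc.continuousAt.eventually (isClosed_Icc.isOpen_compl.mem_nhds h)] with y hy
    simp [tφ, hζ.zero _ hy]

theorem tφx_cont (hL : Law P μ P' μ') (hζ : Cut ζ ζ' p' q') (hp : 0 < p') (hq : q' < 1) (t : ℝ) :
    Continuous fun y => F.tφx μ' χ ζ ζ' (t, y) := by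
  have hmc : Continuous (F.mm t) := F.mm_cont.comp (Continuous.prodMk_right t)
  rw [continuous_iff_continuousAt]
  intro x
  by_cases h : F.mm t x ∈ Icc p' q'
  · have hx := F.mem_of_mm (t := t) (x := x) ⟨hp.trans_le h.1, h.2.trans_lt hq⟩
    have c1 : ContinuousAt (fun y => F.ρx (t, y)) x :=
      (F.cρx t).continuousAt (Icc_mem_nhds hx.1 hx.2)
    have c2 : ContinuousAt (fun y => μ' (F.ρ (t, y))) x :=
      ((F.comp_cont hL.cμ').comp (Continuous.prodMk_right t)).continuousAt
    have c3 : ContinuousAt (fun y => μ (F.ρ (t, y))) x :=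
      ((F.comp_cont hL.cμ).comp (Continuous.prodMk_right t)).continuousAt
    have c4 : ContinuousAt (fun y => ζ (F.mm t y)) x := (hζ.cont.comp hmc).continuousAt
    have c5 : ContinuousAt (fun y => ζ' (F.mm t y)) x := (hζ.cont'.comp hmc).continuousAt
    exact continuousAt_const.mul (((c2.mul c1).mul c4).add (c3.mul (c5.mul (F.cρ t).continuousAt)))
  · refine (continuousAt_const (y := (0:ℝ))).congr ?_
    filter_upwards [hmc.continuousAt.eventually (isClosed_Icc.isOpen_compl.mem_nhds h)] with y hy
    simp [tφx, hζ.zero _ hy, hζ.zero' _ hy]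

theorem tgt_der (hα : 0 < α) (hE : ∀ t ∈ Icc α β, t ∈ F.E n) (hζ : Cut ζ ζ' p' q') (hp : 0 < p')
    (hq : q' < 1) (hχ : Cut χ χ' α' β') (hα' : α < α') (hβ' : β' < β) (p : ℝ × ℝ) :
    HasDerivAt (fun s => F.ρ (s, p.2) * (χ s * ζ (F.mm s p.2))) (F.tgt χ χ' ζ ζ' p) p.1 := by
  have hmc : Continuous fun s => F.mm s p.2 := F.mm_cont.comp (Continuous.prodMk_left p.2)
  by_cases h : F.mm p.1 p.2 ∈ Icc p' q'
  · have hx := F.mem_of_mm (t := p.1) (x := p.2) ⟨hp.trans_le h.1, h.2.trans_lt hq⟩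
    by_cases ht : p.1 ∈ Icc α' β'
    · have ht' : p.1 ∈ Ioo α β := ⟨hα'.trans_le ht.1, ht.2.trans_lt hβ'⟩
      have h1 := F.hρt' (hα.trans ht'.1) hx
      have h2 := (hζ.der (F.mm p.1 p.2)).comp p.1 (F.mm_t hα hE ht' hx)
      refine (h1.fun_mul ((hχ.der p.1).fun_mul h2)).congr_deriv ?_
      simp only [tgt, Function.comp]; ring
    · have h1 : F.tgt χ χ' ζ ζ' p = 0 := by simp [tgt, hχ.zero _ ht, hχ.zero' _ ht]
      rw [h1]
      refine (hasDerivAt_const _ (0:ℝ)).congr_of_eventuallyEq ?_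
      filter_upwards [isClosed_Icc.isOpen_compl.mem_nhds ht] with s hs
      simp [hχ.zero _ hs]
  · have h1 : F.tgt χ χ' ζ ζ' p = 0 := by simp [tgt, hζ.zero _ h, hζ.zero' _ h]
    rw [h1]
    refine (hasDerivAt_const _ (0:ℝ)).congr_of_eventuallyEq ?_
    filter_upwards [hmc.continuousAt.eventually (isClosed_Icc.isOpen_compl.mem_nhds h)] with y hy
    simp [hζ.zero _ hy]

theorem t_bd (hL : Law P μ P' μ') (hα : 0 < α) (hE : ∀ t ∈ Icc α β, t ∈ F.E n)
    (hζ : Cut ζ ζ' p' q') (hp : 0 < p')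
    (hq : q' < 1) (hχ : Cut χ χ' α' β') (hα' : α < α') (hβ' : β' < β) :
    ∃ C, 0 ≤ C ∧ ∀ p, |F.tφx μ' χ ζ ζ' p| ≤ C ∧ |F.tgt χ χ' ζ ζ' p| ≤ C := by
  obtain ⟨c1, hc1, h1, h1'⟩ := hχ.bd
  obtain ⟨c2, hc2, h2, h2'⟩ := hζ.bd
  obtain ⟨M, hM0, hM⟩ := F.bddv α β
  obtain ⟨N, hN0, hN⟩ := F.bddρ α β
  obtain ⟨k1, h10, hk1⟩ := F.bddc hL.cμ' α β
  obtain ⟨k2, h20, hk2⟩ := F.bddc hL.cμ α β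
  set n' := |n|
  set C1 := c1 * (k1 * n' * c2 + k2 * (c2 * N)) with hC1
  set C2 := c1 * (N * c2) + c1 * ((n' * M + N * n') * c2 + N * (c2 * (N * M))) with hC2
  have p1 : 0 ≤ C1 := by positivity
  have p2 : 0 ≤ C2 := by positivity
  refine ⟨C1 + C2, by positivity, fun p => ?_⟩
  by_cases ht : p.1 ∈ Icc α' β'
  · by_cases hm : F.mm p.1 p.2 ∈ Icc p' q'
    · have ht' : p.1 ∈ Icc α β := ⟨hα'.le.trans ht.1, ht.2.trans hβ'.le⟩
      have hx := F.mem_of_mm (t := p.1) (x := p.2) ⟨hp.trans_le hm.1, hm.2.trans_lt hq⟩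
      have a1 : |F.ρx p| ≤ n' := (F.ρx_le (hE _ ht') ⟨hx.1.le, hx.2.le⟩).trans (le_abs_self n)
      have a2 : |F.vx p| ≤ n' :=
        (F.vx_le (hα.trans_le ht'.1) (hE _ ht') ⟨hx.1.le, hx.2.le⟩).trans (le_abs_self n)
      have a3 : |F.v p| ≤ M := hM _ ht' p.2
      have a4 : |F.ρ p| ≤ N := by rw [abs_of_pos (F.ρpos p)]; exact hN _ ht' p.2
      have a5 : |μ' (F.ρ p)| ≤ k1 := hk1 _ ht' p.2
      have a6 : |μ (F.ρ p)| ≤ k2 := hk2 _ ht' p.2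
      have b1 := h1 p.1
      have b2 := h1' p.1
      have b3 := h2 (F.mm p.1 p.2)
      have b4 := h2' (F.mm p.1 p.2)
      constructor
      · have : |F.tφx μ' χ ζ ζ' p| ≤ C1 := by
          rw [tφx, abs_mul]
          refine mul_le_mul b1 ((abs_add_le _ _).trans ?_) (abs_nonneg _) hc1
          simp only [abs_mul]
          gcongr
        linarith
      · have : |F.tgt χ χ' ζ ζ' p| ≤ C2 := by
          rw [tgt]
          refine (abs_add_le _ _).trans (add_le_add ?_ ?_)
          · simp only [abs_mul]; gcongr
          · rw [abs_mul]
            refine mul_le_mul b1 ((abs_add_le _ _).trans ?_) (abs_nonneg _) hc1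
            have : |F.ρx p * F.v p + F.ρ p * F.vx p| ≤ n' * M + N * n' := by
              refine (abs_add_le _ _).trans ?_
              simp only [abs_mul]; gcongr
            simp only [abs_mul, abs_neg]
            gcongr
        linarith
    · simp [tφx, tgt, hζ.zero _ hm, hζ.zero' _ hm]; positivity
  · simp [tφx, tgt, hχ.zero _ ht, hχ.zero' _ ht]; positivity

theorem t_cpt (α' β' p' q' : ℝ) :
    IsCompact {p : ℝ × ℝ | p.1 ∈ Icc α' β' ∧ F.mm p.1 p.2 ∈ Icc p' q'} := by
  have h1 := F.X_cont
  have hK : IsCompact ((fun p : ℝ × ℝ => (p.1, F.X p.1 p.2)) '' (Icc α' β' ×ˢ Icc p' q')) :=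
    (isCompact_Icc.prod isCompact_Icc).image (by fun_prop)
  convert hK using 1
  ext ⟨t, x⟩
  constructor
  · rintro ⟨h2, h3⟩
    exact ⟨(t, F.mm t x), ⟨h2, h3⟩, by simp [X_mm]⟩
  · rintro ⟨⟨t', m⟩, ⟨h2, h3⟩, h4⟩
    simp only [Prod.mk.injEq] at h4
    obtain ⟨rfl, rfl⟩ := h4
    exact ⟨h2, by simpa [mm_X] using h3⟩

theorem tφ_zero (hζ : Cut ζ ζ' p' q') (hχ : Cut χ χ' α' β') (p : ℝ × ℝ)
    (hp : p ∉ {p : ℝ × ℝ | p.1 ∈ Icc α' β' ∧ F.mm p.1 p.2 ∈ Icc p' q'}) :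
    F.tφ χ ζ p = 0 ∧ F.tgt χ χ' ζ ζ' p = 0 ∧ F.tφx μ' χ ζ ζ' p = 0 := by
  simp only [mem_setOf_eq, not_and_or] at hp
  rcases hp with h | h
  · simp [tφ, tgt, tφx, hχ.zero _ h, hχ.zero' _ h]
  · simp [tφ, tgt, tφx, hζ.zero _ h, hζ.zero' _ h]

theorem vxx {t x : ℝ} (hL : Law P μ P' μ') (ht : 0 < t) (hx : x ∈ Ioo (F.a t) (F.b t)) :
    HasDerivAt (fun y => F.vx (t, y)) (F.ρ (t, x) / μ (F.ρ (t, x)) * (F.vt (t, x) -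
      (-F.v (t, x) * F.vx (t, x) - P' (F.ρ (t, x)) * F.ρx (t, x) / F.ρ (t, x) +
        μ' (F.ρ (t, x)) * F.ρx (t, x) * F.vx (t, x) / F.ρ (t, x)))) x := by
  have h1 := F.mom t ht x hx
  have h2 := (hL.dP _ (F.ρpos (t, x))).comp x (F.hρx' hx)
  have h3 := (hL.dμ _ (F.ρpos (t, x))).comp x (F.hρx' hx)
  have hμ := hL.μpos _ (F.ρpos (t, x))
  have h4 := (h1.fun_add h2).fun_div h3 hμ.ne'
  refine (h4.congr_deriv ?_).congr_of_eventuallyEq (Eventually.of_forall fun y => ?_)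
  · have := (F.ρpos (t, x)).ne'
    simp only [Function.comp]
    field_simp
    ring
  · have := (hL.μpos _ (F.ρpos (t, y))).ne'
    simp only [Function.comp]
    field_simp
    ring
end Fl

namespace Fl
variable {P μ : ℝ → ℝ} {Pe : ℝ} (F : Fl P μ Pe) {P' μ' : ℝ → ℝ}
variable {χ χ' ζ ζ' : ℝ → ℝ} {α β n α' β' p q p' q' e : ℝ}

noncomputable def HH (P' μ' χ χ' ζ ζ' : ℝ → ℝ) (e N t m : ℝ) : ℝ :=
  χ' t * ((e * F.vh t m - N) * ζ m) - e * χ t * (F.qh P' μ' t m * ζ m + F.sh t m * ζ' m)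

theorem HH_cont (hL : Law P μ P' μ') (hζ : Cut ζ ζ' p' q') {t : ℝ} (ht : 0 < t) (N : ℝ) :
    ContinuousOn (F.HH P' μ' χ χ' ζ ζ' e N t) (Ioo 0 1) := by
  have c4 : Continuous (F.vh t) := F.vh_cont.comp (Continuous.prodMk_right t)
  have c1 := F.qh_cont hL ht
  have c2 := F.sh_cont hL ht
  have z1 := hζ.cont
  have z2 := hζ.cont'
  have : Continuous fun m => χ' t * ((e * F.vh t m - N) * ζ m) := by fun_prop
  exact this.continuousOn.sub (continuousOn_const.mul
    ((c1.mul z1.continuousOn).add (c2.mul z2.continuousOn)))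

theorem perT (hL : Law P μ P' μ') (hζ : Cut ζ ζ' p' q') (hp : 0 < p) (hpq : p < q)
    (hq : q < 1) (hp' : p < p') (hq' : q' < q) {t : ℝ} (ht : 0 < t) (N : ℝ) :
    (∫ x, (e * F.v (t, x) - N) * F.tgt χ χ' ζ ζ' (t, x)) -
      ∫ x, (e * F.vx (t, x)) * F.tφx μ' χ ζ ζ' (t, x) =
    ∫ m in p..q, F.HH P' μ' χ χ' ζ ζ' e N t m := by
  have hXpq : F.X t p ≤ F.X t q := (F.X_mono t hpq).le
  have hXp := F.X_memo (t := t) ⟨hp, hpq.trans hq⟩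
  have hXq := F.X_memo (t := t) ⟨hp.trans hpq, hq⟩
  have hsub : Icc (F.X t p) (F.X t q) ⊆ Ioo (F.a t) (F.b t) := Icc_subset_Ioo hXp.1 hXq.2
  have hsub' : Icc (F.X t p) (F.X t q) ⊆ Icc (F.a t) (F.b t) := hsub.trans Ioo_subset_Icc_self
  have hout : ∀ x, x ∉ Ioc (F.X t p) (F.X t q) → F.mm t x ∉ Icc p' q' := by
    intro x hx h
    refine hx ⟨?_, ?_⟩
    · rw [← (F.mm_mono t).lt_iff_lt, mm_X]; exact hp'.trans_le h.1
    · rw [← (F.mm_mono t).le_iff_le, mm_X]; exact (h.2.trans_lt hq').le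
  have hmI : ∀ x ∈ Icc (F.X t p) (F.X t q), F.mm t x ∈ Icc p q := fun x hx => by
    constructor
    · rw [← F.mm_X t p]; exact (F.mm_mono t).monotone hx.1
    · rw [← F.mm_X t q]; exact (F.mm_mono t).monotone hx.2
  have i1 : ∫ x, (e * F.v (t, x) - N) * F.tgt χ χ' ζ ζ' (t, x) =
      ∫ x in F.X t p..F.X t q, (e * F.v (t, x) - N) * F.tgt χ χ' ζ ζ' (t, x) := by
    refine (intervalIntegral.integral_eq_integral_of_support_subset fun x hx => ?_).symm
    by_contra h
    exact hx (by simp [tgt, hζ.zero _ (hout x h), hζ.zero' _ (hout x h)])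
  have i2 : ∫ x, (e * F.vx (t, x)) * F.tφx μ' χ ζ ζ' (t, x) =
      ∫ x in F.X t p..F.X t q, (e * F.vx (t, x)) * F.tφx μ' χ ζ ζ' (t, x) := by
    refine (intervalIntegral.integral_eq_integral_of_support_subset fun x hx => ?_).symm
    by_contra h
    exact hx (by simp [tφx, hζ.zero _ (hout x h), hζ.zero' _ (hout x h)])
  have hmc : Continuous (F.mm t) := F.mm_cont.comp (Continuous.prodMk_right t)
  have cρ := F.cρ t
  have cv := F.cv t
  have cvx := (F.cvx t ht).mono hsub'
  have cρx := (F.cρx t).mono hsub'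
  have cμ : Continuous (fun y => μ (F.ρ (t, y))) := (F.comp_cont hL.cμ).comp (Continuous.prodMk_right t)
  have cμ' : Continuous (fun y => μ' (F.ρ (t, y))) := (F.comp_cont hL.cμ').comp (Continuous.prodMk_right t)
  have cP' : Continuous (fun y => P' (F.ρ (t, y))) := (F.comp_cont hL.cP').comp (Continuous.prodMk_right t)
  have cP : Continuous (fun y => P (F.ρ (t, y))) := (F.comp_cont hL.cP).comp (Continuous.prodMk_right t)
  have cz : Continuous (fun y => ζ (F.mm t y)) := hζ.cont.comp hmc
  have cz' : Continuous (fun y => ζ' (F.mm t y)) := hζ.cont'.comp hmc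
  have j1 : ContinuousOn (fun x => (e * F.v (t, x) - N) * F.tgt χ χ' ζ ζ' (t, x))
      (uIcc (F.X t p) (F.X t q)) := by
    rw [uIcc_of_le hXpq]
    have k1 : Continuous fun x => e * F.v (t, x) - N := by fun_prop
    have k2 : Continuous fun x => χ' t * (F.ρ (t, x) * ζ (F.mm t x)) :=
      continuous_const.mul (cρ.mul cz)
    have k3 : Continuous fun x => F.ρ (t, x) * (ζ' (F.mm t x) * -(F.ρ (t, x) * F.v (t, x))) :=
      cρ.mul (cz'.mul (cρ.mul cv).neg)
    exact k1.continuousOn.mul (k2.continuousOn.add ((continuousOn_const (c := χ t)).mul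
      ((((cρx.mul cv.continuousOn).add (cρ.continuousOn.mul cvx)).neg.mul cz.continuousOn).add
        k3.continuousOn)))
  have j2 : ContinuousOn (fun x => (e * F.vx (t, x)) * F.tφx μ' χ ζ ζ' (t, x))
      (uIcc (F.X t p) (F.X t q)) := by
    rw [uIcc_of_le hXpq]
    have k3 : Continuous fun x => μ (F.ρ (t, x)) * (ζ' (F.mm t x) * F.ρ (t, x)) :=
      cμ.mul (cz'.mul cρ)
    exact (continuousOn_const.mul cvx).mul ((continuousOn_const (c := χ t)).mul
      (((cμ'.continuousOn.mul cρx).mul cz.continuousOn).add k3.continuousOn))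
  have j12 : ContinuousOn (fun x => (e * F.v (t, x) - N) * F.tgt χ χ' ζ ζ' (t, x) -
    (e * F.vx (t, x)) * F.tφx μ' χ ζ ζ' (t, x)) (uIcc (F.X t p) (F.X t q)) := j1.sub j2
  rw [i1, i2, ← iSub j1.intervalIntegrable j2.intervalIntegrable]
  set H := F.HH P' μ' χ χ' ζ ζ' e N t
  have hHc : ContinuousOn H (Icc p q) := (F.HH_cont hL hζ ht N).mono (Icc_subset_Ioo hp hq)
  have cov : ∫ x in F.X t p..F.X t q, (H ∘ F.mm t) x * F.ρ (t, x) = ∫ m in p..q, H m := by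
    have := intervalIntegral.integral_comp_mul_deriv' (a := F.X t p) (b := F.X t q) (f := F.mm t)
      (f' := fun x => F.ρ (t, x)) (g := H) (fun x _ => F.mm_der t x) cρ.continuousOn (by
        refine hHc.mono ?_
        rw [uIcc_of_le hXpq]
        rintro _ ⟨x, hx, rfl⟩
        exact hmI x hx)
    rw [mm_X, mm_X] at this
    exact this
  rw [← cov]
  set D : ℝ → ℝ := fun x => (e * F.v (t, x) - N) * F.tgt χ χ' ζ ζ' (t, x) -
    (e * F.vx (t, x)) * F.tφx μ' χ ζ ζ' (t, x) - (H ∘ F.mm t) x * F.ρ (t, x) with hD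
  have j3 : ContinuousOn (fun x => (H ∘ F.mm t) x * F.ρ (t, x)) (uIcc (F.X t p) (F.X t q)) := by
    rw [uIcc_of_le hXpq]
    exact (hHc.comp hmc.continuousOn hmI).mul cρ.continuousOn
  rw [← sub_eq_zero, ← iSub j12.intervalIntegrable
    j3.intervalIntegrable]
  have hb : ∫ x in F.X t p..F.X t q, D x =
    (fun y => -(χ t * ((e * F.v (t, y) - N) * (F.ρ (t, y) * F.v (t, y) * ζ (F.mm t y)))) -
      e * χ t * (P (F.ρ (t, y)) * ζ (F.mm t y))) (F.X t q) -
    (fun y => -(χ t * ((e * F.v (t, y) - N) * (F.ρ (t, y) * F.v (t, y) * ζ (F.mm t y)))) -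
      e * χ t * (P (F.ρ (t, y)) * ζ (F.mm t y))) (F.X t p) := by
    have jD : IntervalIntegrable D volume (F.X t p) (F.X t q) := (j12.sub j3).intervalIntegrable
    refine intervalIntegral.integral_eq_sub_of_hasDerivAt
      (f := (fun y => -(χ t * ((e * F.v (t, y) - N) * (F.ρ (t, y) * F.v (t, y) * ζ (F.mm t y)))) -
      e * χ t * (P (F.ρ (t, y)) * ζ (F.mm t y)))) (fun x hx => ?_) jD
    rw [uIcc_of_le hXpq] at hx
    have hm : F.mm t x ∈ 𝕁 := Icc_subset_Ioo hp hq (hmI x hx)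
    have hx' := hsub hx
    have d1 := F.hρx' hx'
    have d2 := F.hvx' ht hx'
    have d3 := (hζ.der (F.mm t x)).comp x (F.mm_der t x)
    have d4 := (hL.dP _ (F.ρpos (t, x))).comp x d1
    have d5 := ((d2.const_mul e).sub_const N).fun_mul ((d1.fun_mul d2).fun_mul d3)
    have d6 := ((d5.const_mul (χ t)).fun_neg).fun_sub ((d4.fun_mul d3).const_mul (e * χ t))
    refine d6.congr_deriv ?_
    have hr : F.rh t (F.mm t x) = F.ρ (t, x) := by rw [rh, X_mm]
    have hv : F.vh t (F.mm t x) = F.v (t, x) := by rw [vh, X_mm]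
    have hρ0 := (F.ρpos (t, x)).ne'
    simp only [hD, H, HH, tgt, tφx, qh, sh, F.dv_eq ht hm, F.dr_eq hm, X_mm, hr, hv, Function.comp]
    field_simp
    ring
  refine hb.trans ?_
  have z1 : ζ p = 0 := hζ.zero p fun h => absurd h.1 (not_le.2 hp')
  have z2 : ζ q = 0 := hζ.zero q fun h => absurd h.2 (not_le.2 hq')
  simp [mm_X, z1, z2]

end Fl

namespace Fl
variable {P μ : ℝ → ℝ} {Pe : ℝ} (F : Fl P μ Pe) {P' μ' : ℝ → ℝ}
variable {χ χ' ζ ζ' : ℝ → ℝ} {α β n α' β' p q p' q' e : ℝ}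

theorem HH_meas (hL : Law P μ P' μ') (hχ : Cut χ χ' α' β') (hζ : Cut ζ ζ' p' q') {N : ℝ → ℝ}
    (hN : Continuous N) : Measurable fun x : ℝ × ℝ => F.HH P' μ' χ χ' ζ ζ' e (N x.1) x.1 x.2 := by
  have h1 := F.qh_meas hL.cP' hL.cμ'
  have h2 := F.sh_meas hL.cP hL.cμ
  have h3 := F.vh_cont.measurable
  have z1 := hζ.cont.measurable
  have z2 := hζ.cont'.measurable
  have z3 := hχ.cont.measurable
  have z4 := hχ.cont'.measurable
  have z5 := hN.measurable
  exact ((z4.comp measurable_fst).mul ((((measurable_const (a := e)).mul h3).sub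
    (z5.comp measurable_fst)).mul
    (z1.comp measurable_snd))).sub ((((measurable_const (a := e))).mul (z3.comp measurable_fst)).mul
      ((h1.mul (z1.comp measurable_snd)).add (h2.mul (z2.comp measurable_snd))))

theorem HH_bd (hL : Law P μ P' μ') (hα : 0 < α) (hαβ : α ≤ β) (hE : ∀ t ∈ Icc α β, t ∈ F.E n)
    (hχ : Cut χ χ' α' β') (hζ : Cut ζ ζ' p' q') {N : ℝ → ℝ} (hN : Continuous N) :
    ∃ C, 0 ≤ C ∧ ∀ t ∈ Icc α β, ∀ m ∈ 𝕁, |F.HH P' μ' χ χ' ζ ζ' e (N t) t m| ≤ C := by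
  obtain ⟨c1, hc1, h1, h1'⟩ := hχ.bd
  obtain ⟨c2, hc2, h2, h2'⟩ := hζ.bd
  obtain ⟨M, hM0, hM⟩ := F.bddv α β
  obtain ⟨K, hK0, hK⟩ := F.qsBdd hL hα hαβ hE
  obtain ⟨L, hL'⟩ := (isCompact_Icc (a := α) (b := β)).exists_bound_of_continuousOn hN.continuousOn
  have hL0 : 0 ≤ L := (norm_nonneg _).trans (hL' α ⟨le_rfl, hαβ⟩)
  refine ⟨c1 * ((|e| * M + L) * c2) + |e| * c1 * (K * c2 + K * c2), by positivity, fun t ht m hm => ?_⟩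
  rw [HH]
  refine (abs_sub _ _).trans (add_le_add ?_ ?_)
  · rw [abs_mul, abs_mul]
    have : |e * F.vh t m - N t| ≤ |e| * M + L := by
      refine (abs_sub _ _).trans (add_le_add ?_ (hL' t ht))
      rw [abs_mul]; exact mll (hM t ht _) (abs_nonneg _)
    gcongr
    · exact h1' t
    · exact h2 m
  · rw [abs_mul, abs_mul]
    have : |F.qh P' μ' t m * ζ m + F.sh t m * ζ' m| ≤ K * c2 + K * c2 := by
      refine (abs_add_le _ _).trans (add_le_add ?_ ?_) <;> rw [abs_mul]
      · exact mul_le_mul (hK t ht m hm).1 (h2 m) (abs_nonneg _) hK0.le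
      · exact mul_le_mul (hK t ht m hm).2 (h2' m) (abs_nonneg _) hK0.le
    gcongr
    exact h1 t

theorem window (hL : Law P μ P' μ') (hα : 0 < α) (hαβ : α ≤ β) (hE : ∀ t ∈ Icc α β, t ∈ F.E n)
    (hp : 0 < p) (hpq : p < q) (hq : q < 1) (hp' : p < p') (hq' : q' < q) (hζ : Cut ζ ζ' p' q')
    (hα' : α < α') (hβ' : β' < β) (hχ : Cut χ χ' α' β') {G : ℝ → ℝ} (hG : Integrable G)
    (hqG : ∀ t ∈ Ioo α β, ∀ m ∈ Ioo p q, e * F.qh P' μ' t m ≤ G t) :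
    0 ≤ ∫ t in α..β, ∫ m in p..q, F.HH P' μ' χ χ' ζ ζ' e (∫ s in α..t, G s) t m := by
  have hN : Continuous fun t => ∫ s in α..t, G s :=
    intervalIntegral.continuous_primitive (fun _ _ => hG.intervalIntegrable) α
  set N : ℝ → ℝ := fun t => ∫ s in α..t, G s with hNd
  set cl : ℝ → ℝ := fun t => max α (min t β) with hcl
  have hclc : Continuous cl := by fun_prop
  have hclI : ∀ t, cl t ∈ Icc α β := fun t => ⟨le_max_left _ _, max_le hαβ (min_le_right _ _)⟩
  have hcle : ∀ t ∈ Icc α β, cl t = t := fun t ht => by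
    simp only [hcl]; rw [min_eq_left ht.2, max_eq_right ht.1]
  obtain ⟨M, hM0, hM⟩ := F.bddv α β
  obtain ⟨Nρ, hN0, hNρ⟩ := F.bddρ α β
  have hdB : ∀ x, 0 < x → HasDerivAt (fun x => x / μ x) ((1 * μ x - x * μ' x) / μ x ^ 2) x :=
    fun x hx => (hasDerivAt_id x).fun_div (hL.dμ x hx) (hL.μpos x hx).ne'
  have hcB : ContinuousOn (fun x => (1 * μ x - x * μ' x) / μ x ^ 2) (Ioi 0) := by
    have h1 := hL.cμ
    have h2 := hL.cμ'
    exact (ContinuousOn.sub (by fun_prop) (by fun_prop)).div (by fun_prop)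
      fun x hx => pow_ne_zero _ (hL.μpos x hx).ne'
  obtain ⟨K1, hK10, hK1⟩ := F.bddc hcB α β
  obtain ⟨C, hC0, hC⟩ := F.t_bd hL hα hE hζ (hp.trans hp') (hq'.trans hq) hχ hα' hβ'
  set K := {x : ℝ × ℝ | x.1 ∈ Icc α' β' ∧ F.mm x.1 x.2 ∈ Icc p' q'} with hK
  have hKc : IsCompact K := F.t_cpt α' β' p' q'
  set D := {x : ℝ × ℝ | x.1 ∈ Ioo α β ∧ F.mm x.1 x.2 ∈ Ioo p q} with hD
  have hDm : ∀ x ∈ D, x.2 ∈ Ioo (F.a x.1) (F.b x.1) := fun x hx =>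
    F.mem_of_mm ⟨hp.trans hx.2.1, hx.2.2.trans hq⟩
  have hDα : ∀ x ∈ D, 0 < x.1 := fun x hx => hα.trans hx.1.1
  have hcon : Continuous (fun x : ℝ × ℝ => F.ρ x / μ (F.ρ x)) :=
    F.hρ.div (F.comp_cont hL.cμ) fun x => (hL.μpos _ (F.ρpos x)).ne'
  have hφs : tsupport (F.tφ χ ζ) ⊆ K := by
    refine closure_minimal (fun x hx => ?_) hKc.isClosed
    by_contra h
    exact hx (F.tφ_zero (μ' := μ') hζ hχ x h).1
  have hgt := F.tgt_der hα hE hζ (hp.trans hp') (hq'.trans hq) hχ hα' hβ'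
  have hv := F.hv
  have hwc : Continuous fun x : ℝ × ℝ => e * F.v (cl x.1, x.2) := by fun_prop
  have hφc : Continuous (F.tφ χ ζ) :=
    (F.comp_cont hL.cμ).mul ((hχ.cont.comp continuous_fst).mul (hζ.cont.comp F.mm_cont))
  have main := SC1 (w := fun x => e * F.v (cl x.1, x.2)) (wx := fun x => e * F.vx x)
    (wxx := fun x => e * (F.ρ x / μ (F.ρ x) * (F.vt x -
      (-F.v x * F.vx x - P' (F.ρ x) * F.ρx x / F.ρ x + μ' (F.ρ x) * F.ρx x * F.vx x / F.ρ x))))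
    (wt := fun x => e * F.vt x) (B := fun x => F.ρ x / μ (F.ρ x))
    (Bt := fun x => (1 * μ (F.ρ x) - F.ρ x * μ' (F.ρ x)) / μ (F.ρ x) ^ 2 *
      (-(F.ρx x * F.v x + F.ρ x * F.vx x)))
    (φ := F.tφ χ ζ) (φx := F.tφx μ' χ ζ ζ') (gt := F.tgt χ χ' ζ ζ') (F := G) (D := D)
    (M := |e| * M) (L := |e| * n) (LB := K1 * (n * M + Nρ * n)) (C := C)
    (by
      have h1 : IsOpen {x : ℝ × ℝ | x.1 ∈ Ioo α β} := isOpen_Ioo.preimage continuous_fst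
      exact h1.inter (isOpen_Ioo.preimage F.mm_cont))
    (by
      intro t
      constructor
      rintro x ⟨hx1, hx2⟩ y ⟨hy1, hy2⟩ z hz
      exact ⟨hx1, hx2.1.trans_le ((F.mm_mono t).monotone hz.1),
        ((F.mm_mono t).monotone hz.2).trans_lt hy2.2⟩)
    hwc
    (fun x => by
      rw [abs_mul]; exact mll (hM _ (hclI _) _) (abs_nonneg _))
    (fun t x y => by
      rw [← mul_sub, abs_mul, mul_assoc]
      exact mll (hE _ (hclI _) _ _).1 (abs_nonneg _))
    (fun x hx => by
      simp only [hcle x.1 ⟨hx.1.1.le, hx.1.2.le⟩]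
      exact (F.hvx' (hDα x hx) (hDm x hx)).const_mul e)
    (fun x hx => (F.vxx hL (hDα x hx) (hDm x hx)).const_mul e)
    (fun x hx => by
      refine ((F.hvt x.1 (hDα x hx) x.2 (hDm x hx)).const_mul e).congr_of_eventuallyEq ?_
      filter_upwards [Ioo_mem_nhds hx.1.1 hx.1.2] with s hs
      simp only [hcle s ⟨hs.1.le, hs.2.le⟩])
    hG
    (fun x hx => by
      have h1 := hqG x.1 hx.1 _ hx.2
      rw [qh, F.dv_eq (hDα x hx) ⟨hp.trans hx.2.1, hx.2.2.trans hq⟩,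
        F.dr_eq ⟨hp.trans hx.2.1, hx.2.2.trans hq⟩, rh, vh, X_mm] at h1
      have h2 : 0 ≤ F.ρ x / μ (F.ρ x) := (div_pos (F.ρpos x) (hL.μpos _ (F.ρpos x))).le
      have h3 := mll h1 h2
      simp only [Prod.mk.eta] at h3 ⊢
      linarith)
    hcon
    (fun x _ => (div_pos (F.ρpos x) (hL.μpos _ (F.ρpos x))).le)
    (fun x hx => HasDerivAt.comp (h₂ := fun x => x / μ x) x.1 (hdB _ (F.ρpos (x.1, x.2)))
      (F.hρt' (hDα x hx) (hDm x hx)))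
    (fun x hx => by
      have hI : x.1 ∈ Icc α β := ⟨hx.1.1.le, hx.1.2.le⟩
      have hxI : x.2 ∈ Icc (F.a x.1) (F.b x.1) := ⟨(hDm x hx).1.le, (hDm x hx).2.le⟩
      rw [abs_mul]
      refine mul_le_mul (hK1 x.1 hI x.2) ?_ (abs_nonneg _) hK10.le
      rw [abs_neg]
      refine (abs_add_le _ _).trans (add_le_add ?_ ?_) <;> rw [abs_mul]
      · have h1 := F.ρx_le (hE _ hI) hxI
        exact mul_le_mul h1 (hM _ hI _) (abs_nonneg _) ((abs_nonneg _).trans h1)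
      · rw [abs_of_pos (F.ρpos x)]
        exact mul_le_mul (hNρ _ hI _) (F.vx_le (hDα x hx) (hE _ hI) hxI) (abs_nonneg _) hN0.le)
    hφc
    (fun x => mul_nonneg (hL.μpos _ (F.ρpos x)).le (mul_nonneg (hχ.nonneg _) (hζ.nonneg _)))
    (HasCompactSupport.of_support_subset_isCompact hKc (subset_closure.trans hφs))
    (hφs.trans fun x hx => ⟨⟨hα'.trans_le hx.1.1, hx.1.2.trans_lt hβ'⟩,
      ⟨hp'.trans_le hx.2.1, hx.2.2.trans_lt hq'⟩⟩)
    (fun x => F.tφx_der hL hζ (hp.trans hp') (hq'.trans hq) x)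
    (fun t => F.tφx_cont hL hζ (hp.trans hp') (hq'.trans hq) t)
    (fun x => (hC x).1)
    (fun x => by
      refine (hgt x).congr_of_eventuallyEq (Eventually.of_forall fun s => ?_)
      have := (hL.μpos _ (F.ρpos (s, x.2))).ne'
      simp only [tφ]
      field_simp)
    (fun x => (hC x).2) α
  have hgm : Measurable (F.tgt χ χ' ζ ζ') := by
    have h1 := measurable_deriv_with_param (𝕜 := ℝ) (α := ℝ)
      (f := fun x s => F.ρ (s, x) * (χ s * ζ (F.mm s x))) (by
        have h1 := F.hρ
        exact (h1.comp continuous_swap).mul ((hχ.cont.comp continuous_snd).mul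
          ((hζ.cont.comp F.mm_cont).comp continuous_swap)))
    have h2 : F.tgt χ χ' ζ ζ' = fun x : ℝ × ℝ => (fun x : ℝ × ℝ => deriv
      ((fun x s => F.ρ (s, x) * (χ s * ζ (F.mm s x))) x.1) x.2) (x.2, x.1) := by
      funext x; exact (hgt x).deriv.symm
    rw [h2]; exact h1.comp measurable_swap
  have hgi : Integrable (fun x : ℝ × ℝ => (e * F.v (cl x.1, x.2) - N x.1) * F.tgt χ χ' ζ ζ' x) := by
    rw [← integrableOn_iff_integrable_of_support_subset (s := K) fun x hx => by
      by_contra h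
      exact hx (by simp only [(F.tφ_zero (μ' := μ') hζ hχ x h).2.1, mul_zero])]
    have hc : Continuous fun x : ℝ × ℝ => e * F.v (cl x.1, x.2) - N x.1 := by fun_prop
    obtain ⟨C2, hC2⟩ := hKc.exists_bound_of_continuousOn hc.continuousOn
    refine Measure.integrableOn_of_bounded (M := C2 * C) hKc.measure_lt_top.ne
      (hc.measurable.mul hgm).aestronglyMeasurable ?_
    filter_upwards [ae_restrict_mem hKc.measurableSet] with x hx
    rw [norm_mul]
    exact mul_le_mul (hC2 x hx) (hC x).2 (abs_nonneg _) ((norm_nonneg _).trans (hC2 x hx))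
  rw [Measure.volume_eq_prod, integral_prod _ hgi] at main
  have hBi := hgi.integral_prod_left
  set H : ℝ → ℝ := fun t => ∫ m in p..q, F.HH P' μ' χ χ' ζ ζ' e (N t) t m with hHd
  have hsup : Function.support H ⊆ Ioc α β := fun t ht => by
    by_contra h
    have h' : t ∉ Icc α' β' := fun h' => h ⟨hα'.trans_le h'.1, (h'.2.trans_lt hβ').le⟩
    exact ht (by simp [hHd, HH, hχ.zero _ h', hχ.zero' _ h'])
  have hHi : Integrable H := by
    rw [← integrableOn_iff_integrable_of_support_subset hsup]
    obtain ⟨C3, hC30, hC3⟩ := F.HH_bd (e := e) hL hα hαβ hE hχ hζ hN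
    have hm : StronglyMeasurable H := by
      have := (F.HH_meas (e := e) hL hχ hζ hN).stronglyMeasurable.integral_prod_right'
        (ν := volume.restrict (Ioc p q))
      convert this using 1
      funext t
      simp only [hHd]
      rw [intervalIntegral.integral_of_le hpq.le]
    refine Measure.integrableOn_of_bounded (M := C3 * |q - p|) (by simp) hm.aestronglyMeasurable ?_
    filter_upwards [ae_restrict_mem measurableSet_Ioc] with t ht
    refine iNorm fun m hm => ?_
    rw [uIoc_of_le hpq.le] at hm
    exact hC3 t ⟨ht.1.le, ht.2⟩ m ⟨hp.trans hm.1, hm.2.trans_lt hq⟩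
  have hA : ∀ t, ∫ x, e * F.vx (t, x) * F.tφx μ' χ ζ ζ' (t, x) =
      (∫ x, (e * F.v (cl t, x) - N t) * F.tgt χ χ' ζ ζ' (t, x)) - H t := by
    intro t
    by_cases ht : t ∈ Ioo α β
    · have := F.perT (χ := χ) (χ' := χ') (e := e) hL hζ hp hpq hq hp' hq' (hα.trans ht.1) (N t)
      rw [hcle t ⟨ht.1.le, ht.2.le⟩]
      simp only [hHd]
      linarith
    · have h' : t ∉ Icc α' β' := fun h' => ht ⟨hα'.trans_le h'.1, h'.2.trans_lt hβ'⟩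
      simp [hHd, HH, hχ.zero _ h', hχ.zero' _ h', tφx, tgt]
  simp only [hA] at main
  rw [integral_sub (by exact hBi) hHi] at main
  rw [intervalIntegral.integral_eq_integral_of_support_subset hsup]
  linarith

end Fl

theorem bumpCut {ε p q : ℝ} (hε : 0 < ε) (hpq : p ≤ q) : Cut (bump ε p q) (bump' ε p q) p (q + ε) :=
  ⟨bump_der ε p q, bump'_cont ε p q, bump_nonneg hε hpq, fun _ h => bump_zero hε hpq h⟩

namespace Fl
variable {P μ : ℝ → ℝ} {Pe : ℝ} (F : Fl P μ Pe) {P' μ' : ℝ → ℝ}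
variable {χ χ' ζ ζ' : ℝ → ℝ} {α β n α' β' p q p' q' e : ℝ}

theorem innerInt {h : ℝ → ℝ → ℝ} (hpq : p ≤ q) {C : ℝ} (hαβ : α ≤ β)
    (hm : Measurable fun x : ℝ × ℝ => h x.1 x.2)
    (hC : ∀ t ∈ Icc α β, ∀ m ∈ Ioc p q, |h t m| ≤ C) :
    IntervalIntegrable (fun t => ∫ m in p..q, h t m) volume α β := by
  have hm' : StronglyMeasurable fun t => ∫ m in p..q, h t m := by
    have := hm.stronglyMeasurable.integral_prod_right' (ν := volume.restrict (Ioc p q))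
    convert this using 1
    funext t
    rw [intervalIntegral.integral_of_le hpq]
  rw [intervalIntegrable_iff_integrableOn_Ioc_of_le hαβ]
  refine Measure.integrableOn_of_bounded (M := C * |q - p|) (by simp) hm'.aestronglyMeasurable ?_
  filter_upwards [ae_restrict_mem measurableSet_Ioc] with t ht
  refine iNorm fun m hm => ?_
  rw [uIoc_of_le hpq] at hm
  exact hC t ⟨ht.1.le, ht.2⟩ m hm

theorem qs_int (hL : Law P μ P' μ') (hα : 0 < α) (hαβ : α ≤ β) (hE : ∀ t ∈ Icc α β, t ∈ F.E n)
    (hp : 0 < p) (hpq : p < q) (hq : q < 1) (hζ : Continuous ζ) (hζb : ∃ C, ∀ t, |ζ t| ≤ C) :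
    IntervalIntegrable (fun t => ∫ m in p..q, F.qh P' μ' t m * ζ m) volume α β ∧
    IntervalIntegrable (fun t => ∫ m in p..q, F.sh t m * ζ m) volume α β := by
  obtain ⟨K, hK0, hK⟩ := F.qsBdd hL hα hαβ hE
  obtain ⟨C, hC⟩ := hζb
  have key : ∀ x z, |x| ≤ K → |ζ z| ≤ C → |x * ζ z| ≤ K * C := fun x z h1 h2 => by
    rw [abs_mul]; exact mul_le_mul h1 h2 (abs_nonneg _) hK0.le
  exact ⟨innerInt hpq.le hαβ ((F.qh_meas hL.cP' hL.cμ').mul (hζ.measurable.comp measurable_snd))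
    fun t ht m hm => key _ _ (hK t ht m ⟨hp.trans hm.1, hm.2.trans_lt hq⟩).1 (hC m),
    innerInt hpq.le hαβ ((F.sh_meas hL.cP hL.cμ).mul (hζ.measurable.comp measurable_snd))
    fun t ht m hm => key _ _ (hK t ht m ⟨hp.trans hm.1, hm.2.trans_lt hq⟩).2 (hC m)⟩

theorem epsLim (hL : Law P μ P' μ') (hα : 0 < α) (hE : ∀ t ∈ Icc α β, t ∈ F.E n)
    (hp : 0 < p) (hpq : p < q) (hq : q < 1) (hp' : p < p') (hq' : q' < q) (hζ : Cut ζ ζ' p' q')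
    {G : ℝ → ℝ} (hG : Integrable G)
    (hqG : ∀ t ∈ Ioo α β, ∀ m ∈ Ioo p q, e * F.qh P' μ' t m ≤ G t)
    {s t : ℝ} (hs : α < s) (hst : s ≤ t) (ht : t < β) :
    0 ≤ (∫ m in p..q, (e * F.vh s m - ∫ x in α..s, G x) * ζ m) -
      (∫ m in p..q, (e * F.vh t m - ∫ x in α..t, G x) * ζ m) -
      e * ((∫ τ in s..t, ∫ m in p..q, F.qh P' μ' τ m * ζ m) +
        ∫ τ in s..t, ∫ m in p..q, F.sh τ m * ζ' m) := by
  have hαβ : α ≤ β := (hs.le.trans hst).trans ht.le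
  have hN : Continuous fun t => ∫ s in α..t, G s :=
    intervalIntegral.continuous_primitive (fun _ _ => hG.intervalIntegrable) α
  set N : ℝ → ℝ := fun t => ∫ s in α..t, G s with hNd
  set A : ℝ → ℝ := fun τ => ∫ m in p..q, (e * F.vh τ m - N τ) * ζ m with hA
  have hvc := F.vh_cont
  have hζc := hζ.cont
  have hAc : Continuous A := by
    refine intervalIntegral.continuous_parametric_intervalIntegral_of_continuous' (by fun_prop) p q
  obtain ⟨c2, hc2, h2, h2'⟩ := hζ.bd
  have i1 := (F.qs_int hL hα hαβ hE hp hpq hq hζ.cont ⟨c2, h2⟩).1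
  have i2 := (F.qs_int hL hα hαβ hE hp hpq hq hζ.cont' ⟨c2, h2'⟩).2
  have i12 : IntervalIntegrable (fun t => (∫ m in p..q, F.qh P' μ' t m * ζ m) +
    ∫ m in p..q, F.sh t m * ζ' m) volume α β := i1.add i2
  set B : ℝ → ℝ := fun t => (∫ m in p..q, F.qh P' μ' t m * ζ m) + ∫ m in p..q, F.sh t m * ζ' m
    with hB
  have hlim := (bumpLim hAc.continuousOn (A := α) (B := β) (p := s) (q := t) ⟨hs.le, hst.trans_lt ht⟩
    ⟨hs.le.trans hst, ht⟩).sub ((bumpInt hs.le hst ht.le i12).const_mul e)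
  have hsub : uIcc s t ⊆ uIcc α β := by
    rw [uIcc_of_le hst, uIcc_of_le hαβ]; exact Icc_subset_Icc hs.le ht.le
  have hBs : ∫ τ in s..t, B τ = (∫ τ in s..t, ∫ m in p..q, F.qh P' μ' τ m * ζ m) +
        ∫ τ in s..t, ∫ m in p..q, F.sh τ m * ζ' m :=
    iAdd (i1.mono_set hsub) (i2.mono_set hsub)
  rw [← hBs]
  refine ge_of_tendsto hlim ?_
  filter_upwards [self_mem_nhdsWithin, nhdsWithin_le_nhds (Iio_mem_nhds (sub_pos.2 ht))] with ε h1 h2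
  have h1 : 0 < ε := h1
  have h2 : ε < β - t := h2
  have hw := F.window hL hα hαβ hE hp hpq hq hp' hq' hζ hs (by linarith) (bumpCut h1 hst) hG hqG
  refine hw.trans_eq ?_
  have e1 : ∀ τ ∈ uIcc α β, ∫ m in p..q, F.HH P' μ' (bump ε s t) (bump' ε s t) ζ ζ' e (N τ) τ m =
      A τ * bump' ε s t τ - e * (B τ * bump ε s t τ) := by
    intro τ hτ
    rw [uIcc_of_le hαβ] at hτ
    have h0 : 0 < τ := hα.trans_le hτ.1
    have hI : uIcc p q ⊆ Ioo 0 1 := by rw [uIcc_of_le hpq.le]; exact Icc_subset_Ioo hp hq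
    have c1 : ContinuousOn (fun m => F.qh P' μ' τ m * ζ m) (uIcc p q) :=
      ((F.qh_cont hL h0).mono hI).mul hζ.cont.continuousOn
    have c2 : ContinuousOn (fun m => F.sh τ m * ζ' m) (uIcc p q) :=
      ((F.sh_cont hL h0).mono hI).mul hζ.cont'.continuousOn
    have c3 : Continuous fun m => (e * F.vh τ m - N τ) * ζ m := by fun_prop
    have c12 : ContinuousOn (fun m => F.qh P' μ' τ m * ζ m + F.sh τ m * ζ' m) (uIcc p q) := c1.add c2
    simp only [HH]
    rw [iSub (by exact ((c3.intervalIntegrable p q).const_mul _))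
      (by exact (c12.intervalIntegrable.const_mul _)), iCM,
      iCM,
      iAdd c1.intervalIntegrable c2.intervalIntegrable]
    simp only [hA, hB]
    ring
  rw [iCong e1, iSub, iCM]
  · exact (hAc.mul (bump'_cont ε s t)).intervalIntegrable _ _
  · exact (i12.mul_continuousOn (bump_cont ε s t).continuousOn).const_mul e

end Fl

namespace Fl
variable {P μ : ℝ → ℝ} {Pe : ℝ} (F : Fl P μ Pe) {P' μ' : ℝ → ℝ}
variable {χ χ' ζ ζ' : ℝ → ℝ} {α β n α' β' p q p' q' e : ℝ}

theorem qs_pt (hL : Law P μ P' μ') (hα : 0 < α) (hαβ : α ≤ β) (hE : ∀ t ∈ Icc α β, t ∈ F.E n)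
    {m : ℝ} (hm : m ∈ 𝕁) : IntervalIntegrable (fun τ => F.qh P' μ' τ m) volume α β ∧
    IntervalIntegrable (fun τ => F.sh τ m) volume α β := by
  obtain ⟨K, hK0, hK⟩ := F.qsBdd hL hα hαβ hE
  have h1 : Measurable fun τ => F.qh P' μ' τ m := (F.qh_meas hL.cP' hL.cμ').comp measurable_prodMk_right
  have h2 : Measurable fun τ => F.sh τ m := (F.sh_meas hL.cP hL.cμ).comp measurable_prodMk_right
  simp only [intervalIntegrable_iff_integrableOn_Ioc_of_le hαβ]
  constructor
  · refine Measure.integrableOn_of_bounded (M := K) (by simp) h1.aestronglyMeasurable ?_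
    filter_upwards [ae_restrict_mem measurableSet_Ioc] with t ht using (hK t ⟨ht.1.le, ht.2⟩ m hm).1
  · refine Measure.integrableOn_of_bounded (M := K) (by simp) h2.aestronglyMeasurable ?_
    filter_upwards [ae_restrict_mem measurableSet_Ioc] with t ht using (hK t ⟨ht.1.le, ht.2⟩ m hm).2

theorem win3 (hL : Law P μ P' μ') (hα : 0 < α) (hE : ∀ t ∈ Icc α β, t ∈ F.E n)
    (hp : 0 < p) (hpq : p < q) (hq : q < 1) (hp' : p < p') (hq' : q' < q) (hζ : Cut ζ ζ' p' q')
    (he : |e| ≤ 1) {Ω : ℝ → ℝ} (hΩ : IntervalIntegrable Ω volume α β) {m0 : ℝ} (hm0 : m0 ∈ Ioo p q)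
    (hqΩ : ∀ t ∈ Ioo α β, ∀ m ∈ Ioo p q, |F.qh P' μ' t m - F.qh P' μ' t m0| ≤ Ω t)
    {s t : ℝ} (hs : α < s) (hst : s ≤ t) (ht : t < β) :
    e * ((∫ m in p..q, (F.vh t m - F.vh s m) * ζ m) + ∫ τ in s..t, ∫ m in p..q, F.sh τ m * ζ' m) ≤
      (2 * ∫ τ in s..t, Ω τ) * ∫ m in p..q, ζ m := by
  have hαβ : α ≤ β := (hs.le.trans hst).trans ht.le
  have hI01 : Ioo p q ⊆ Ioo 0 1 := Ioo_subset_Ioo hp.le hq.le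
  have iq := (F.qs_pt hL hα hαβ hE (hI01 hm0)).1
  set g : ℝ → ℝ := fun τ => e * F.qh P' μ' τ m0 + Ω τ with hg
  have ig : IntervalIntegrable g volume α β := (iq.const_mul e).add hΩ
  have heb : ∀ x y z, |x - y| ≤ z → e * (x - y) ≤ z := fun x y z h => by
    refine (le_abs_self _).trans ?_
    rw [abs_mul]
    exact (mul_le_of_le_one_left (abs_nonneg _) he).trans h
  have key := F.epsLim (e := e) hL hα hE hp hpq hq hp' hq' hζ (G := (Ioc α β).indicator g)
    ((integrable_indicator_iff measurableSet_Ioc).2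
      ((intervalIntegrable_iff_integrableOn_Ioc_of_le hαβ).1 ig))
    (fun τ hτ m hm => by
      rw [indicator_of_mem (show τ ∈ Ioc α β from ⟨hτ.1, hτ.2.le⟩)]
      have := heb _ _ _ (hqΩ τ hτ m hm)
      simp only [hg]; linarith) hs hst ht
  have hN : ∀ x ∈ Icc α β, ∫ y in α..x, (Ioc α β).indicator g y = ∫ y in α..x, g y := fun x hx => by
    refine intervalIntegral.integral_congr_ae (Eventually.of_forall fun y hy => ?_)
    rw [uIoc_of_le hx.1] at hy
    exact indicator_of_mem (show y ∈ Ioc α β from ⟨hy.1, hy.2.trans hx.2⟩) g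
  rw [hN s ⟨hs.le, hst.trans ht.le⟩, hN t ⟨hs.le.trans hst, ht.le⟩] at key
  have hvc := F.vh_cont
  have hζc := hζ.cont
  have iζ : IntervalIntegrable ζ volume p q := hζc.intervalIntegrable _ _
  have ivs : ∀ s, IntervalIntegrable (fun m => F.vh s m * ζ m) volume p q := fun s =>
    Continuous.intervalIntegrable (by fun_prop) _ _
  have e1 : ∀ s c, ∫ m in p..q, (e * F.vh s m - c) * ζ m =
      e * (∫ m in p..q, F.vh s m * ζ m) - c * ∫ m in p..q, ζ m := fun s c => by
    rw [← iCM, ← iCM,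
      ← iSub ((ivs s).const_mul e) (iζ.const_mul c)]
    congr 1; funext m; ring
  have e2 : ∫ m in p..q, (F.vh t m - F.vh s m) * ζ m =
      (∫ m in p..q, F.vh t m * ζ m) - ∫ m in p..q, F.vh s m * ζ m := by
    rw [← iSub (ivs t) (ivs s)]
    congr 1; funext m; ring
  rw [e1, e1] at key
  have hsub : uIcc s t ⊆ uIcc α β := by
    rw [uIcc_of_le hst, uIcc_of_le hαβ]; exact Icc_subset_Icc hs.le ht.le
  have hsub1 : uIcc α s ⊆ uIcc α β := by
    rw [uIcc_of_le hs.le, uIcc_of_le hαβ]; exact Icc_subset_Icc le_rfl (hst.trans ht.le)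
  have hNd : (∫ y in α..s, g y) + ∫ y in s..t, g y = ∫ y in α..t, g y :=
    iAdj (ig.mono_set hsub1) (ig.mono_set hsub)
  obtain ⟨c2, hc2, h2, h2'⟩ := hζ.bd
  have i1 := ((F.qs_int hL hα hαβ hE hp hpq hq hζ.cont ⟨c2, h2⟩).1).mono_set hsub
  have igs := ig.mono_set hsub
  have iΩs := hΩ.mono_set hsub
  have hle : (∫ y in s..t, g y) * (∫ m in p..q, ζ m) -
      e * (∫ τ in s..t, ∫ m in p..q, F.qh P' μ' τ m * ζ m) ≤ (2 * ∫ τ in s..t, Ω τ) * ∫ m in p..q, ζ m := by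
    rw [← iMC, ← iCM e,
      ← iCM 2, ← iMC,
      ← iSub (igs.mul_const _) (i1.const_mul e)]
    refine intervalIntegral.integral_mono_on hst ((igs.mul_const _).sub (i1.const_mul e))
      ((iΩs.const_mul 2).mul_const _) fun τ hτ => ?_
    have hτ0 : τ ∈ Ioo α β := ⟨hs.trans_le hτ.1, hτ.2.trans_lt ht⟩
    have hI : uIcc p q ⊆ Ioo 0 1 := by rw [uIcc_of_le hpq.le]; exact Icc_subset_Ioo hp hq
    have c1 : ContinuousOn (fun m => F.qh P' μ' τ m * ζ m) (uIcc p q) :=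
      ((F.qh_cont hL (hα.trans hτ0.1)).mono hI).mul hζ.cont.continuousOn
    have ic1 := c1.intervalIntegrable (μ := volume)
    rw [← iCM, ← iCM,
      ← iCM, ← iSub (iζ.const_mul _) (ic1.const_mul e)]
    refine intervalIntegral.integral_mono_on_of_le_Ioo hpq.le
      ((iζ.const_mul _).sub (ic1.const_mul e)) (iζ.const_mul _) fun m hm => ?_
    have h3 := hqΩ τ hτ0 m hm
    rw [abs_sub_comm] at h3
    have h4 := mlr (heb _ _ _ h3) (hζ.nonneg m)
    simp only [hg]
    linarith
  rw [← hNd] at key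
  rw [e2]
  linarith

theorem win4 (hL : Law P μ P' μ') (hα : 0 < α) (hE : ∀ t ∈ Icc α β, t ∈ F.E n)
    (hp : 0 < p) (hpq : p < q) (hq : q < 1)
    {Ω : ℝ → ℝ} (hΩ : IntervalIntegrable Ω volume α β) {m0 : ℝ} (hm0 : m0 ∈ Ioo p q)
    (hqΩ : ∀ t ∈ Ioo α β, ∀ m ∈ Ioo p q, |F.qh P' μ' t m - F.qh P' μ' t m0| ≤ Ω t)
    {s t : ℝ} (hs : α < s) (hst : s ≤ t) (ht : t < β) {m1 m2 : ℝ} (h1 : p < m1) (h12 : m1 ≤ m2)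
    (h2 : m2 < q) :
    |(∫ m in m1..m2, (F.vh t m - F.vh s m)) + ∫ τ in s..t, (F.sh τ m1 - F.sh τ m2)| ≤
      (2 * ∫ τ in s..t, Ω τ) * (m2 - m1) := by
  have hαβ : α ≤ β := (hs.le.trans hst).trans ht.le
  have hvc := F.vh_cont
  have l1 := bumpInt h1.le h12 h2.le (g := fun m => F.vh t m - F.vh s m)
    (Continuous.intervalIntegrable (by fun_prop) p q)
  have l2 := bumpInt h1.le h12 h2.le (g := fun _ => (1:ℝ)) (Continuous.intervalIntegrable (by fun_prop) p q)
  simp only [one_mul, iConst, smul_eq_mul, mul_one] at l2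
  obtain ⟨K, hK0, hK⟩ := F.qsBdd hL hα hαβ hE
  have hI : Icc p q ⊆ Ioo 0 1 := Icc_subset_Ioo hp hq
  have l3 : Tendsto (fun δ => ∫ τ in s..t, ∫ m in p..q, F.sh τ m * bump' δ m1 m2 m) (𝓝[>] 0)
      (𝓝 (∫ τ in s..t, (F.sh τ m1 - F.sh τ m2))) := by
    refine intervalIntegral.tendsto_integral_filter_of_dominated_convergence (fun _ => 2 * K) ?_ ?_
      (by simp) ?_
    · refine Eventually.of_forall fun δ => ?_
      have := ((F.sh_meas hL.cP hL.cμ).mul ((bump'_cont δ m1 m2).measurable.comp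
        measurable_snd)).stronglyMeasurable.integral_prod_right' (ν := volume.restrict (Ioc p q))
      simp only [intervalIntegral.integral_of_le hpq.le]
      exact this.aestronglyMeasurable
    · filter_upwards [self_mem_nhdsWithin] with δ hδ
      refine Eventually.of_forall fun τ hτ => ?_
      rw [uIoc_of_le hst] at hτ
      have hτ0 : τ ∈ Icc α β := ⟨(hs.trans hτ.1).le, hτ.2.trans ht.le⟩
      exact bumpInt_le hδ hpq.le ((F.sh_cont hL (hα.trans_le hτ0.1)).mono hI)
        fun m hm => (hK τ hτ0 m (hI hm)).2
    · refine Eventually.of_forall fun τ hτ => ?_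
      rw [uIoc_of_le hst] at hτ
      exact bumpLim ((F.sh_cont hL (hα.trans (hs.trans hτ.1))).mono hI) ⟨h1.le, h12.trans_lt h2⟩
        ⟨h1.le.trans h12, h2⟩
  have key : ∀ e : ℝ, |e| ≤ 1 → e * ((∫ m in m1..m2, (F.vh t m - F.vh s m)) +
      ∫ τ in s..t, (F.sh τ m1 - F.sh τ m2)) ≤ (2 * ∫ τ in s..t, Ω τ) * (m2 - m1) := fun e he => by
    refine le_of_tendsto_of_tendsto ((l1.add l3).const_mul e) (l2.const_mul _) ?_
    filter_upwards [self_mem_nhdsWithin, nhdsWithin_le_nhds (Iio_mem_nhds (sub_pos.2 h2))] with δ hδ hδ2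
    have hδ2 : δ < q - m2 := hδ2
    exact F.win3 hL hα hE hp hpq hq h1 (by linarith) (bumpCut hδ h12) he hΩ hm0 hqΩ hs hst ht
  rw [abs_le]
  have k1 := key 1 (by simp)
  have k2 := key (-1) (by simp)
  constructor <;> linarith

end Fl

namespace Fl
variable {P μ : ℝ → ℝ} {Pe : ℝ} (F : Fl P μ Pe) {P' μ' : ℝ → ℝ}
variable {α β n : ℝ}

theorem momI (hL : Law P μ P' μ') (hα : 0 < α) (hE : ∀ t ∈ Icc α β, t ∈ F.E n)
    {s t : ℝ} (hs : α < s) (hst : s ≤ t) (ht : t < β) {m1 m2 : ℝ} (h1 : 0 < m1) (h12 : m1 ≤ m2)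
    (h2 : m2 < 1) :
    ∫ m in m1..m2, (F.vh t m - F.vh s m) = ∫ τ in s..t, (F.sh τ m2 - F.sh τ m1) := by
  have hαβ : α ≤ β := (hs.le.trans hst).trans ht.le
  have hvc := F.vh_cont
  have hsub : uIcc s t ⊆ uIcc α β := by
    rw [uIcc_of_le hst, uIcc_of_le hαβ]; exact Icc_subset_Icc hs.le ht.le
  have ish : ∀ m ∈ 𝕁, IntervalIntegrable (fun τ => F.sh τ m) volume s t := fun m hm =>
    (F.qs_pt hL hα hαβ hE hm).2.mono_set hsub
  have iv : ∀ x y, IntervalIntegrable (fun m => F.vh t m - F.vh s m) volume x y := fun x y =>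
    Continuous.intervalIntegrable (by fun_prop) _ _
  set Φ : ℝ → ℝ := fun m => (∫ x in (1/2:ℝ)..m, (F.vh t x - F.vh s x)) - ∫ τ in s..t, F.sh τ m with hΦ
  have hΦd : ∀ x ∈ 𝕁, ∀ y ∈ 𝕁, Φ y - Φ x =
      (∫ m in x..y, (F.vh t m - F.vh s m)) + ∫ τ in s..t, (F.sh τ x - F.sh τ y) := by
    intro x hx y hy
    rw [iSub (ish x hx) (ish y hy),
      ← iISL (iv (1/2) y) (iv (1/2) x)]
    simp only [hΦ]; ring
  obtain ⟨K, hK0, hK⟩ := F.qsBdd hL hα hαβ hE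
  have hder : ∀ m0 ∈ 𝕁, HasDerivAt Φ 0 m0 := by
    intro m0 hm0
    set Ω : ℝ → ℝ → ℝ := fun δ τ => ⨆ r : {r : ℚ // (r:ℝ) ∈ Ioo (m0 - δ) (m0 + δ)},
      |F.qh P' μ' τ (r.1:ℝ) - F.qh P' μ' τ m0| with hΩd
    have hmeas : ∀ δ, Measurable (Ω δ) := fun δ => by
      refine Measurable.iSup fun r => ?_
      have : ∀ m, Measurable fun τ => F.qh P' μ' τ m := fun m =>
        (F.qh_meas hL.cP' hL.cμ').comp measurable_prodMk_right
      exact continuous_abs.measurable.comp ((this _).sub (this _))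
    have hd : 0 < min m0 (1 - m0) := lt_min hm0.1 (sub_pos.2 hm0.2)
    have hwin : ∀ δ, δ < min m0 (1 - m0) → Ioo (m0 - δ) (m0 + δ) ⊆ Ioo 0 1 := fun δ hδ =>
      Ioo_subset_Ioo (by have := hδ.trans_le (min_le_left _ _); linarith)
        (by have := hδ.trans_le (min_le_right _ _); linarith)
    have hΩ0 : ∀ δ τ, 0 ≤ Ω δ τ := fun δ τ => Real.iSup_nonneg fun _ => abs_nonneg _
    have hbd : ∀ δ, δ < min m0 (1 - m0) → ∀ τ ∈ Icc α β, ∀ m ∈ Ioo (m0 - δ) (m0 + δ),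
        |F.qh P' μ' τ m - F.qh P' μ' τ m0| ≤ 2 * K := fun δ hδ τ hτ m hm => by
      have k1 := (hK τ hτ m (hwin δ hδ hm)).1
      have k2 := (hK τ hτ m0 hm0).1
      have := abs_sub (F.qh P' μ' τ m) (F.qh P' μ' τ m0)
      linarith
    have hΩK : ∀ δ, δ < min m0 (1 - m0) → ∀ τ ∈ Icc α β, Ω δ τ ≤ 2 * K := fun δ hδ τ hτ =>
      Real.iSup_le (fun r => hbd δ hδ τ hτ _ r.2) (by positivity)
    have hi : ∀ δ, δ < min m0 (1 - m0) → IntervalIntegrable (Ω δ) volume α β := fun δ hδ => by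
      rw [intervalIntegrable_iff_integrableOn_Ioc_of_le hαβ]
      refine Measure.integrableOn_of_bounded (M := 2 * K) (by simp) (hmeas δ).aestronglyMeasurable ?_
      filter_upwards [ae_restrict_mem measurableSet_Ioc] with τ hτ
      rw [Real.norm_of_nonneg (hΩ0 _ _)]
      exact hΩK δ hδ τ ⟨hτ.1.le, hτ.2⟩
    have hqΩ : ∀ δ, δ < min m0 (1 - m0) → ∀ τ ∈ Ioo α β, ∀ m ∈ Ioo (m0 - δ) (m0 + δ),
        |F.qh P' μ' τ m - F.qh P' μ' τ m0| ≤ Ω δ τ := by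
      intro δ hδ τ hτ m hm
      by_contra hcon
      push Not at hcon
      have c1 : ContinuousAt (fun m => |F.qh P' μ' τ m - F.qh P' μ' τ m0|) m :=
        (((F.qh_cont hL (hα.trans hτ.1)).continuousAt
          (Ioo_mem_nhds (hwin δ hδ hm).1 (hwin δ hδ hm).2)).sub continuousAt_const).abs
      have c2 := (c1.eventually (lt_mem_nhds hcon)).and (Ioo_mem_nhds hm.1 hm.2)
      obtain ⟨l, u, hlu, hsubI⟩ := mem_nhds_iff_exists_Ioo_subset.1 c2
      obtain ⟨r, hr1, hr2⟩ := exists_rat_btwn (hlu.1.trans hlu.2)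
      obtain ⟨k1, k2⟩ := hsubI ⟨hr1, hr2⟩
      refine absurd (le_ciSup (f := fun r : {r : ℚ // (r:ℝ) ∈ Ioo (m0 - δ) (m0 + δ)} =>
        |F.qh P' μ' τ (r.1:ℝ) - F.qh P' μ' τ m0|) ⟨2 * K, ?_⟩ ⟨r, k2⟩) (not_le.2 k1)
      rintro _ ⟨r, rfl⟩
      exact hbd δ hδ τ ⟨hτ.1.le, hτ.2.le⟩ _ r.2
    have hlim : Tendsto (fun δ => ∫ τ in s..t, Ω δ τ) (𝓝[>] 0) (𝓝 (∫ τ in s..t, (0:ℝ))) := by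
      refine intervalIntegral.tendsto_integral_filter_of_dominated_convergence (fun _ => 2 * K)
        (Eventually.of_forall fun δ => (hmeas δ).aestronglyMeasurable) ?_ (by simp) ?_
      · filter_upwards [nhdsWithin_le_nhds (Iio_mem_nhds hd)] with δ hδ
        refine Eventually.of_forall fun τ hτ => ?_
        rw [uIoc_of_le hst] at hτ
        rw [Real.norm_of_nonneg (hΩ0 _ _)]
        exact hΩK δ hδ τ ⟨(hs.trans hτ.1).le, hτ.2.trans ht.le⟩
      · refine Eventually.of_forall fun τ hτ => ?_
        rw [uIoc_of_le hst] at hτ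
        have c1 : ContinuousAt (F.qh P' μ' τ) m0 := (F.qh_cont hL (hα.trans (hs.trans hτ.1))).continuousAt
          (Ioo_mem_nhds hm0.1 hm0.2)
        rw [Metric.tendsto_nhds]
        intro ε hε
        obtain ⟨d, hd0, hdm⟩ := Metric.continuousAt_iff.1 c1 (ε / 2) (by positivity)
        filter_upwards [nhdsWithin_le_nhds (Iio_mem_nhds hd0)] with δ hδ
        rw [dist_zero_right, Real.norm_of_nonneg (hΩ0 _ _)]
        refine lt_of_le_of_lt (Real.iSup_le (fun r => ?_) (by positivity : 0 ≤ ε / 2)) (by linarith)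
        have hr := r.2
        have := hdm (x := (r.1:ℝ)) (by
          rw [Real.dist_eq, abs_lt]; have hδ : δ < d := hδ
          constructor <;> linarith [hr.1, hr.2])
        rw [Real.dist_eq] at this; exact this.le
    rw [intervalIntegral.integral_zero] at hlim
    rw [hasDerivAt_iff_isLittleO, Asymptotics.isLittleO_iff]
    intro c hc
    have ev1 : ∀ᶠ δ in 𝓝[>] (0:ℝ), 0 < δ := self_mem_nhdsWithin
    have ev2 : ∀ᶠ δ in 𝓝[>] (0:ℝ), δ < min m0 (1 - m0) := nhdsWithin_le_nhds (Iio_mem_nhds hd)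
    obtain ⟨δ, hδI, hδ0, hδ⟩ := ((hlim.eventually (gt_mem_nhds (show (0:ℝ) < c / 2 by positivity))).and
      (ev1.and ev2)).exists
    have w1 := hwin δ hδ
    filter_upwards [Ioo_mem_nhds (show m0 - δ / 2 < m0 by linarith) (show m0 < m0 + δ / 2 by linarith)]
      with y hy
    have hd2 : δ / 2 < min m0 (1 - m0) := by linarith
    have hp0 : 0 < m0 - δ := by have := hδ.trans_le (min_le_left m0 (1 - m0)); linarith
    have hq1 : m0 + δ < 1 := by have := hδ.trans_le (min_le_right m0 (1 - m0)); linarith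
    have W : ∀ x y, m0 - δ < x → x ≤ y → y < m0 + δ → |Φ y - Φ x| ≤ c * (y - x) := by
      intro x y hx hxy hy
      have := F.win4 hL hα hE hp0 (by linarith) hq1 (hi δ hδ) (m0 := m0) ⟨by linarith, by linarith⟩
        (hqΩ δ hδ) hs hst ht hx hxy hy
      rw [← hΦd x (w1 ⟨hx, hxy.trans_lt hy⟩) y (w1 ⟨hx.trans_le hxy, hy⟩)] at this
      exact this.trans (mlr (by linarith) (sub_nonneg.2 hxy))
    simp only [smul_zero, sub_zero, Real.norm_eq_abs]
    rcases le_total m0 y with h | h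
    · rw [abs_of_nonneg (sub_nonneg.2 h)]
      exact W m0 y (by linarith) h (by linarith [hy.2])
    · rw [abs_sub_comm, abs_sub_comm y, abs_of_nonneg (sub_nonneg.2 h)]
      exact W y m0 (by linarith [hy.1]) h (by linarith)
  have hconst : Φ m2 = Φ m1 := by
    refine constant_of_has_deriv_right_zero (a := m1) (b := m2) (fun x hx => ?_) (fun x hx => ?_) m2 ⟨h12, le_rfl⟩
    · exact (hder x ⟨h1.trans_le hx.1, hx.2.trans_lt h2⟩).continuousAt.continuousWithinAt
    · exact (hder x ⟨h1.trans_le hx.1, hx.2.trans h2⟩).hasDerivWithinAt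
  have := hΦd m1 ⟨h1, h12.trans_lt h2⟩ m2 ⟨h1.trans_le h12, h2⟩
  rw [hconst, sub_self, iSub (ish _ ⟨h1, h12.trans_lt h2⟩) (ish _ ⟨h1.trans_le h12, h2⟩)] at this
  rw [iSub (ish _ ⟨h1.trans_le h12, h2⟩) (ish _ ⟨h1, h12.trans_lt h2⟩)]
  linarith

end Fl

namespace Fl
variable {P μ : ℝ → ℝ} {Pe : ℝ} (F : Fl P μ Pe) {P' μ' : ℝ → ℝ}
variable {α β n : ℝ}

structure Ids (k : ℝ → ℝ) (s t : ℝ) : Prop where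
  A : (F.vh t 0 + k (F.rh t 0)) - (F.vh s 0 + k (F.rh s 0)) = ∫ τ in s..t, (F.u τ + Pe - P (F.rh τ 0))
  B : (F.vh t 1 - k (F.rh t 1)) - (F.vh s 1 - k (F.rh s 1)) = ∫ τ in s..t, (P (F.rh τ 1) - Pe)
  C : ∀ m ∈ 𝕀, (∫ x in 0..m, (F.vh t x - F.vh s x)) + (k (F.rh t m) - k (F.rh s m)) -
    (k (F.rh t 0) - k (F.rh s 0)) = -∫ τ in s..t, (P (F.rh τ m) - P (F.rh τ 0))

theorem f_int (hL : Law P μ P' μ') (hα : 0 < α) (hαβ : α ≤ β) (hE : ∀ t ∈ Icc α β, t ∈ F.E n)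
    {k : ℝ → ℝ} (hk : ∀ x, 0 < x → HasDerivAt k (μ x / x) x) {m : ℝ} (hm : m ∈ 𝕀) :
    IntervalIntegrable (fun τ => μ (F.rh τ m) * F.vx (τ, F.X τ m)) volume α β ∧
    k (F.rh β m) - k (F.rh α m) = -∫ τ in α..β, μ (F.rh τ m) * F.vx (τ, F.X τ m) := by
  obtain ⟨K, hK0, hK⟩ := F.bddc hL.cμ α β
  have hne : (𝓝[𝕁] m).NeBot := by
    rw [← mem_closure_iff_nhdsWithin_neBot, closure_Ioo (by norm_num)]; exact hm
  have hb : ∀ m ∈ 𝕀, ∀ τ ∈ Icc α β, |μ (F.rh τ m) * F.vx (τ, F.X τ m)| ≤ K * n := by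
    intro m hm τ hτ
    rw [abs_mul]
    exact mul_le_mul (hK τ hτ _) (F.vx_le (hα.trans_le hτ.1) (hE τ hτ) (F.X_mem hm)) (abs_nonneg _) hK0.le
  have hms : ∀ m ∈ 𝕁, AEStronglyMeasurable (fun τ => μ (F.rh τ m) * F.vx (τ, F.X τ m))
      (volume.restrict (uIoc α β)) := by
    intro m hm
    have h1 : Measurable fun τ => μ (F.rh τ m) * F.dv τ m :=
      ((F.comp_rh hL.cμ).measurable.mul F.dv_meas).comp (measurable_prodMk_right (y := m))
    refine h1.aestronglyMeasurable.congr ?_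
    filter_upwards [ae_restrict_mem measurableSet_uIoc] with τ hτ
    rw [uIoc_of_le hαβ] at hτ
    rw [F.dv_eq (hα.trans hτ.1) hm]
  have hlim : ∀ τ ∈ Ioc α β, Tendsto (fun m => μ (F.rh τ m) * F.vx (τ, F.X τ m)) (𝓝[𝕁] m)
      (𝓝 (μ (F.rh τ m) * F.vx (τ, F.X τ m))) := by
    intro τ hτ
    have hX : Continuous (F.X τ) := F.X_cont.comp (Continuous.prodMk_right τ)
    have c1 : Continuous fun m => μ (F.rh τ m) := (F.comp_rh hL.cμ).comp (Continuous.prodMk_right τ)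
    have c2 : ContinuousOn (fun m => F.vx (τ, F.X τ m)) (Icc 0 1) :=
      (F.cvx τ (hα.trans hτ.1)).comp hX.continuousOn fun m hm => F.X_mem hm
    exact ((c1.continuousOn.mul c2) m hm).mono_left (nhdsWithin_mono _ Ioo_subset_Icc_self)
  have hint : IntervalIntegrable (fun τ => μ (F.rh τ m) * F.vx (τ, F.X τ m)) volume α β := by
    obtain ⟨u, hu1, hu2⟩ := (mem_closure_iff_seq_limit (s := 𝕁) (a := m)).1
      (by rw [closure_Ioo (by norm_num)]; exact hm)
    have hu : Tendsto u atTop (𝓝[𝕁] m) := tendsto_nhdsWithin_iff.2 ⟨hu2, Eventually.of_forall hu1⟩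
    rw [intervalIntegrable_iff_integrableOn_Ioc_of_le hαβ]
    refine Integrable.of_bound (C := K * n) ?_ ?_
    · rw [← uIoc_of_le hαβ]
      refine aestronglyMeasurable_of_tendsto_ae atTop (fun i => hms (u i) (hu1 i)) ?_
      filter_upwards [ae_restrict_mem measurableSet_uIoc] with τ hτ
      rw [uIoc_of_le hαβ] at hτ
      exact (hlim τ hτ).comp hu
    · filter_upwards [ae_restrict_mem measurableSet_Ioc] with τ hτ
      exact hb m hm τ ⟨hτ.1.le, hτ.2⟩
  refine ⟨hint, ?_⟩
  have t1 : Tendsto (fun m => ∫ τ in α..β, μ (F.rh τ m) * F.vx (τ, F.X τ m)) (𝓝[𝕁] m)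
      (𝓝 (∫ τ in α..β, μ (F.rh τ m) * F.vx (τ, F.X τ m))) := by
    refine intervalIntegral.tendsto_integral_filter_of_dominated_convergence (fun _ => K * n) ?_ ?_
      (by simp) ?_
    · filter_upwards [self_mem_nhdsWithin] with m hm using hms m hm
    · filter_upwards [self_mem_nhdsWithin] with m hm
      refine Eventually.of_forall fun τ hτ => ?_
      rw [uIoc_of_le hαβ] at hτ
      exact hb m ⟨hm.1.le, hm.2.le⟩ τ ⟨hτ.1.le, hτ.2⟩
    · refine Eventually.of_forall fun τ hτ => ?_
      rw [uIoc_of_le hαβ] at hτ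
      exact hlim τ hτ
  have hkc : ContinuousOn k (Ioi 0) := fun x hx => (hk x hx).continuousAt.continuousWithinAt
  have c3 : ∀ τ, Continuous fun m => k (F.rh τ m) := fun τ =>
    (F.comp_rh hkc).comp (Continuous.prodMk_right τ)
  have t2 : Tendsto (fun m => k (F.rh β m) - k (F.rh α m)) (𝓝[𝕁] m)
      (𝓝 (k (F.rh β m) - k (F.rh α m))) :=
    (((c3 β).sub (c3 α)).tendsto m).mono_left nhdsWithin_le_nhds
  refine tendsto_nhds_unique t2 (t1.neg.congr' ?_)
  filter_upwards [self_mem_nhdsWithin] with m hm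
  exact (F.κ_int hα hαβ hE hL.cμ hk hm).symm

theorem ids0 (hL : Law P μ P' μ') (hα : 0 < α) (hE : ∀ t ∈ Icc α β, t ∈ F.E n)
    {k : ℝ → ℝ} (hk : ∀ x, 0 < x → HasDerivAt k (μ x / x) x)
    {s t : ℝ} (hs : α < s) (hst : s ≤ t) (ht : t < β) : F.Ids k s t := by
  have hs0 := hα.trans hs
  have hE' : ∀ τ ∈ Icc s t, τ ∈ F.E n := fun τ hτ => hE τ ⟨hs.le.trans hτ.1, hτ.2.trans ht.le⟩
  have hf : ∀ m ∈ 𝕀, _ := fun m hm => F.f_int hL hs0 hst hE' hk hm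
  have hkc : ContinuousOn k (Ioi 0) := fun x hx => (hk x hx).continuousAt.continuousWithinAt
  have cP : Continuous fun p : ℝ × ℝ => P (F.rh p.1 p.2) := F.comp_rh hL.cP
  have iP : ∀ m, IntervalIntegrable (fun τ => P (F.rh τ m)) volume s t := fun m =>
    (cP.comp (Continuous.prodMk_left m)).intervalIntegrable _ _
  have hv := F.vh_cont
  have hu := F.hu
  have iu : IntervalIntegrable (fun τ => F.u τ + Pe) volume s t := Continuous.intervalIntegrable (by fun_prop) _ _
  have hI : ∀ τ, τ ∈ uIcc s t → 0 < τ := fun τ hτ => by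
    rw [uIcc_of_le hst] at hτ; exact hs0.trans_le hτ.1
  refine ⟨?_, ?_, ?_⟩
  · obtain ⟨i0, e0⟩ := hf 0 ⟨le_rfl, zero_le_one⟩
    have h1 := intervalIntegral.integral_eq_sub_of_hasDerivAt (f := fun τ => F.vh τ 0)
      (f' := fun τ => F.u τ + Pe - P (F.rh τ 0) + μ (F.rh τ 0) * F.vx (τ, F.X τ 0))
      (a := s) (b := t) (fun τ hτ => by
        have := F.na τ (hI τ hτ)
        simpa only [vh, rh, X_0] using this) ((iu.sub (iP 0)).add i0)
    rw [iAdd (iu.sub (iP 0)) i0] at h1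
    linarith
  · obtain ⟨i0, e0⟩ := hf 1 ⟨zero_le_one, le_rfl⟩
    have h1 := intervalIntegral.integral_eq_sub_of_hasDerivAt (f := fun τ => F.vh τ 1)
      (f' := fun τ => (P (F.rh τ 1) - Pe) - μ (F.rh τ 1) * F.vx (τ, F.X τ 1))
      (a := s) (b := t) (fun τ hτ => by
        have := F.nb τ (hI τ hτ)
        simp only [vh, rh, X_1]
        exact this.congr_deriv (by ring)) (((iP 1).sub intervalIntegrable_const).sub i0)
    rw [iSub ((iP 1).sub intervalIntegrable_const) i0] at h1
    linarith
  · set Ψ : ℝ → ℝ := fun m => (∫ x in 0..m, (F.vh t x - F.vh s x)) + (k (F.rh t m) - k (F.rh s m)) +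
      ∫ τ in s..t, P (F.rh τ m) with hΨ
    have c3 : ∀ τ, Continuous fun m => k (F.rh τ m) := fun τ =>
      (F.comp_rh hkc).comp (Continuous.prodMk_right τ)
    have iv : ∀ x y, IntervalIntegrable (fun m => F.vh t m - F.vh s m) volume x y := fun x y =>
      Continuous.intervalIntegrable (by fun_prop) _ _
    have hΨc : Continuous Ψ := by
      refine ((intervalIntegral.continuous_primitive iv 0).add ((c3 t).sub (c3 s))).add ?_
      exact intervalIntegral.continuous_parametric_intervalIntegral_of_continuous'
        (f := fun m τ => P (F.rh τ m)) (cP.comp continuous_swap) s t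
    have hconst : ∀ m ∈ 𝕁, Ψ m = Ψ (1/2) := by
      have key : ∀ m ∈ 𝕁, ∀ m' ∈ 𝕁, m ≤ m' → Ψ m' = Ψ m := by
        intro m hm m' hm' hmm
        have h1 := F.momI hL hα hE hs hst ht hm.1 hmm hm'.2
        have h2 : ∀ m ∈ 𝕁, ∫ τ in s..t, F.sh τ m =
            -(k (F.rh t m) - k (F.rh s m)) - ∫ τ in s..t, P (F.rh τ m) := by
          intro m hm
          obtain ⟨i0, e0⟩ := hf m ⟨hm.1.le, hm.2.le⟩
          rw [e0, neg_neg, ← iSub i0 (iP m)]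
          refine iCong fun τ hτ => ?_
          simp only [sh]
          rw [F.dv_eq (hI τ hτ) hm]
        have ish : ∀ m ∈ 𝕁, IntervalIntegrable (fun τ => F.sh τ m) volume s t := fun m hm =>
          (F.qs_pt hL hs0 hst hE' hm).2
        rw [iSub (ish m' hm') (ish m hm), h2 m' hm', h2 m hm,
          ← iISL (iv 0 m') (iv 0 m)] at h1
        simp only [hΨ]
        linarith
      intro m hm
      rcases le_total m (1/2) with h | h
      · exact (key m hm (1/2) (by norm_num) h).symm
      · exact key (1/2) (by norm_num) m hm h
    have hconst' : ∀ m ∈ 𝕀, Ψ m = Ψ (1/2) := by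
      have hcl : IsClosed {m | Ψ m = Ψ (1/2)} := isClosed_eq hΨc continuous_const
      have := closure_minimal (s := 𝕁) hconst hcl
      rw [closure_Ioo (by norm_num)] at this
      exact fun m hm => this hm
    intro m hm
    have h1 := hconst' m hm
    have h2 := hconst' 0 ⟨le_rfl, zero_le_one⟩
    rw [iSub (iP m) (iP 0)]
    simp only [hΨ, iSame] at h1 h2
    linarith

end Fl

namespace Fl
variable {P μ : ℝ → ℝ} {Pe : ℝ} (F : Fl P μ Pe) {P' μ' : ℝ → ℝ}

theorem E_of {t n : ℝ} (hn : 0 ≤ n) (h : ∀ x y, F.a t ≤ y → y ≤ x → x ≤ F.b t →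
    |F.v (t, x) - F.v (t, y)| ≤ n * (x - y) ∧ |F.ρ (t, x) - F.ρ (t, y)| ≤ n * (x - y)) : t ∈ F.E n := by
  have key : ∀ x y, y ≤ x →
      |F.v (t, x) - F.v (t, y)| ≤ n * (x - y) ∧ |F.ρ (t, x) - F.ρ (t, y)| ≤ n * (x - y) := by
    intro x y hxy
    have hab := (F.hab t).le
    have hc : ∀ g : ℝ × ℝ → ℝ, (∀ x, x ≤ F.a t → g (t, x) = g (t, F.a t)) →
        (∀ x, F.b t ≤ x → g (t, x) = g (t, F.b t)) → ∀ x, g (t, x) = g (t, max (F.a t) (min x (F.b t))) := by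
      intro g h1 h2 x
      rcases le_total x (F.a t) with h | h
      · rw [h1 x h, min_eq_left (h.trans hab), max_eq_left h]
      · rcases le_total x (F.b t) with h' | h'
        · rw [min_eq_left h', max_eq_right h]
        · rw [h2 x h', min_eq_right h', max_eq_right hab]
    rw [hc F.v (F.hvl t) (F.hvr t) x, hc F.v (F.hvl t) (F.hvr t) y, hc F.ρ (F.hρl t) (F.hρr t) x,
      hc F.ρ (F.hρl t) (F.hρr t) y]
    have h1 := h (max (F.a t) (min x (F.b t))) (max (F.a t) (min y (F.b t))) (le_max_left _ _)
      (max_le_max le_rfl (min_le_min hxy le_rfl)) (max_le hab (min_le_right _ _))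
    have h2 : max (F.a t) (min x (F.b t)) - max (F.a t) (min y (F.b t)) ≤ x - y := by
      have := abs_max_sub_max_le_abs (min x (F.b t)) (min y (F.b t)) (F.a t)
      have h3 := abs_min_sub_min_le_max x (F.b t) y (F.b t)
      rw [sub_self, abs_zero, max_eq_left (abs_nonneg _), abs_of_nonneg (sub_nonneg.2 hxy)] at h3
      rw [max_comm, max_comm (F.a t)]
      exact (le_abs_self _).trans (this.trans h3)
    exact ⟨h1.1.trans (mll h2 hn), h1.2.trans (mll h2 hn)⟩
  intro x y
  rcases le_total y x with hh | hh
  · rw [abs_of_nonneg (sub_nonneg.2 hh)]; exact key x y hh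
  · rw [abs_sub_comm (F.v _), abs_sub_comm (F.ρ _), abs_sub_comm x, abs_of_nonneg (sub_nonneg.2 hh)]
    exact key y x hh

theorem E_ex {t : ℝ} (ht : 0 < t) : ∃ n : ℕ, t ∈ F.E n := by
  obtain ⟨A, hA⟩ := (isCompact_Icc.exists_bound_of_continuousOn (F.cvx t ht))
  obtain ⟨B, hB⟩ := (isCompact_Icc.exists_bound_of_continuousOn (F.cρx t))
  obtain ⟨n, hn⟩ := exists_nat_ge (max A B)
  refine ⟨n, F.E_of n.cast_nonneg fun x y h1 h2 h3 => ⟨?_, ?_⟩⟩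
  · have := Convex.norm_image_sub_le_of_norm_hasDerivWithin_le (C := n) (F.hvx t ht)
      (fun z hz => (hA z hz).trans ((le_max_left _ _).trans hn)) (convex_Icc _ _)
      (⟨h1, h2.trans h3⟩ : y ∈ Icc _ _) (⟨h1.trans h2, h3⟩ : x ∈ Icc _ _)
    rwa [Real.norm_eq_abs, Real.norm_eq_abs, abs_of_nonneg (sub_nonneg.2 h2)] at this
  · have := Convex.norm_image_sub_le_of_norm_hasDerivWithin_le (C := n) (F.hρx t)
      (fun z hz => (hB z hz).trans ((le_max_right _ _).trans hn)) (convex_Icc _ _)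
      (⟨h1, h2.trans h3⟩ : y ∈ Icc _ _) (⟨h1.trans h2, h3⟩ : x ∈ Icc _ _)
    rwa [Real.norm_eq_abs, Real.norm_eq_abs, abs_of_nonneg (sub_nonneg.2 h2)] at this

def GU : Set ℝ := ⋃ n : ℕ, interior (F.E n)

theorem idsU (hL : Law P μ P' μ') {k : ℝ → ℝ} (hk : ∀ x, 0 < x → HasDerivAt k (μ x / x) x)
    {s t : ℝ} (hs : 0 < s) (hst : s ≤ t) (h : Icc s t ⊆ F.GU) : F.Ids k s t := by
  obtain ⟨n, hn⟩ := isCompact_Icc.elim_directed_cover (fun n : ℕ => interior (F.E n))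
    (fun n => isOpen_interior) h (Monotone.directed_le fun i j hij =>
      interior_mono (F.E_mono (Nat.cast_le.2 hij)))
  obtain ⟨δ, hδ, hd⟩ := isCompact_Icc.exists_thickening_subset_open isOpen_interior hn
  refine F.ids0 hL (n := n) (α := max (s / 2) (s - δ / 2)) (β := t + δ / 2) (lt_max_of_lt_left (by positivity)) ?_ hk
    (max_lt (by linarith) (by linarith)) hst (by linarith)
  intro τ hτ
  refine interior_subset (hd (Metric.mem_thickening_iff.2 ?_))
  have h1 := (le_max_right _ _).trans hτ.1
  rcases le_total τ s with h | h
  · exact ⟨s, ⟨le_rfl, hst⟩, by rw [Real.dist_eq, abs_lt]; constructor <;> linarith⟩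
  rcases le_total τ t with h' | h'
  · exact ⟨τ, ⟨h, h'⟩, by rw [dist_self]; exact hδ⟩
  · exact ⟨t, ⟨hst, le_rfl⟩, by rw [Real.dist_eq, abs_lt]; constructor <;> linarith [hτ.2]⟩

theorem ids_ext (hL : Law P μ P' μ') {k : ℝ → ℝ} (hkc : ContinuousOn k (Ioi 0)) {α β : ℝ} 
    (h : ∀ s t, α < s → s ≤ t → t < β → F.Ids k s t) {s t : ℝ} (hs : α ≤ s) (hst : s < t)
    (ht : t ≤ β) : F.Ids k s t := by
  set c := (s + t) / 2 with hc
  have key : ∀ (f : ℝ → ℝ) (g : ℝ → ℝ), Continuous f → Continuous g →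
      (∀ s t, α < s → s ≤ t → t < β → f t - f s = ∫ τ in s..t, g τ) → f t - f s = ∫ τ in s..t, g τ := by
    intro f g hf hg hfg
    have hG : Continuous fun x => ∫ τ in c..x, g τ :=
      intervalIntegral.continuous_primitive (fun a b => hg.intervalIntegrable a b) c
    have h0 : ∀ x ∈ Ioo s t, f x - f c = ∫ τ in c..x, g τ := by
      intro x hx
      rcases le_total c x with h1 | h1
      · exact hfg c x (by rw [hc]; linarith) h1 (by linarith [hx.2])
      · have := hfg x c (by linarith [hx.1]) h1 (by rw [hc]; linarith)
        rw [intervalIntegral.integral_symm, ← this]; ring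
    have h1 : EqOn (fun x => f x - f c) (fun x => ∫ τ in c..x, g τ) (Icc s t) := by
      have : EqOn (fun x => f x - f c) (fun x => ∫ τ in c..x, g τ) (Ioo s t) := h0
      rw [← closure_Ioo hst.ne]
      exact this.closure (by fun_prop) hG
    have h2 := h1 (⟨le_rfl, hst.le⟩ : s ∈ Icc s t)
    have h3 := h1 (⟨hst.le, le_rfl⟩ : t ∈ Icc s t)
    simp only at h2 h3
    rw [← iISL (hg.intervalIntegrable c t) (hg.intervalIntegrable c s),
      ← h2, ← h3]; ring
  have hv : ∀ m, Continuous fun τ => F.vh τ m := fun m => F.vh_cont.comp (Continuous.prodMk_left m)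
  have hkr : ∀ m, Continuous fun τ => k (F.rh τ m) := fun m =>
    (F.comp_rh hkc).comp (Continuous.prodMk_left m)
  have hP : ∀ m, Continuous fun τ => P (F.rh τ m) := fun m =>
    (F.comp_rh hL.cP).comp (Continuous.prodMk_left m)
  have hv' : ∀ τ, Continuous fun m => F.vh τ m := fun m => F.vh_cont.comp (Continuous.prodMk_right m)
  have hI : ∀ m, Continuous fun τ => ∫ x in 0..m, F.vh τ x := fun m =>
    intervalIntegral.continuous_parametric_intervalIntegral_of_continuous' F.vh_cont _ _
  refine ⟨?_, ?_, fun m hm => ?_⟩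
  · exact key (fun τ => F.vh τ 0 + k (F.rh τ 0)) _ ((hv 0).add (hkr 0))
      ((F.hu.add continuous_const).sub (hP 0)) fun s t h1 h2 h3 => (h s t h1 h2 h3).A
  · exact key (fun τ => F.vh τ 1 - k (F.rh τ 1)) _ ((hv 1).sub (hkr 1))
      ((hP 1).sub continuous_const) fun s t h1 h2 h3 => (h s t h1 h2 h3).B
  · have := key (fun τ => (∫ x in 0..m, F.vh τ x) + k (F.rh τ m) - k (F.rh τ 0))
      (fun τ => -(P (F.rh τ m) - P (F.rh τ 0))) (((hI m).add (hkr m)).sub (hkr 0))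
      ((hP m).sub (hP 0)).neg fun s t h1 h2 h3 => by
        have := (h s t h1 h2 h3).C m hm
        rw [iSub ((hv' t).intervalIntegrable _ _) ((hv' s).intervalIntegrable _ _)] at this
        rw [intervalIntegral.integral_neg, ← this]; ring
    rw [intervalIntegral.integral_neg] at this
    rw [iSub ((hv' t).intervalIntegrable _ _) ((hv' s).intervalIntegrable _ _), ← this]; ring
end Fl

theorem bilip {f f' : ℝ → ℝ} {lo : ℝ} (hlo : 0 < lo) (hi : ℝ) (hd : ∀ x, 0 < x → HasDerivAt f (f' x) x)
    (hc : ContinuousOn f' (Ioi 0)) (hp : ∀ x, 0 < x → 0 < f' x) :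
    ∃ L > 0, ∃ c > 0, ∀ x ∈ Icc lo hi, ∀ y ∈ Icc lo hi,
      (y ≤ x → c * (x - y) ≤ f x - f y ∧ f x - f y ≤ L * (x - y)) ∧
      c * |x - y| ≤ |f x - f y| ∧ |f x - f y| ≤ L * |x - y| := by
  have hs : Icc lo hi ⊆ Ioi 0 := fun x hx => hlo.trans_le hx.1
  obtain ⟨A, hA⟩ := isCompact_Icc.exists_bound_of_continuousOn (hc.mono hs)
  obtain ⟨B, hB⟩ := isCompact_Icc.exists_bound_of_continuousOn
    ((hc.mono hs).inv₀ fun x hx => (hp x (hs hx)).ne')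
  have key : ∀ x ∈ Icc lo hi, ∀ y ∈ Icc lo hi,
      (y ≤ x → (max B 1)⁻¹ * (x - y) ≤ f x - f y ∧ f x - f y ≤ (max A 1) * (x - y)) := by
    intro x hx y hy hxy
    have hI : Icc y x ⊆ Icc lo hi := Icc_subset_Icc hy.1 hx.2
    have hcf : ContinuousOn f (Icc y x) := fun z hz => (hd z (hs (hI hz))).continuousAt.continuousWithinAt
    have hdf : DifferentiableOn ℝ f (interior (Icc y x)) := fun z hz =>
      (hd z (hs (hI (interior_subset hz)))).differentiableAt.differentiableWithinAt
    constructor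
    · refine (convex_Icc y x).mul_sub_le_image_sub_of_le_deriv hcf hdf (fun z hz => ?_) y ⟨le_rfl, hxy⟩ x ⟨hxy, le_rfl⟩ hxy
      have hz := hI (interior_subset hz)
      rw [(hd z (hs hz)).deriv]
      have h1 := (le_abs_self _).trans ((hB z hz).trans (le_max_left _ 1))
      exact inv_le_of_inv_le₀ (hp z (hs hz)) h1
    · refine (convex_Icc y x).image_sub_le_mul_sub_of_deriv_le hcf hdf (fun z hz => ?_) y ⟨le_rfl, hxy⟩ x ⟨hxy, le_rfl⟩ hxy
      have hz := hI (interior_subset hz)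
      rw [(hd z (hs hz)).deriv]
      exact (le_abs_self _).trans ((hA z hz).trans (le_max_left _ 1))
  refine ⟨max A 1, by positivity, (max B 1)⁻¹, by positivity, fun x hx y hy => ⟨key x hx y hy, ?_⟩⟩
  have hb : 0 < (max B 1)⁻¹ := by positivity
  rcases le_total y x with h | h
  · have h1 := key x hx y hy h
    have h2 : 0 ≤ f x - f y := (mul_nonneg hb.le (sub_nonneg.2 h)).trans h1.1
    rwa [abs_of_nonneg (sub_nonneg.2 h), abs_of_nonneg h2]
  · have h1 := key y hy x hx h
    have h2 : 0 ≤ f y - f x := (mul_nonneg hb.le (sub_nonneg.2 h)).trans h1.1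
    rwa [abs_sub_comm x, abs_sub_comm (f x), abs_of_nonneg (sub_nonneg.2 h), abs_of_nonneg h2]

namespace Fl
variable {P μ : ℝ → ℝ} {Pe : ℝ} (F : Fl P μ Pe) {P' μ' : ℝ → ℝ}

theorem gapρ (hL : Law P μ P' μ') {k : ℝ → ℝ} (hk : ∀ x, 0 < x → HasDerivAt k (μ x / x) x) (T0 T1 : ℝ) :
    ∃ δ > 0, ∀ n, ∃ N, 0 ≤ N ∧ ∀ α β, T0 ≤ α → β ≤ T1 → β - α ≤ δ →
      (∀ x y, |F.ρ (α, x) - F.ρ (α, y)| ≤ n * |x - y|) →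
      (∀ t, α < t → t ≤ β → F.Ids k α t) → ∀ t ∈ Icc α β, ∀ x ∈ Icc (F.a t) (F.b t),
      ∀ y ∈ Icc (F.a t) (F.b t), |F.ρ (t, x) - F.ρ (t, y)| ≤ N * |x - y| := by
  obtain ⟨Mr, hMr0, hMr⟩ := F.bddρ T0 T1
  obtain ⟨Mi, hMi0, hMi⟩ := F.bddi T0 T1
  obtain ⟨Mv, hMv0, hMv⟩ := F.bddv T0 T1
  have hkc : ContinuousOn k (Ioi 0) := fun x hx => (hk x hx).continuousAt.continuousWithinAt
  have hR : ∀ t ∈ Icc T0 T1, ∀ m, F.rh t m ∈ Icc Mi⁻¹ Mr := fun t ht m =>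
    ⟨inv_le_of_inv_le₀ (F.rh_pos _ _) (hMi t ht _), hMr t ht _⟩
  obtain ⟨LP, hLP, _, _, hP⟩ := bilip (inv_pos.2 hMi0) Mr hL.dP hL.cP' hL.P'pos
  obtain ⟨Lk, hLk, ck, hck, hK⟩ := bilip (inv_pos.2 hMi0) Mr hk
    (hL.cμ.div continuousOn_id fun x hx => (ne_of_gt hx)) (fun x hx => div_pos (hL.μpos x hx) hx)
  refine ⟨ck / (2 * LP), by positivity, fun n => ?_⟩
  refine ⟨2 * (Lk * (|n| * Mi) + 2 * Mv) / ck * Mr, by positivity, fun α β hα hβ hαβ hn hid t ht x hx y hy => ?_⟩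
  have hI : Icc α β ⊆ Icc T0 T1 := Icc_subset_Icc hα hβ
  have hαI : α ∈ Icc α β := ⟨le_rfl, ht.1.trans ht.2⟩
  have key : ∀ m ∈ 𝕀, ∀ m' ∈ 𝕀, |F.rh t m - F.rh t m'| ≤
      2 * (Lk * (|n| * Mi) + 2 * Mv) / ck * |m - m'| := by
    intro m hm m' hm'
    have hkr : ∀ m, Continuous fun τ => k (F.rh τ m) := fun m =>
      (F.comp_rh hkc).comp (Continuous.prodMk_left m)
    have hPr : ∀ m, Continuous fun τ => P (F.rh τ m) := fun m =>
      (F.comp_rh hL.cP).comp (Continuous.prodMk_left m)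
    have hv' : ∀ τ, Continuous fun m => F.vh τ m := fun m => F.vh_cont.comp (Continuous.prodMk_right m)
    set D : ℝ → ℝ := fun τ => |k (F.rh τ m) - k (F.rh τ m')| with hD
    have hDc : Continuous D := ((hkr m).sub (hkr m')).abs
    obtain ⟨t1, ht1, hmax⟩ := isCompact_Icc.exists_isMaxOn ⟨α, hαI⟩ hDc.continuousOn
    have h0 : D α ≤ Lk * (|n| * Mi) * |m - m'| := by
      refine ((hK _ (hR α (hI hαI) m) _ (hR α (hI hαI) m')).2.2).trans ?_
      rw [mul_assoc]
      exact mll (F.rh_lip hMi (hI hαI) (abs_nonneg n) (fun x y =>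
        (hn x y).trans (mlr (le_abs_self n) (abs_nonneg _))) m m') hLk.le
    have h1 : D t1 ≤ (Lk * (|n| * Mi) + 2 * Mv) * |m - m'| + 1 / 2 * D t1 := by
      rcases ht1.1.eq_or_lt with he | hlt
      · rw [← he]
        have : 0 ≤ D α := abs_nonneg _
        have : 0 ≤ Mv * |m - m'| := by positivity
        linarith
      have hid := hid t1 hlt ht1.2
      have e1 := hid.C m hm
      have e2 := hid.C m' hm'
      have iv : ∀ p q, IntervalIntegrable (fun x => F.vh t1 x - F.vh α x) volume p q := fun p q =>
        ((hv' t1).sub (hv' α)).intervalIntegrable p q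
      have ip : ∀ m, IntervalIntegrable (fun τ => P (F.rh τ m) - P (F.rh τ 0)) volume α t1 := fun m =>
        ((hPr m).sub (hPr 0)).intervalIntegrable _ _
      have e3 := iISL (iv 0 m) (iv 0 m')
      have e4 := iSub (ip m) (ip m')
      have e5 : |∫ x in m'..m, (F.vh t1 x - F.vh α x)| ≤ 2 * Mv * |m - m'| := by
        rw [← Real.norm_eq_abs]
        refine iNorm fun x _ => ?_
        have g1 : |F.vh t1 x| ≤ Mv := hMv t1 (hI ht1) (F.X t1 x)
        have g2 : |F.vh α x| ≤ Mv := hMv α (hI hαI) (F.X α x)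
        exact (abs_sub _ _).trans (by linarith)
      have e6 : |∫ τ in α..t1, (P (F.rh τ m) - P (F.rh τ 0) - (P (F.rh τ m') - P (F.rh τ 0)))| ≤
          LP * ck⁻¹ * D t1 * |t1 - α| := by
        rw [← Real.norm_eq_abs]
        exact iNorm fun τ hτ => by
          rw [uIoc_of_le hlt.le] at hτ
          have hτ' : τ ∈ Icc α β := ⟨hτ.1.le, hτ.2.trans ht1.2⟩
          rw [sub_sub_sub_cancel_right]
          have g1 := (hP _ (hR τ (hI hτ') m) _ (hR τ (hI hτ') m')).2.2
          have g2 := (hK _ (hR τ (hI hτ') m) _ (hR τ (hI hτ') m')).2.1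
          have g3 : D τ ≤ D t1 := hmax hτ'
          rw [Real.norm_eq_abs, mul_assoc]
          refine g1.trans (mll ?_ hLP.le)
          rw [inv_mul_eq_div, le_div_iff₀ hck, mul_comm]
          exact g2.trans g3
      have e7 : LP * ck⁻¹ * D t1 * |t1 - α| ≤ 1 / 2 * D t1 := by
        rw [abs_of_pos (sub_pos.2 hlt)]
        have : t1 - α ≤ ck / (2 * LP) := by linarith [ht1.2]
        have g := mll this (show 0 ≤ LP * ck⁻¹ * D t1 from mul_nonneg (by positivity) (abs_nonneg _))
        refine g.trans (le_of_eq ?_)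
        field_simp
      have e8 : k (F.rh t1 m) - k (F.rh t1 m') = (k (F.rh α m) - k (F.rh α m')) -
          (∫ x in m'..m, (F.vh t1 x - F.vh α x)) -
          ∫ τ in α..t1, (P (F.rh τ m) - P (F.rh τ 0) - (P (F.rh τ m') - P (F.rh τ 0))) := by
        rw [e4, ← e3]; linarith
      have e9 : D t1 ≤ D α + |∫ x in m'..m, (F.vh t1 x - F.vh α x)| +
          |∫ τ in α..t1, (P (F.rh τ m) - P (F.rh τ 0) - (P (F.rh τ m') - P (F.rh τ 0)))| := by
        simp only [hD]
        rw [e8]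
        exact (abs_sub _ _).trans (add_le_add (abs_sub _ _) le_rfl)
      linarith
    have h2 : D t ≤ D t1 := hmax ht
    have h3 := (hK _ (hR t (hI ht) m) _ (hR t (hI ht) m')).2.1
    rw [div_mul_eq_mul_div, le_div_iff₀ hck, mul_comm]
    refine h3.trans (h2.trans ?_)
    linarith
  have hm : ∀ x ∈ Icc (F.a t) (F.b t), F.mm t x ∈ 𝕀 := fun x hx => by
    rw [← F.mm_a t, ← F.mm_b t]; exact ⟨(F.mm_mono t).monotone hx.1, (F.mm_mono t).monotone hx.2⟩
  have h1 := key _ (hm x hx) _ (hm y hy)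
  simp only [rh, X_mm] at h1
  refine h1.trans ?_
  rw [mul_assoc]
  refine mll ?_ (by positivity)
  rw [F.mm_sub]
  rw [← Real.norm_eq_abs]
  exact iNorm fun z _ => by
    rw [Real.norm_eq_abs, abs_of_pos (F.ρpos _)]; exact hMr t (hI ht) z
end Fl

namespace Fl
variable {P μ : ℝ → ℝ} {Pe : ℝ} (F : Fl P μ Pe) {P' μ' : ℝ → ℝ}

theorem gapv (hL : Law P μ P' μ') {T0 : ℝ} (hT0 : 0 < T0) (T1 n N : ℝ) (hN : 0 ≤ N) :
    ∃ L, 0 ≤ L ∧ ∀ α β, T0 ≤ α → β ≤ T1 → α ∈ F.E n → (∀ t ∈ Icc α β, ∀ x ∈ Icc (F.a t) (F.b t),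
      ∀ y ∈ Icc (F.a t) (F.b t), |F.ρ (t, x) - F.ρ (t, y)| ≤ N * |x - y|) →
      ∀ t ∈ Icc α β, ∀ y x, F.a t ≤ y → y ≤ x → x ≤ F.b t → |F.v (t, x) - F.v (t, y)| ≤ L * (x - y) := by
  obtain ⟨Mr, hMr0, hMr⟩ := F.bddρ T0 T1
  obtain ⟨Mi, hMi0, hMi⟩ := F.bddi T0 T1
  obtain ⟨Mv, hMv0, hMv⟩ := F.bddv T0 T1
  obtain ⟨MP, hMP0, hMP⟩ := F.bddc hL.cP T0 T1
  obtain ⟨MP', hMP'0, hMP'⟩ := F.bddc hL.cP' T0 T1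
  obtain ⟨Mμ', hMμ'0, hMμ'⟩ := F.bddc hL.cμ' T0 T1
  obtain ⟨Mh, hMh0, hMh⟩ := F.bddc (h := fun x => x / μ x)
    (continuousOn_id.div hL.cμ fun x hx => (hL.μpos x hx).ne') T0 T1
  obtain ⟨Mu, hMu⟩ := isCompact_Icc.exists_bound_of_continuousOn (s := Icc T0 T1) F.hu.continuousOn
  set C := Mv + (MP' + Mμ') * N * Mi + |Mu| + |Pe| + MP with hC
  have hC0 : 0 ≤ C := by positivity
  set K := (4 * C + 2 * Mv + 1) * Mh + 2 * Mr with hK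
  set L := 1 + |n| + 2 * Mv * K with hLd
  have hK0 : 0 < K := by positivity
  refine ⟨2 * L, by positivity, fun α β hα hβ hn hρ t ht y x h1 h2 h3 => ?_⟩
  have hI : ∀ {t}, t ∈ Icc α β → t ∈ Icc T0 T1 := fun h => ⟨hα.trans h.1, h.2.trans hβ⟩
  have hJ : ∀ {t}, t ∈ Ioc α β → t ∈ Icc T0 T1 := fun h => hI ⟨h.1.le, h.2⟩
  have hp : ∀ {t}, t ∈ Ioc α β → 0 < t := fun h => hT0.trans_le (hJ h).1
  have key : ∀ e : ℝ, |e| = 1 → e * F.v (t, x) - e * F.v (t, y) ≤ 2 * L * (x - y) := by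
    intro e he
    refine GB (a := F.a) (b := F.b) (w := fun p => e * F.v p) (wt := fun t x => e * F.vt (t, x))
      (wx := fun t x => e * F.vx (t, x)) (wxx := fun t x => e * _) (A := fun t x => μ (F.ρ (t, x)) / F.ρ (t, x))
      (a' := fun t => F.v (t, F.a t)) (b' := fun t => F.v (t, F.b t))
      (ca := fun t => μ (F.ρ (t, F.a t))) (cb := fun t => μ (F.ρ (t, F.b t)))
      (α := α) (β := β) (M := Mv) (C := C) (c := Mh⁻¹) (n := |n|) (ℓ := Mr⁻¹) (K := K) (L := L)
      F.ha F.hb (continuous_const.mul F.hv) (inv_pos.2 hMr0) (fun t ht => ?_) (fun t ht x => ?_)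
      (fun t ht => hMv t (hJ ht) _) (fun t ht => hMv t (hJ ht) _) (fun t ht => F.ha' t (hp ht))
      (fun t ht => F.hb' t (hp ht)) (fun t ht x hx => (F.hvt t (hp ht) x hx).const_mul e)
      (fun t ht x hx => (F.hvx' (hp ht) hx).const_mul e)
      (fun t ht x hx => (F.vxx hL (hp ht) hx).const_mul e)
      (fun t ht => ?_) (fun t ht => ?_) (fun t ht => (F.na t (hp ht)).const_mul e)
      (fun t ht => (F.nb t (hp ht)).const_mul e) (inv_pos.2 hMh0) hC0 (fun t ht x hx => ?_)
      (fun t ht x hx => ?_) (fun t ht => (hL.μpos _ (F.ρpos _)).le) (fun t ht => (hL.μpos _ (F.ρpos _)).le)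
      (fun t ht => ?_) (fun t ht => ?_) (fun x hx y hy => ?_) ?_ ?_ ?_ ?_ ?_ t ht y x h1 h2 h3
    · have hh := F.mass t
      have := iNorm (C := Mr) (a := F.a t) (b := F.b t)
        (f := fun x => F.ρ (t, x)) fun x _ => by
          rw [Real.norm_eq_abs, abs_of_pos (F.ρpos _)]; exact hMr t (hI ht) x
      rw [hh, norm_one, abs_of_pos (sub_pos.2 (F.hab t))] at this
      rwa [inv_eq_one_div, div_le_iff₀' hMr0]
    · rw [abs_mul, he, one_mul]; exact hMv t (hI ht) x
    · exact (((F.hvx t (hp ht) _ ⟨le_rfl, (F.hab t).le⟩).mono_of_mem_nhdsWithin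
        (Icc_mem_nhdsGT (F.hab t)))).const_mul e
    · exact (((F.hvx t (hp ht) _ ⟨(F.hab t).le, le_rfl⟩).mono_of_mem_nhdsWithin
        (Icc_mem_nhdsLT (F.hab t)))).const_mul e
    · have g1 := (le_abs_self _).trans (hMh t (hJ ht) x)
      rw [← inv_div]
      exact inv_anti₀ (div_pos (F.ρpos _) (hL.μpos _ (F.ρpos _))) g1
    · have hr := F.ρpos (t, x)
      have hμ := hL.μpos _ hr
      have g1 : |F.ρx (t, x)| ≤ N := (F.hρx' hx).le_of_lip' hN (by
        filter_upwards [Icc_mem_nhds hx.1 hx.2] with y hy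
        exact hρ t ⟨ht.1.le, ht.2⟩ y hy x ⟨hx.1.le, hx.2.le⟩)
      have g2 : |F.ρx (t, x) / F.ρ (t, x)| ≤ N * Mi := by
        rw [div_eq_mul_inv, abs_mul, abs_of_pos (inv_pos.2 hr)]
        exact mul_le_mul g1 (hMi t (hJ ht) x) (inv_pos.2 hr).le hN
      have g3 : |P' (F.ρ (t, x)) * (F.ρx (t, x) / F.ρ (t, x))| ≤ MP' * (N * Mi) := by
        rw [abs_mul]; exact mul_le_mul (hMP' t (hJ ht) x) g2 (abs_nonneg _) hMP'0.le
      have g4 : |μ' (F.ρ (t, x)) * (F.ρx (t, x) / F.ρ (t, x)) * F.vx (t, x)| ≤ Mμ' * (N * Mi) * |F.vx (t, x)| := by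
        rw [abs_mul, abs_mul]
        exact mlr (mul_le_mul (hMμ' t (hJ ht) x) g2 (abs_nonneg _) hMμ'0.le) (abs_nonneg _)
      have g5 : |F.v (t, x) * F.vx (t, x)| ≤ Mv * |F.vx (t, x)| := by
        rw [abs_mul]; exact mlr (hMv t (hJ ht) x) (abs_nonneg _)
      have e1 : ∀ q : ℝ, e * F.vt (t, x) - μ (F.ρ (t, x)) / F.ρ (t, x) * (e * (F.ρ (t, x) / μ (F.ρ (t, x)) *
          (F.vt (t, x) - q))) = e * q := by
        intro q; field_simp; ring
      rw [e1, abs_mul, he, one_mul, abs_mul, he, one_mul, mul_div_assoc]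
      have e2 : -F.v (t, x) * F.vx (t, x) - P' (F.ρ (t, x)) * (F.ρx (t, x) / F.ρ (t, x)) +
          μ' (F.ρ (t, x)) * F.ρx (t, x) * F.vx (t, x) / F.ρ (t, x) =
          -(F.v (t, x) * F.vx (t, x)) - P' (F.ρ (t, x)) * (F.ρx (t, x) / F.ρ (t, x)) +
          μ' (F.ρ (t, x)) * (F.ρx (t, x) / F.ρ (t, x)) * F.vx (t, x) := by ring
      rw [e2]
      refine (abs_add_le _ _).trans ((add_le_add ((abs_sub _ _).trans (add_le_add (abs_neg _).le le_rfl)) le_rfl).trans ?_)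
      have p1 : 0 ≤ |F.vx (t, x)| := abs_nonneg _
      have p2 : 0 ≤ MP' * (N * Mi) := by positivity
      have p3 : 0 ≤ Mμ' * (N * Mi) := by positivity
      have p4 : 0 ≤ |Mu| + |Pe| + MP := by positivity
      have p5 := mul_nonneg p2 p1
      have p6 := mul_nonneg p4 p1
      have e3 : C * (1 + |F.vx (t, x)|) = Mv + MP' * (N * Mi) + Mμ' * (N * Mi) + (|Mu| + |Pe| + MP)
        + Mv * |F.vx (t, x)| + MP' * (N * Mi) * |F.vx (t, x)| + Mμ' * (N * Mi) * |F.vx (t, x)| +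
        (|Mu| + |Pe| + MP) * |F.vx (t, x)| := by rw [hC]; ring
      linarith
    · have e1 : e * (P (F.ρ (t, F.b t)) - μ (F.ρ (t, F.b t)) * F.vx (t, F.b t) - Pe) + μ (F.ρ (t, F.b t)) *
          (e * F.vx (t, F.b t)) = e * (P (F.ρ (t, F.b t)) - Pe) := by ring
      rw [e1, abs_mul, he, one_mul]
      have p1 := (abs_sub (P (F.ρ (t, F.b t))) Pe).trans (add_le_add (hMP t (hJ ht) _) le_rfl)
      have p2 : 0 ≤ (MP' + Mμ') * N * Mi := by positivity
      linarith [abs_nonneg Mu]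
    · have e1 : e * (F.u t + Pe - P (F.ρ (t, F.a t)) + μ (F.ρ (t, F.a t)) * F.vx (t, F.a t)) - μ (F.ρ (t, F.a t)) *
          (e * F.vx (t, F.a t)) = e * (F.u t + Pe - P (F.ρ (t, F.a t))) := by ring
      rw [e1, abs_mul, he, one_mul]
      have p1 := (abs_sub (F.u t + Pe) (P (F.ρ (t, F.a t)))).trans (add_le_add (abs_add_le _ _) (hMP t (hJ ht) _))
      have p2 : 0 ≤ (MP' + Mμ') * N * Mi := by positivity
      have p3 : |F.u t| ≤ |Mu| := (hMu t (hJ ht)).trans (le_abs_self _)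
      linarith
    · rw [← mul_sub, abs_mul, he, one_mul]
      exact (hn x y).1.trans (mlr (le_abs_self n) (abs_nonneg _))
    · have : Mh⁻¹ * K = 4 * C + 2 * Mv + 1 + 2 * Mr * Mh⁻¹ := by rw [hK]; field_simp
      have : 0 < 2 * Mr * Mh⁻¹ := by positivity
      linarith
    · have : K * Mr⁻¹ = (4 * C + 2 * Mv + 1) * Mh * Mr⁻¹ + 2 := by rw [hK]; field_simp
      have : 0 < (4 * C + 2 * Mv + 1) * Mh * Mr⁻¹ := by positivity
      linarith
    · have : 0 ≤ 2 * Mv * K := by positivity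
      linarith [abs_nonneg n]
    · have : 0 ≤ 2 * Mv * K := by positivity
      linarith
    · linarith [abs_nonneg n]
  have k1 := key 1 (by simp)
  have k2 := key (-1) (by simp)
  rw [abs_le]; constructor <;> linarith

theorem GU_all (hL : Law P μ P' μ') {k : ℝ → ℝ} (hk : ∀ x, 0 < x → HasDerivAt k (μ x / x) x) :
    Ioi 0 ⊆ F.GU := by
  have hUo : IsOpen F.GU := isOpen_iUnion fun n => isOpen_interior
  by_contra hne
  obtain ⟨t0, h0, h0'⟩ := not_subset.1 hne
  set B : Set ℝ := F.GUᶜ ∩ Ioi 0 with hB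
  have hBl : IsLocallyClosed B := ⟨Ioi 0, F.GUᶜ, isOpen_Ioi, hUo.isClosed_compl, inter_comm _ _⟩
  have := hBl.locallyCompactSpace
  have : Nonempty B := ⟨⟨t0, h0', h0⟩⟩
  obtain ⟨n, ⟨t1, ht1B⟩, ht1⟩ := nonempty_interior_of_iUnion_of_closed
    (f := fun n : ℕ => (Subtype.val ⁻¹' F.E n : Set B)) (fun n => (F.E_closed n).preimage continuous_subtype_val)
    (by
      rw [eq_univ_iff_forall]
      intro t
      obtain ⟨n, hn⟩ := F.E_ex t.2.2
      exact mem_iUnion.2 ⟨n, hn⟩)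
  rw [mem_interior_iff_mem_nhds, Metric.mem_nhds_iff] at ht1
  obtain ⟨ε, hε, hb⟩ := ht1
  have ht1p : 0 < t1 := ht1B.2
  set η := min (ε / 2) (t1 / 2) with hη
  have hη0 : 0 < η := by rw [hη]; positivity
  have hη1 : η < ε := (min_le_left _ _).trans_lt (by linarith)
  have hη2 : η ≤ t1 / 2 := min_le_right _ _
  obtain ⟨δ, hδ, hgap⟩ := F.gapρ hL hk (t1 - η) (t1 + η)
  set θ := min η (δ / 2) with hθ
  have hθ0 : 0 < θ := by rw [hθ]; positivity
  have hθ1 : θ ≤ η := min_le_left _ _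
  have hθ2 : θ ≤ δ / 2 := min_le_right _ _
  set c := t1 - θ with hc
  obtain ⟨n2, hn2⟩ := F.E_ex (t := c) (by linarith)
  obtain ⟨N, hN0, hN⟩ := hgap (max n n2 : ℝ)
  obtain ⟨L, hL0, hLv⟩ := F.gapv hL (T0 := t1 - η) (by linarith) (t1 + η) (max n n2 : ℝ) N hN0
  have key : ∀ s ∈ Icc c (t1 + θ), s ∈ F.E (max N L) := by
    intro s hs
    have hAc : IsCompact (insert c (F.GUᶜ ∩ Icc c s)) :=
      ((isCompact_Icc.inter_left hUo.isClosed_compl)).insert c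
    obtain ⟨α, hα1, hα2⟩ := hAc.exists_isGreatest ⟨c, mem_insert _ _⟩
    have hcα : c ≤ α := hα2 (mem_insert _ _)
    have hαs : α ≤ s := by
      rcases hα1 with h | h
      · rw [h]; exact hs.1
      · exact h.2.2
    have hαE : α ∈ F.E (max n n2 : ℝ) := by
      rcases hα1 with h | h
      · rw [h]; exact F.E_mono (le_max_right _ _) hn2
      · refine F.E_mono (le_max_left _ _) ?_
        have hBα : α ∈ B := ⟨h.1, by simp only [mem_Ioi]; linarith⟩
        refine hb (show (⟨α, hBα⟩ : B) ∈ _ from ?_)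
        rw [Metric.mem_ball, Subtype.dist_eq, Real.dist_eq, abs_lt]
        constructor <;> linarith [hs.2]
    have hids : ∀ t, α < t → t ≤ s → F.Ids k α t := by
      intro t h1 h2
      refine F.ids_ext hL (fun x hx => (hk x hx).continuousAt.continuousWithinAt) (α := α) (β := s)
        (fun p q hp hpq hq => F.idsU hL hk (by linarith) hpq fun τ hτ => ?_) le_rfl h1 h2
      by_contra hτU
      have := hα2 (mem_insert_of_mem c ⟨hτU, by linarith [hτ.1], by linarith [hτ.2]⟩)
      linarith [hτ.1]
    have g1 := hN α s (by linarith) (by linarith [hs.2]) (by linarith [hs.2]) (fun x y => (hαE x y).2) hids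
    have g2 := hLv α s (by linarith) (by linarith [hs.2]) hαE g1
    refine F.E_of (le_max_of_le_left hN0) fun x y h1 h2 h3 => ⟨?_, ?_⟩
    · exact (g2 s ⟨hαs, le_rfl⟩ y x h1 h2 h3).trans (mlr (le_max_right _ _) (sub_nonneg.2 h2))
    · have := g1 s ⟨hαs, le_rfl⟩ x ⟨h1.trans h2, h3⟩ y ⟨h1, h2.trans h3⟩
      rw [abs_of_nonneg (sub_nonneg.2 h2)] at this
      exact this.trans (mlr (le_max_left _ _) (sub_nonneg.2 h2))
  obtain ⟨p, hp⟩ := exists_nat_ge (max N L)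
  refine ht1B.1 (mem_iUnion.2 ⟨p, mem_interior_iff_mem_nhds.2 ?_⟩)
  filter_upwards [Icc_mem_nhds (show c < t1 by linarith) (show t1 < t1 + θ by linarith)] with s hs
  exact F.E_mono hp (key s hs)

theorem ids (hL : Law P μ P' μ') {k : ℝ → ℝ} (hk : ∀ x, 0 < x → HasDerivAt k (μ x / x) x) {s t : ℝ}
    (hs : 0 ≤ s) (hst : s < t) : F.Ids k s t :=
  F.ids_ext hL (fun x hx => (hk x hx).continuousAt.continuousWithinAt) (α := 0) (β := t)
    (fun _ _ hp hpq _ => F.idsU hL hk hp hpq fun _ hτ => F.GU_all hL hk (hp.trans_le hτ.1)) hs hst le_rfl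
end Fl

theorem ciI {f : ℝ → ℝ} (hf : ContinuousOn f (Icc 0 1)) {p q : ℝ} (hp : p ∈ 𝕀)
    (hq : q ∈ 𝕀) : IntervalIntegrable f volume p q :=
  ContinuousOn.intervalIntegrable (hf.mono (uIcc_subset_Icc hp hq))

theorem contBd {g : ℝ → ℝ} {C : ℝ} (hC : 0 ≤ C) (hg : ContinuousOn g (Icc 0 1))
    (h : ∀ m ∈ 𝕀, ∀ m' ∈ 𝕀, |∫ x in m'..m, g x| ≤ C * |m - m'|) :
    ∀ m ∈ 𝕀, |g m| ≤ C := by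
  have h1 : ∀ m ∈ 𝕁, |g m| ≤ C := by
    intro m hm
    have hm' : m ∈ 𝕀 := ⟨hm.1.le, hm.2.le⟩
    have hd : HasDerivAt (fun x => ∫ y in 0..x, g y) (g m) m :=
      iHD (ciI hg ⟨le_rfl, zero_le_one⟩ hm')
        ((hg.mono Ioo_subset_Icc_self).stronglyMeasurableAtFilter isOpen_Ioo m hm)
        (hg.continuousAt (Icc_mem_nhds hm.1 hm.2))
    refine hd.le_of_lip' hC ?_
    filter_upwards [Icc_mem_nhds hm.1 hm.2] with x hx
    rw [iISL (ciI hg ⟨le_rfl, zero_le_one⟩ hx)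
      (ciI hg ⟨le_rfl, zero_le_one⟩ hm')]
    exact h x hx m hm'
  intro m hm
  have hne : (𝓝[𝕁] m).NeBot := by
    rw [← mem_closure_iff_nhdsWithin_neBot, closure_Ioo (by norm_num)]; exact hm
  refine le_of_tendsto ((hg m hm).mono_left (nhdsWithin_mono _ Ioo_subset_Icc_self)).abs ?_
  filter_upwards [self_mem_nhdsWithin] with x hx using h1 x hx

namespace Fl
variable {P μ : ℝ → ℝ} {Pe : ℝ} (F : Fl P μ Pe) {P' μ' : ℝ → ℝ}

noncomputable def rm (t m : ℝ) : ℝ := F.ρx (t, F.X t m) * (F.rh t m)⁻¹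
noncomputable def zz (t m : ℝ) : ℝ := F.vh t m + μ (F.rh t m) / F.rh t m * F.rm t m

theorem cX (t : ℝ) : Continuous (F.X t) := F.X_cont.comp (Continuous.prodMk_right t)
theorem crh (t : ℝ) : Continuous (F.rh t) := F.rh_cont.comp (Continuous.prodMk_right t)
theorem cvh (t : ℝ) : Continuous (F.vh t) := F.vh_cont.comp (Continuous.prodMk_right t)
theorem cch {h : ℝ → ℝ} (hh : ContinuousOn h (Ioi 0)) (t : ℝ) : Continuous fun m => h (F.rh t m) :=
  (F.comp_rh hh).comp (Continuous.prodMk_right t)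
theorem cct {h : ℝ → ℝ} (hh : ContinuousOn h (Ioi 0)) (m : ℝ) : Continuous fun t => h (F.rh t m) :=
  (F.comp_rh hh).comp (Continuous.prodMk_left m)
theorem crm (t : ℝ) : ContinuousOn (F.rm t) (Icc 0 1) :=
  ((F.cρx t).comp (F.cX t).continuousOn fun _ h => F.X_mem h).mul
    ((F.crh t).inv₀ fun m => (F.rh_pos t m).ne').continuousOn
theorem cvm {t : ℝ} (ht : 0 < t) : ContinuousOn (F.vm t) (Icc 0 1) :=
  ((F.cvx t ht).comp (F.cX t).continuousOn fun _ h => F.X_mem h).mul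
    ((F.crh t).inv₀ fun m => (F.rh_pos t m).ne').continuousOn

theorem rh_m (t : ℝ) {m : ℝ} (hm : m ∈ 𝕁) : HasDerivAt (F.rh t) (F.rm t m) m :=
  (F.hρx' (F.X_memo hm)).comp m (F.X_der t m)

theorem ftc {f f' : ℝ → ℝ} (hd : ∀ x, 0 < x → HasDerivAt f (f' x) x) (hc : ContinuousOn f' (Ioi 0))
    (t : ℝ) {p q : ℝ} (hp : p ∈ 𝕀) (hq : q ∈ 𝕀) :
    ∫ m in p..q, f' (F.rh t m) * F.rm t m = f (F.rh t q) - f (F.rh t p) := by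
  have hfc : ContinuousOn f (Ioi 0) := fun x hx => (hd x hx).continuousAt.continuousWithinAt
  refine intervalIntegral.integral_eq_sub_of_hasDeriv_right (F.cch hfc t).continuousOn (fun m hm => ?_)
    (ciI ((F.cch hc t).continuousOn.mul (F.crm t)) hp hq)
  have hm' : m ∈ 𝕁 := ⟨(le_min hp.1 hq.1).trans_lt hm.1, hm.2.trans_le (max_le hp.2 hq.2)⟩
  exact ((hd _ (F.rh_pos t m)).comp m (F.rh_m t hm')).hasDerivWithinAt

theorem rxB (hL : Law P μ P' μ') {k : ℝ → ℝ} (hk : ∀ x, 0 < x → HasDerivAt k (μ x / x) x) {T : ℝ}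
    (hT : 0 < T) : ∃ N, 0 ≤ N ∧ ∀ t ∈ Icc 0 T, ∀ x ∈ Icc (F.a t) (F.b t), |F.ρx (t, x)| ≤ N := by
  obtain ⟨δ, hδ, hg⟩ := F.gapρ hL hk 0 T
  obtain ⟨B, hB⟩ := isCompact_Icc.exists_bound_of_continuousOn (F.cρx 0)
  have h0 : ∀ x y, |F.ρ (0, x) - F.ρ (0, y)| ≤ max B 0 * |x - y| := by
    have hab := (F.hab 0).le
    have cl : ∀ x, F.ρ (0, x) = F.ρ (0, (projIcc _ _ hab x : ℝ)) := by
      intro x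
      rcases le_total x (F.a 0) with h | h
      · rw [F.hρl 0 x h, projIcc_of_le_left _ h]
      · rcases le_total x (F.b 0) with h' | h'
        · rw [projIcc_of_mem hab ⟨h, h'⟩]
        · rw [F.hρr 0 x h', projIcc_of_right_le _ h']
    intro x y
    rw [cl x, cl y]
    refine (Convex.norm_image_sub_le_of_norm_hasDerivWithin_le (C := max B 0) (F.hρx 0)
      (fun z hz => (hB z hz).trans (le_max_left _ _)) (convex_Icc _ _) (projIcc _ _ hab y).2 (projIcc _ _ hab x).2).trans ?_
    exact mll (abs_projIcc_sub_projIcc hab) (le_max_right _ _)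
  obtain ⟨N, hN0, hN⟩ := hg (max B 0)
  set c := min δ T with hc
  have hc0 : 0 < c := lt_min hδ hT
  have h1 := hN 0 c le_rfl (min_le_right _ _) (by rw [sub_zero]; exact min_le_left _ _) h0
    fun t h1 _ => F.ids hL hk le_rfl h1
  obtain ⟨n, hn⟩ := isCompact_Icc.elim_directed_cover (fun n : ℕ => interior (F.E n))
    (fun n => isOpen_interior) (s := Icc c T) (fun x hx => F.GU_all hL hk (hc0.trans_le hx.1))
    (Monotone.directed_le fun i j hij => interior_mono (F.E_mono (Nat.cast_le.2 hij)))
  refine ⟨max N n, le_max_of_le_left hN0, fun t ht x hx => ?_⟩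
  rcases le_total t c with h | h
  · exact (derBd (F.hab t) hx (F.hρx t x hx) fun y hy => h1 t ⟨ht.1, h⟩ y hy x hx).trans (le_max_left _ _)
  · exact (F.ρx_le (interior_subset (hn ⟨h, ht.2⟩)) hx).trans (le_max_right _ _)

theorem czz (hL : Law P μ P' μ') (t : ℝ) : ContinuousOn (F.zz t) (Icc 0 1) :=
  (F.cvh t).continuousOn.add ((F.cch (hL.cμ.div continuousOn_id fun _ hx => ne_of_gt hx) t).continuousOn.mul (F.crm t))

theorem zI (hL : Law P μ P' μ') {k : ℝ → ℝ} (hk : ∀ x, 0 < x → HasDerivAt k (μ x / x) x) {s t : ℝ}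
    (hs : 0 ≤ s) (hst : s < t) {m : ℝ} (hm : m ∈ 𝕀) :
    ∫ x in 0..m, (F.zz t x - F.zz s x) = -∫ τ in s..t, (P (F.rh τ m) - P (F.rh τ 0)) := by
  have h0 : (0:ℝ) ∈ 𝕀 := ⟨le_rfl, zero_le_one⟩
  have hc : ContinuousOn (fun x => μ x / x) (Ioi 0) := hL.cμ.div continuousOn_id fun _ hx => ne_of_gt hx
  have i1 : ∀ t, IntervalIntegrable (F.vh t) volume 0 m := fun t => (F.cvh t).intervalIntegrable _ _
  have i2 : ∀ t, IntervalIntegrable (fun m => μ (F.rh t m) / F.rh t m * F.rm t m) volume 0 m := fun t =>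
    ciI ((F.cch hc t).continuousOn.mul (F.crm t)) h0 hm
  have e1 : ∀ t, ∫ x in 0..m, F.zz t x = (∫ x in 0..m, F.vh t x) + (k (F.rh t m) - k (F.rh t 0)) := by
    intro t
    rw [← F.ftc hk hc t h0 hm]
    exact iAdd (i1 t) (i2 t)
  rw [iSub (ciI (F.czz hL t) h0 hm) (ciI (F.czz hL s) h0 hm), e1, e1,
    ← (F.ids hL hk hs hst).C m hm, iSub (i1 t) (i1 s)]
  ring

theorem zLip (hL : Law P μ P' μ') {k : ℝ → ℝ} (hk : ∀ x, 0 < x → HasDerivAt k (μ x / x) x) {T : ℝ}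
    (hT : 0 < T) : ∃ N, 0 < N ∧ (∀ t ∈ Icc 0 T, ∀ m ∈ 𝕀, |P' (F.rh t m) * F.rm t m| ≤ N) ∧
      ∀ s t, 0 ≤ s → s < t → t ≤ T → ∀ m ∈ 𝕀, |F.zz t m - F.zz s m| ≤ N * (t - s) := by
  obtain ⟨B, hB0, hB⟩ := F.rxB hL hk hT
  obtain ⟨Mi, hMi0, hMi⟩ := F.bddi 0 T
  obtain ⟨MP, hMP0, hMP⟩ := F.bddc hL.cP' 0 T
  have hb : ∀ t ∈ Icc 0 T, ∀ m ∈ 𝕀, |P' (F.rh t m) * F.rm t m| ≤ MP * (B * Mi) + 1 := by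
    intro t ht m hm
    have g1 := hB t ht _ (F.X_mem hm)
    have g2 : (F.rh t m)⁻¹ ≤ Mi := hMi t ht _
    have g3 : |P' (F.rh t m)| ≤ MP := hMP t ht _
    have g4 := inv_pos.2 (F.rh_pos t m)
    rw [rm, abs_mul, abs_mul, abs_of_pos g4]
    have := mul_le_mul g3 (mul_le_mul g1 g2 g4.le hB0) (by positivity) hMP0.le
    linarith
  refine ⟨MP * (B * Mi) + 1, by positivity, hb, fun s t hs hst htT => ?_⟩
  have hp := sub_pos.2 hst
  have h0 : (0:ℝ) ∈ 𝕀 := ⟨le_rfl, zero_le_one⟩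
  have hd : ContinuousOn (fun m => F.zz t m - F.zz s m) (Icc 0 1) := (F.czz hL t).sub (F.czz hL s)
  refine contBd (by positivity) hd fun m hm m' hm' => ?_
  have hPc : ∀ m, Continuous fun τ => P (F.rh τ m) := F.cct hL.cP
  have ip : ∀ m, IntervalIntegrable (fun τ => P (F.rh τ m) - P (F.rh τ 0)) volume s t := fun m =>
    ((hPc m).sub (hPc 0)).intervalIntegrable _ _
  rw [← iISL (ciI hd h0 hm) (ciI hd h0 hm'), F.zI hL hk hs hst hm,
    F.zI hL hk hs hst hm', neg_sub_neg, ← iSub (ip m') (ip m),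
    ← Real.norm_eq_abs]
  refine (iNorm (C := (MP * (B * Mi) + 1) * |m - m'|) fun τ hτ => ?_).trans ?_
  · rw [uIoc_of_le hst.le] at hτ
    have hτ' : τ ∈ Icc 0 T := ⟨hs.trans hτ.1.le, hτ.2.trans htT⟩
    rw [sub_sub_sub_cancel_right, ← F.ftc hL.dP hL.cP' τ hm hm', abs_sub_comm m]
    refine iNorm fun x hx => hb τ hτ' x ?_
    exact uIcc_subset_Icc hm hm' (uIoc_subset_uIcc hx)
  · rw [abs_of_pos hp]; exact le_of_eq (by ring)
end Fl

theorem tInt {g : ℝ → ℝ} (hg : Continuous g) (t : ℝ) :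
    Tendsto (fun s => (t - s)⁻¹ * ∫ τ in s..t, g τ) (𝓝[<] t) (𝓝 (g t)) := by
  have hd := (hg.integral_hasStrictDerivAt t t).hasDerivAt
  rw [hasDerivAt_iff_tendsto_slope] at hd
  refine (hd.mono_left (nhdsWithin_mono t fun x hx => ne_of_lt hx)).congr fun s => ?_
  rw [slope_def_field, iSame, sub_zero, intervalIntegral.integral_symm,
    ← neg_sub t s, neg_div_neg_eq, div_eq_inv_mul]

theorem tayl {f f1 f2 : ℝ → ℝ} (h1 : ∀ x, 0 < x → HasDerivAt f (f1 x) x)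
    (h2 : ∀ x, 0 < x → HasDerivAt f1 (f2 x) x) (hc : ContinuousOn f2 (Ioi 0)) {lo : ℝ} (hlo : 0 < lo) (hi : ℝ) :
    ∃ C, 0 ≤ C ∧ ∀ a ∈ Icc lo hi, ∀ b ∈ Icc lo hi, |f a - f b - f1 a * (a - b)| ≤ C * (a - b) ^ 2 := by
  obtain ⟨B, hB⟩ := isCompact_Icc.exists_bound_of_continuousOn
    (hc.mono fun x (hx : x ∈ Icc lo hi) => hlo.trans_le hx.1)
  refine ⟨max B 0, le_max_right _ _, fun a ha b hb => ?_⟩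
  have hs : uIcc a b ⊆ Icc lo hi := uIcc_subset_Icc ha hb
  have hp : ∀ x ∈ uIcc a b, 0 < x := fun x hx => hlo.trans_le (hs hx).1
  have l1 : ∀ x ∈ uIcc a b, |f1 x - f1 a| ≤ max B 0 * |a - b| := by
    intro x hx
    refine (Convex.norm_image_sub_le_of_norm_hasDerivWithin_le (C := max B 0)
      (fun z hz => (h2 z (hp z hz)).hasDerivWithinAt)
      (fun z hz => (hB z (hs hz)).trans (le_max_left _ _)) (convex_uIcc a b) left_mem_uIcc hx).trans ?_
    refine mll ?_ (le_max_right _ _)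
    rw [Real.norm_eq_abs, abs_sub_comm a b]
    exact abs_sub_left_of_mem_uIcc hx
  have := Convex.norm_image_sub_le_of_norm_hasDerivWithin_le (f := fun x => f x - f1 a * x)
    (f' := fun x => f1 x - f1 a * 1) (C := max B 0 * |a - b|) (s := uIcc a b)
      (fun z hz => ((h1 z (hp z hz)).fun_sub ((hasDerivAt_id z).const_mul (f1 a))).hasDerivWithinAt)
      (fun z hz => by rw [mul_one]; exact l1 z hz) (convex_uIcc a b) right_mem_uIcc left_mem_uIcc
  rw [Real.norm_eq_abs, Real.norm_eq_abs, mul_assoc, ← abs_mul, abs_of_nonneg (mul_self_nonneg (a - b)), ← sq] at this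
  refine le_trans (le_of_eq ?_) this
  congr 1; ring

namespace Fl
variable {P μ : ℝ → ℝ} {Pe : ℝ} (F : Fl P μ Pe) {P' μ' : ℝ → ℝ}

theorem zW (hL : Law P μ P' μ') {k : ℝ → ℝ} (hk : ∀ x, 0 < x → HasDerivAt k (μ x / x) x) {t : ℝ} (ht : 0 < t)
    {g : ℝ → ℝ} (hg : ContinuousOn g (Icc 0 1)) :
    Tendsto (fun s => ∫ m in 0..1, (t - s)⁻¹ * (F.zz t m - F.zz s m) * g m) (𝓝[<] t)
      (𝓝 (∫ m in 0..1, -(P' (F.rh t m) * F.rm t m) * g m)) := by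
  obtain ⟨N, hN0, hN1, hN2⟩ := F.zLip hL hk ht
  have h0 : (0:ℝ) ∈ 𝕀 := ⟨le_rfl, zero_le_one⟩
  have hPc : ∀ m, Continuous fun τ => P (F.rh τ m) := F.cct hL.cP
  refine weakConv (L := N) zero_le_one (Eventually.of_forall fun s =>
    continuousOn_const.mul ((F.czz hL t).sub (F.czz hL s)))
    ((F.cch hL.cP' t).continuousOn.mul (F.crm t)).neg ?_ (fun m hm => ?_) (fun m hm => ?_) hg
  · filter_upwards [Ioo_mem_nhdsLT ht] with s hs m hm
    have hp := sub_pos.2 hs.2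
    rw [abs_mul, abs_of_pos (inv_pos.2 hp), inv_mul_le_iff₀ hp, mul_comm]
    exact hN2 s t hs.1.le hs.2 le_rfl m hm
  · rw [abs_neg]; exact hN1 t ⟨ht.le, le_rfl⟩ m hm
  · rw [intervalIntegral.integral_neg, F.ftc hL.dP hL.cP' t h0 hm]
    refine ((tInt ((hPc m).sub (hPc 0)) t).neg).congr' ?_
    filter_upwards [Ioo_mem_nhdsLT ht] with s hs
    rw [iCM, F.zI hL hk hs.1.le hs.2 hm, mul_neg]
    rfl

theorem cθ (t : ℝ) : Continuous fun m => (F.rh t m)⁻¹ := (F.crh t).inv₀ fun m => (F.rh_pos t m).ne'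

theorem θW (hL : Law P μ P' μ') {k : ℝ → ℝ} (hk : ∀ x, 0 < x → HasDerivAt k (μ x / x) x) {t : ℝ} (ht : 0 < t) :
    (∃ L, 0 ≤ L ∧ ∀ᶠ s in 𝓝[<] t, ∀ m ∈ 𝕀, |(F.rh t m)⁻¹ - (F.rh s m)⁻¹| ≤ L * (t - s)) ∧
    ∀ {g : ℝ → ℝ}, ContinuousOn g (Icc 0 1) →
    Tendsto (fun s => ∫ m in 0..1, (t - s)⁻¹ * ((F.rh t m)⁻¹ - (F.rh s m)⁻¹) * g m) (𝓝[<] t)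
      (𝓝 (∫ m in 0..1, F.vm t m * g m)) := by
  have h0 : (0:ℝ) ∈ 𝕀 := ⟨le_rfl, zero_le_one⟩
  obtain ⟨n, hn⟩ := mem_iUnion.1 (F.GU_all hL hk ht)
  obtain ⟨δ, hδ, hb⟩ := Metric.isOpen_iff.1 isOpen_interior t hn
  have hE : ∀ s ∈ Ioc (t - δ) t, s ∈ F.E n := fun s hs => interior_subset (hb (by
    rw [Metric.mem_ball, Real.dist_eq, abs_sub_lt_iff]; constructor <;> linarith [hs.1, hs.2]))
  obtain ⟨C, hC0, hC⟩ := F.bddi (t / 2) t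
  have hev : ∀ᶠ s in 𝓝[<] t, s ∈ Ioo (max (t - δ) (t / 2)) t :=
    Ioo_mem_nhdsLT (max_lt (by linarith) (by linarith))
  have hE' : ∀ s ∈ Ioo (max (t - δ) (t / 2)) t, 0 < s ∧ t / 2 < s ∧ ∀ τ ∈ Icc s t, τ ∈ F.E n := fun s hs => by
    have h1 := (le_max_right _ _).trans_lt hs.1
    have h2 := (le_max_left _ _).trans_lt hs.1
    exact ⟨by linarith, h1, fun τ hτ => hE τ ⟨h2.trans_le hτ.1, hτ.2⟩⟩
  have tE := hE t ⟨by linarith, le_rfl⟩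
  have hvm : ∀ τ ∈ Icc (t / 2) t, τ ∈ F.E n → ∀ m ∈ 𝕀, |F.vm τ m| ≤ n * C :=
    fun τ hτ h m hm => F.vm_le hC (by linarith) hτ h hm
  have hcd : ∀ s, ContinuousOn (fun m => (F.rh t m)⁻¹ - (F.rh s m)⁻¹) (Icc 0 1) := fun s =>
    ((F.cθ t).sub (F.cθ s)).continuousOn
  have hXi : ∀ t m, ∫ x in 0..m, (F.rh t x)⁻¹ = F.X t m - F.X t 0 := fun t m =>
    intervalIntegral.integral_eq_sub_of_hasDerivAt (f := F.X t) (fun x _ => F.X_der t x)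
      ((F.cθ t).intervalIntegrable _ _)
  have hbd : ∀ s ∈ Ioo (max (t - δ) (t / 2)) t, ∀ m ∈ 𝕀,
      |(F.rh t m)⁻¹ - (F.rh s m)⁻¹| ≤ n * C * (t - s) := by
    intro s hs
    obtain ⟨e1, e2, e3⟩ := hE' s hs
    have hIoo : ∀ m ∈ 𝕁, |(F.rh t m)⁻¹ - (F.rh s m)⁻¹| ≤ n * C * (t - s) := by
      intro m hm
      rw [F.θ_int e1 hs.2.le e3 hm, ← abs_of_pos (sub_pos.2 hs.2), ← Real.norm_eq_abs (∫ τ in s..t, _)]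
      refine iNorm fun τ hτ => ?_
      rw [uIoc_of_le hs.2.le] at hτ
      exact hvm τ ⟨(e2.trans hτ.1).le, hτ.2⟩ (e3 τ ⟨hτ.1.le, hτ.2⟩) m ⟨hm.1.le, hm.2.le⟩
    intro m hm
    have hcl : m ∈ closure 𝕁 := by rw [closure_Ioo (by norm_num)]; exact hm
    exact (isClosed_le ((F.cθ t).sub (F.cθ s)).abs continuous_const).closure_subset_iff.2 hIoo hcl
  refine ⟨⟨n * C, by positivity, hev.mono hbd⟩, fun {g} hg => ?_⟩
  refine weakConv (L := n * C) zero_le_one (Eventually.of_forall fun s =>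
    continuousOn_const.mul (hcd s)) (F.cvm ht) ?_ (hvm t ⟨by linarith, le_rfl⟩ tE) (fun m hm => ?_) hg
  · filter_upwards [hev] with s hs m hm
    have hp := sub_pos.2 hs.2
    rw [abs_mul, abs_of_pos (inv_pos.2 hp), inv_mul_le_iff₀ hp, mul_comm]
    exact hbd s hs m hm
  · have hvc : ∀ m, Continuous fun τ => F.vh τ m := fun m => F.vh_cont.comp (Continuous.prodMk_left m)
    have e : ∫ y in 0..m, F.vm t y = F.vh t m - F.vh t 0 := by
      refine intervalIntegral.integral_eq_sub_of_hasDeriv_right (F.cvh t).continuousOn (fun x hx => ?_)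
        (ciI (F.cvm ht) h0 hm)
      rw [min_eq_left hm.1, max_eq_right hm.1] at hx
      exact (F.vh_m ht ⟨hx.1, hx.2.trans_le hm.2⟩).hasDerivWithinAt
    rw [e]
    refine (tInt ((hvc m).sub (hvc 0)) t).congr' ?_
    filter_upwards [hev] with s hs
    obtain ⟨e1, e2, e3⟩ := hE' s hs
    rw [iCM, iSub
      ((F.cθ t).intervalIntegrable _ _) ((F.cθ s).intervalIntegrable _ _), hXi, hXi,
      show F.X t m - F.X t 0 - (F.X s m - F.X s 0) = (F.X t m - F.X s m) - (F.X t 0 - F.X s 0) by ring,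
      F.X_int e1 hs.2.le e3 hm, F.X_int e1 hs.2.le e3 h0]
    congr 1
    exact iSub ((hvc m).intervalIntegrable _ _) ((hvc 0).intervalIntegrable _ _)

theorem nlW (hL : Law P μ P' μ') {k : ℝ → ℝ} (hk : ∀ x, 0 < x → HasDerivAt k (μ x / x) x) {t : ℝ} (ht : 0 < t)
    {f f1 f2 : ℝ → ℝ} (h1 : ∀ x, 0 < x → HasDerivAt f (f1 x) x)
    (h2 : ∀ x, 0 < x → HasDerivAt f1 (f2 x) x) (hc : ContinuousOn f2 (Ioi 0))
    {g : ℝ → ℝ} (hg : ContinuousOn g (Icc 0 1)) :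
    Tendsto (fun s => (t - s)⁻¹ * ∫ m in 0..1, (f (F.rh t m)⁻¹ - f (F.rh s m)⁻¹) * g m) (𝓝[<] t)
      (𝓝 (∫ m in 0..1, F.vm t m * (f1 (F.rh t m)⁻¹ * g m))) := by
  have h0 : (0:ℝ) ∈ 𝕀 := ⟨le_rfl, zero_le_one⟩
  have h1' : (1:ℝ) ∈ 𝕀 := ⟨zero_le_one, le_rfl⟩
  have inv0 : ContinuousOn (fun x : ℝ => x⁻¹) (Ioi 0) := continuousOn_id.inv₀ fun x hx => ne_of_gt hx
  have mp : MapsTo (fun x : ℝ => x⁻¹) (Ioi 0) (Ioi 0) := fun x (hx : 0 < x) => show 0 < x⁻¹ from inv_pos.2 hx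
  have cf : ContinuousOn f (Ioi 0) := fun x hx => (h1 x hx).continuousAt.continuousWithinAt
  have cf1 : ContinuousOn f1 (Ioi 0) := fun x hx => (h2 x hx).continuousAt.continuousWithinAt
  have kf : ∀ s, Continuous fun m => f (F.rh s m)⁻¹ := fun s => F.cch (cf.comp inv0 mp) s
  have kf1 : ∀ s, Continuous fun m => f1 (F.rh s m)⁻¹ := fun s => F.cch (cf1.comp inv0 mp) s
  obtain ⟨⟨L, hL0, hev⟩, hW⟩ := F.θW hL hk ht
  obtain ⟨C, hC0, hC⟩ := F.bddi 0 t
  obtain ⟨D, hD0, hD⟩ := F.bddρ 0 t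
  obtain ⟨M, hM0, hM⟩ := tayl h1 h2 hc (inv_pos.2 hD0) C
  obtain ⟨B, hB⟩ := isCompact_Icc.exists_bound_of_continuousOn hg
  have hB0 : 0 ≤ B := (norm_nonneg _).trans (hB 0 h0)
  have hlim := hW (g := fun m => f1 (F.rh t m)⁻¹ * g m) ((kf1 t).continuousOn.mul hg)
  have herr : Tendsto (fun s => (t - s)⁻¹ * ∫ m in 0..1, (f (F.rh t m)⁻¹ - f (F.rh s m)⁻¹
      - f1 (F.rh t m)⁻¹ * ((F.rh t m)⁻¹ - (F.rh s m)⁻¹)) * g m) (𝓝[<] t) (𝓝 0) := by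
    have h3 : Tendsto (fun s => M * L ^ 2 * B * (t - s)) (𝓝[<] t) (𝓝 0) := by
      have : Continuous fun s => M * L ^ 2 * B * (t - s) := by fun_prop
      exact (this.tendsto' t 0 (by simp)).mono_left nhdsWithin_le_nhds
    refine squeeze_zero_norm' ?_ h3
    filter_upwards [hev, Ioo_mem_nhdsLT ht] with s hs hs'
    have hp := sub_pos.2 hs'.2
    rw [norm_mul, norm_inv, Real.norm_of_nonneg hp.le, inv_mul_le_iff₀ hp]
    refine (iNorm (C := M * (L * (t - s)) ^ 2 * B) fun m hm => ?_).trans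
      (le_of_eq ?_)
    · rw [uIoc_of_le zero_le_one] at hm
      have hm' : m ∈ 𝕀 := ⟨hm.1.le, hm.2⟩
      rw [norm_mul]
      have hI : ∀ s ∈ Icc 0 t, (F.rh s m)⁻¹ ∈ Icc D⁻¹ C := fun s hs =>
        ⟨inv_anti₀ (F.rh_pos s m) (hD s hs _), hC s hs _⟩
      refine mul_le_mul ((hM _ (hI t ⟨ht.le, le_rfl⟩) _ (hI s ⟨hs'.1.le, hs'.2.le⟩)).trans ?_) (hB m hm')
        (norm_nonneg _) (by positivity)
      exact mll (sq_le_sq' (abs_le.1 (hs m hm')).1 (abs_le.1 (hs m hm')).2) hM0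
    · rw [sub_zero, abs_one]; ring
  have := hlim.add herr
  rw [add_zero] at this
  refine this.congr fun s => ?_
  have i1 : IntervalIntegrable (fun m => (f (F.rh t m)⁻¹ - f (F.rh s m)⁻¹
      - f1 (F.rh t m)⁻¹ * ((F.rh t m)⁻¹ - (F.rh s m)⁻¹)) * g m) volume 0 1 :=
    ciI (((((kf t).sub (kf s)).sub ((kf1 t).mul ((F.cθ t).sub (F.cθ s)))).continuousOn).mul hg) h0 h1'
  have i2 : IntervalIntegrable (fun m => (t - s)⁻¹ * ((F.rh t m)⁻¹ - (F.rh s m)⁻¹) * (f1 (F.rh t m)⁻¹ * g m)) volume 0 1 :=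
    ciI ((continuous_const.mul ((F.cθ t).sub (F.cθ s))).continuousOn.mul ((kf1 t).continuousOn.mul hg)) h0 h1'
  rw [← iCM, ← iCM, ← iAdd i2 (i1.const_mul _)]
  congr 1; ext m; ring
end Fl

theorem hinv {f f' : ℝ → ℝ} (h : ∀ x, 0 < x → HasDerivAt f (f' x) x) (x : ℝ) (hx : 0 < x) :
    HasDerivAt (fun y => f y⁻¹) (-(f' x⁻¹ / x ^ 2)) x :=
  ((h _ (inv_pos.2 hx)).comp x (hasDerivAt_inv hx.ne')).congr_deriv (by rw [div_eq_mul_inv]; ring)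

theorem cinv {f : ℝ → ℝ} (h : ContinuousOn f (Ioi 0)) : ContinuousOn (fun x => f x⁻¹) (Ioi 0) :=
  h.comp (continuousOn_id.inv₀ fun x hx => ne_of_gt hx) fun x (hx : 0 < x) => show 0 < x⁻¹ from inv_pos.2 hx

theorem sqI {f g : ℝ → ℝ} (hf : ContinuousOn f (Icc 0 1)) (hg : ContinuousOn g (Icc 0 1)) :
    (1 / 2) * (∫ m in 0..1, f m ^ 2) - (1 / 2) * (∫ m in 0..1, g m ^ 2)
      ≤ ∫ m in 0..1, (f m - g m) * f m := by
  have h0 : (0:ℝ) ∈ 𝕀 := ⟨le_rfl, zero_le_one⟩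
  have h1 : (1:ℝ) ∈ 𝕀 := ⟨zero_le_one, le_rfl⟩
  rw [← mul_sub, ← iSub (ciI (hf.fun_pow 2) h0 h1) (ciI (hg.fun_pow 2) h0 h1),
    ← iCM]
  have a1 : ContinuousOn (fun m => 1 / 2 * (f m ^ 2 - g m ^ 2)) (Icc 0 1) := 
    continuousOn_const.mul ((hf.pow 2).sub (hg.pow 2))
  refine intervalIntegral.integral_mono_on zero_le_one (ciI a1 h0 h1) (ciI ((hf.sub hg).mul hf) h0 h1) fun m _ => ?_
  show 1 / 2 * (f m ^ 2 - g m ^ 2) ≤ (f m - g m) * f m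
  nlinarith [sq_nonneg (f m - g m)]

namespace Fl
variable {P μ : ℝ → ℝ} {Pe : ℝ} (F : Fl P μ Pe) {P' μ' : ℝ → ℝ}

noncomputable def Vl (k q : ℝ → ℝ) (r t : ℝ) : ℝ :=
  (1 / 2) * (∫ m in 0..1, F.zz t m ^ 2) + (1 / 2) * (F.vh t 1 - k (F.rh t 1)) ^ 2
    + (1 / 2) * (F.vh t 0 + k (F.rh t 0)) ^ 2
    + r * ((1 / 2) * F.vh t 0 ^ 2 + (1 / 2) * F.vh t 1 ^ 2 + (1 / 2) * ∫ m in 0..1, F.vh t m ^ 2)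
    + (1 + r) * ∫ m in 0..1, q (F.rh t m)

noncomputable def km (t m : ℝ) : ℝ := μ (F.rh t m) / F.rh t m * F.rm t m

noncomputable def Dl (P' k : ℝ → ℝ) (r t : ℝ) : ℝ :=
  (∫ m in 0..1, P' (F.rh t m) * F.rm t m * F.km t m) + k (F.rh t 1) * (P (F.rh t 1) - Pe)
    + k (F.rh t 0) * (P (F.rh t 0) - Pe) + r * ∫ m in 0..1, μ (F.rh t m) * F.rh t m * F.vm t m ^ 2

theorem ckm (hL : Law P μ P' μ') (t : ℝ) : ContinuousOn (F.km t) (Icc 0 1) :=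
  (F.cch (hL.cμ.div continuousOn_id fun _ hx => ne_of_gt hx) t).continuousOn.mul (F.crm t)

theorem ibp {t : ℝ} (ht : 0 < t) {f f' : ℝ → ℝ} (hf : ContinuousOn f (Icc 0 1))
    (hd : ∀ m ∈ 𝕁, HasDerivAt f (f' m) m) (hc : ContinuousOn f' (Icc 0 1)) :
    ∫ m in 0..1, F.vh t m * f' m = F.vh t 1 * f 1 - F.vh t 0 * f 0 - ∫ m in 0..1, F.vm t m * f m := by
  have h0 : (0:ℝ) ∈ 𝕀 := ⟨le_rfl, zero_le_one⟩
  have h1 : (1:ℝ) ∈ 𝕀 := ⟨zero_le_one, le_rfl⟩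
  refine intervalIntegral.integral_mul_deriv_eq_deriv_mul_of_hasDeriv_right (F.cvh t).continuousOn
    (by rwa [uIcc_of_le zero_le_one]) (fun x hx => ?_) (fun x hx => ?_) (ciI (F.cvm ht) h0 h1) (ciI hc h0 h1)
  all_goals rw [min_eq_left zero_le_one, max_eq_right zero_le_one] at hx
  · exact (F.vh_m ht hx).hasDerivWithinAt
  · exact (hd x hx).hasDerivWithinAt

theorem dini (hL : Law P μ P' μ') {k q : ℝ → ℝ} (hk : ∀ x, 0 < x → HasDerivAt k (μ x / x) x)
    (hq : ∀ x, 0 < x → HasDerivAt q ((P x - Pe) / x ^ 2) x) {r : ℝ} (hr : 0 ≤ r) {t : ℝ} (ht : 0 < t)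
    {ε : ℝ} (hε : 0 < ε) : ∀ᶠ s in 𝓝[<] t, F.Vl k q r t - F.Vl k q r s
      ≤ (-F.Dl P' k r t + F.u t * ((r + 1) * F.vh t 0 + k (F.rh t 0)) + ε) * (t - s) := by
  have h0 : (0:ℝ) ∈ 𝕀 := ⟨le_rfl, zero_le_one⟩
  have h1 : (1:ℝ) ∈ 𝕀 := ⟨zero_le_one, le_rfl⟩
  have ck : ContinuousOn k (Ioi 0) := fun x hx => (hk x hx).continuousAt.continuousWithinAt
  have cq : ContinuousOn q (Ioi 0) := fun x hx => (hq x hx).continuousAt.continuousWithinAt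
  have hPc : ∀ m, Continuous fun τ => P (F.rh τ m) := F.cct hL.cP
  have hPm : ContinuousOn (fun m => P' (F.rh t m) * F.rm t m) (Icc 0 1) :=
    (F.cch hL.cP' t).continuousOn.mul (F.crm t)
  have L1 := F.zW hL hk ht (F.czz hL t)
  have L2 := F.zW hL hk ht (F.cvh t).continuousOn
  have L3 : Tendsto (fun s => (t - s)⁻¹ * ((F.vh t 1 - k (F.rh t 1)) - (F.vh s 1 - k (F.rh s 1)))) (𝓝[<] t)
      (𝓝 (P (F.rh t 1) - Pe)) := by
    refine (tInt ((hPc 1).sub continuous_const) t).congr' ?_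
    filter_upwards [Ioo_mem_nhdsLT ht] with s hs
    rw [(F.ids hL hk hs.1.le hs.2).B]; rfl
  have L4 : Tendsto (fun s => (t - s)⁻¹ * ((F.vh t 0 + k (F.rh t 0)) - (F.vh s 0 + k (F.rh s 0)))) (𝓝[<] t)
      (𝓝 (F.u t + Pe - P (F.rh t 0))) := by
    refine (tInt ((F.hu.add continuous_const).sub (hPc 0)) t).congr' ?_
    filter_upwards [Ioo_mem_nhdsLT ht] with s hs
    rw [(F.ids hL hk hs.1.le hs.2).A]; rfl
  have L5 := F.nlW hL hk ht (f := fun x => k x⁻¹) (f1 := fun x => -(μ x⁻¹ / x))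
    (f2 := fun x => μ' x⁻¹ / x ^ 3 + μ x⁻¹ / x ^ 2) (fun x hx => (hinv hk x hx).congr_deriv (by field_simp))
    (fun x hx => ((hinv hL.dμ x hx).fun_div (hasDerivAt_id x) hx.ne').fun_neg.congr_deriv (by
      simp only [id]; field_simp; ring))
    (((cinv hL.cμ').div (continuousOn_id.pow 3) fun x hx => pow_ne_zero _ (ne_of_gt hx)).add
      ((cinv hL.cμ).div (continuousOn_id.pow 2) fun x hx => pow_ne_zero _ (ne_of_gt hx))) (F.cvm ht)
  have L6 := F.nlW hL hk ht (f := fun x => q x⁻¹) (f1 := fun x => -(P x⁻¹ - Pe)) (f2 := fun x => P' x⁻¹ / x ^ 2)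
    (fun x hx => (hinv hq x hx).congr_deriv (by field_simp))
    (fun x hx => ((hinv hL.dP x hx).sub_const Pe).fun_neg.congr_deriv (by ring))
    ((cinv hL.cP').div (continuousOn_id.pow 2) fun x hx => pow_ne_zero _ (ne_of_gt hx)) (g := fun _ => 1) continuousOn_const
  simp only [inv_inv, mul_one] at L5 L6
  have Lim := (((L1.add (L3.const_mul (F.vh t 1 - k (F.rh t 1)))).add (L4.const_mul (F.vh t 0 + k (F.rh t 0)))).add
    ((((L4.const_mul (F.vh t 0)).add (L3.const_mul (F.vh t 1))).add (L2.add L5)).const_mul r)).add (L6.const_mul (1 + r))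
  have eD : (∫ m in 0..1, -(P' (F.rh t m) * F.rm t m) * F.zz t m) + (F.vh t 1 - k (F.rh t 1)) * (P (F.rh t 1) - Pe)
      + (F.vh t 0 + k (F.rh t 0)) * (F.u t + Pe - P (F.rh t 0))
      + r * (F.vh t 0 * (F.u t + Pe - P (F.rh t 0)) + F.vh t 1 * (P (F.rh t 1) - Pe)
        + ((∫ m in 0..1, -(P' (F.rh t m) * F.rm t m) * F.vh t m)
          + ∫ m in 0..1, F.vm t m * (-(μ (F.rh t m) / (F.rh t m)⁻¹) * F.vm t m)))
      + (1 + r) * (∫ m in 0..1, F.vm t m * -(P (F.rh t m) - Pe))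
      = -F.Dl P' k r t + F.u t * ((r + 1) * F.vh t 0 + k (F.rh t 0)) := by
    have e1 : ∫ m in 0..1, -(P' (F.rh t m) * F.rm t m) * F.zz t m
        = -(∫ m in 0..1, F.vh t m * (P' (F.rh t m) * F.rm t m)) - ∫ m in 0..1, P' (F.rh t m) * F.rm t m * F.km t m := by
      have i1 : ContinuousOn (fun m => -(F.vh t m * (P' (F.rh t m) * F.rm t m))) (Icc 0 1) :=
        ((F.cvh t).continuousOn.mul hPm).neg
      rw [← intervalIntegral.integral_neg, ← iSub (ciI i1 h0 h1) (ciI (hPm.fun_mul (F.ckm hL t)) h0 h1)]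
      congr 1; ext m; simp only [zz, km]; ring
    have e2 : ∫ m in 0..1, -(P' (F.rh t m) * F.rm t m) * F.vh t m
        = -∫ m in 0..1, F.vh t m * (P' (F.rh t m) * F.rm t m) := by
      rw [← intervalIntegral.integral_neg]; congr 1; ext m; ring
    have e3 := F.ibp ht (f := fun m => P (F.rh t m) - Pe) (f' := fun m => P' (F.rh t m) * F.rm t m)
      ((F.cch hL.cP t).sub continuous_const).continuousOn
      (fun m hm => ((hL.dP _ (F.rh_pos t m)).comp m (F.rh_m t hm)).sub_const Pe) hPm
    have e4 : ∫ m in 0..1, F.vm t m * (-(μ (F.rh t m) / (F.rh t m)⁻¹) * F.vm t m)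
        = -∫ m in 0..1, μ (F.rh t m) * F.rh t m * F.vm t m ^ 2 := by
      rw [← intervalIntegral.integral_neg]; congr 1; ext m; rw [div_inv_eq_mul]; ring
    have e5 : ∫ m in 0..1, F.vm t m * -(P (F.rh t m) - Pe) = -∫ m in 0..1, F.vm t m * (P (F.rh t m) - Pe) := by
      rw [← intervalIntegral.integral_neg]; congr 1; ext m; ring
    rw [e1, e2, e4, e5, e3, Dl]; ring
  rw [eD] at Lim
  filter_upwards [Lim.eventually_lt_const (lt_add_of_pos_right _ hε), Ioo_mem_nhdsLT ht] with s hs hs'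
  have hp := sub_pos.2 hs'.2
  have f1 := sqI (F.czz hL t) (F.czz hL s)
  have f2 := sqI (F.cvh t).continuousOn (F.cvh s).continuousOn (f := F.vh t) (g := F.vh s)
  have f3 : ∫ m in 0..1, (F.vh t m - F.vh s m) * F.vh t m
      = (∫ m in 0..1, (F.zz t m - F.zz s m) * F.vh t m)
        - (F.vh t 1 * (k (F.rh t 1) - k (F.rh s 1)) - F.vh t 0 * (k (F.rh t 0) - k (F.rh s 0))
          - ∫ m in 0..1, (k (F.rh t m) - k (F.rh s m)) * F.vm t m) := by
    have e3 := F.ibp ht (f := fun m => k (F.rh t m) - k (F.rh s m)) (f' := fun m => F.km t m - F.km s m)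
      ((F.cch ck t).sub (F.cch ck s)).continuousOn
      (fun m hm => ((hk _ (F.rh_pos t m)).comp m (F.rh_m t hm)).sub ((hk _ (F.rh_pos s m)).comp m (F.rh_m s hm)))
      ((F.ckm hL t).sub (F.ckm hL s))
    simp only [mul_comm _ (F.vm t _)]
    rw [← e3, ← iSub (ciI (((F.czz hL t).fun_sub (F.czz hL s)).fun_mul (F.cvh t).continuousOn) h0 h1)
      (ciI ((F.cvh t).continuousOn.fun_mul ((F.ckm hL t).fun_sub (F.ckm hL s))) h0 h1)]
    congr 1; ext m; simp only [Pi.sub_apply, Pi.mul_apply, zz, km]; ring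
  have f4 : (∫ m in 0..1, q (F.rh t m)) - (∫ m in 0..1, q (F.rh s m))
      = ∫ m in 0..1, (q (F.rh t m) - q (F.rh s m)) :=
    (iSub ((F.cch cq t).intervalIntegrable _ _) ((F.cch cq s).intervalIntegrable _ _)).symm
  have m1 : ∀ g : ℝ → ℝ, ∫ m in 0..1, (t - s)⁻¹ * (F.zz t m - F.zz s m) * g m
      = (t - s)⁻¹ * ∫ m in 0..1, (F.zz t m - F.zz s m) * g m := fun g => by
    rw [← iCM]; congr 1; ext m; ring
  rw [m1, m1] at hs
  refine le_trans ?_ (mlr hs.le hp.le)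
  have hh : (t - s)⁻¹ * (t - s) = 1 := inv_mul_cancel₀ hp.ne'
  rw [f3] at f2
  generalize (∫ m in 0..1, (F.zz t m - F.zz s m) * F.zz t m) = A at *
  generalize (∫ m in 0..1, (F.zz t m - F.zz s m) * F.vh t m) = B at *
  generalize (∫ m in 0..1, (k (F.rh t m) - k (F.rh s m)) * F.vm t m) = C at *
  generalize (∫ m in 0..1, (q (F.rh t m) - q (F.rh s m))) = D at *
  have goal2 : F.Vl k q r t - F.Vl k q r s ≤ A + (F.vh t 1 - k (F.rh t 1)) * ((F.vh t 1 - k (F.rh t 1)) - (F.vh s 1 - k (F.rh s 1)))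
      + (F.vh t 0 + k (F.rh t 0)) * ((F.vh t 0 + k (F.rh t 0)) - (F.vh s 0 + k (F.rh s 0)))
      + r * (F.vh t 0 * ((F.vh t 0 + k (F.rh t 0)) - (F.vh s 0 + k (F.rh s 0)))
        + F.vh t 1 * ((F.vh t 1 - k (F.rh t 1)) - (F.vh s 1 - k (F.rh s 1))) + (B + C)) + (1 + r) * D := by
    have sq : ∀ x y : ℝ, 1 / 2 * x ^ 2 - 1 / 2 * y ^ 2 ≤ x * (x - y) := fun x y => by nlinarith [sq_nonneg (x - y)]
    have g1 := sq (F.vh t 1 - k (F.rh t 1)) (F.vh s 1 - k (F.rh s 1))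
    have g2 := sq (F.vh t 0 + k (F.rh t 0)) (F.vh s 0 + k (F.rh s 0))
    have g3 := mll (add_le_add (add_le_add (sq (F.vh t 0) (F.vh s 0)) (sq (F.vh t 1) (F.vh s 1))) f2) hr
    rw [Vl, Vl, ← f4]
    linarith
  refine goal2.trans (le_of_eq ?_)
  linear_combination -(A + (F.vh t 1 - k (F.rh t 1)) * ((F.vh t 1 - k (F.rh t 1)) - (F.vh s 1 - k (F.rh s 1)))
      + (F.vh t 0 + k (F.rh t 0)) * ((F.vh t 0 + k (F.rh t 0)) - (F.vh s 0 + k (F.rh s 0)))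
      + r * (F.vh t 0 * ((F.vh t 0 + k (F.rh t 0)) - (F.vh s 0 + k (F.rh s 0)))
        + F.vh t 1 * ((F.vh t 1 - k (F.rh t 1)) - (F.vh s 1 - k (F.rh s 1))) + (B + C)) + (1 + r) * D) * hh
end Fl

structure Sc (P μ : ℝ → ℝ) (Pe ρs : ℝ) (k q : ℝ → ℝ) : Prop where
  ρs0 : 0 < ρs
  Ps : P ρs = Pe
  hk : ∀ x, 0 < x → HasDerivAt k (μ x / x) x
  ks : k ρs = 0
  hq : ∀ x, 0 < x → HasDerivAt q ((P x - Pe) / x ^ 2) x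
  qs : q ρs = 0

theorem posMin {f : ℝ → ℝ} {lo hi : ℝ} (hlo : 0 < lo) (h : lo ≤ hi) (hf : ContinuousOn f (Ioi 0))
    (hp : ∀ x, 0 < x → 0 < f x) : ∃ c, 0 < c ∧ ∀ x ∈ Icc lo hi, c ≤ f x ∧ f x ≤ c⁻¹ := by
  have hs : Icc lo hi ⊆ Ioi 0 := fun x hx => hlo.trans_le hx.1
  obtain ⟨x, hx, hxm⟩ := isCompact_Icc.exists_isMinOn (nonempty_Icc.2 h) (hf.mono hs)
  obtain ⟨y, hy, hym⟩ := isCompact_Icc.exists_isMaxOn (nonempty_Icc.2 h) (hf.mono hs)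
  have py := hp y (hs hy)
  refine ⟨min (f x) (f y)⁻¹, lt_min (hp x (hs hx)) (inv_pos.2 py), fun z hz => ⟨(min_le_left _ _).trans (hxm hz), ?_⟩⟩
  refine (hym hz : f z ≤ f y).trans ?_
  rw [le_inv_comm₀ py (lt_min (hp x (hs hx)) (inv_pos.2 py))]
  exact min_le_right _ _

namespace Sc
variable {P μ P' μ' : ℝ → ℝ} {Pe ρs : ℝ} {k q : ℝ → ℝ}

theorem Pmono (H : Sc P μ Pe ρs k q) (hL : Law P μ P' μ') : StrictMonoOn P (Ioi 0) :=
  strictMonoOn_of_deriv_pos (convex_Ioi 0) hL.cP (fun x hx => by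
    rw [interior_Ioi] at hx; rw [(hL.dP x hx).deriv]; exact hL.P'pos x hx)

theorem qanti (H : Sc P μ Pe ρs k q) (hL : Law P μ P' μ') : AntitoneOn q (Ioc 0 ρs) := by
  refine antitoneOn_of_deriv_nonpos (convex_Ioc 0 ρs) (fun x hx => (H.hq x hx.1).continuousAt.continuousWithinAt)
    (fun x hx => ?_) (fun x hx => ?_) <;> rw [interior_Ioc] at hx
  · exact (H.hq x hx.1).differentiableAt.differentiableWithinAt
  · rw [(H.hq x hx.1).deriv, ← H.Ps]
    exact div_nonpos_of_nonpos_of_nonneg (sub_nonpos.2 (H.Pmono hL hx.1 H.ρs0 hx.2).le) (sq_nonneg _)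

theorem qnn (H : Sc P μ Pe ρs k q) (hL : Law P μ P' μ') {x : ℝ} (hx : 0 < x) : 0 ≤ q x := by
  rcases le_total x ρs with h | h
  · rw [← H.qs]; exact H.qanti hL ⟨hx, h⟩ ⟨H.ρs0, le_rfl⟩ h
  · have : MonotoneOn q (Ici ρs) := by
      refine monotoneOn_of_deriv_nonneg (convex_Ici ρs) (fun x hx => (H.hq x (H.ρs0.trans_le hx)).continuousAt.continuousWithinAt)
        (fun x hx => ?_) (fun x hx => ?_) <;> rw [interior_Ici] at hx
      · exact (H.hq x (H.ρs0.trans hx)).differentiableAt.differentiableWithinAt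
      · rw [(H.hq x (H.ρs0.trans hx)).deriv, ← H.Ps]
        exact div_nonneg (sub_nonneg.2 (H.Pmono hL H.ρs0 (H.ρs0.trans hx) hx).le) (sq_nonneg _)
    rw [← H.qs]; exact this self_mem_Ici h h

theorem qbig (H : Sc P μ Pe ρs k q) (hL : Law P μ P' μ') (S : ℝ) : ∃ δ, 0 < δ ∧ δ ≤ ρs ∧ S < q δ := by
  have h2 : 0 < ρs / 2 := half_pos H.ρs0
  set c := Pe - P (ρs / 2) with hc
  have c0 : 0 < c := by rw [hc, ← H.Ps]; exact sub_pos.2 (H.Pmono hL h2 H.ρs0 (half_lt_self H.ρs0))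
  have an : AntitoneOn (fun x => q x - c * x⁻¹) (Ioc 0 (ρs / 2)) := by
    have hd : ∀ x, 0 < x → HasDerivAt (fun x => q x - c * x⁻¹) ((P x - Pe) / x ^ 2 - c * -(x ^ 2)⁻¹) x := fun x hx =>
      (H.hq x hx).fun_sub ((hasDerivAt_inv hx.ne').const_mul c)
    refine antitoneOn_of_deriv_nonpos (convex_Ioc 0 _) (fun x hx => (hd x hx.1).continuousAt.continuousWithinAt)
      (fun x hx => ?_) (fun x hx => ?_) <;> rw [interior_Ioc] at hx
    · exact (hd x hx.1).differentiableAt.differentiableWithinAt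
    · rw [(hd x hx.1).deriv]
      have := (H.Pmono hL hx.1 h2 hx.2).le
      rw [div_eq_mul_inv, mul_neg, sub_neg_eq_add, ← add_mul]
      exact mul_nonpos_of_nonpos_of_nonneg (by rw [hc]; linarith) (by positivity)
  obtain ⟨A, hA⟩ : ∃ A, A = max (|S| / c + 1 + (ρs / 2)⁻¹) (ρs / 2)⁻¹ := ⟨_, rfl⟩
  have A0 : 0 < A := hA ▸ lt_max_of_lt_right (inv_pos.2 h2)
  have A1 : A⁻¹ ≤ ρs / 2 := by rw [inv_le_comm₀ A0 h2, hA]; exact le_max_right _ _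
  refine ⟨A⁻¹, inv_pos.2 A0, by linarith, ?_⟩
  have := an ⟨inv_pos.2 A0, A1⟩ ⟨h2, le_rfl⟩ A1
  simp only [inv_inv] at this
  have q0 := H.qnn hL h2
  have A2 : |S| / c + 1 + (ρs / 2)⁻¹ ≤ A := hA ▸ le_max_left _ _
  have := mll A2 c0.le
  have e : c * (|S| / c + 1 + (ρs / 2)⁻¹) = |S| + c + c * (ρs / 2)⁻¹ := by field_simp
  linarith [le_abs_self S]

theorem consts (H : Sc P μ Pe ρs k q) (hL : Law P μ P' μ') {lo hi : ℝ} (hlo : 0 < lo) (h1 : lo ≤ ρs) (h2 : ρs ≤ hi) : ∃ c, 0 < c ∧ ∀ x ∈ Icc lo hi,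
    c * k x ^ 2 ≤ k x * (P x - Pe) ∧ c * q x ≤ k x ^ 2 ∧ c ≤ P' x * x / μ x ∧ c ≤ μ x * x ∧
    c * |x - ρs| ≤ |k x| ∧ c * |k x| ≤ |x - ρs| ∧ (c ≤ μ x / x ∧ μ x / x ≤ c⁻¹) ∧ c ≤ x ∧ x ≤ c⁻¹ := by
  have ine : ∀ x ∈ Ioi (0:ℝ), x ≠ 0 := fun x hx => ne_of_gt hx
  have hh := h1.trans h2
  have mo : ContinuousOn (fun x => μ x / x) (Ioi 0) := hL.cμ.div continuousOn_id ine
  have mop : ∀ x, 0 < x → 0 < μ x / x := fun x hx => div_pos (hL.μpos x hx) hx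
  obtain ⟨c1, hc1, C1⟩ := posMin hlo hh ((hL.cP'.fun_mul continuousOn_id).div hL.cμ fun x hx => (hL.μpos x hx).ne')
    (fun x hx => div_pos (mul_pos (hL.P'pos x hx) hx) (hL.μpos x hx))
  obtain ⟨c2, hc2, C2⟩ := posMin hlo hh (hL.cμ.fun_mul continuousOn_id) (fun x hx => mul_pos (hL.μpos x hx) hx)
  obtain ⟨c3, hc3, C3⟩ := posMin hlo hh mo mop
  obtain ⟨c4, hc4, C4⟩ := posMin (f := fun x => x) hlo hh continuousOn_id (fun x hx => hx)
  obtain ⟨Lk, hLk, dk, hdk, bk⟩ := bilip hlo hi H.hk mo mop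
  obtain ⟨LP, hLP, dP, hdP, bP⟩ := bilip hlo hi hL.dP hL.cP' hL.P'pos
  obtain ⟨c, hc⟩ : ∃ c, c = min (min (min c1 c2) (min c3 c4)) (min (min (dP / Lk) (dk ^ 2 * lo ^ 2 / LP)) (min dk Lk⁻¹)) := ⟨_, rfl⟩
  have hs : ρs ∈ Icc lo hi := ⟨h1, h2⟩
  refine ⟨c, by rw [hc]; positivity, fun x hx => ?_⟩
  have i1 : c ≤ c1 := by rw [hc]; simp
  have i2 : c ≤ c2 := by rw [hc]; simp
  have i3 : c ≤ c3 := by rw [hc]; simp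
  have i4 : c ≤ c4 := by rw [hc]; simp
  have i5 : c ≤ dP / Lk := by rw [hc]; simp
  have i6 : c ≤ dk ^ 2 * lo ^ 2 / LP := by rw [hc]; simp
  have i7 : c ≤ dk := by rw [hc]; simp
  have i8 : c ≤ Lk⁻¹ := by rw [hc]; simp
  have c0 : 0 < c := by rw [hc]; positivity
  obtain ⟨-, kl, ku⟩ := bk x hx ρs hs
  rw [H.ks, sub_zero] at kl ku
  have x0 : 0 < x := hlo.trans_le hx.1
  refine ⟨?_, ?_, i1.trans (C1 x hx).1, i2.trans (C2 x hx).1, (mlr i7 (abs_nonneg _)).trans kl, ?_,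
    ⟨i3.trans (C3 x hx).1, (C3 x hx).2.trans (inv_anti₀ c0 i3)⟩, i4.trans (C4 x hx).1, (C4 x hx).2.trans (inv_anti₀ c0 i4)⟩
  · have key : ∀ a b d : ℝ, 0 ≤ d → 0 ≤ a → a ≤ Lk * d → dP * d ≤ b → c * a ^ 2 ≤ a * b := by
      intro a b d hd ha h1 h2
      have : c * a ≤ b := by
        calc c * a ≤ dP / Lk * (Lk * d) := mul_le_mul i5 h1 ha (by positivity)
          _ = dP * d := by field_simp
          _ ≤ b := h2
      nlinarith [mll this ha]
    rcases le_total ρs x with h | h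
    · have a1 := (bk x hx ρs hs).1 h
      have a2 := (bP x hx ρs hs).1 h
      rw [H.ks] at a1; rw [H.Ps] at a2
      have := key (k x) (P x - Pe) (x - ρs) (sub_nonneg.2 h) (by nlinarith [mul_nonneg hdk.le (sub_nonneg.2 h)]) (by linarith) a2.1
      exact this
    · have a1 := (bk ρs hs x hx).1 h
      have a2 := (bP ρs hs x hx).1 h
      rw [H.ks] at a1; rw [H.Ps] at a2
      have := key (-k x) (Pe - P x) (ρs - x) (sub_nonneg.2 h) (by nlinarith [mul_nonneg hdk.le (sub_nonneg.2 h)]) (by linarith) a2.1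
      rw [neg_sq] at this; linarith
  · have hu : uIcc ρs x ⊆ Icc lo hi := uIcc_subset_Icc hs hx
    have := Convex.norm_image_sub_le_of_norm_hasDerivWithin_le (f := q) (C := LP * |x - ρs| / lo ^ 2) (s := uIcc ρs x)
      (fun z hz => (H.hq z (hlo.trans_le (hu hz).1)).hasDerivWithinAt) (fun z hz => ?_) (convex_uIcc _ _) left_mem_uIcc right_mem_uIcc
    · rw [H.qs, sub_zero, Real.norm_eq_abs, Real.norm_eq_abs] at this
      have h3 : q x ≤ LP / lo ^ 2 * |x - ρs| ^ 2 := (le_abs_self _).trans (this.trans (le_of_eq (by ring)))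
      have h4 : (dk * |x - ρs|) ^ 2 ≤ k x ^ 2 := by
        rw [← sq_abs (k x)]; exact pow_le_pow_left₀ (by positivity) kl 2
      calc c * q x ≤ dk ^ 2 * lo ^ 2 / LP * (LP / lo ^ 2 * |x - ρs| ^ 2) := 
            mul_le_mul i6 h3 (H.qnn hL x0) (by positivity)
        _ = (dk * |x - ρs|) ^ 2 := by field_simp
        _ ≤ _ := h4
    · have z0 : 0 < z := hlo.trans_le (hu hz).1
      rw [Real.norm_eq_abs, abs_div, abs_of_nonneg (sq_nonneg z), ← H.Ps]
      refine div_le_div₀ (by positivity) (((bP z (hu hz) ρs hs).2.2).trans ?_) (by positivity)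
        (pow_le_pow_left₀ hlo.le (hu hz).1 2)
      exact mll (abs_sub_left_of_mem_uIcc hz) hLP.le
  · calc c * |k x| ≤ Lk⁻¹ * (Lk * |x - ρs|) := mul_le_mul i8 ku (abs_nonneg _) (by positivity)
      _ = |x - ρs| := by field_simp
end Sc

theorem imono {f g : ℝ → ℝ} (hf : ContinuousOn f (Icc 0 1)) (hg : ContinuousOn g (Icc 0 1))
    (h : ∀ m ∈ 𝕀, f m ≤ g m) : ∫ m in 0..1, f m ≤ ∫ m in 0..1, g m :=
  intervalIntegral.integral_mono_on zero_le_one (ciI hf ⟨le_rfl, zero_le_one⟩ ⟨zero_le_one, le_rfl⟩)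
    (ciI hg ⟨le_rfl, zero_le_one⟩ ⟨zero_le_one, le_rfl⟩) h

theorem inn {f : ℝ → ℝ} (h : ∀ m, 0 ≤ f m) : 0 ≤ ∫ m in 0..1, f m :=
  intervalIntegral.integral_nonneg zero_le_one fun m _ => h m

theorem icl {f g : ℝ → ℝ} (hf : ContinuousOn f (Icc 0 1)) (hg : ContinuousOn g (Icc 0 1)) (x y : ℝ) :
    ∫ m in 0..1, (x * f m + y * g m) = x * (∫ m in 0..1, f m) + y * ∫ m in 0..1, g m := by
  have h0 : (0:ℝ) ∈ 𝕀 := ⟨le_rfl, zero_le_one⟩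
  have h1 : (1:ℝ) ∈ 𝕀 := ⟨zero_le_one, le_rfl⟩
  rw [iAdd ((ciI hf h0 h1).const_mul x) ((ciI hg h0 h1).const_mul y),
    iCM, iCM]

theorem csI {f : ℝ → ℝ} (hf : ContinuousOn f (Icc 0 1)) {m : ℝ} (hm : m ∈ 𝕀) :
    (∫ x in 0..m, f x) ^ 2 ≤ ∫ x in 0..1, f x ^ 2 := by
  have h0 : (0:ℝ) ∈ 𝕀 := ⟨le_rfl, zero_le_one⟩
  have h1 : (1:ℝ) ∈ 𝕀 := ⟨zero_le_one, le_rfl⟩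
  obtain ⟨a, ha⟩ : ∃ a, a = ∫ x in 0..m, f x := ⟨_, rfl⟩
  have i1 := ciI hf h0 hm
  have i2 : IntervalIntegrable (fun x => f x ^ 2) volume 0 m := ciI (hf.fun_pow 2) h0 hm
  have e : ∫ x in 0..m, (f x - a) ^ 2 = (∫ x in 0..m, f x ^ 2) - 2 * a * a + m * a ^ 2 := by
    have : ∀ x, (f x - a) ^ 2 = f x ^ 2 - 2 * a * f x + a ^ 2 := fun x => by ring
    simp only [this]
    rw [iAdd (i2.sub (i1.const_mul _)) intervalIntegrable_const,
      iSub i2 (i1.const_mul _), iCM,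
      iConst, ← ha, sub_zero, smul_eq_mul]
  have p : 0 ≤ ∫ x in 0..m, (f x - a) ^ 2 := intervalIntegral.integral_nonneg hm.1 fun x _ => sq_nonneg _
  have p2 : 0 ≤ ∫ x in m..(1:ℝ), f x ^ 2 := intervalIntegral.integral_nonneg hm.2 fun x _ => sq_nonneg _
  have e2 := iAdj i2 (ciI (hf.fun_pow 2) hm h1)
  rw [← ha]
  nlinarith [mul_nonneg (sub_nonneg.2 hm.2) (sq_nonneg a)]

namespace Fl
variable {P μ : ℝ → ℝ} {Pe ρs : ℝ} {P' μ' k q : ℝ → ℝ}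

noncomputable def Yl (F : Fl P μ Pe) (k : ℝ → ℝ) (t : ℝ) : ℝ :=
  (∫ m in 0..1, F.km t m ^ 2) + k (F.rh t 0) ^ 2 + k (F.rh t 1) ^ 2 + F.vh t 0 ^ 2 + F.vh t 1 ^ 2
    + ∫ m in 0..1, F.vh t m ^ 2

theorem YV (F : Fl P μ Pe) (hL : Law P μ P' μ') (H : Sc P μ Pe ρs k q) {r : ℝ} (hr : 0 < r) (t : ℝ) :
    F.Yl k t ≤ (4 + 6 / r) * F.Vl k q r t ∧ ∫ m in 0..1, q (F.rh t m) ≤ F.Vl k q r t := by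
  have q0 : 0 ≤ ∫ m in 0..1, q (F.rh t m) := inn fun m => H.qnn hL (F.rh_pos t m)
  have z0 : 0 ≤ ∫ m in 0..1, F.zz t m ^ 2 := inn fun m => sq_nonneg _
  have v0 : 0 ≤ ∫ m in 0..1, F.vh t m ^ 2 := inn fun m => sq_nonneg _
  have zc : ContinuousOn (fun m => F.zz t m ^ 2) (Icc 0 1) := (F.czz hL t).fun_pow 2
  have vc : ContinuousOn (fun m => F.vh t m ^ 2) (Icc 0 1) := (F.cvh t).continuousOn.fun_pow 2
  have kz : ∫ m in 0..1, F.km t m ^ 2 ≤ 2 * (∫ m in 0..1, F.zz t m ^ 2) + 2 * ∫ m in 0..1, F.vh t m ^ 2 := by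
    rw [← icl zc vc]
    refine imono ((F.ckm hL t).fun_pow 2) ((continuousOn_const.fun_mul zc).fun_add (continuousOn_const.fun_mul vc)) fun m _ => ?_
    have : F.zz t m = F.vh t m + F.km t m := rfl
    rw [this]; nlinarith [sq_nonneg (2 * F.vh t m + F.km t m)]
  rw [Vl, Yl]
  generalize (∫ m in 0..1, q (F.rh t m)) = A at *
  generalize (∫ m in 0..1, F.zz t m ^ 2) = B at *
  generalize (∫ m in 0..1, F.vh t m ^ 2) = C at *
  generalize (∫ m in 0..1, F.km t m ^ 2) = D at *
  generalize F.vh t 0 = x at *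
  generalize F.vh t 1 = y at *
  generalize k (F.rh t 0) = κ at *
  generalize k (F.rh t 1) = l at *
  have n1 : 0 ≤ r * (1 / 2 * x ^ 2 + 1 / 2 * y ^ 2 + 1 / 2 * C) := by positivity
  constructor
  · have s1 : κ ^ 2 ≤ 2 * (x + κ) ^ 2 + 2 * x ^ 2 := by nlinarith [sq_nonneg (2 * x + κ)]
    have s2 : l ^ 2 ≤ 2 * (y - l) ^ 2 + 2 * y ^ 2 := by nlinarith [sq_nonneg (2 * y - l)]
    have e : (4 + 6 / r) * (1 / 2 * B + 1 / 2 * (y - l) ^ 2 + 1 / 2 * (x + κ) ^ 2 + r * (1 / 2 * x ^ 2 + 1 / 2 * y ^ 2 + 1 / 2 * C) + (1 + r) * A)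
       = 2 * B + 2 * (y - l) ^ 2 + 2 * (x + κ) ^ 2 + 3 * (x ^ 2 + y ^ 2 + C)
        + (6 / r * (1 / 2 * B + 1 / 2 * (y - l) ^ 2 + 1 / 2 * (x + κ) ^ 2 + (1 + r) * A)
          + 4 * (r * (1 / 2 * x ^ 2 + 1 / 2 * y ^ 2 + 1 / 2 * C)) + 4 * ((1 + r) * A)) := by field_simp; ring
    rw [e]
    have : 0 ≤ (6 / r * (1 / 2 * B + 1 / 2 * (y - l) ^ 2 + 1 / 2 * (x + κ) ^ 2 + (1 + r) * A)
          + 4 * (r * (1 / 2 * x ^ 2 + 1 / 2 * y ^ 2 + 1 / 2 * C)) + 4 * ((1 + r) * A)) := by positivity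
    linarith
  · nlinarith [sq_nonneg (y - l), sq_nonneg (x + κ), mul_nonneg hr.le q0]

theorem bnd (hL : Law P μ P' μ') (H : Sc P μ Pe ρs k q) {g : ℝ → ℝ}
    (hg : ∀ x, 0 < x → HasDerivAt g (μ x / x * √(q x)) x) (g1 : Tendsto g atTop atTop)
    (g0 : Tendsto g (𝓝[>] 0) atBot) (k1 : Tendsto k atTop atTop) {r : ℝ} (hr : 0 < r) (S : ℝ) :
    ∃ lo hi, 0 < lo ∧ lo ≤ ρs ∧ ρs ≤ hi ∧ ∀ (F : Fl P μ Pe) (t : ℝ), F.Vl k q r t ≤ S →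
      ∀ m ∈ 𝕀, F.rh t m ∈ Icc lo hi := by
  obtain ⟨C, hC⟩ : ∃ C, C = (4 + 6 / r) * S := ⟨_, rfl⟩
  have ine : ∀ x ∈ Ioi (0:ℝ), x ≠ 0 := fun x hx => ne_of_gt hx
  have cq : ContinuousOn q (Ioi 0) := fun x hx => (H.hq x hx).continuousAt.continuousWithinAt
  have cg' : ContinuousOn (fun x => μ x / x * √(q x)) (Ioi 0) := (hL.cμ.div continuousOn_id ine).mul cq.sqrt
  have gm : MonotoneOn g (Ioi 0) := by
    refine monotoneOn_of_deriv_nonneg (convex_Ioi 0) (fun x hx => (hg x hx).continuousAt.continuousWithinAt)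
      (fun x hx => ?_) (fun x hx => ?_) <;> rw [interior_Ioi] at hx
    · exact (hg x hx).differentiableAt.differentiableWithinAt
    · rw [(hg x hx).deriv]
      exact mul_nonneg (div_nonneg (hL.μpos x hx).le (le_of_lt hx)) (Real.sqrt_nonneg _)
  obtain ⟨h0, hh0⟩ := eventually_atTop.1 (k1.eventually_gt_atTop (C + 1))
  obtain ⟨h1, hh1⟩ := eventually_atTop.1 (g1.eventually_gt_atTop (g (max h0 ρs) + (S + C)))
  obtain ⟨δ, hδ, hδs, hδq⟩ := H.qbig hL S
  obtain ⟨η, hη, hη'⟩ := mem_nhdsGT_iff_exists_Ioo_subset.1 (g0.eventually_lt_atBot (g δ - (S + C)))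
  have hη : 0 < η := hη
  refine ⟨min η ρs, max h1 ρs, lt_min hη H.ρs0, min_le_right _ _, le_max_right _ _, fun F t hV => ?_⟩
  obtain ⟨y1, y2⟩ := F.YV hL H hr t
  have y1 : F.Yl k t ≤ C := y1.trans (hC ▸ mll hV (by positivity))
  rw [Yl] at y1
  have v0 : 0 ≤ ∫ m in 0..1, F.vh t m ^ 2 := inn fun m => sq_nonneg _
  have k0 : 0 ≤ ∫ m in 0..1, F.km t m ^ 2 := inn fun m => sq_nonneg _
  have hκ : k (F.rh t 0) ≤ C + 1 := by
    nlinarith [sq_nonneg (k (F.rh t 0) - 1), sq_nonneg (k (F.rh t 1)), sq_nonneg (F.vh t 0), sq_nonneg (F.vh t 1), sq_nonneg (k (F.rh t 0))]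
  have hKC : ∫ m in 0..1, F.km t m ^ 2 ≤ C := by
    nlinarith [sq_nonneg (k (F.rh t 1)), sq_nonneg (F.vh t 0), sq_nonneg (F.vh t 1), sq_nonneg (k (F.rh t 0))]
  have cqr : ContinuousOn (fun m => q (F.rh t m)) (Icc 0 1) := (F.cch cq t).continuousOn
  have ck2 : ContinuousOn (fun m => F.km t m ^ 2) (Icc 0 1) := (F.ckm hL t).fun_pow 2
  have osc : ∀ p ∈ 𝕀, ∀ p' ∈ 𝕀, g (F.rh t p) - g (F.rh t p') ≤ S + C := by
    intro p hp p' hp'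
    have hI : ContinuousOn (fun m => μ (F.rh t m) / F.rh t m * √(q (F.rh t m)) * F.rm t m) (Icc 0 1) :=
      (F.cch cg' t).continuousOn.mul (F.crm t)
    rw [← F.ftc hg cg' t hp' hp]
    refine (le_abs_self _).trans ?_
    rw [← Real.norm_eq_abs]
    refine intervalIntegral.norm_integral_le_integral_norm_uIoc.trans ?_
    have hsub : uIoc p' p ⊆ Ioc 0 1 := by
      intro x hx
      exact ⟨(le_min hp'.1 hp.1).trans_lt hx.1, hx.2.trans (max_le hp'.2 hp.2)⟩
    have hI' := hI.norm
    refine (setIntegral_mono_set ((ciI hI' ⟨le_rfl, zero_le_one⟩ ⟨zero_le_one, le_rfl⟩).1)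
      (Eventually.of_forall fun x => norm_nonneg _) (HasSubset.Subset.eventuallyLE hsub)).trans ?_
    rw [← intervalIntegral.integral_of_le zero_le_one]
    have := icl cqr ck2 1 1
    refine (imono hI' ((continuousOn_const.fun_mul cqr).fun_add (continuousOn_const.fun_mul ck2)) fun m _ => ?_).trans
      (this.le.trans (by linarith))
    have qp := H.qnn hL (F.rh_pos t m)
    rw [show μ (F.rh t m) / F.rh t m * √(q (F.rh t m)) * F.rm t m = √(q (F.rh t m)) * F.km t m by rw [km]; ring,
      norm_mul, Real.norm_eq_abs, Real.norm_eq_abs]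
    have e1 := Real.sq_sqrt qp
    rw [← sq_abs] at e1
    have e2 := sq_abs (F.km t m)
    nlinarith [sq_nonneg (|√(q (F.rh t m))| - |F.km t m|), sq_nonneg (F.km t m)]
  have z0 : (0:ℝ) ∈ 𝕀 := ⟨le_rfl, zero_le_one⟩
  have hr0 : F.rh t 0 ≤ max h0 ρs := by
    by_contra hc
    exact absurd hκ (not_le.2 (hh0 _ ((le_max_left _ _).trans (not_le.1 hc).le)))
  have hm0 : ∃ m0 ∈ 𝕀, δ ≤ F.rh t m0 := by
    by_contra hc
    push Not at hc
    have := imono (f := fun _ => q δ) continuousOn_const cqr fun m hm =>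
      H.qanti hL ⟨F.rh_pos t m, (hc m hm).le.trans hδs⟩ ⟨hδ, hδs⟩ (hc m hm).le
    rw [iConst, sub_zero, one_smul] at this
    linarith
  obtain ⟨m0, hm0, hm0'⟩ := hm0
  intro m hm
  constructor
  · refine (min_le_left _ _).trans (not_lt.1 fun hc => ?_)
    have a1 : g (F.rh t m) < g δ - (S + C) := hη' ⟨F.rh_pos t m, hc⟩
    have a2 := osc m0 hm0 m hm
    have a3 := gm hδ (F.rh_pos t m0) hm0'
    linarith
  · refine le_trans (not_lt.1 fun hc => ?_) (le_max_left _ _)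
    have a1 := hh1 _ hc.le
    have a2 := osc m hm 0 z0
    have a3 := gm (F.rh_pos t 0) (lt_max_of_lt_right H.ρs0) hr0
    linarith
end Fl

def Cst (P μ P' k q : ℝ → ℝ) (Pe ρs c x : ℝ) : Prop :=
    c * k x ^ 2 ≤ k x * (P x - Pe) ∧ c * q x ≤ k x ^ 2 ∧ c ≤ P' x * x / μ x ∧ c ≤ μ x * x ∧
    c * |x - ρs| ≤ |k x| ∧ c * |k x| ≤ |x - ρs| ∧ (c ≤ μ x / x ∧ μ x / x ≤ c⁻¹) ∧ c ≤ x ∧ x ≤ c⁻¹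

namespace Fl
variable {P μ : ℝ → ℝ} {Pe ρs : ℝ} {P' μ' k q : ℝ → ℝ}

theorem km_int (F : Fl P μ Pe) (hL : Law P μ P' μ') (H : Sc P μ Pe ρs k q) (t : ℝ) {m : ℝ} (hm : m ∈ 𝕀) :
    ∫ x in 0..m, F.km t x = k (F.rh t m) - k (F.rh t 0) :=
  F.ftc H.hk (hL.cμ.div continuousOn_id fun _ hx => ne_of_gt hx) t ⟨le_rfl, zero_le_one⟩ hm

theorem kpt (F : Fl P μ Pe) (hL : Law P μ P' μ') (H : Sc P μ Pe ρs k q) (t : ℝ) {m : ℝ} (hm : m ∈ 𝕀) :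
    k (F.rh t m) ^ 2 ≤ 2 * k (F.rh t 0) ^ 2 + 2 * ∫ x in 0..1, F.km t x ^ 2 := by
  have := csI (F.ckm hL t) hm
  rw [F.km_int hL H t hm] at this
  nlinarith [sq_nonneg (k (F.rh t m) - 2 * k (F.rh t 0))]

theorem VY (F : Fl P μ Pe) (hL : Law P μ P' μ') (H : Sc P μ Pe ρs k q) {r : ℝ} (hr : 0 < r) {t c : ℝ} (hc : 0 < c)
    (h : ∀ m ∈ 𝕀, Cst P μ P' k q Pe ρs c (F.rh t m)) :
    F.Vl k q r t ≤ (1 + r + (1 + r) * (2 / c)) * F.Yl k t := by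
  have cq : ContinuousOn q (Ioi 0) := fun x hx => (H.hq x hx).continuousAt.continuousWithinAt
  have z0 : 0 ≤ ∫ m in 0..1, F.km t m ^ 2 := inn fun m => sq_nonneg _
  have v0 : 0 ≤ ∫ m in 0..1, F.vh t m ^ 2 := inn fun m => sq_nonneg _
  have kc : ContinuousOn (fun m => F.km t m ^ 2) (Icc 0 1) := (F.ckm hL t).fun_pow 2
  have vc : ContinuousOn (fun m => F.vh t m ^ 2) (Icc 0 1) := (F.cvh t).continuousOn.fun_pow 2
  have zk : ∫ m in 0..1, F.zz t m ^ 2 ≤ 2 * (∫ m in 0..1, F.km t m ^ 2) + 2 * ∫ m in 0..1, F.vh t m ^ 2 := by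
    rw [← icl kc vc]
    refine imono ((F.czz hL t).fun_pow 2) ((continuousOn_const.fun_mul kc).fun_add (continuousOn_const.fun_mul vc)) fun m _ => ?_
    have : F.zz t m = F.vh t m + F.km t m := rfl
    rw [this]; nlinarith [sq_nonneg (F.vh t m - F.km t m)]
  have qk : ∫ m in 0..1, q (F.rh t m) ≤ 2 / c * (k (F.rh t 0) ^ 2 + ∫ x in 0..1, F.km t x ^ 2) := by
    have := imono (F.cch cq t).continuousOn (g := fun _ => 2 / c * (k (F.rh t 0) ^ 2 + ∫ x in 0..1, F.km t x ^ 2)) continuousOn_const fun m hm => by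
      have h1 := (h m hm).2.1
      have h2 := F.kpt hL H t hm
      rw [div_mul_eq_mul_div, le_div_iff₀ hc]; linarith
    rwa [iConst, sub_zero, one_smul] at this
  rw [Vl, Yl]
  generalize (∫ m in 0..1, q (F.rh t m)) = A at *
  generalize (∫ m in 0..1, F.zz t m ^ 2) = B at *
  generalize (∫ m in 0..1, F.vh t m ^ 2) = C at *
  generalize (∫ m in 0..1, F.km t m ^ 2) = D at *
  generalize F.vh t 0 = x at *
  generalize F.vh t 1 = y at *
  generalize k (F.rh t 0) = κ at *
  generalize k (F.rh t 1) = l at *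
  obtain ⟨d, hd⟩ : ∃ d, d = 2 / c := ⟨_, rfl⟩
  have d0 : 0 < d := by rw [hd]; positivity
  rw [← hd] at qk ⊢
  have a1 := mll qk (by positivity : 0 ≤ 1 + r)
  have a2 : 1 / 2 * (y - l) ^ 2 ≤ y ^ 2 + l ^ 2 := by nlinarith [sq_nonneg (y + l)]
  have a3 : 1 / 2 * (x + κ) ^ 2 ≤ x ^ 2 + κ ^ 2 := by nlinarith [sq_nonneg (x - κ)]
  have a4 : 0 ≤ r * (D + κ ^ 2 + l ^ 2 + 1 / 2 * x ^ 2 + 1 / 2 * y ^ 2 + 1 / 2 * C) + (1 + r) * d * (l ^ 2 + x ^ 2 + y ^ 2 + C) := by positivity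
  linarith

theorem diss (F : Fl P μ Pe) (hL : Law P μ P' μ') (H : Sc P μ Pe ρs k q) {r R : ℝ} (hr : 0 < r) (hR : 0 < R)
    {t c : ℝ} (ht : 0 < t) (hc : 0 < c) (h : ∀ m ∈ 𝕀, Cst P μ P' k q Pe ρs c (F.rh t m)) :
    min c (min (r * c) R) / 11 * F.Yl k t ≤ F.Dl P' k r t + R * ((r + 1) * F.vh t 0 + k (F.rh t 0)) ^ 2 := by
  have h0 : (0:ℝ) ∈ 𝕀 := ⟨le_rfl, zero_le_one⟩
  have h1 : (1:ℝ) ∈ 𝕀 := ⟨zero_le_one, le_rfl⟩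
  have z0 : 0 ≤ ∫ m in 0..1, F.km t m ^ 2 := inn fun m => sq_nonneg _
  have w0 : 0 ≤ ∫ m in 0..1, F.vm t m ^ 2 := inn fun m => sq_nonneg _
  have kc : ContinuousOn (fun m => F.km t m ^ 2) (Icc 0 1) := (F.ckm hL t).fun_pow 2
  have wc : ContinuousOn (fun m => F.vm t m ^ 2) (Icc 0 1) := (F.cvm ht).fun_pow 2
  have a1 : c * (∫ m in 0..1, F.km t m ^ 2) ≤ ∫ m in 0..1, P' (F.rh t m) * F.rm t m * F.km t m := by
    rw [← iCM]
    refine imono (continuousOn_const.fun_mul kc) (((F.cch hL.cP' t).continuousOn.fun_mul (F.crm t)).fun_mul (F.ckm hL t)) fun m hm => ?_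
    have hp := F.rh_pos t m
    have hμ := (hL.μpos _ hp).ne'
    rw [show P' (F.rh t m) * F.rm t m * F.km t m = P' (F.rh t m) * F.rh t m / μ (F.rh t m) * F.km t m ^ 2 by
      rw [km]; field_simp]
    exact mlr (h m hm).2.2.1 (sq_nonneg _)
  have a2 : c * (∫ m in 0..1, F.vm t m ^ 2) ≤ ∫ m in 0..1, μ (F.rh t m) * F.rh t m * F.vm t m ^ 2 := by
    rw [← iCM]
    exact imono (continuousOn_const.fun_mul wc) (((F.cch hL.cμ t).continuousOn.fun_mul (F.crh t).continuousOn).fun_mul wc)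
      fun m hm => mlr (h m hm).2.2.2.1 (sq_nonneg _)
  have a3 : ∀ m ∈ 𝕀, F.vh t m ^ 2 ≤ 2 * F.vh t 0 ^ 2 + 2 * ∫ m in 0..1, F.vm t m ^ 2 := by
    intro m hm
    have := csI (F.cvm ht) hm
    have e : ∫ y in 0..m, F.vm t y = F.vh t m - F.vh t 0 := by
      refine intervalIntegral.integral_eq_sub_of_hasDeriv_right (F.cvh t).continuousOn (fun x hx => ?_)
        (ciI (F.cvm ht) h0 hm)
      rw [min_eq_left hm.1, max_eq_right hm.1] at hx
      exact (F.vh_m ht ⟨hx.1, hx.2.trans_le hm.2⟩).hasDerivWithinAt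
    rw [e] at this
    nlinarith [sq_nonneg (F.vh t m - 2 * F.vh t 0)]
  have a4 := imono ((F.cvh t).continuousOn.fun_pow 2) (g := fun _ => 2 * F.vh t 0 ^ 2 + 2 * ∫ m in 0..1, F.vm t m ^ 2) continuousOn_const a3
  rw [iConst, sub_zero, one_smul] at a4
  have a5 := a3 1 h1
  have a6 := (h 0 h0).1
  have a7 := (h 1 h1).1
  obtain ⟨e, he⟩ : ∃ e, e = min c (min (r * c) R) := ⟨_, rfl⟩
  have e1 : e ≤ c := he ▸ min_le_left _ _
  have e2 : e ≤ r * c := he ▸ (min_le_right _ _).trans (min_le_left _ _)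
  have e3 : e ≤ R := he ▸ (min_le_right _ _).trans (min_le_right _ _)
  have e0 : 0 < e := by rw [he]; positivity
  rw [← he, Dl, Yl]
  generalize (∫ m in 0..1, F.km t m ^ 2) = A at *
  generalize (∫ m in 0..1, F.vm t m ^ 2) = B at *
  generalize (∫ m in 0..1, F.vh t m ^ 2) = C at *
  generalize (∫ m in 0..1, P' (F.rh t m) * F.rm t m * F.km t m) = D1 at *
  generalize (∫ m in 0..1, μ (F.rh t m) * F.rh t m * F.vm t m ^ 2) = D2 at *
  generalize F.vh t 0 = x at *
  generalize F.vh t 1 = y at *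
  generalize k (F.rh t 0) = κ at *
  generalize k (F.rh t 1) = l at *
  obtain ⟨w, hw⟩ : ∃ w, w = (r + 1) * x + κ := ⟨_, rfl⟩
  rw [← hw]
  have b1 : x ^ 2 ≤ 2 * w ^ 2 + 2 * κ ^ 2 := by
    have : ((r + 1) * x) ^ 2 ≤ 2 * w ^ 2 + 2 * κ ^ 2 := by rw [hw]; nlinarith [sq_nonneg ((r + 1) * x + 2 * κ)]
    nlinarith [mul_nonneg hr.le (sq_nonneg x), mul_nonneg (sq_nonneg r) (sq_nonneg x)]
  have b2 : A + κ ^ 2 + l ^ 2 + x ^ 2 + y ^ 2 + C ≤ 11 * (A + κ ^ 2 + l ^ 2 + w ^ 2 + B) := by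
    nlinarith [sq_nonneg κ, sq_nonneg l, sq_nonneg w]
  have b3 := mll b2 e0.le
  have c1 := mlr e1 z0
  have c2 := mlr e1 (sq_nonneg κ)
  have c3 := mlr e1 (sq_nonneg l)
  have c4 := mlr e3 (sq_nonneg w)
  have c5 := mlr e2 w0
  have c6 := mll a2 hr.le
  linarith

theorem Vcont (F : Fl P μ Pe) (hL : Law P μ P' μ') (H : Sc P μ Pe ρs k q) (r : ℝ) {T : ℝ} (hT : 0 < T) :
    ContinuousOn (F.Vl k q r) (Icc 0 T) := by
  have h0 : (0:ℝ) ∈ 𝕀 := ⟨le_rfl, zero_le_one⟩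
  have h1 : (1:ℝ) ∈ 𝕀 := ⟨zero_le_one, le_rfl⟩
  have ck : ContinuousOn k (Ioi 0) := fun x hx => (H.hk x hx).continuousAt.continuousWithinAt
  have cq : ContinuousOn q (Ioi 0) := fun x hx => (H.hq x hx).continuousAt.continuousWithinAt
  have cv : ∀ m, Continuous fun t => F.vh t m := fun m => F.vh_cont.comp (Continuous.prodMk_left m)
  have ci : ∀ {f : ℝ → ℝ → ℝ}, Continuous (fun p : ℝ × ℝ => f p.1 p.2) → Continuous fun t => ∫ m in 0..1, f t m := fun h =>
    intervalIntegral.continuous_parametric_intervalIntegral_of_continuous' h 0 1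
  have zc : ContinuousOn (fun t => ∫ m in 0..1, F.zz t m ^ 2) (Icc 0 T) := by
    obtain ⟨N, hN0, -, hN⟩ := F.zLip hL H.hk hT
    obtain ⟨B, hB⟩ := isCompact_Icc.exists_bound_of_continuousOn (F.czz hL T)
    have hN' : ∀ s ∈ Icc 0 T, ∀ t ∈ Icc 0 T, ∀ m ∈ 𝕀, |F.zz t m - F.zz s m| ≤ N * |t - s| := by
      intro s hs t ht m hm
      rcases lt_trichotomy s t with h | h | h
      · rw [abs_of_pos (sub_pos.2 h)]; exact hN s t hs.1 h ht.2 m hm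
      · simp [h]
      · rw [abs_sub_comm, abs_sub_comm t, abs_of_pos (sub_pos.2 h)]; exact hN t s ht.1 h hs.2 m hm
    have hbd : ∀ s ∈ Icc 0 T, ∀ m ∈ 𝕀, |F.zz s m| ≤ B + N * T := by
      intro s hs m hm
      have a1 := hN' s hs T ⟨hT.le, le_rfl⟩ m hm
      have a2 : |F.zz T m| ≤ B := hB m hm
      rw [abs_of_nonneg (sub_nonneg.2 hs.2)] at a1
      have := mll (sub_le_self T hs.1) hN0.le
      have := abs_sub_abs_le_abs_sub (F.zz s m) (F.zz T m)
      rw [abs_sub_comm] at this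
      linarith
    have hC : 0 ≤ B + N * T := (abs_nonneg _).trans (hbd 0 ⟨le_rfl, hT.le⟩ 0 h0)
    refine LipschitzOnWith.continuousOn (K := ⟨N * (2 * (B + N * T)), by positivity⟩)
      (LipschitzOnWith.of_dist_le_mul fun t ht s hs => ?_)
    rw [Real.dist_eq, Real.dist_eq, ← iSub (ciI ((F.czz hL t).fun_pow 2) h0 h1) (ciI ((F.czz hL s).fun_pow 2) h0 h1)]
    refine (absInt (C := N * (2 * (B + N * T)) * |t - s|) fun m hm => ?_).trans (by rw [sub_zero, abs_one, mul_one]; exact le_rfl)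
    rw [uIoc_of_le zero_le_one] at hm
    have hm' : m ∈ 𝕀 := ⟨hm.1.le, hm.2⟩
    rw [sq_sub_sq, abs_mul, mul_comm]
    have b1 := hN' s hs t ht m hm'
    have b2 : |F.zz t m + F.zz s m| ≤ 2 * (B + N * T) := (abs_add_le _ _).trans (by linarith [hbd t ht m hm', hbd s hs m hm'])
    exact (mul_le_mul b1 b2 (abs_nonneg _) (by positivity)).trans (le_of_eq (by ring))
  have cw := ci (f := fun t m => F.vh t m ^ 2) (F.vh_cont.pow 2)
  have cQ := ci (f := fun t m => q (F.rh t m)) (F.comp_rh cq)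
  have d1 : Continuous fun t => (1 / 2) * (F.vh t 1 - k (F.rh t 1)) ^ 2 := continuous_const.mul (((cv 1).sub (F.cct ck 1)).pow 2)
  have d2 : Continuous fun t => (1 / 2) * (F.vh t 0 + k (F.rh t 0)) ^ 2 := continuous_const.mul (((cv 0).add (F.cct ck 0)).pow 2)
  have d3 : Continuous fun t => r * ((1 / 2) * F.vh t 0 ^ 2 + (1 / 2) * F.vh t 1 ^ 2 + (1 / 2) * ∫ m in 0..1, F.vh t m ^ 2) :=
    continuous_const.mul (((continuous_const.mul ((cv 0).pow 2)).add (continuous_const.mul ((cv 1).pow 2))).add (continuous_const.mul cw))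
  exact (((((continuousOn_const.fun_mul zc).fun_add d1.continuousOn).fun_add d2.continuousOn).fun_add d3.continuousOn).fun_add
    (continuous_const.mul cQ).continuousOn)

theorem expV (hL : Law P μ P' μ') (H : Sc P μ Pe ρs k q) {g : ℝ → ℝ}
    (hg : ∀ x, 0 < x → HasDerivAt g (μ x / x * √(q x)) x) (g1 : Tendsto g atTop atTop)
    (g0 : Tendsto g (𝓝[>] 0) atBot) (k1 : Tendsto k atTop atTop) {r R : ℝ} (hr : 0 < r) (hR : 0 < R) (S : ℝ) :
    ∃ c σ, 0 < c ∧ 0 < σ ∧ ∀ F : Fl P μ Pe, (∀ t, 0 < t → F.u t = -R * ((r + 1) * F.vh t 0 + k (F.rh t 0))) →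
      F.Vl k q r 0 ≤ S → ∀ t, 0 ≤ t → (∀ m ∈ 𝕀, Cst P μ P' k q Pe ρs c (F.rh t m)) ∧
        F.Vl k q r t ≤ F.Vl k q r 0 * Real.exp (-σ * t) := by
  obtain ⟨lo, hi, hlo, hlo1, hhi, hb⟩ := bnd hL H hg g1 g0 k1 hr S
  obtain ⟨c, hc, hcs⟩ := H.consts hL hlo hlo1 hhi
  have e0 : 0 < min c (min (r * c) R) / 11 := by positivity
  have C0 : 0 < 1 + r + (1 + r) * (2 / c) := by positivity
  refine ⟨c, min c (min (r * c) R) / 11 / (1 + r + (1 + r) * (2 / c)), hc, div_pos e0 C0, fun F hu hV => ?_⟩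
  have Ynn : ∀ t, 0 ≤ F.Yl k t := fun t => by
    have z0 : 0 ≤ ∫ m in 0..1, F.km t m ^ 2 := inn fun m => sq_nonneg _
    have v0 : 0 ≤ ∫ m in 0..1, F.vh t m ^ 2 := inn fun m => sq_nonneg _
    rw [Yl]; positivity
  have mono : ∀ t, 0 ≤ t → F.Vl k q r t ≤ F.Vl k q r 0 := by
    intro T hT
    rcases hT.eq_or_lt with rfl | hT0
    · exact le_rfl
    have := decay (c := 0) hT (F.Vcont hL H r hT0) fun t ht ε hε => ?_
    · simpa using this
    obtain ⟨M1, hM1, b1⟩ := F.bddi 0 T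
    obtain ⟨M2, hM2, b2⟩ := F.bddρ 0 T
    obtain ⟨c', hc', hcs'⟩ := H.consts hL (lo := min M1⁻¹ ρs) (hi := max M2 ρs) (lt_min (inv_pos.2 hM1) H.ρs0) (min_le_right _ _) (le_max_right _ _)
    have ht' : t ∈ Icc 0 T := ⟨ht.1.le, ht.2⟩
    have hd := F.diss hL H hr hR ht.1 hc' fun m _ => hcs' (F.rh t m)
      ⟨(min_le_left _ _).trans (inv_le_of_inv_le₀ (F.rh_pos t m) (b1 t ht' _)), (b2 t ht' _).trans (le_max_left _ _)⟩
    have hd0 := (mul_nonneg (by positivity) (Ynn t)).trans hd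
    filter_upwards [F.dini hL H.hk H.hq hr.le ht.1 hε, self_mem_nhdsWithin] with s hs hs'
    refine hs.trans (mlr ?_ (sub_nonneg.2 (le_of_lt hs')))
    rw [hu t ht.1]; nlinarith
  have hC : ∀ t, 0 ≤ t → ∀ m ∈ 𝕀, Cst P μ P' k q Pe ρs c (F.rh t m) := fun t ht m hm =>
    hcs _ (hb F t ((mono t ht).trans hV) m hm)
  intro T hT
  refine ⟨hC T hT, ?_⟩
  rcases hT.eq_or_lt with rfl | hT0
  · simp
  refine decay hT (F.Vcont hL H r hT0) fun t ht ε hε => ?_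
  have hd := F.diss hL H hr hR ht.1 hc (hC t ht.1.le)
  have hv := F.VY hL H hr hc (hC t ht.1.le)
  filter_upwards [F.dini hL H.hk H.hq hr.le ht.1 hε, self_mem_nhdsWithin] with s hs hs'
  refine hs.trans (mlr ?_ (sub_nonneg.2 (le_of_lt hs')))
  have : min c (min (r * c) R) / 11 / (1 + r + (1 + r) * (2 / c)) * F.Vl k q r t ≤ min c (min (r * c) R) / 11 * F.Yl k t := by
    rw [div_mul_eq_mul_div, div_le_iff₀ C0, mul_assoc]
    exact mll (hv.trans (le_of_eq (mul_comm _ _))) e0.le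
  rw [hu t ht.1]; nlinarith
end Fl

theorem iI {f : ℝ → ℝ} (hf : ContinuousOn f (Ioi 0)) {s x : ℝ} (hs : 0 < s) (hx : 0 < x) :
    HasDerivAt (fun y => ∫ τ in s..y, f τ) (f x) x :=
  iHD
    ((hf.mono fun _ h => (lt_min hs hx).trans_le h.1).intervalIntegrable)
    (hf.stronglyMeasurableAtFilter isOpen_Ioi x hx) (hf.continuousAt (Ioi_mem_nhds hx))

theorem scal {P μ P' : ℝ → ℝ} {Pe ρs : ℝ} (hP : ContDiffOn ℝ 2 P (Ioi 0)) (hμ : ContDiffOn ℝ 2 μ (Ioi 0))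
    (hPpos : ∀ x, 0 < x → 0 < P x) (hμpos : ∀ x, 0 < x → 0 < μ x)
    (hP' : ∀ x, 0 < x → HasDerivAt P (P' x) x)
    (hP'pos : ∀ x, 0 < x → 0 < P' x) (hρs : 0 < ρs) (hPρs : P ρs = Pe) :
    Law P μ P' (deriv μ) ∧ Sc P μ Pe ρs (kf μ ρs) (fun x => Qf P ρs x / x) ∧
      ∀ x, 0 < x → HasDerivAt (Gf P μ ρs) (μ x / x * √(Qf P ρs x / x)) x := by
  have cP := hP.continuousOn
  have cμ := hμ.continuousOn
  have c1 : ContinuousOn (fun τ => P τ / τ ^ 2) (Ioi 0) :=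
    cP.div (by fun_prop) fun x hx => pow_ne_zero _ (ne_of_gt hx)
  have c2 : ContinuousOn (fun τ => μ τ / τ) (Ioi 0) := cμ.div continuousOn_id fun x hx => ne_of_gt hx
  have dQ : ∀ x, 0 < x → HasDerivAt (Qf P ρs)
      (1 * (∫ τ in ρs..x, P τ / τ ^ 2) + x * (P x / x ^ 2) - P ρs / ρs * 1) x := fun x hx =>
    (((hasDerivAt_id x).fun_mul (iI c1 hρs hx)).fun_sub ((hasDerivAt_id x).const_mul _)).add_const _
  refine ⟨⟨hP', fun x hx => ((hμ.differentiableOn two_ne_zero).differentiableAt (Ioi_mem_nhds hx)).hasDerivAt,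
    (hP.continuousOn_deriv_of_isOpen isOpen_Ioi (by norm_num)).congr fun x hx => (hP' x hx).deriv.symm,
    hμ.continuousOn_deriv_of_isOpen isOpen_Ioi (by norm_num), hPpos, hμpos, hP'pos⟩,
    ⟨hρs, hPρs, fun x hx => iI c2 hρs hx, iSame, fun x hx => ?_, ?_⟩, fun x hx => ?_⟩
  · refine ((dQ x hx).fun_div (hasDerivAt_id x) hx.ne').congr_deriv ?_
    simp only [id, Qf, ← hPρs]
    field_simp
    ring
  · simp only [Qf, iSame]
    field_simp
    ring
  · have : ContinuousOn (fun l => μ l / l ^ ((3 : ℝ) / 2) * √(Qf P ρs l)) (Ioi 0) :=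
      (cμ.div (continuousOn_id.rpow_const fun x hx => Or.inl (ne_of_gt hx))
        fun x hx => (Real.rpow_pos_of_pos hx _).ne').fun_mul
        (ContinuousOn.sqrt fun x hx => (dQ x hx).continuousAt.continuousWithinAt)
    refine (iI this hρs hx).congr_deriv ?_
    have h1 : x ^ ((3:ℝ) / 2) = x * √x := by
      rw [Real.sqrt_eq_rpow, show (3:ℝ) / 2 = 1 + 1 / 2 by norm_num, Real.rpow_add hx, Real.rpow_one]
    have := Real.sqrt_pos.2 hx
    rw [h1, Real.sqrt_div' _ hx.le]
    field_simp

namespace Fl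
variable {P μ : ℝ → ℝ} {Pe ρs : ℝ} {P' μ' k q : ℝ → ℝ}

theorem cov2 (F : Fl P μ Pe) (t : ℝ) {g : ℝ → ℝ} (hg : ContinuousOn g (Icc (F.a t) (F.b t))) :
    ∫ x in F.a t..F.b t, g x = ∫ m in 0..1, g (F.X t m) * (F.rh t m)⁻¹ := by
  rw [← F.X_0, ← F.X_1]
  refine (intervalIntegral.integral_comp_mul_deriv'' (g := g) (F.cX t).continuousOn
    (fun m _ => (F.X_der t m).hasDerivWithinAt) ((F.crh t).inv₀ fun m => (F.rh_pos t m).ne').continuousOn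
    (hg.mono ?_)).symm
  rintro _ ⟨m, hm, rfl⟩
  rw [uIcc_of_le zero_le_one] at hm
  exact F.X_mem hm

noncomputable def NF (F : Fl P μ Pe) (ρs t : ℝ) : ℝ :=
  √(F.v (t, F.a t) ^ 2 + F.v (t, F.b t) ^ 2)
  + sSup ((fun x => |F.ρ (t, x) - ρs|) '' Icc (F.a t) (F.b t))
  + √((F.b t - F.a t)⁻¹ * ∫ x in F.a t..F.b t, F.v (t, x) ^ 2)
  + √((F.b t - F.a t) * ∫ x in F.a t..F.b t, F.ρx (t, x) ^ 2)

theorem imono2 {f g : ℝ → ℝ} {d : ℝ} (hf : ContinuousOn f (Icc 0 1)) (hg : ContinuousOn g (Icc 0 1))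
    (h : ∀ m ∈ 𝕀, f m ≤ d * g m) : ∫ m in 0..1, f m ≤ d * ∫ m in 0..1, g m := by
  rw [← iCM]
  exact imono hf (continuousOn_const.fun_mul hg) h

theorem NYa {L d A A' D D' s k0 k1 y0 y1 Y : ℝ} (d0 : 0 < d) (d1 : 1 ≤ d) (L1 : L ≤ d) (L2 : 1 ≤ d * L)
    (V1 : A' ≤ d * A) (V2 : A ≤ d * A') (R1 : D' ≤ d ^ 3 * D) (R2 : D ≤ d ^ 3 * D') (a0 : 0 ≤ A) (b0 : 0 ≤ D)
    (s3 : s ≤ 2 * d * √Y) (z0 : |k0| ≤ d * s) (z1 : |k1| ≤ d * s)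
    (hY : Y = D + k0 ^ 2 + k1 ^ 2 + y0 ^ 2 + y1 ^ 2 + A) :
    0 ≤ √(y0 ^ 2 + y1 ^ 2) + s + √(L⁻¹ * A') + √(L * D') ∧
    √(y0 ^ 2 + y1 ^ 2) + s + √(L⁻¹ * A') + √(L * D') ≤ (1 + 2 * d + d + d ^ 2) * √Y ∧
    Y ≤ 2 * d ^ 4 * (√(y0 ^ 2 + y1 ^ 2) + s + √(L⁻¹ * A') + √(L * D')) ^ 2 := by
  have L0 : 0 < L := by by_contra hh; linarith [mul_nonneg d0.le (neg_nonneg.2 (not_lt.1 hh))]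
  have Li : L⁻¹ ≤ d := by
    rw [inv_le_iff_one_le_mul₀ L0]; exact L2
  have Lj : 1 ≤ d * L⁻¹ := by
    rw [← div_eq_mul_inv, le_div_iff₀ L0]; linarith
  have Li0 : 0 < L⁻¹ := by positivity
  have A0 : 0 ≤ A' := by by_contra hh; linarith [mul_neg_of_pos_of_neg d0 (not_le.1 hh)]
  have D0 : 0 ≤ D' := by
    by_contra hh
    have := mul_neg_of_pos_of_neg (by positivity : 0 < d ^ 3) (not_le.1 hh)
    linarith
  have S0 : 0 ≤ s := by
    by_contra hh
    have := mul_neg_of_pos_of_neg d0 (not_le.1 hh)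
    linarith [abs_nonneg k0]
  have Y0 : 0 ≤ Y := by rw [hY]; positivity
  have AY : A ≤ Y := by rw [hY]; linarith [sq_nonneg k0, sq_nonneg k1, sq_nonneg y0, sq_nonneg y1]
  have DY : D ≤ Y := by rw [hY]; linarith [sq_nonneg k0, sq_nonneg k1, sq_nonneg y0, sq_nonneg y1]
  have yY : y0 ^ 2 + y1 ^ 2 ≤ Y := by rw [hY]; linarith [sq_nonneg k0, sq_nonneg k1]
  have n1 := Real.sqrt_nonneg (y0 ^ 2 + y1 ^ 2)
  have n2 := Real.sqrt_nonneg (L⁻¹ * A')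
  have n3 := Real.sqrt_nonneg (L * D')
  have sc : ∀ e : ℝ, 0 ≤ e → e * √Y = √(e ^ 2 * Y) := fun e he => by
    rw [Real.sqrt_mul (by positivity), Real.sqrt_sq he]
  refine ⟨by positivity, ?_, ?_⟩
  · have q1 := Real.sqrt_le_sqrt yY
    have q2 : √(L⁻¹ * A') ≤ d * √Y := by
      rw [sc d d0.le]
      refine Real.sqrt_le_sqrt ?_
      calc L⁻¹ * A' ≤ d * (d * Y) := by gcongr; exact V1.trans (by gcongr)
        _ = _ := by ring
    have q3 : √(L * D') ≤ d ^ 2 * √Y := by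
      rw [sc (d ^ 2) (by positivity)]
      refine Real.sqrt_le_sqrt ?_
      calc L * D' ≤ d * (d ^ 3 * Y) := by gcongr; exact R1.trans (by gcongr)
        _ = _ := by ring
    linarith
  · have q1 := Real.sq_sqrt (by positivity : 0 ≤ y0 ^ 2 + y1 ^ 2)
    have q2 := Real.sq_sqrt (by positivity : 0 ≤ L⁻¹ * A')
    have q3 := Real.sq_sqrt (by positivity : 0 ≤ L * D')
    have w1 : A ≤ d ^ 4 * √(L⁻¹ * A') ^ 2 := by
      rw [q2]
      calc A ≤ d * (1 * A') := by rw [one_mul]; exact V2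
        _ ≤ d * ((d * L⁻¹) * A') := by gcongr
        _ = d ^ 2 * (L⁻¹ * A') := by ring
        _ ≤ _ := by gcongr; norm_num
    have w2 : D ≤ d ^ 4 * √(L * D') ^ 2 := by
      rw [q3]
      calc D ≤ d ^ 3 * (1 * D') := by rw [one_mul]; exact R2
        _ ≤ d ^ 3 * ((d * L) * D') := by gcongr
        _ = _ := by ring
    have w3 : ∀ x, |x| ≤ d * s → x ^ 2 ≤ d ^ 4 * s ^ 2 := fun x hx => by
      rw [← sq_abs]
      calc |x| ^ 2 ≤ (d * s) ^ 2 := by gcongr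
        _ = d ^ 2 * s ^ 2 := by ring
        _ ≤ _ := by gcongr; norm_num
    have w4 : y0 ^ 2 + y1 ^ 2 ≤ d ^ 4 * √(y0 ^ 2 + y1 ^ 2) ^ 2 := by
      rw [q1]; exact le_mul_of_one_le_left (by positivity) (one_le_pow₀ d1)
    have w5 := w3 _ z0
    have w6 := w3 _ z1
    generalize √(L⁻¹ * A') = x1 at *
    generalize √(L * D') = x2 at *
    generalize √(y0 ^ 2 + y1 ^ 2) = x3 at *
    have : 0 ≤ d ^ 4 * (2 * (x1 * x2 + x1 * x3 + x2 * x3 + s * x1 + s * x2 + s * x3) + (x1 ^ 2 + x2 ^ 2 + x3 ^ 2) / 2) := by positivity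
    linarith

theorem NY (F : Fl P μ Pe) (hL : Law P μ P' μ') (H : Sc P μ Pe ρs k q)
    {t c d : ℝ} (hc : 0 < c) (hd : c⁻¹ = d) (h : ∀ m ∈ 𝕀, Cst P μ P' k q Pe ρs c (F.rh t m)) :
    0 ≤ F.NF ρs t ∧ F.NF ρs t ≤ (1 + 2 * d + d + d ^ 2) * √(F.Yl k t) ∧ F.Yl k t ≤ 2 * d ^ 4 * F.NF ρs t ^ 2 := by
  have h0 : (0:ℝ) ∈ 𝕀 := ⟨le_rfl, zero_le_one⟩
  have h1 : (1:ℝ) ∈ 𝕀 := ⟨zero_le_one, le_rfl⟩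
  have d0 : 0 < d := by rw [← hd]; positivity
  have cd : c * d = 1 := by rw [← hd]; field_simp
  have d1 : 1 ≤ d := by
    have := (h 0 h0).2.2.2.2.2.2.2
    rw [hd] at this
    nlinarith
  have ci : ContinuousOn (fun m => (F.rh t m)⁻¹) 𝕀 :=
    ((F.crh t).inv₀ fun m => (F.rh_pos t m).ne').continuousOn
  have cx : ContinuousOn (fun m => F.ρx (t, F.X t m)) 𝕀 :=
    (F.cρx t).comp (F.cX t).continuousOn fun m hm => F.X_mem hm
  have pb : ∀ m ∈ 𝕀, 0 < (F.rh t m)⁻¹ ∧ (F.rh t m)⁻¹ ≤ d ∧ 1 ≤ d * (F.rh t m)⁻¹ ∧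
      F.ρx (t, F.X t m) ^ 2 * (F.rh t m)⁻¹ ≤ d ^ 3 * F.km t m ^ 2 ∧
      F.km t m ^ 2 ≤ d ^ 3 * (F.ρx (t, F.X t m) ^ 2 * (F.rh t m)⁻¹) := fun m hm => by
    obtain ⟨-, -, -, -, -, -, ⟨e1, e2⟩, e3, e4⟩ := h m hm
    have p := F.rh_pos t m
    rw [hd] at e2 e4
    rw [km, rm]
    generalize F.ρx (t, F.X t m) = y at *
    generalize F.rh t m = x at *
    generalize μ x / x = w at *
    have w0 : 0 < w := hc.trans_le e1
    have xi : (0:ℝ) < x⁻¹ := by positivity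
    have xx : x * x⁻¹ = 1 := mul_inv_cancel₀ p.ne'
    have f1 : x⁻¹ ≤ d := by rw [← hd]; exact inv_anti₀ hc e3
    have f2 : 1 ≤ d * x⁻¹ := by rw [← xx]; gcongr
    have f3 : 1 ≤ d * w := by rw [← cd, mul_comm]; gcongr
    refine ⟨xi, f1, f2, ?_, ?_⟩
    · have : (1:ℝ) ≤ (d * w) ^ 2 * (d * x⁻¹) := one_le_mul_of_one_le_of_one_le (one_le_pow₀ f3) f2
      have := mll this (by positivity : 0 ≤ y ^ 2 * x⁻¹)
      linarith
    · have : w ^ 2 * x⁻¹ ≤ d ^ 2 * d := by gcongr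
      have := mll this (by positivity : 0 ≤ y ^ 2 * x⁻¹)
      linarith
  have eL : F.b t - F.a t = ∫ m in 0..1, (F.rh t m)⁻¹ := by
    have := F.cov2 t (g := fun _ => 1) continuousOn_const
    simpa using this
  have ev := F.cov2 t (g := fun x => F.v (t, x) ^ 2) ((F.cv t).pow 2).continuousOn
  have er := F.cov2 t (g := fun x => F.ρx (t, x) ^ 2) ((F.cρx t).fun_pow 2)
  have cv := (F.cvh t).continuousOn (s := Icc 0 1)
  have L1 : ∫ m in 0..1, (F.rh t m)⁻¹ ≤ d := by
    have := imono2 (d := d) ci (g := fun _ => 1) continuousOn_const fun m hm => by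
      rw [mul_one]; exact (pb m hm).2.1
    simpa using this
  have L2 : 1 ≤ d * ∫ m in 0..1, (F.rh t m)⁻¹ := by
    have := imono2 (d := d) (f := fun _ => 1) continuousOn_const ci fun m hm => (pb m hm).2.2.1
    simpa using this
  have V1 : ∫ m in 0..1, F.v (t, F.X t m) ^ 2 * (F.rh t m)⁻¹ ≤ d * ∫ m in 0..1, F.vh t m ^ 2 :=
    imono2 ((cv.fun_pow 2).fun_mul ci) (cv.fun_pow 2) fun m hm => by
      rw [mul_comm d]; exact mll (pb m hm).2.1 (sq_nonneg _)
  have V2 : ∫ m in 0..1, F.vh t m ^ 2 ≤ d * ∫ m in 0..1, F.v (t, F.X t m) ^ 2 * (F.rh t m)⁻¹ :=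
    imono2 (cv.fun_pow 2) ((cv.fun_pow 2).fun_mul ci) fun m hm => by
      have := mll (pb m hm).2.2.1 (sq_nonneg (F.vh t m))
      rw [vh] at *; linarith
  have R1 := imono2 ((cx.fun_pow 2).fun_mul ci) ((F.ckm hL t).fun_pow 2) fun m hm => (pb m hm).2.2.2.1
  have R2 := imono2 ((F.ckm hL t).fun_pow 2) ((cx.fun_pow 2).fun_mul ci) fun m hm => (pb m hm).2.2.2.2
  have kp := fun m hm => F.kpt hL H t (m := m) hm
  have a0 : 0 ≤ ∫ m in 0..1, F.vh t m ^ 2 := inn fun m => sq_nonneg _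
  have b0 : 0 ≤ ∫ m in 0..1, F.km t m ^ 2 := inn fun m => sq_nonneg _
  have s1 : ∀ m ∈ 𝕀, |F.rh t m - ρs| ≤ 2 * d * √(F.Yl k t) := fun m hm => by
    have e := (h m hm).2.2.2.2.1
    have : |k (F.rh t m)| ≤ 2 * √(F.Yl k t) := by
      rw [← Real.sqrt_sq (by norm_num : (0:ℝ) ≤ 2), ← Real.sqrt_mul (by positivity), ← Real.sqrt_sq_eq_abs]
      refine Real.sqrt_le_sqrt ((kp m hm).trans ?_)
      rw [Yl]; nlinarith [sq_nonneg (k (F.rh t 0)), sq_nonneg (k (F.rh t 1)), sq_nonneg (F.vh t 0), sq_nonneg (F.vh t 1)]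
    calc |F.rh t m - ρs| = d * (c * |F.rh t m - ρs|) := by rw [← mul_assoc, mul_comm d, cd, one_mul]
      _ ≤ d * (2 * √(F.Yl k t)) := mll (e.trans this) d0.le
      _ = _ := by ring
  have s2 : ∀ x ∈ Icc (F.a t) (F.b t), |F.ρ (t, x) - ρs| ≤ 2 * d * √(F.Yl k t) := fun x hx => by
    have hm : F.mm t x ∈ 𝕀 := by
      rw [← F.mm_a t, ← F.mm_b t]
      exact ⟨(F.mm_mono t).monotone hx.1, (F.mm_mono t).monotone hx.2⟩
    have := s1 _ hm
    rwa [rh, X_mm] at this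
  have s3 : sSup ((fun x => |F.ρ (t, x) - ρs|) '' Icc (F.a t) (F.b t)) ≤ 2 * d * √(F.Yl k t) :=
    csSup_le ((nonempty_Icc.2 (F.hab t).le).image _) (by rintro _ ⟨x, hx, rfl⟩; exact s2 x hx)
  have s4 : ∀ m ∈ 𝕀, |k (F.rh t m)| ≤ d * sSup ((fun x => |F.ρ (t, x) - ρs|) '' Icc (F.a t) (F.b t)) := fun m hm => by
    have e := (h m hm).2.2.2.2.2.1
    calc |k (F.rh t m)| = d * (c * |k (F.rh t m)|) := by rw [← mul_assoc, mul_comm d, cd, one_mul]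
      _ ≤ _ := by
        gcongr
        refine e.trans (le_csSup ⟨2 * d * √(F.Yl k t), ?_⟩ ⟨F.X t m, F.X_mem hm, rfl⟩)
        rintro _ ⟨x, hx, rfl⟩; exact s2 x hx
  have z0 := s4 0 h0
  have z1 := s4 1 h1
  have v0 : F.v (t, F.a t) = F.vh t 0 := by rw [vh, X_0]
  have v1 : F.v (t, F.b t) = F.vh t 1 := by rw [vh, X_1]
  rw [NF, ev, er, eL, v0, v1]
  exact NYa d0 d1 L1 L2 V1 V2 R1 R2 a0 b0 s3 z0 z1 rfl

end Fl

namespace PistonSol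
variable {P μ : ℝ → ℝ} {Pe : ℝ} (s : PistonSol P μ Pe)

noncomputable def ex (f : ℝ → ℝ → ℝ) (p : ℝ × ℝ) : ℝ :=
  f (max p.1 0) (max (s.a (max p.1 0)) (min p.2 (s.b (max p.1 0))))

theorem exe (f : ℝ → ℝ → ℝ) {t x : ℝ} (ht : 0 ≤ t) (hx : x ∈ Icc (s.a t) (s.b t)) : s.ex f (t, x) = f t x := by
  simp only [ex, max_eq_left ht, min_eq_left hx.2, max_eq_right hx.1]

theorem ca : Continuous fun t => s.a (max t 0) :=
  ContinuousOn.comp_continuous (s := Ici 0) (fun t ht => (s.ha' t ht).continuousWithinAt) (by fun_prop) fun t => le_max_right t 0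
theorem cb : Continuous fun t => s.b (max t 0) :=
  ContinuousOn.comp_continuous (s := Ici 0) (fun t ht => (s.hb' t ht).continuousWithinAt) (by fun_prop) fun t => le_max_right t 0

theorem mx (t : ℝ) : 0 ≤ max t 0 := le_max_right _ _
theorem lm (t x : ℝ) : max (s.a (max t 0)) (min x (s.b (max t 0))) ∈ Icc (s.a (max t 0)) (s.b (max t 0)) :=
  ⟨le_max_left _ _, max_le (s.hab _ (mx t)).le (min_le_right _ _)⟩

theorem cex {f : ℝ → ℝ → ℝ} (hf : ContinuousOn (fun p : ℝ × ℝ => f p.1 p.2)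
    {p : ℝ × ℝ | 0 ≤ p.1 ∧ p.2 ∈ Icc (s.a p.1) (s.b p.1)}) : Continuous (s.ex f) :=
  hf.comp_continuous (f := fun p : ℝ × ℝ => (max p.1 0, max (s.a (max p.1 0)) (min p.2 (s.b (max p.1 0)))))
    ((continuous_fst.max continuous_const).prodMk
      ((s.ca.comp continuous_fst).max (continuous_snd.min (s.cb.comp continuous_fst)))) fun p => ⟨mx _, s.lm _ _⟩

theorem exl (f : ℝ → ℝ → ℝ) (t x : ℝ) (h : x ≤ s.a (max t 0)) : s.ex f (t, x) = s.ex f (t, s.a (max t 0)) := by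
  have := (s.hab _ (mx t)).le
  simp only [ex, min_eq_left (h.trans this), max_eq_left h, min_eq_left this, max_self]
theorem exr (f : ℝ → ℝ → ℝ) (t x : ℝ) (h : s.b (max t 0) ≤ x) : s.ex f (t, x) = s.ex f (t, s.b (max t 0)) := by
  simp only [ex, min_eq_right h, min_self]

theorem ev {t : ℝ} (ht : 0 < t) : ∀ᶠ y in 𝓝 t, max y 0 = y ∧ 0 ≤ y := by
  filter_upwards [lt_mem_nhds ht] with y hy using ⟨max_eq_left hy.le, hy.le⟩

theorem evx {t x : ℝ} (ht : 0 ≤ t) (hx : x ∈ Ioo (s.a t) (s.b t)) (f : ℝ → ℝ → ℝ) :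
    ∀ᶠ y in 𝓝 x, s.ex f (t, y) = f t y := by
  filter_upwards [Ioo_mem_nhds hx.1 hx.2] with y hy using s.exe f ht ⟨hy.1.le, hy.2.le⟩

noncomputable def toFl (hm : ∀ t, 0 ≤ t → (∫ x in s.a t..s.b t, s.ρ t x) = 1) : Fl P μ Pe where
  a t := s.a (max t 0)
  b t := s.b (max t 0)
  u t := s.u (max t 0)
  ρ := s.ex s.ρ
  v := s.ex s.v
  ρx p := s.ρx (max p.1 0) p.2
  vx p := s.vx p.1 p.2
  vt p := s.vt p.1 p.2
  ha := s.ca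
  hb := s.cb
  hu := s.u_cont.comp_continuous (by fun_prop) mx
  hab t := s.hab _ (mx t)
  hρ := s.cex s.ρ_cont
  hv := s.cex s.v_cont
  ρpos p := s.ρ_pos _ (mx _) _ (s.lm _ _)
  hρl := s.exl _
  hρr := s.exr _
  hvl := s.exl _
  hvr := s.exr _
  mass t := by
    rw [← hm _ (mx t)]
    refine iCong fun x hx => ?_
    rw [uIcc_of_le (s.hab _ (mx t)).le] at hx
    have := s.exe s.ρ (mx t) hx
    rw [← this]
    simp only [ex, max_eq_left (mx t)]
  ha' t ht := by
    have h := (s.ha' t ht.le).hasDerivAt (Ici_mem_nhds ht)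
    rw [max_eq_left ht.le, s.exe _ ht.le ⟨le_rfl, (s.hab t ht.le).le⟩, s.bc_a t ht.le]
    exact h.congr_of_eventuallyEq ((ev ht).mono fun y hy => by simp only [hy.1])
  hb' t ht := by
    have h := (s.hb' t ht.le).hasDerivAt (Ici_mem_nhds ht)
    rw [max_eq_left ht.le, s.exe _ ht.le ⟨(s.hab t ht.le).le, le_rfl⟩, s.bc_b t ht.le]
    exact h.congr_of_eventuallyEq ((ev ht).mono fun y hy => by simp only [hy.1])
  hρt t ht x hx := by
    rw [max_eq_left ht.le] at hx
    rw [s.exe _ ht.le hx, s.exe _ ht.le hx]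
    have e : s.ρt t x = -(s.ρx (max t 0) x * s.v t x + s.ρ t x * s.vx t x) := by
      rw [max_eq_left ht.le]; linarith [s.mass_eq t ht x hx]
    rw [← e]
    refine (s.hρt t ht x hx).hasDerivWithinAt.congr_of_eventuallyEq ?_ (s.exe _ ht.le hx)
    filter_upwards [self_mem_nhdsWithin, mem_nhdsWithin_of_mem_nhds (ev ht)] with y hy hy'
    rw [hy'.1] at hy
    exact s.exe _ hy'.2 hy
  hvt t ht x hx := by
    rw [max_eq_left ht.le] at hx
    refine (s.hvt t ht x ⟨hx.1.le, hx.2.le⟩).congr_of_eventuallyEq ?_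
    have h1 := s.ca.continuousAt.eventually_lt (continuousAt_const (y := x)) (x₀ := t) (by rw [max_eq_left ht.le]; exact hx.1)
    have h2 := (continuousAt_const (y := x)).eventually_lt s.cb.continuousAt (x₀ := t) (by rw [max_eq_left ht.le]; exact hx.2)
    filter_upwards [h1, h2, ev ht] with y h1 h2 hy
    rw [hy.1] at h1 h2
    exact s.exe _ hy.2 ⟨h1.le, h2.le⟩
  hρx t x hx := (s.hρx _ (mx t) x hx).hasDerivWithinAt.congr (fun y hy => by
    rw [← s.exe s.ρ (mx t) hy]; simp only [ex, max_eq_left (mx t)]) (by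
    rw [← s.exe s.ρ (mx t) hx]; simp only [ex, max_eq_left (mx t)])
  hvx t ht x hx := by
    rw [max_eq_left ht.le] at hx ⊢
    exact (s.hvx t ht x hx).hasDerivWithinAt.congr (fun y hy => s.exe _ ht.le hy) (s.exe _ ht.le hx)
  cρx t := s.ρx_cont _ (mx t)
  cvx t ht := by rw [max_eq_left ht.le]; exact s.vx_cont t ht
  mom t ht x hx := by
    rw [max_eq_left ht.le] at hx
    rw [s.exe _ ht.le ⟨hx.1.le, hx.2.le⟩, s.exe _ ht.le ⟨hx.1.le, hx.2.le⟩]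
    exact (s.momentum_eq t ht x hx).congr_of_eventuallyEq ((s.evx ht.le hx s.ρ).mono fun y hy => by simp only [hy])
  na t ht := by
    have ha := (s.hab t ht.le).le
    rw [max_eq_left ht.le, s.exe _ ht.le ⟨le_rfl, ha⟩, ← s.newton_a t ht]
    refine (s.ha'' t ht).congr_of_eventuallyEq ((ev ht).mono fun y hy => ?_)
    simp only [hy.1]
    rw [s.exe _ hy.2 ⟨le_rfl, (s.hab y hy.2).le⟩, s.bc_a y hy.2]
  nb t ht := by
    have ha := (s.hab t ht.le).le
    rw [max_eq_left ht.le, s.exe _ ht.le ⟨ha, le_rfl⟩, ← s.newton_b t ht]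
    refine (s.hb'' t ht).congr_of_eventuallyEq ((ev ht).mono fun y hy => ?_)
    simp only [hy.1]
    rw [s.exe _ hy.2 ⟨(s.hab y hy.2).le, le_rfl⟩, s.bc_b y hy.2]

variable (hm : ∀ t, 0 ≤ t → (∫ x in s.a t..s.b t, s.ρ t x) = 1)

theorem toN (ρs : ℝ) {t : ℝ} (ht : 0 ≤ t) : (s.toFl hm).NF ρs t = Npiston ρs s t := by
  have hab := (s.hab t ht).le
  rw [Fl.NF, Npiston]
  simp only [toFl, max_eq_left ht]
  rw [s.exe _ ht ⟨le_rfl, hab⟩, s.exe _ ht ⟨hab, le_rfl⟩]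
  congr 3
  · congr 1
    exact image_congr fun x hx => by rw [s.exe _ ht hx]
  · congr 1
    refine iCong fun x hx => ?_
    rw [uIcc_of_le hab] at hx
    simp only [s.exe _ ht hx]

theorem toV (hμ : ContinuousOn μ (Ioi 0)) {ρs : ℝ} (hQ : ContinuousOn (Qf P ρs) (Ioi 0)) (r : ℝ) :
    (s.toFl hm).Vl (kf μ ρs) (fun x => Qf P ρs x / x) r 0 = Vf P μ ρs r (s.a 0) (s.b 0) (s.ρ 0) (s.ρx 0) (s.v 0) := by
  have hab := (s.hab 0 le_rfl).le
  obtain ⟨F, hF⟩ : ∃ F, F = s.toFl hm := ⟨_, rfl⟩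
  have ea : F.a 0 = s.a 0 := by rw [hF]; simp only [toFl, max_self]
  have eb : F.b 0 = s.b 0 := by rw [hF]; simp only [toFl, max_self]
  have er : ∀ x ∈ Icc (s.a 0) (s.b 0), F.ρ (0, x) = s.ρ 0 x := fun x hx => by
    rw [hF]; exact s.exe s.ρ le_rfl hx
  have ev : ∀ x ∈ Icc (s.a 0) (s.b 0), F.v (0, x) = s.v 0 x := fun x hx => by
    rw [hF]; exact s.exe s.v le_rfl hx
  have ex : ∀ x, F.ρx (0, x) = s.ρx 0 x := fun x => by rw [hF]; simp only [toFl, max_self]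
  rw [← hF]
  have ha : s.a 0 ∈ Icc (s.a 0) (s.b 0) := ⟨le_rfl, hab⟩
  have hb : s.b 0 ∈ Icc (s.a 0) (s.b 0) := ⟨hab, le_rfl⟩
  have i0 : ContinuousOn (fun x => F.ρ (0, x)) (Icc (F.a 0) (F.b 0)) := (F.cρ 0).continuousOn
  have i1 : ContinuousOn (fun x => F.v (0, x)) (Icc (F.a 0) (F.b 0)) := (F.cv 0).continuousOn
  have iμ : ContinuousOn (fun x => μ (F.ρ (0, x))) (Icc (F.a 0) (F.b 0)) := hμ.comp i0 fun x _ => F.ρpos _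
  have ii : ContinuousOn (fun x => (F.ρ (0, x))⁻¹) (Icc (F.a 0) (F.b 0)) := i0.inv₀ fun x _ => (F.ρpos _).ne'
  have c1 := F.cov2 0 (g := fun x => Qf P ρs (F.ρ (0, x))) (hQ.comp i0 fun x _ => F.ρpos _)
  have c2 := F.cov2 0 (g := fun x => F.ρ (0, x) * F.v (0, x) ^ 2) (i0.fun_mul (i1.fun_pow 2))
  have c3 := F.cov2 0 (g := fun x => (F.ρ (0, x))⁻¹ * (F.ρ (0, x) * F.v (0, x) + μ (F.ρ (0, x)) * (F.ρ (0, x))⁻¹ * F.ρx (0, x)) ^ 2)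
    (ii.fun_mul (((i0.fun_mul i1).fun_add ((iμ.fun_mul ii).fun_mul (F.cρx 0))).fun_pow 2))
  have d1 : ∫ m in 0..1, Qf P ρs (F.rh 0 m) / F.rh 0 m = ∫ x in s.a 0..s.b 0, Qf P ρs (s.ρ 0 x) := by
    simp only [div_eq_mul_inv]
    refine c1.symm.trans ?_
    rw [ea, eb]
    refine iCong fun x hx => ?_
    rw [uIcc_of_le hab] at hx
    simp only [er x hx]
  have d2 : ∫ m in 0..1, F.vh 0 m ^ 2 = ∫ x in s.a 0..s.b 0, s.ρ 0 x * s.v 0 x ^ 2 := by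
    refine Eq.trans ?_ (c2.symm.trans ?_)
    · refine iCong fun m _ => ?_
      have := (F.ρpos (0, F.X 0 m)).ne'
      simp only [Fl.vh, Fl.rh]
      field_simp
    rw [ea, eb]
    refine iCong fun x hx => ?_
    rw [uIcc_of_le hab] at hx
    simp only [er x hx, ev x hx]
  have d3 : ∫ m in 0..1, F.zz 0 m ^ 2 = ∫ x in s.a 0..s.b 0,
      (s.ρ 0 x)⁻¹ * (s.ρ 0 x * s.v 0 x + μ (s.ρ 0 x) * (s.ρ 0 x)⁻¹ * s.ρx 0 x) ^ 2 := by
    refine Eq.trans ?_ (c3.symm.trans ?_)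
    · refine iCong fun m _ => ?_
      have := (F.ρpos (0, F.X 0 m)).ne'
      simp only [Fl.zz, Fl.rm, Fl.vh, Fl.rh]
      field_simp
    rw [ea, eb]
    refine iCong fun x hx => ?_
    rw [uIcc_of_le hab] at hx
    simp only [er x hx, ev x hx, ex]
  rw [Fl.Vl, d1, d2, d3, Vf, Wf, Ef, Uf]
  simp only [Fl.vh, Fl.rh, F.X_0, F.X_1, ea, eb, er _ ha, er _ hb, ev _ ha, ev _ hb]
  ring

end PistonSol

/-- **Theorem 1 of the paper.**  Under Assumption (H), for every `R, r > 0` and `S ≥ 0`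
there are `M, σ > 0` such that every classical solution of the two-piston system with
unit total mass, driven by the boundary feedback
`u(t) = −R((r+1) v(t,a(t)) + k(ρ(t,a(t))))`, and with initial Lyapunov value
`V(a(0), b(0), ρ[0], v[0]) ≤ S`, satisfies `N(t) ≤ M e^{−σ t} N(0)` for all `t ≥ 0`. -/
theorem two_piston_global_stabilization_CLF_feedback
    (P μ P' : ℝ → ℝ) (Pext ρs : ℝ)
    (hP : ContDiffOn ℝ 2 P (Ioi 0)) (hμ : ContDiffOn ℝ 2 μ (Ioi 0))
    (hPpos : ∀ x, 0 < x → 0 < P x) (hμpos : ∀ x, 0 < x → 0 < μ x)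
    (hP' : ∀ x, 0 < x → HasDerivAt P (P' x) x)
    (hP'pos : ∀ x, 0 < x → 0 < P' x)
    (hPrange : P '' Ioi 0 = Ioi 0)
    (hPext : 0 < Pext) (hρs : 0 < ρs) (hPρs : P ρs = Pext)
    (hH : AssumpH P μ ρs)
    (R r S : ℝ) (hR : 0 < R) (hr : 0 < r) (hS : 0 ≤ S) :
    ∃ M σ : ℝ, 0 < M ∧ 0 < σ ∧
      ∀ sol : PistonSol P μ Pext,
        (∀ t, 0 ≤ t → (∫ x in sol.a t..sol.b t, sol.ρ t x) = 1) →
        (∀ t, 0 < t →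
          sol.u t = -R * ((r + 1) * sol.v t (sol.a t) + kf μ ρs (sol.ρ t (sol.a t)))) →
        Vf P μ ρs r (sol.a 0) (sol.b 0) (sol.ρ 0) (sol.ρx 0) (sol.v 0) ≤ S →
        ∀ t, 0 ≤ t →
          Npiston ρs sol t ≤ M * Real.exp (-σ * t) * Npiston ρs sol 0 := by
  obtain ⟨hL, H, hg⟩ := scal hP hμ hPpos hμpos hP' hP'pos hρs hPρs
  obtain ⟨c, σ, hc, hσ, hV⟩ := Fl.expV hL H hg hH.1 hH.2.1 hH.2.2 hr hR S
  have hQ : ContinuousOn (Qf P ρs) (Ioi 0) := by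
    have : ContinuousOn (fun x => Qf P ρs x / x * x) (Ioi 0) := fun x hx =>
      ((H.hq x hx).continuousAt.mul continuousAt_id).continuousWithinAt
    exact this.congr fun x hx => (div_mul_cancel₀ _ (ne_of_gt hx)).symm
  obtain ⟨d, hd⟩ : ∃ d, c⁻¹ = d := ⟨_, rfl⟩
  have d0 : 0 < d := by rw [← hd]; positivity
  obtain ⟨C, hC⟩ : ∃ C, C = (4 + 6 / r) * (1 + r + (1 + r) * (2 / c)) * (2 * d ^ 4) := ⟨_, rfl⟩
  have C0 : 0 < C := by rw [hC]; positivity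
  refine ⟨(1 + 2 * d + d + d ^ 2) * √C, σ / 2, by positivity, by positivity, fun sol hm hu hS t ht => ?_⟩
  obtain ⟨F, hF⟩ : ∃ F, F = sol.toFl hm := ⟨_, rfl⟩
  rw [← sol.toN hm ρs ht, ← sol.toN hm ρs le_rfl]
  rw [← sol.toV hm hμ.continuousOn hQ] at hS
  have hu' : ∀ t, 0 < t → F.u t = -R * ((r + 1) * F.vh t 0 + kf μ ρs (F.rh t 0)) := fun t ht => by
    have h0 : sol.a t ∈ Icc (sol.a t) (sol.b t) := ⟨le_rfl, (sol.hab t ht.le).le⟩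
    have e1 : F.a t = sol.a t := by rw [hF]; simp only [PistonSol.toFl, max_eq_left ht.le]
    have e2 : F.u t = sol.u t := by rw [hF]; simp only [PistonSol.toFl, max_eq_left ht.le]
    have e3 : F.v (t, sol.a t) = sol.v t (sol.a t) := by rw [hF]; exact sol.exe sol.v ht.le h0
    have e4 : F.ρ (t, sol.a t) = sol.ρ t (sol.a t) := by rw [hF]; exact sol.exe sol.ρ ht.le h0
    rw [Fl.vh, Fl.rh, F.X_0, e1, e2, e3, e4, hu t ht]
  rw [← hF] at hS ⊢
  have v0 := hV F hu' hS 0 le_rfl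
  have vt := hV F hu' hS t ht
  obtain ⟨n0, -, n2⟩ := F.NY hL H hc hd v0.1
  obtain ⟨-, m1, -⟩ := F.NY hL H hc hd vt.1
  have y1 := (F.YV hL H hr t).1
  have y2 := F.VY hL H hr hc v0.1
  have key : F.Yl (kf μ ρs) t ≤ C * (Real.exp (-(σ / 2) * t) * F.NF ρs 0) ^ 2 := by
    have e : Real.exp (-σ * t) = Real.exp (-(σ / 2) * t) ^ 2 := by rw [← Real.exp_nat_mul]; congr 1; push_cast; ring
    calc F.Yl (kf μ ρs) t ≤ (4 + 6 / r) * (((1 + r + (1 + r) * (2 / c)) * (2 * d ^ 4 * F.NF ρs 0 ^ 2)) * Real.exp (-σ * t)) := by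
          refine y1.trans ?_
          gcongr
          refine vt.2.trans ?_
          gcongr
          refine y2.trans ?_
          gcongr
      _ = _ := by rw [hC, e]; ring
  have k2 : √(F.Yl (kf μ ρs) t) ≤ √C * (Real.exp (-(σ / 2) * t) * F.NF ρs 0) := by
    have := Real.sqrt_le_sqrt key
    rwa [Real.sqrt_mul C0.le, Real.sqrt_sq (by positivity)] at this
  calc F.NF ρs t ≤ (1 + 2 * d + d + d ^ 2) * (√C * (Real.exp (-(σ / 2) * t) * F.NF ρs 0)) := by
        refine m1.trans ?_
        gcongr
    _ = _ := by ring
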